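/- Let 0 < R₁ < R₂ < R, let Γ be a nonempty open subset of the unit sphere S^{d−1}, and set ω_Γ = { rθ : R₁ < r < R₂, θ ∈ Γ } and T* = R₁²/(2d). For every β > 1 there exists c_β > 0 (with c_β → ∞ as β → 1) such that for every μ > 0, every T > T*, and every solution y_μ of the harmonic heat equation with parameter μ on [0,T], one has ∫_{B_R} |y_μ(T,·)|² ≤ e^{c_β/(T−T*)^{2β}} ∫₀^T ∫_{ω_Γ} |y_μ|². -/

import Mathlib

open MeasureTheory Metric Set Filter

/-- The Euclidean Laplacian of `f : ℝ^n → ℝ` at `x`. -/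
noncomputable def lapl {n : ℕ} (f : EuclideanSpace ℝ (Fin n) → ℝ)
    (x : EuclideanSpace ℝ (Fin n)) : ℝ :=
  ∑ i, fderiv ℝ (fun z => fderiv ℝ f z (EuclideanSpace.single i 1)) x (EuclideanSpace.single i 1)

/-- `y` is a solution of the harmonic heat equation `∂ₜy − Δy + μ²‖x‖² y = 0`
on `(0,T) × B_R`. -/
structure IsHarmonicHeatSolution (n : ℕ) (R μ T : ℝ)
    (y : ℝ → EuclideanSpace ℝ (Fin n) → ℝ) : Prop where
  continuousOn : ContinuousOn (fun p : ℝ × EuclideanSpace ℝ (Fin n) => y p.1 p.2)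
    (Icc 0 T ×ˢ closedBall (0 : EuclideanSpace ℝ (Fin n)) R)
  smoothOn : ContDiffOn ℝ (⊤ : ℕ∞) (fun p : ℝ × EuclideanSpace ℝ (Fin n) => y p.1 p.2)
    (Ioo 0 T ×ˢ ball (0 : EuclideanSpace ℝ (Fin n)) R)
  eqn : ∀ t ∈ Ioo (0:ℝ) T, ∀ x ∈ ball (0 : EuclideanSpace ℝ (Fin n)) R,
    deriv (fun s => y s x) t - lapl (y t) x + μ ^ 2 * ‖x‖ ^ 2 * y t x = 0
  boundary : ∀ t ∈ Ioo (0:ℝ) T, ∀ x ∈ sphere (0 : EuclideanSpace ℝ (Fin n)) R, y t x = 0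

open scoped ContDiff Topology Real

local notation "ℰ" n:max => EuclideanSpace ℝ (Fin n)

/-- The `i`-th partial derivative. -/
noncomputable def pd {n : ℕ} (i : Fin n) (f : ℰ n → ℝ) (x : ℰ n) : ℝ :=
  fderiv ℝ f x (EuclideanSpace.single i 1)

lemma two_le_smooth : (2 : WithTop ℕ∞) ≤ ∞ := WithTop.coe_le_coe.2 le_top

section Calculus

variable {n : ℕ} {f g : ℰ n → ℝ} {x : ℰ n}

lemma lapl_eq_sum_pd : lapl f x = ∑ i, pd i (pd i f) x := rfl

lemma pd_congr (i : Fin n) (h : f =ᶠ[𝓝 x] g) : pd i f x = pd i g x := by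
  simp only [pd, h.fderiv_eq]

lemma pd_eventuallyEq (i : Fin n) (h : f =ᶠ[𝓝 x] g) : pd i f =ᶠ[𝓝 x] pd i g :=
  h.eventuallyEq_nhds.mono fun _ hz => pd_congr i hz

lemma lapl_congr (h : f =ᶠ[𝓝 x] g) : lapl f x = lapl g x := by
  simp only [lapl_eq_sum_pd]
  exact Finset.sum_congr rfl fun i _ => pd_congr i (pd_eventuallyEq i h)

lemma pd_add (i : Fin n) (hf : DifferentiableAt ℝ f x) (hg : DifferentiableAt ℝ g x) :
    pd i (fun z => f z + g z) x = pd i f x + pd i g x := by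
  simp [pd, fderiv_fun_add hf hg]

lemma pd_sub (i : Fin n) (hf : DifferentiableAt ℝ f x) (hg : DifferentiableAt ℝ g x) :
    pd i (fun z => f z - g z) x = pd i f x - pd i g x := by
  simp [pd, fderiv_fun_sub hf hg]

lemma pd_mul (i : Fin n) (hf : DifferentiableAt ℝ f x) (hg : DifferentiableAt ℝ g x) :
    pd i (fun z => f z * g z) x = pd i f x * g x + f x * pd i g x := by
  simp [pd, fderiv_fun_mul hf hg]; ring

lemma pd_comp (i : Fin n) {φ : ℝ → ℝ} (hφ : DifferentiableAt ℝ φ (f x))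
    (hf : DifferentiableAt ℝ f x) :
    pd i (fun z => φ (f z)) x = deriv φ (f x) * pd i f x := by
  have := (hφ.hasDerivAt.comp_hasFDerivAt x hf.hasFDerivAt).fderiv
  simp only [pd]
  rw [show (fun z => φ (f z)) = φ ∘ f from rfl, this]
  simp

lemma pd_const (i : Fin n) (c : ℝ) : pd i (fun _ : ℰ n => c) x = 0 := by
  simp [pd]

lemma ContDiffAt.pd {m k : WithTop ℕ∞} (hf : ContDiffAt ℝ m f x) (i : Fin n)
    (hk : k + 1 ≤ m) : ContDiffAt ℝ k (pd i f) x :=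
  (hf.fderiv_right hk).clm_apply contDiffAt_const

lemma ContDiff.pd {m k : WithTop ℕ∞} (hf : ContDiff ℝ m f) (i : Fin n)
    (hk : k + 1 ≤ m) : ContDiff ℝ k (pd i f) :=
  contDiff_iff_contDiffAt.2 fun _ => hf.contDiffAt.pd i hk

lemma ContDiffAt.differentiableAt_pd (hf : ContDiffAt ℝ 2 f x) (i : Fin n) :
    DifferentiableAt ℝ (_root_.pd i f) x :=
  (hf.pd (k := 1) i (by norm_num)).differentiableAt (by norm_num)

lemma ContDiffAt.eventually_differentiableAt (hf : ContDiffAt ℝ 2 f x) :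
    ∀ᶠ z in 𝓝 x, DifferentiableAt ℝ f z :=
  (hf.eventually (by simp)).mono fun _ hz => hz.differentiableAt (by norm_num)

lemma pd_pd_add (i : Fin n) (hf : ContDiffAt ℝ 2 f x) (hg : ContDiffAt ℝ 2 g x) :
    pd i (pd i (fun z => f z + g z)) x = pd i (pd i f) x + pd i (pd i g) x := by
  rw [← pd_add i (hf.differentiableAt_pd i) (hg.differentiableAt_pd i)]
  refine pd_congr i ?_
  filter_upwards [hf.eventually_differentiableAt, hg.eventually_differentiableAt] with z h1 h2
  exact pd_add i h1 h2

lemma pd_pd_mul (i : Fin n) (hf : ContDiffAt ℝ 2 f x) (hg : ContDiffAt ℝ 2 g x) :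
    pd i (pd i (fun z => f z * g z)) x
      = pd i (pd i f) x * g x + 2 * (pd i f x * pd i g x) + f x * pd i (pd i g) x := by
  have hf1 := hf.differentiableAt (by norm_num)
  have hg1 := hg.differentiableAt (by norm_num)
  have hf2 := hf.differentiableAt_pd i
  have hg2 := hg.differentiableAt_pd i
  have h : pd i (fun z => f z * g z) =ᶠ[𝓝 x] fun z => pd i f z * g z + f z * pd i g z := by
    filter_upwards [hf.eventually_differentiableAt, hg.eventually_differentiableAt] with z h1 h2
    exact pd_mul i h1 h2
  rw [pd_congr i h, pd_add i (hf2.fun_mul hg1) (hf1.fun_mul hg2), pd_mul i hf2 hg1, pd_mul i hf1 hg2]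
  ring

lemma pd_pd_comp (i : Fin n) {φ : ℝ → ℝ} (hφ : ContDiff ℝ 2 φ) (hf : ContDiffAt ℝ 2 f x) :
    pd i (pd i (fun z => φ (f z))) x
      = deriv (deriv φ) (f x) * pd i f x ^ 2 + deriv φ (f x) * pd i (pd i f) x := by
  have hφ1 : Differentiable ℝ (deriv φ) := by
    have : ContDiff ℝ 1 (deriv φ) := (contDiff_succ_iff_deriv (n := 1).1 hφ).2.2
    exact this.differentiable (by norm_num)
  have hφ0 : Differentiable ℝ φ := hφ.differentiable (by norm_num)
  have hf1 := hf.differentiableAt (by norm_num)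
  have hf2 := hf.differentiableAt_pd i
  have h : pd i (fun z => φ (f z)) =ᶠ[𝓝 x] fun z => deriv φ (f z) * pd i f z := by
    filter_upwards [hf.eventually_differentiableAt] with z h1
    exact pd_comp i (hφ0 _) h1
  rw [pd_congr i h, pd_mul i ((hφ1 (f x)).fun_comp' x hf1) hf2, pd_comp i (hφ1 _) hf1]
  ring

lemma lapl_add (hf : ContDiffAt ℝ 2 f x) (hg : ContDiffAt ℝ 2 g x) :
    lapl (fun z => f z + g z) x = lapl f x + lapl g x := by
  simp only [lapl_eq_sum_pd, pd_pd_add _ hf hg, Finset.sum_add_distrib]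

lemma lapl_mul (hf : ContDiffAt ℝ 2 f x) (hg : ContDiffAt ℝ 2 g x) : lapl (fun z => f z * g z) x
      = lapl f x * g x + 2 * ∑ i, pd i f x * pd i g x + f x * lapl g x := by
  simp only [lapl_eq_sum_pd, pd_pd_mul _ hf hg, Finset.sum_add_distrib, Finset.sum_mul,
    Finset.mul_sum]

lemma lapl_comp {φ : ℝ → ℝ} (hφ : ContDiff ℝ 2 φ) (hf : ContDiffAt ℝ 2 f x) :
    lapl (fun z => φ (f z)) x
      = deriv (deriv φ) (f x) * ∑ i, pd i f x ^ 2 + deriv φ (f x) * lapl f x := by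
  simp only [lapl_eq_sum_pd, pd_pd_comp _ hφ hf, Finset.sum_add_distrib, Finset.mul_sum]

lemma lapl_const (c : ℝ) : lapl (fun _ : ℰ n => c) x = 0 := by
  have : ∀ i, pd i (fun _ : ℰ n => c) = fun _ => 0 := fun i => funext fun z => pd_const i c
  simp only [lapl_eq_sum_pd, this, pd_const, Finset.sum_const_zero]

lemma lapl_const_mul (c : ℝ) (hf : ContDiffAt ℝ 2 f x) :
    lapl (fun z => c * f z) x = c * lapl f x := by
  rw [lapl_mul contDiffAt_const hf, lapl_const]
  simp [pd_const]

lemma lapl_neg : lapl (fun z => - f z) x = - lapl f x := by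
  have : ∀ (i : Fin n) (h : ℰ n → ℝ),
      pd i (fun z => - h z) = fun z => - pd i h z := fun i h => funext fun z => by
    simp [pd, fderiv_fun_neg]
  simp only [lapl_eq_sum_pd, this, Finset.sum_neg_distrib]

lemma lapl_sub (hf : ContDiffAt ℝ 2 f x) (hg : ContDiffAt ℝ 2 g x) :
    lapl (fun z => f z - g z) x = lapl f x - lapl g x := by
  simp only [sub_eq_add_neg]
  rw [lapl_add hf hg.neg, lapl_neg]

lemma pd_coord (i j : Fin n) : pd i (fun z : ℰ n => z j) x = if j = i then 1 else 0 := by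
  have : fderiv ℝ (fun z : ℰ n => z j) x
      = EuclideanSpace.proj j := (EuclideanSpace.proj (𝕜 := ℝ) j).fderiv
  simp [pd, this]

lemma pd_inner (i : Fin n) (v : ℰ n) : pd i (fun z => inner ℝ z v) x = v i := by
  have : (fun z : ℰ n => inner ℝ z v) = innerSL ℝ v := by ext z; simp [real_inner_comm]
  rw [pd, this, ContinuousLinearMap.fderiv]
  simp [EuclideanSpace.inner_single_right]

lemma pd_norm_sq (i : Fin n) : pd i (fun z : ℰ n => ‖z‖ ^ 2) x = 2 * x i := by
  have := (hasStrictFDerivAt_norm_sq x).hasFDerivAt.fderiv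
  simp [pd, this, EuclideanSpace.inner_single_right]

lemma lapl_inner (v : ℰ n) : lapl (fun z => inner ℝ z v) x = 0 := by
  have : ∀ i, pd i (fun z : ℰ n => inner ℝ z v) = fun _ => v i :=
    fun i => funext fun z => pd_inner i v
  simp only [lapl_eq_sum_pd, this, pd_const, Finset.sum_const_zero]

lemma lapl_norm_sq : lapl (fun z : ℰ n => ‖z‖ ^ 2) x = 2 * n := by
  have : ∀ i, pd i (fun z : ℰ n => ‖z‖ ^ 2) = fun z => 2 * z i :=
    fun i => funext fun z => pd_norm_sq i
  have h2 : ∀ i : Fin n, pd i (fun z : ℰ n => 2 * z i) x = 2 := fun i => by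
    rw [pd_mul i (differentiableAt_const _) (by fun_prop), pd_const, pd_coord]; simp
  simp [lapl_eq_sum_pd, this, h2, mul_comm]

@[fun_prop]
lemma contDiff_inner_left {m : WithTop ℕ∞} (v : ℰ n) : ContDiff ℝ m (fun z : ℰ n => inner ℝ z v) :=
  contDiff_id.inner ℝ contDiff_const

@[fun_prop]
lemma contDiff_norm_sq_euclidean {m : WithTop ℕ∞} : ContDiff ℝ m (fun z : ℰ n => ‖z‖ ^ 2) :=
  contDiff_norm_sq ℝ

@[fun_prop]
lemma differentiable_inner_left (v : ℰ n) : Differentiable ℝ (fun z : ℰ n => inner ℝ z v) :=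
  (contDiff_inner_left (m := 1) v).differentiable (by norm_num)

@[fun_prop]
lemma differentiable_norm_sq_euclidean : Differentiable ℝ (fun z : ℰ n => ‖z‖ ^ 2) :=
  (contDiff_norm_sq_euclidean (m := 1)).differentiable (by norm_num)

lemma pd_quad (i : Fin n) (a c : ℝ) (v : ℰ n) :
    pd i (fun z => a * ‖z‖ ^ 2 + inner ℝ z v + c) x = 2 * a * x i + v i := by
  have h : DifferentiableAt ℝ (fun z : ℰ n => ‖z‖ ^ 2) x := differentiable_norm_sq_euclidean x
  rw [pd_add i (by fun_prop) (by fun_prop), pd_add i (by fun_prop) (by fun_prop),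
    pd_mul i (by fun_prop) h, pd_const, pd_const, pd_inner, pd_norm_sq]
  ring

lemma contDiff_quad (a c : ℝ) (v : ℰ n) {m : WithTop ℕ∞} :
    ContDiff ℝ m (fun z : ℰ n => a * ‖z‖ ^ 2 + inner ℝ z v + c) := by
  have := contDiff_norm_sq (E := ℰ n) ℝ (n := m)
  fun_prop

lemma contDiff_exp_quad (a c : ℝ) (v : ℰ n) {m : WithTop ℕ∞} : ContDiff ℝ m (fun z : ℰ n =>
      rexp (a * ‖z‖ ^ 2 + inner ℝ z v + c)) :=
  Real.contDiff_exp.comp (contDiff_quad a c v)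

lemma lapl_quad (a c : ℝ) (v : ℰ n) :
    lapl (fun z => a * ‖z‖ ^ 2 + inner ℝ z v + c) x = 2 * a * n := by
  have h1 : ContDiffAt ℝ 2 (fun z : ℰ n => ‖z‖ ^ 2) x := (contDiff_norm_sq ℝ).contDiffAt
  have h2 : ContDiffAt ℝ 2 (fun z : ℰ n => inner ℝ z v) x := by fun_prop
  rw [lapl_add ((contDiffAt_const.mul h1).add h2) contDiffAt_const,
    lapl_add (contDiffAt_const.mul h1) h2, lapl_const_mul _ h1, lapl_inner, lapl_norm_sq,
    lapl_const]
  ring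

lemma lapl_exp_quad (a c : ℝ) (v : ℰ n) :
    lapl (fun z => rexp (a * ‖z‖ ^ 2 + inner ℝ z v + c)) x
      = (‖(2 * a) • x + v‖ ^ 2 + 2 * a * n) * rexp (a * ‖x‖ ^ 2 + inner ℝ x v + c) := by
  rw [lapl_comp Real.contDiff_exp (contDiff_quad a c v).contDiffAt]
  have h : ‖(2 * a) • x + v‖ ^ 2 = ∑ i, (2 * a * x i + v i) ^ 2 := by
    rw [EuclideanSpace.norm_sq_eq]; simp
  rw [h, lapl_quad]
  simp only [pd_quad, Real.deriv_exp]
  ring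

/-- Along coordinate lines second derivatives are given by `pd i (pd i f)`. -/
lemma deriv_deriv_line (hf : ContDiffAt ℝ 2 f x) (i : Fin n) :
    deriv (fun s : ℝ => f (x + s • EuclideanSpace.single i (1:ℝ))) 0 = pd i f x ∧
    deriv (deriv fun s : ℝ => f (x + s • EuclideanSpace.single i (1:ℝ))) 0 = pd i (pd i f) x := by
  set e : ℰ n := EuclideanSpace.single i (1:ℝ)
  have hl : ∀ s : ℝ, HasDerivAt (fun s : ℝ => x + s • e) e s := fun s => by
    simpa using ((hasDerivAt_id s).smul_const e).const_add x
  have key : ∀ (h : ℰ n → ℝ) (s : ℝ), DifferentiableAt ℝ h (x + s • e) →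
      deriv (fun s : ℝ => h (x + s • e)) s = pd i h (x + s • e) := fun h s hh =>
    (hh.hasFDerivAt.comp_hasDerivAt s (hl s)).deriv
  have hcont : Tendsto (fun s : ℝ => x + s • e) (𝓝 0) (𝓝 x) := by
    have := (hl 0).continuousAt
    simpa [ContinuousAt] using this
  have hev : deriv (fun s : ℝ => f (x + s • e)) =ᶠ[𝓝 0] fun s => pd i f (x + s • e) :=
    (hcont.eventually hf.eventually_differentiableAt).mono fun s hs => key f s hs
  constructor
  · have := hev.eq_of_nhds; simpa using this
  · rw [hev.deriv_eq, key _ 0 (by simpa using hf.differentiableAt_pd i)]; simp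

lemma lapl_nonpos_of_isLocalMax (hf : ContDiffAt ℝ 2 f x) (h : IsLocalMax f x) :
    lapl f x ≤ 0 := by
  rw [lapl_eq_sum_pd]
  refine Finset.sum_nonpos fun i _ => ?_
  by_contra hpos
  push Not at hpos
  obtain ⟨h1, h2⟩ := deriv_deriv_line hf i
  set e : ℰ n := EuclideanSpace.single i (1:ℝ)
  set φ : ℝ → ℝ := fun s => f (x + s • e) with hφ
  have hc0 : ContinuousAt (fun s : ℝ => x + s • e) 0 := by fun_prop
  have hcont : Tendsto (fun s : ℝ => x + s • e) (𝓝 0) (𝓝 x) := by simpa [ContinuousAt] using hc0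
  have hmaxφ : IsLocalMax φ 0 := by
    have := hcont.eventually h
    simpa [IsLocalMax, IsMaxFilter, hφ] using this
  have hd0 : deriv φ 0 = 0 := hmaxφ.deriv_eq_zero
  have hφc : ContinuousAt φ 0 := by
    refine ContinuousAt.comp (g := f) ?_ hc0
    simpa using hf.continuousAt
  have hmin : IsLocalMin φ 0 := isLocalMin_of_deriv_deriv_pos (by rw [h2]; exact hpos) hd0 hφc
  have hconst : φ =ᶠ[𝓝 0] fun _ => φ 0 := by
    filter_upwards [hmin, hmaxφ] with s h1 h2 using le_antisymm h2 h1
  have : deriv (deriv φ) 0 = 0 := by rw [hconst.deriv.deriv_eq]; simp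
  rw [h2] at this
  exact hpos.ne' this

lemma lapl_eq_laplacian (hf : ContDiffAt ℝ 2 f x) : lapl f x = Laplacian.laplacian f x := by
  have := congrFun (InnerProductSpace.laplacian_eq_iteratedFDeriv_orthonormalBasis f
    (EuclideanSpace.basisFun (Fin n) ℝ)) x
  rw [this, lapl]
  refine Finset.sum_congr rfl fun i _ => ?_
  rw [iteratedFDeriv_two_apply]
  have h2 : DifferentiableAt ℝ (fderiv ℝ f) x :=
    (hf.fderiv_right (m := 1) (by norm_num)).differentiableAt (by norm_num)
  rw [fderiv_clm_apply h2 (differentiableAt_const _)]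
  simp

lemma lapl_comp_isometry (Q : ℰ n ≃ₗᵢ[ℝ] ℰ n)
    (hf : ContDiffAt ℝ 2 f (Q x)) : lapl (fun z => f (Q z)) x = lapl f (Q x) := by
  have hQ : ContDiff ℝ 2 (fun z => Q z) := Q.toContinuousLinearEquiv.contDiff
  have hc : ContDiffAt ℝ 2 (fun z => f (Q z)) x := hf.comp x hQ.contDiffAt
  rw [lapl_eq_laplacian hc, lapl_eq_laplacian hf,
    InnerProductSpace.laplacian_eq_iteratedFDeriv_orthonormalBasis _
      (EuclideanSpace.basisFun (Fin n) ℝ),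
    InnerProductSpace.laplacian_eq_iteratedFDeriv_orthonormalBasis _
      ((EuclideanSpace.basisFun (Fin n) ℝ).map Q)]
  refine Finset.sum_congr rfl fun i _ => ?_
  simp only [iteratedFDeriv_two_apply]
  have h1 : ∀ z, DifferentiableAt ℝ f (Q z) → fderiv ℝ (fun z => f (Q z)) z
      = (fderiv ℝ f (Q z)).comp (Q.toContinuousLinearEquiv : _ →L[ℝ] _) := fun z hz =>
    (hz.hasFDerivAt.comp z (Q.toContinuousLinearEquiv.hasFDerivAt)).fderiv
  have h2 : DifferentiableAt ℝ (fderiv ℝ f) (Q x) :=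
    (hf.fderiv_right (m := 1) (by norm_num)).differentiableAt (by norm_num)
  have hev : fderiv ℝ (fun z => f (Q z)) =ᶠ[𝓝 x]
      fun z => (fderiv ℝ f (Q z)).comp (Q.toContinuousLinearEquiv : _ →L[ℝ] _) :=
    (hQ.continuous.continuousAt.eventually hf.eventually_differentiableAt).mono h1
  rw [hev.fderiv_eq]
  have h3 : HasFDerivAt (fun z => fderiv ℝ f (Q z))
      ((fderiv ℝ (fderiv ℝ f) (Q x)).comp (Q.toContinuousLinearEquiv : _ →L[ℝ] _)) x :=
    h2.hasFDerivAt.comp x (Q.toContinuousLinearEquiv.hasFDerivAt)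
  have h4 := (h3.clm_comp (hasFDerivAt_const (Q.toContinuousLinearEquiv : ℰ n →L[ℝ] ℰ n) x)).fderiv
  rw [h4]
  simp

end Calculus
section MaximumPrinciple

variable {n : ℕ}

lemma deriv_nonneg_of_le_left {f : ℝ → ℝ} {t a : ℝ} (hat : a < t) (hf : DifferentiableAt ℝ f t)
    (h : ∀ s ∈ Ioo a t, f s ≤ f t) : 0 ≤ deriv f t := by
  have h1 : HasDerivWithinAt f (deriv f t) (Iio t) t := hf.hasDerivAt.hasDerivWithinAt
  rw [hasDerivWithinAt_iff_tendsto_slope' (by simp)] at h1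
  refine ge_of_tendsto h1 ?_
  filter_upwards [Ioo_mem_nhdsLT hat] with s hs
  rw [slope_def_field]
  exact div_nonneg_of_nonpos (by linarith [h s hs]) (by linarith [hs.2])

/-- Weak maximum principle for subsolutions of the heat equation with a nonnegative potential. -/
lemma parabolic_max {R T : ℝ} {w : ℝ → ℰ n → ℝ} {V : ℰ n → ℝ}
    (hc : ContinuousOn (fun p : ℝ × ℰ n => w p.1 p.2) (Icc 0 T ×ˢ closedBall 0 R))
    (hdt : ∀ t ∈ Ioo 0 T, ∀ x ∈ ball 0 R, DifferentiableAt ℝ (fun s => w s x) t)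
    (hdx : ∀ t ∈ Ioo 0 T, ∀ x ∈ ball 0 R, ContDiffAt ℝ 2 (w t) x)
    (hV : ∀ x, 0 ≤ V x)
    (hle : ∀ t ∈ Ioo 0 T, ∀ x ∈ ball 0 R, deriv (fun s => w s x) t - lapl (w t) x + V x * w t x ≤ 0)
    (hbd : ∀ t ∈ Ioo 0 T, ∀ x ∈ sphere 0 R, w t x ≤ 0)
    (h0 : ∀ x ∈ closedBall 0 R, w 0 x ≤ 0) :
    ∀ t ∈ Icc 0 T, ∀ x ∈ closedBall 0 R, w t x ≤ 0 := by
  have key : ∀ t ∈ Ioo 0 T, ∀ x ∈ closedBall 0 R, ∀ ε > 0, w t x ≤ ε * t := by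
    intro t ht x hx ε hε
    by_contra hcon
    push Not at hcon
    set v : ℝ × ℰ n → ℝ := fun p => w p.1 p.2 - ε * p.1
    have hK : IsCompact (Icc 0 t ×ˢ closedBall (0 : ℰ n) R) :=
      isCompact_Icc.prod (isCompact_closedBall _ _)
    have hvc : ContinuousOn v (Icc 0 t ×ˢ closedBall 0 R) :=
      (hc.mono (prod_mono (Icc_subset_Icc_right ht.2.le) Subset.rfl)).sub (by fun_prop)
    obtain ⟨⟨t', x'⟩, ⟨ht', hx'⟩, hmax⟩ := hK.exists_isMaxOn ⟨(t, x), ⟨⟨ht.1.le, le_rfl⟩, hx⟩⟩ hvc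
    have hmax' : ∀ s ∈ Icc 0 t, ∀ z ∈ closedBall 0 R,
        w s z - ε * s ≤ w t' x' - ε * t' := fun s hs z hz =>
      isMaxOn_iff.1 hmax (s, z) ⟨hs, hz⟩
    clear hmax
    simp only at ht' hx'
    have hpos : 0 < w t' x' - ε * t' := by
      have := hmax' t ⟨ht.1.le, le_rfl⟩ x hx
      linarith
    have ht0 : 0 < t' := by
      rcases ht'.1.lt_or_eq with h | h
      · exact h
      · exfalso
        subst h
        have := h0 x' hx'
        simp at hpos
        linarith
    have htT : t' ∈ Ioo 0 T := ⟨ht0, ht'.2.trans_lt ht.2⟩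
    have hεt : 0 < ε * t' := by positivity
    have hxb : x' ∈ ball 0 R := by
      rcases (mem_closedBall.1 hx').lt_or_eq with h | h
      · exact h
      · have := hbd t' htT x' h
        linarith
    have hlap : lapl (w t') x' ≤ 0 := by
      refine lapl_nonpos_of_isLocalMax (hdx t' htT x' hxb) ?_
      filter_upwards [isOpen_ball.mem_nhds hxb] with z hz
      have := hmax' t' ht' z (ball_subset_closedBall hz)
      linarith
    have hd := hdt t' htT x' hxb
    have hderiv : 0 ≤ deriv (fun s => w s x' - ε * s) t' := by
      refine deriv_nonneg_of_le_left ht0 (hd.sub (by fun_prop)) fun s hs => ?_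
      exact hmax' s ⟨hs.1.le, hs.2.le.trans ht'.2⟩ x' hx'
    rw [deriv_fun_sub hd (by fun_prop), deriv_const_mul_field, deriv_id''] at hderiv
    have := hle t' htT x' hxb
    have h3 : 0 ≤ V x' * w t' x' := mul_nonneg (hV _) (by linarith)
    linarith
  have key2 : ∀ t ∈ Ioo 0 T, ∀ x ∈ closedBall 0 R, w t x ≤ 0 := by
    intro t ht x hx
    refine le_of_forall_pos_le_add fun ε hε => ?_
    have := key t ht x hx (ε / t) (div_pos hε ht.1)
    rw [div_mul_cancel₀ _ ht.1.ne'] at this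
    linarith
  intro t ht x hx
  rcases ht.1.lt_or_eq with h | h
  swap
  · rw [← h]; exact h0 x hx
  rcases ht.2.lt_or_eq with h' | h'
  · exact key2 t ⟨h, h'⟩ x hx
  subst h'
  have hcw : ContinuousWithinAt (fun s => w s x) (Ioo 0 t) t := by
    have h1 := hc (t, x) ⟨ht, hx⟩
    exact h1.comp (t := Icc 0 t ×ˢ closedBall 0 R) (f := fun s => (s, x)) (s := Ioo 0 t)
      (by fun_prop) fun s hs => ⟨⟨hs.1.le, hs.2.le⟩, hx⟩
  have : (𝓝[Ioo 0 t] t).NeBot := by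
    rw [← mem_closure_iff_nhdsWithin_neBot, closure_Ioo h.ne]
    exact ht
  exact le_of_tendsto hcw (eventually_mem_nhdsWithin.mono fun s hs => key2 s hs x hx)

/-- Weak maximum principle for subharmonic functions. -/
lemma elliptic_max [NeZero n] {Ω : Set (ℰ n)} (hΩ : IsOpen Ω)
    (hb : Bornology.IsBounded Ω) {f : ℰ n → ℝ}
    (hc : ContinuousOn f (closure Ω)) (hd : ∀ x ∈ Ω, ContDiffAt ℝ 2 f x)
    (hl : ∀ x ∈ Ω, 0 ≤ lapl f x) (hf : ∀ x ∈ frontier Ω, f x ≤ 0) :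
    ∀ x ∈ closure Ω, f x ≤ 0 := by
  intro x hx
  obtain ⟨C, hC⟩ := hb.closure.exists_norm_le
  refine le_of_forall_pos_le_add fun ε hε => ?_
  have hK : IsCompact (closure Ω) := hb.isCompact_closure
  set a : ℝ := ε / (C ^ 2 + 1) with ha
  set v : ℰ n → ℝ := fun z => f z + a * ‖z‖ ^ 2 with hv
  obtain ⟨z, hz, hmax⟩ := hK.exists_isMaxOn ⟨x, hx⟩ (f := v) (hc.add (by fun_prop))
  have hzΩ : z ∉ Ω := by
    intro hzΩ
    have h1 : ContDiffAt ℝ 2 (fun z : ℰ n => ‖z‖ ^ 2) z := (contDiff_norm_sq ℝ).contDiffAt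
    have h2 : lapl v z ≤ 0 := by
      refine lapl_nonpos_of_isLocalMax ((hd z hzΩ).add (contDiffAt_const.mul h1)) ?_
      filter_upwards [hΩ.mem_nhds hzΩ] with u hu using hmax (subset_closure hu)
    rw [lapl_add (hd z hzΩ) (contDiffAt_const.mul h1), lapl_const_mul _ h1, lapl_norm_sq] at h2
    have := hl z hzΩ
    have hn : (0 : ℝ) < n := Nat.cast_pos.2 (NeZero.pos n)
    have : 0 < a * (2 * n) := by positivity
    linarith
  have h1 : f z ≤ 0 := hf z ⟨hz, by rwa [hΩ.interior_eq]⟩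
  have h2 : v x ≤ v z := hmax hx
  simp only [hv] at h2
  have h3 : ‖z‖ ^ 2 ≤ C ^ 2 + 1 := by
    have := hC z hz
    nlinarith [norm_nonneg z]
  have h4 : a * ‖z‖ ^ 2 ≤ ε := by
    calc a * ‖z‖ ^ 2 ≤ a * (C ^ 2 + 1) := by gcongr
      _ = ε := by rw [ha]; field_simp
  have h5 : 0 ≤ a * ‖x‖ ^ 2 := by positivity
  linarith

end MaximumPrinciple
namespace IsHarmonicHeatSolution

variable {n : ℕ} {R μ T : ℝ} {y : ℝ → ℰ n → ℝ}

lemma contDiffAt (h : IsHarmonicHeatSolution n R μ T y) {t : ℝ} (ht : t ∈ Ioo 0 T)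
    {x : ℰ n} (hx : x ∈ ball 0 R) :
    ContDiffAt ℝ ∞ (fun p : ℝ × ℰ n => y p.1 p.2) (t, x) :=
  h.smoothOn.contDiffAt ((isOpen_Ioo.prod isOpen_ball).mem_nhds ⟨ht, hx⟩)

lemma contDiffAt_space (h : IsHarmonicHeatSolution n R μ T y) {t : ℝ} (ht : t ∈ Ioo 0 T)
    {x : ℰ n} (hx : x ∈ ball 0 R) : ContDiffAt ℝ ∞ (y t) x :=
  (h.contDiffAt ht hx).comp x (f := fun z => (t, z)) (by fun_prop)

lemma contDiffAt_time (h : IsHarmonicHeatSolution n R μ T y) {t : ℝ} (ht : t ∈ Ioo 0 T)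
    {x : ℰ n} (hx : x ∈ ball 0 R) : ContDiffAt ℝ ∞ (fun s => y s x) t :=
  (h.contDiffAt ht hx).comp t (f := fun s => (s, x)) (by fun_prop)

lemma differentiableAt_time (h : IsHarmonicHeatSolution n R μ T y) {t : ℝ} (ht : t ∈ Ioo 0 T)
    {x : ℰ n} (hx : x ∈ ball 0 R) :
    DifferentiableAt ℝ (fun s => y s x) t :=
  (h.contDiffAt_time ht hx).differentiableAt (by simp)

lemma continuousOn_slice (h : IsHarmonicHeatSolution n R μ T y) {t : ℝ} (ht : t ∈ Icc 0 T) :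
    ContinuousOn (y t) (closedBall 0 R) :=
  h.continuousOn.comp (f := fun x => (t, x)) (by fun_prop) fun _ hx => ⟨ht, hx⟩

lemma neg (h : IsHarmonicHeatSolution n R μ T y) :
    IsHarmonicHeatSolution n R μ T (fun t x => - y t x) where
  continuousOn := h.continuousOn.neg
  smoothOn := h.smoothOn.neg
  eqn t ht x hx := by
    have := h.eqn t ht x hx
    rw [deriv.fun_neg, lapl_neg]
    linarith
  boundary t ht x hx := by simp [h.boundary t ht x hx]

lemma shift (h : IsHarmonicHeatSolution n R μ T y) {a b : ℝ} (ha : 0 ≤ a) (hb : b ≤ T) :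
    IsHarmonicHeatSolution n R μ (b - a) (fun t x => y (a + t) x) where
  continuousOn := h.continuousOn.comp (f := fun p : ℝ × ℰ n => (a + p.1, p.2)) (by fun_prop)
    fun p hp => ⟨⟨by linarith [hp.1.1], by linarith [hp.1.2]⟩, hp.2⟩
  smoothOn := h.smoothOn.comp (f := fun p : ℝ × ℰ n => (a + p.1, p.2)) (by fun_prop)
    fun p hp => ⟨⟨by linarith [hp.1.1], by linarith [hp.1.2]⟩, hp.2⟩
  eqn t ht x hx := by
    have := h.eqn (a + t) ⟨by linarith [ht.1], by linarith [ht.2]⟩ x hx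
    rw [deriv_comp_const_add (f := fun s => y s x)]
    exact this
  boundary t ht x hx := h.boundary (a + t) ⟨by linarith [ht.1], by linarith [ht.2]⟩ x hx

lemma boundary_closed (h : IsHarmonicHeatSolution n R μ T y) (hT : 0 < T) {t : ℝ}
    (ht : t ∈ Icc 0 T) {x : ℰ n} (hx : x ∈ sphere 0 R) : y t x = 0 := by
  have hcw : ContinuousWithinAt (fun s => y s x) (Ioo 0 T) t :=
    (h.continuousOn (t, x) ⟨ht, sphere_subset_closedBall hx⟩).comp
      (t := Icc 0 T ×ˢ closedBall 0 R) (f := fun s => (s, x)) (s := Ioo 0 T)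
      (by fun_prop) fun s hs => ⟨⟨hs.1.le, hs.2.le⟩, sphere_subset_closedBall hx⟩
  have : (𝓝[Ioo 0 T] t).NeBot := by
    rw [← mem_closure_iff_nhdsWithin_neBot, closure_Ioo hT.ne]
    exact ht
  refine tendsto_nhds_unique hcw.tendsto (tendsto_const_nhds.congr' ?_)
  exact eventually_mem_nhdsWithin.mono fun s hs => (h.boundary s hs x hx).symm

/-- Comparison with nonnegative supersolutions. -/
lemma abs_le_of_supersolution (h : IsHarmonicHeatSolution n R μ T y) {ψ : ℝ → ℰ n → ℝ}
    (hc : ContinuousOn (fun p : ℝ × ℰ n => ψ p.1 p.2) (Icc 0 T ×ˢ closedBall 0 R))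
    (hdt : ∀ t ∈ Ioo 0 T, ∀ x ∈ ball 0 R, DifferentiableAt ℝ (fun s => ψ s x) t)
    (hdx : ∀ t ∈ Ioo 0 T, ∀ x ∈ ball 0 R, ContDiffAt ℝ 2 (ψ t) x)
    (hle : ∀ t ∈ Ioo 0 T, ∀ x ∈ ball 0 R,
      0 ≤ deriv (fun s => ψ s x) t - lapl (ψ t) x + μ ^ 2 * ‖x‖ ^ 2 * ψ t x)
    (hbd : ∀ t ∈ Ioo 0 T, ∀ x ∈ sphere 0 R, 0 ≤ ψ t x)
    (h0 : ∀ x ∈ closedBall 0 R, |y 0 x| ≤ ψ 0 x) :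
    ∀ t ∈ Icc 0 T, ∀ x ∈ closedBall 0 R, |y t x| ≤ ψ t x := by
  have key : ∀ y : ℝ → ℰ n → ℝ, IsHarmonicHeatSolution n R μ T y →
      (∀ x ∈ closedBall 0 R, y 0 x ≤ ψ 0 x) →
      ∀ t ∈ Icc 0 T, ∀ x ∈ closedBall 0 R, y t x ≤ ψ t x := by
    intro y h h0 t ht x hx
    have := parabolic_max (w := fun t x => y t x - ψ t x) (V := fun x => μ ^ 2 * ‖x‖ ^ 2)
      (h.continuousOn.sub hc)
      (fun t ht x hx => (h.differentiableAt_time ht hx).sub (hdt t ht x hx))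
      (fun t ht x hx => ((h.contDiffAt_space ht hx).of_le two_le_smooth).sub (hdx t ht x hx))
      (fun x => by positivity)
      (fun t ht x hx => ?_) (fun t ht x hx => ?_) (fun x hx => by linarith [h0 x hx]) t ht x hx
    · linarith
    · rw [deriv_fun_sub (h.differentiableAt_time ht hx) (hdt t ht x hx),
        lapl_sub ((h.contDiffAt_space ht hx).of_le two_le_smooth) (hdx t ht x hx)]
      linarith [h.eqn t ht x hx, hle t ht x hx]
    · rw [h.boundary t ht x hx]
      linarith [hbd t ht x hx]
  intro t ht x hx
  rw [abs_le']
  exact ⟨key y h (fun x hx => (le_abs_self _).trans (h0 x hx)) t ht x hx,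
    key _ h.neg (fun x hx => (neg_le_abs _).trans (h0 x hx)) t ht x hx⟩

lemma abs_le (h : IsHarmonicHeatSolution n R μ T y) {M : ℝ} (hM : 0 ≤ M)
    (h0 : ∀ x ∈ closedBall 0 R, |y 0 x| ≤ M) :
    ∀ t ∈ Icc 0 T, ∀ x ∈ closedBall 0 R, |y t x| ≤ M :=
  h.abs_le_of_supersolution (ψ := fun _ _ => M) continuousOn_const
    (fun _ _ _ _ => differentiableAt_const _) (fun _ _ _ _ => contDiffAt_const)
    (fun t _ x _ => by rw [lapl_const]; simp; positivity) (fun _ _ _ _ => hM) h0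

/-- Comparison with the Gaussian solution emanating from a constant. -/
lemma abs_le_gaussian (h : IsHarmonicHeatSolution n R μ T y) (hμ : 0 < μ) {M : ℝ} (hM : 0 ≤ M)
    (h0 : ∀ x ∈ closedBall 0 R, |y 0 x| ≤ M) :
    ∀ t ∈ Icc 0 T, ∀ x ∈ closedBall 0 R,
      |y t x| ≤ M * rexp (-(μ / 2 * Real.tanh (2 * μ * t)) * ‖x‖ ^ 2
        - n / 2 * Real.log (Real.cosh (2 * μ * t))) := by
  have hch : ∀ t, 0 < Real.cosh (2 * μ * t) := fun t => Real.cosh_pos _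
  have htanh : ∀ t, HasDerivAt (fun t => Real.tanh (2 * μ * t))
      ((2 * μ) / Real.cosh (2 * μ * t) ^ 2) t := by
    intro t
    have hl : HasDerivAt (fun t : ℝ => 2 * μ * t) (2 * μ) t := by
      simpa using (hasDerivAt_id t).const_mul (2 * μ)
    have := (hl.sinh.div hl.cosh (hch t).ne')
    refine (this.congr_of_eventuallyEq ?_).congr_deriv ?_
    · exact Eventually.of_forall fun s => Real.tanh_eq_sinh_div_cosh _
    · have h2 := Real.cosh_sq (2 * μ * t)
      have := (hch t).ne'
      field_simp
      linear_combination h2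
  have hlog : ∀ t, HasDerivAt (fun t => Real.log (Real.cosh (2 * μ * t)))
      (2 * μ * Real.tanh (2 * μ * t)) t := by
    intro t
    have hl : HasDerivAt (fun t : ℝ => 2 * μ * t) (2 * μ) t := by
      simpa using (hasDerivAt_id t).const_mul (2 * μ)
    refine (hl.cosh.log (hch t).ne').congr_deriv ?_
    rw [Real.tanh_eq_sinh_div_cosh]; ring
  have hexp : ∀ x : ℰ n, ∀ t,
      HasDerivAt (fun t => rexp (-(μ / 2 * Real.tanh (2 * μ * t)) * ‖x‖ ^ 2
        - n / 2 * Real.log (Real.cosh (2 * μ * t))))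
      (rexp (-(μ / 2 * Real.tanh (2 * μ * t)) * ‖x‖ ^ 2
        - n / 2 * Real.log (Real.cosh (2 * μ * t))) *
        (-(μ / 2 * ((2 * μ) / Real.cosh (2 * μ * t) ^ 2)) * ‖x‖ ^ 2 -
          n / 2 * (2 * μ * Real.tanh (2 * μ * t)))) t := fun x t =>
    ((((htanh t).const_mul (μ / 2)).neg.mul_const _).sub ((hlog t).const_mul _)).exp
  have htc : Continuous fun t => Real.tanh (2 * μ * t) :=
    continuous_iff_continuousAt.2 fun t => (htanh t).continuousAt
  have hlc : Continuous fun t => Real.log (Real.cosh (2 * μ * t)) :=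
    continuous_iff_continuousAt.2 fun t => (hlog t).continuousAt
  have hform : ∀ t, (fun x : ℰ n =>
      M * rexp (-(μ / 2 * Real.tanh (2 * μ * t)) * ‖x‖ ^ 2
        - n / 2 * Real.log (Real.cosh (2 * μ * t)))) = fun x =>
      M * rexp (-(μ / 2 * Real.tanh (2 * μ * t)) * ‖x‖ ^ 2 + inner ℝ x 0
        + -(n / 2 * Real.log (Real.cosh (2 * μ * t)))) := by
    intro t; ext x; rw [inner_zero_right]; ring_nf
  refine h.abs_le_of_supersolution ?_ (fun t _ x _ => ((hexp x t).const_mul M).differentiableAt)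
    (fun t _ x _ => ?_) (fun t _ x _ => ?_) (fun t _ x _ => by positivity) ?_
  · refine Continuous.continuousOn ?_
    have h1 := htc.comp (continuous_fst (X := ℝ) (Y := ℰ n))
    have h2 := hlc.comp (continuous_fst (X := ℝ) (Y := ℰ n))
    simp only [Function.comp_def] at h1 h2
    fun_prop
  · rw [hform]
    exact contDiffAt_const.mul (contDiff_exp_quad _ _ _).contDiffAt
  · rw [((hexp x t).const_mul M).deriv]
    rw [hform]
    rw [lapl_const_mul _ (contDiff_exp_quad _ _ _).contDiffAt,
      lapl_exp_quad, inner_zero_right, add_zero, norm_smul, mul_pow, Real.norm_eq_abs, sq_abs,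
      Real.tanh_eq_sinh_div_cosh]
    refine le_of_eq ?_
    have h2 := Real.cosh_sq (2 * μ * t)
    have h3 := (hch t).ne'
    set E := rexp (-(μ / 2 * (Real.sinh (2 * μ * t) / Real.cosh (2 * μ * t))) * ‖x‖ ^ 2
        - n / 2 * Real.log (Real.cosh (2 * μ * t))) with hE
    rw [show -(μ / 2 * (Real.sinh (2 * μ * t) / Real.cosh (2 * μ * t))) * ‖x‖ ^ 2 + 0
        + -(n / 2 * Real.log (Real.cosh (2 * μ * t)))
        = -(μ / 2 * (Real.sinh (2 * μ * t) / Real.cosh (2 * μ * t))) * ‖x‖ ^ 2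
        - n / 2 * Real.log (Real.cosh (2 * μ * t)) by ring, ← hE]
    clear_value E
    generalize Real.cosh (2 * μ * t) = c at *
    generalize Real.sinh (2 * μ * t) = s at *
    field_simp
    linear_combination (-‖x‖ ^ 2 * E * M * μ ^ 2) * h2
  · intro x hx
    simpa using h0 x hx

/-- Exponential decay with a rate independent of the potential. -/
lemma abs_le_decay (h : IsHarmonicHeatSolution n R μ T y) (hR : 0 < R) {M : ℝ} (hM : 0 ≤ M)
    (h0 : ∀ x ∈ closedBall 0 R, |y 0 x| ≤ M) :
    ∀ t ∈ Icc 0 T, ∀ x ∈ closedBall 0 R, |y t x| ≤ 2 * M * rexp (-(n / R ^ 2) * t) := by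
  have hsq : ∀ x : ℰ n, x ∈ closedBall 0 R → ‖x‖ ^ 2 ≤ R ^ 2 := fun x hx => by
    have := mem_closedBall_zero_iff.1 hx
    gcongr
  have hform : (fun x : ℰ n => 2 * R ^ 2 - ‖x‖ ^ 2)
      = fun x => (-1) * ‖x‖ ^ 2 + inner ℝ x 0 + 2 * R ^ 2 := by
    ext x; rw [inner_zero_right]; ring
  have hexp : ∀ t, HasDerivAt (fun t => rexp (-(n / R ^ 2) * t))
      (rexp (-(n / R ^ 2) * t) * -(n / R ^ 2)) t := fun t => by
    simpa using ((hasDerivAt_id t).const_mul (-(n / R ^ 2 : ℝ))).exp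
  have hcd : ContDiff ℝ 2 (fun x : ℰ n => 2 * R ^ 2 - ‖x‖ ^ 2) := by
    rw [hform]; exact contDiff_quad _ _ _
  have hlap : ∀ x : ℰ n, lapl (fun x => 2 * R ^ 2 - ‖x‖ ^ 2) x = -2 * n := by
    intro x
    rw [hform, lapl_quad]; ring
  have main := h.abs_le_of_supersolution
    (ψ := fun t x => M / R ^ 2 * rexp (-(n / R ^ 2) * t) * (2 * R ^ 2 - ‖x‖ ^ 2))
    (by fun_prop) (fun t _ x _ => ((hexp t).differentiableAt.const_mul _).mul_const _)
    (fun t _ x _ => contDiffAt_const.mul hcd.contDiffAt)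
    (fun t _ x hx => ?_) (fun t _ x hx => ?_) (fun x hx => ?_)
  · intro t ht x hx
    refine (main t ht x hx).trans ?_
    have : 2 * M * rexp (-(n / R ^ 2) * t)
        = M / R ^ 2 * rexp (-(n / R ^ 2) * t) * (2 * R ^ 2) := by field_simp
    rw [this]
    have := sq_nonneg ‖x‖
    gcongr
    linarith
  · rw [(((hexp t).const_mul _).mul_const _).deriv, lapl_const_mul _ hcd.contDiffAt, hlap]
    have h1 := hsq x (ball_subset_closedBall hx)
    have e : M / R ^ 2 * (rexp (-(n / R ^ 2) * t) * -(n / R ^ 2)) * (2 * R ^ 2 - ‖x‖ ^ 2) -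
        M / R ^ 2 * rexp (-(n / R ^ 2) * t) * (-2 * n)
        = M / R ^ 2 * rexp (-(n / R ^ 2) * t) * (n * (‖x‖ ^ 2 / R ^ 2)) := by
      field_simp; ring
    rw [e]
    have : 0 ≤ 2 * R ^ 2 - ‖x‖ ^ 2 := by nlinarith [sq_nonneg R]
    positivity
  · have h1 := hsq x (sphere_subset_closedBall hx)
    have : 0 ≤ 2 * R ^ 2 - ‖x‖ ^ 2 := by nlinarith [sq_nonneg R]
    positivity
  · refine (h0 x hx).trans ?_
    have h1 := hsq x hx
    have : M = M / R ^ 2 * rexp (-(n / R ^ 2) * 0) * R ^ 2 := by simp; field_simp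
    nth_rw 1 [this]
    gcongr
    linarith

end IsHarmonicHeatSolution
section Integrals

variable {n : ℕ}

lemma integrable_of_continuous_of_zero_off {f : ℰ n → ℝ}
    {K : Set (ℰ n)} (hK : IsCompact K) (hf : Continuous f)
    (h0 : ∀ x ∉ K, f x = 0) : Integrable f :=
  hf.integrable_of_hasCompactSupport (HasCompactSupport.intro hK h0)

lemma pd_eq_zero_of_zero_off {f : ℰ n → ℝ} {K : Set (ℰ n)} (hK : IsClosed K)
    (h0 : ∀ x ∉ K, f x = 0) (i : Fin n) : ∀ x ∉ K, pd i f x = 0 := by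
  intro x hx
  have : f =ᶠ[𝓝 x] fun _ => 0 := (hK.isOpen_compl.mem_nhds hx : Kᶜ ∈ 𝓝 x) |> fun h => by
      filter_upwards [h] with z hz using h0 z hz
  rw [pd_congr i this, pd_const]

lemma integral_pd_eq_zero {f : ℰ n → ℝ} {K : Set (ℰ n)} (hK : IsCompact K) (hf : ContDiff ℝ 1 f)
    (h0 : ∀ x ∉ K, f x = 0) (i : Fin n) : ∫ x, pd i f x = 0 := by
  have hpd : Continuous (pd i f) := (hf.pd (k := 0) i (by norm_num)).continuous
  have h1 : Integrable f := integrable_of_continuous_of_zero_off hK hf.continuous h0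
  have h2 : Integrable (pd i f) :=
    integrable_of_continuous_of_zero_off hK hpd (pd_eq_zero_of_zero_off hK.isClosed h0 i)
  have h3 : Integrable fun x => fderiv ℝ f x (EuclideanSpace.single i 1) := h2
  have := integral_mul_fderiv_eq_neg_fderiv_mul_of_integrable (μ := volume) (𝕜 := ℝ)
    (f := fun _ : ℰ n => (1:ℝ)) (g := f) (v := EuclideanSpace.single i 1)
    (by simp) (by simpa only [one_mul] using h3) (by simpa using h1) (by fun_prop)
    (fun x _ => hf.differentiable (by norm_num) x)
  simpa [pd] using this

/-- Green's identity for functions one of which has compact support. -/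
lemma integral_mul_lapl_comm {f g : ℰ n → ℝ}
    {K : Set (ℰ n)} (hK : IsCompact K) (hf : ContDiff ℝ 2 f)
    (hg : ContDiff ℝ 2 g) (h0 : ∀ x ∉ K, g x = 0) :
    ∫ x, f x * lapl g x = ∫ x, lapl f x * g x := by
  have hf1 : ∀ i, ContDiff ℝ 1 (pd i f) := fun i => hf.pd i (by norm_num)
  have hg1 : ∀ i, ContDiff ℝ 1 (pd i g) := fun i => hg.pd i (by norm_num)
  have hf2 : ∀ i, Continuous (pd i (pd i f)) := fun i =>
    ((hf1 i).pd (k := 0) i (by norm_num)).continuous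
  have hg2 : ∀ i, Continuous (pd i (pd i g)) := fun i =>
    ((hg1 i).pd (k := 0) i (by norm_num)).continuous
  have hz1 := fun i => pd_eq_zero_of_zero_off hK.isClosed h0 i
  have hz2 := fun i => pd_eq_zero_of_zero_off hK.isClosed (hz1 i) i
  have hi1 : ∀ i, Integrable fun x => f x * pd i (pd i g) x := fun i =>
    integrable_of_continuous_of_zero_off hK (hf.continuous.mul (hg2 i))
      fun x hx => by simp [hz2 i x hx]
  have hi2 : ∀ i, Integrable fun x => pd i (pd i f) x * g x := fun i =>
    integrable_of_continuous_of_zero_off hK ((hf2 i).mul hg.continuous)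
      fun x hx => by simp [h0 x hx]
  simp only [lapl_eq_sum_pd, Finset.mul_sum, Finset.sum_mul]
  rw [integral_finsetSum _ fun i _ => hi1 i, integral_finsetSum _ fun i _ => hi2 i]
  refine Finset.sum_congr rfl fun i _ => ?_
  rw [← sub_eq_zero, ← integral_sub (hi1 i) (hi2 i)]
  have hf0 : ContDiff ℝ 1 f := hf.of_le (by norm_num)
  have hg0 : ContDiff ℝ 1 g := hg.of_le (by norm_num)
  rw [← integral_pd_eq_zero (f := fun x => f x * pd i g x - pd i f x * g x) hK
    ((hf0.mul (hg1 i)).sub ((hf1 i).mul hg0))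
    (fun x hx => by simp [h0 x hx, hz1 i x hx]) i]
  refine integral_congr_ae (.of_forall fun x => ?_)
  have d1 := (hf0.differentiable (by norm_num)) x
  have d2 := (hg0.differentiable (by norm_num)) x
  have d3 := ((hf1 i).differentiable (by norm_num)) x
  have d4 := ((hg1 i).differentiable (by norm_num)) x
  simp only
  rw [pd_sub i (d1.fun_mul d4) (d3.fun_mul d2), pd_mul i d1 d4, pd_mul i d3 d2]
  ring

lemma deriv_eq_fderiv_prod {W : ℝ → ℰ n → ℝ} {t : ℝ} {x : ℰ n}
    (h : DifferentiableAt ℝ (fun p : ℝ × ℰ n => W p.1 p.2) (t, x)) :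
    HasDerivAt (fun s => W s x) (fderiv ℝ (fun p : ℝ × ℰ n => W p.1 p.2) (t, x) (1, 0)) t := by
  have := h.hasFDerivAt.comp_hasDerivAt t (f := fun s => (s, x))
    ((hasDerivAt_id t).prodMk (hasDerivAt_const t x))
  exact this

lemma pd_eq_fderiv_prod {W : ℝ → ℰ n → ℝ} {t : ℝ} {x : ℰ n} (i : Fin n)
    (h : DifferentiableAt ℝ (fun p : ℝ × ℰ n => W p.1 p.2) (t, x)) :
    pd i (W t) x = fderiv ℝ (fun p : ℝ × ℰ n => W p.1 p.2) (t, x)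
      (0, EuclideanSpace.single i 1) := by
  have := h.hasFDerivAt.comp x (f := fun z => (t, z))
    ((hasFDerivAt_const t x).prodMk (hasFDerivAt_id x))
  have h2 : HasFDerivAt (W t) _ x := this
  rw [pd, h2.fderiv]
  simp

/-- Differentiation under the integral sign for uniformly compactly supported integrands. -/
lemma hasDerivAt_integral_of_zero_off {W : ℝ → ℰ n → ℝ} {J : Set ℝ}
    (hJ : IsOpen J) {K : Set (ℰ n)} (hK : IsCompact K)
    (hW : ∀ t ∈ J, ∀ x, ContDiffAt ℝ 1 (fun p : ℝ × ℰ n => W p.1 p.2) (t, x))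
    (h0 : ∀ t ∈ J, ∀ x ∉ K, W t x = 0) {t : ℝ} (ht : t ∈ J) :
    HasDerivAt (fun s => ∫ x, W s x) (∫ x, deriv (fun s => W s x) t) t := by
  obtain ⟨δ, hδ, hδJ⟩ := Metric.isOpen_iff.1 hJ t ht
  set I : Set ℝ := closedBall t (δ / 2)
  have hIJ : I ⊆ J := (closedBall_subset_ball (by linarith)).trans hδJ
  have hI : I ∈ 𝓝 t := closedBall_mem_nhds t (by positivity)
  set w : ℝ × ℰ n → ℝ := fun p => fderiv ℝ (fun p : ℝ × ℰ n => W p.1 p.2) p (1, 0)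
  have hwc : ∀ s ∈ J, ∀ x, ContinuousAt w (s, x) := fun s hs x =>
    (((hW s hs x).fderiv_right (m := 0) (by norm_num)).continuousAt).clm_apply continuousAt_const
  have hd : ∀ s ∈ J, ∀ x, HasDerivAt (fun s => W s x) (w (s, x)) s := fun s hs x =>
    deriv_eq_fderiv_prod ((hW s hs x).differentiableAt (by norm_num))
  have hwz : ∀ s ∈ J, ∀ x ∉ K, w (s, x) = 0 := fun s hs x hx => by
    rw [← (hd s hs x).deriv]
    have : (fun s => W s x) =ᶠ[𝓝 s] fun _ => 0 := by
      filter_upwards [hJ.mem_nhds hs] with r hr using h0 r hr x hx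
    rw [this.deriv_eq, deriv_const]
  have hcs : ∀ s ∈ J, Continuous (W s) := fun s hs => continuous_iff_continuousAt.2 fun x =>
    (hW s hs x).continuousAt.comp (f := fun z => (s, z)) (by fun_prop)
  have hcw : Continuous fun x => w (t, x) := continuous_iff_continuousAt.2 fun x =>
    (hwc t ht x).comp (f := fun z => (t, z)) (by fun_prop)
  obtain ⟨C, hC⟩ := ((isCompact_closedBall t (δ / 2)).prod hK).exists_bound_of_continuousOn
    (f := w) fun p hp => (hwc p.1 (hIJ hp.1) p.2).continuousWithinAt
  have hCb : ∀ x, ∀ s ∈ I, ‖w (s, x)‖ ≤ K.indicator (fun _ => C) x := fun x s hs => by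
    by_cases hx : x ∈ K
    · rw [indicator_of_mem hx]
      exact hC (s, x) ⟨hs, hx⟩
    · rw [indicator_of_notMem hx, hwz s (hIJ hs) x hx, norm_zero]
  have := (hasDerivAt_integral_of_dominated_loc_of_deriv_le (μ := volume) (F := W)
    (F' := fun s x => w (s, x)) (bound := K.indicator fun _ => C) (s := I) hI
    (by filter_upwards [hI] with s hs using (hcs s (hIJ hs)).aestronglyMeasurable)
    (integrable_of_continuous_of_zero_off hK (hcs t ht) (h0 t ht))
    hcw.aestronglyMeasurable (Eventually.of_forall hCb)
    ((integrable_indicator_iff hK.measurableSet).2 (integrableOn_const hK.measure_lt_top.ne))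
    (.of_forall fun x s hs => hd s (hIJ hs) x)).2
  simpa only [(hd t ht _).deriv] using this

end Integrals
/-- The coefficient `(μ/2) coth(2μτ)` of the Mehler kernel. -/
noncomputable def mehlerA (μ τ : ℝ) : ℝ := μ / 2 * (Real.cosh (2 * μ * τ) / Real.sinh (2 * μ * τ))

/-- The coefficient `μ / sinh(2μτ)` of the Mehler kernel. -/
noncomputable def mehlerB (μ τ : ℝ) : ℝ := μ / Real.sinh (2 * μ * τ)

/-- The Mehler kernel, i.e. the heat kernel of the harmonic oscillator on the whole space. -/
noncomputable def mehler {n : ℕ} (μ τ : ℝ) (x z : ℰ n) : ℝ :=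
  rexp (-mehlerA μ τ * ‖z‖ ^ 2 + inner ℝ z (mehlerB μ τ • x)
    + (n / 2 * Real.log (mehlerB μ τ / (2 * π)) - mehlerA μ τ * ‖x‖ ^ 2))

section Mehler

variable {n : ℕ} {μ τ : ℝ}

lemma sinh_pos_of_pos (hμ : 0 < μ) (hτ : 0 < τ) : 0 < Real.sinh (2 * μ * τ) :=
  Real.sinh_pos_iff.2 (by positivity)

lemma mehlerB_pos (hμ : 0 < μ) (hτ : 0 < τ) : 0 < mehlerB μ τ :=
  div_pos hμ (sinh_pos_of_pos hμ hτ)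

lemma mehlerA_pos (hμ : 0 < μ) (hτ : 0 < τ) : 0 < mehlerA μ τ :=
  mul_pos (by positivity) (div_pos (Real.cosh_pos _) (sinh_pos_of_pos hμ hτ))

lemma mehlerA_sq_sub (hμ : 0 < μ) (hτ : 0 < τ) :
    4 * mehlerA μ τ ^ 2 - mehlerB μ τ ^ 2 = μ ^ 2 := by
  have h := (sinh_pos_of_pos hμ hτ).ne'
  have h2 := Real.cosh_sq (2 * μ * τ)
  rw [mehlerA, mehlerB]
  generalize Real.cosh (2 * μ * τ) = c at *
  generalize Real.sinh (2 * μ * τ) = s at *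
  field_simp
  linear_combination 4 * h2

lemma hasDerivAt_two_mul (μ τ : ℝ) : HasDerivAt (fun t : ℝ => 2 * μ * t) (2 * μ) τ := by
  simpa using (hasDerivAt_id τ).const_mul (2 * μ)

lemma hasDerivAt_mehlerA (hμ : 0 < μ) (hτ : 0 < τ) :
    HasDerivAt (mehlerA μ) (-mehlerB μ τ ^ 2) τ := by
  have h := (sinh_pos_of_pos hμ hτ).ne'
  have hl := hasDerivAt_two_mul μ τ
  refine ((hl.cosh.div hl.sinh h).const_mul (μ / 2)).congr_deriv ?_
  have h2 := Real.cosh_sq (2 * μ * τ)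
  rw [mehlerB]
  generalize Real.cosh (2 * μ * τ) = c at *
  generalize Real.sinh (2 * μ * τ) = s at *
  field_simp
  linear_combination -h2

lemma hasDerivAt_mehlerB (hμ : 0 < μ) (hτ : 0 < τ) :
    HasDerivAt (mehlerB μ) (-4 * mehlerA μ τ * mehlerB μ τ) τ := by
  have h := (sinh_pos_of_pos hμ hτ).ne'
  have hl := hasDerivAt_two_mul μ τ
  refine ((hasDerivAt_const τ μ).div hl.sinh h).congr_deriv ?_
  rw [mehlerB, mehlerA]
  generalize Real.cosh (2 * μ * τ) = c at *
  generalize Real.sinh (2 * μ * τ) = s at *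
  field_simp
  ring

lemma contDiffAt_mehlerA (hμ : 0 < μ) (hτ : 0 < τ) : ContDiffAt ℝ ∞ (mehlerA μ) τ := by
  have h := (sinh_pos_of_pos hμ hτ).ne'
  have hl : ContDiffAt ℝ ∞ (fun t : ℝ => 2 * μ * t) τ := by fun_prop
  exact contDiffAt_const.mul (hl.cosh.div hl.sinh h)

lemma contDiffAt_mehlerB (hμ : 0 < μ) (hτ : 0 < τ) : ContDiffAt ℝ ∞ (mehlerB μ) τ := by
  have h := (sinh_pos_of_pos hμ hτ).ne'
  have hl : ContDiffAt ℝ ∞ (fun t : ℝ => 2 * μ * t) τ := by fun_prop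
  exact contDiffAt_const.div hl.sinh h

lemma mehler_pos (x z : ℰ n) : 0 < mehler μ τ x z := Real.exp_pos _

lemma contDiff_mehler (x : ℰ n) : ContDiff ℝ ∞ (mehler μ τ x) := contDiff_exp_quad _ _ _

lemma contDiffAt_mehler (hμ : 0 < μ) (hτ : 0 < τ) (x z : ℰ n) :
    ContDiffAt ℝ ∞ (fun p : ℝ × ℰ n => mehler μ p.1 x p.2) (τ, z) := by
  have hA : ContDiffAt ℝ ∞ (fun p : ℝ × ℰ n => mehlerA μ p.1) (τ, z) :=
    ContDiffAt.comp (g := mehlerA μ) (τ, z) (contDiffAt_mehlerA hμ hτ) contDiffAt_fst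
  have hB : ContDiffAt ℝ ∞ (fun p : ℝ × ℰ n => mehlerB μ p.1) (τ, z) :=
    ContDiffAt.comp (g := mehlerB μ) (τ, z) (contDiffAt_mehlerB hμ hτ) contDiffAt_fst
  have hn : ContDiffAt ℝ ∞ (fun p : ℝ × ℰ n => ‖p.2‖ ^ 2) (τ, z) :=
    (contDiff_snd.norm_sq ℝ).contDiffAt
  have hl : ContDiffAt ℝ ∞ (fun p : ℝ × ℰ n => Real.log (mehlerB μ p.1 / (2 * π))) (τ, z) :=
    (hB.div_const _).log (div_pos (mehlerB_pos hμ hτ) (by positivity)).ne'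
  have hi : ContDiffAt ℝ ∞ (fun p : ℝ × ℰ n => (inner ℝ p.2 (mehlerB μ p.1 • x) : ℝ)) (τ, z) :=
    contDiffAt_snd.inner ℝ (hB.smul contDiffAt_const)
  exact ((((hA.neg).mul hn).add hi).add ((contDiffAt_const.mul hl).sub
    (hA.mul contDiffAt_const))).exp

/-- The Mehler kernel solves the harmonic heat equation. -/
lemma hasDerivAt_mehler (hμ : 0 < μ) (hτ : 0 < τ) (x z : ℰ n) :
    HasDerivAt (fun t => mehler μ t x z)
      (lapl (mehler μ τ x) z - μ ^ 2 * ‖z‖ ^ 2 * mehler μ τ x z) τ := by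
  have hb := mehlerB_pos hμ hτ
  have hA := hasDerivAt_mehlerA hμ hτ
  have hB := hasDerivAt_mehlerB hμ hτ
  have hl := (hB.div_const (2 * π)).log (div_pos hb (by positivity)).ne'
  have h1 := (((hA.neg.mul_const (‖z‖ ^ 2)).add (hB.mul_const (inner ℝ z x))).add
    ((hl.const_mul (n / 2 : ℝ)).sub (hA.mul_const (‖x‖ ^ 2)))).exp
  have e : ∀ t, (fun t => mehler μ t x z) t = rexp (-mehlerA μ t * ‖z‖ ^ 2
      + mehlerB μ t * inner ℝ z x + (n / 2 * Real.log (mehlerB μ t / (2 * π))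
        - mehlerA μ t * ‖x‖ ^ 2)) := fun t => by
    simp only [mehler, real_inner_smul_right]
  refine (h1.congr_of_eventuallyEq (Eventually.of_forall e)).congr_deriv ?_
  have h2 := mehlerA_sq_sub hμ hτ
  have e2 := e τ
  simp only at e2
  simp only [Pi.add_apply, Pi.sub_apply, Pi.neg_apply]
  rw [← e2]
  have e3 : lapl (mehler μ τ x) z = (‖(2 * -mehlerA μ τ) • z + mehlerB μ τ • x‖ ^ 2
      + 2 * -mehlerA μ τ * n) * mehler μ τ x z := lapl_exp_quad _ _ _
  rw [e3, norm_add_sq_real, norm_smul, norm_smul, mul_pow, mul_pow, Real.norm_eq_abs,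
    Real.norm_eq_abs, sq_abs, sq_abs, real_inner_smul_left, real_inner_smul_right]
  generalize mehler μ τ x z = k
  field_simp
  linear_combination (-2 * ‖z‖ ^ 2 * k) * h2

/-- Derivative in time of the pairing of the backward Mehler kernel with a compactly supported
function. -/
lemma hasDerivAt_integral_mehler_mul (hμ : 0 < μ) {J : Set ℝ} (hJ : IsOpen J)
    {K : Set (ℰ n)} (hK : IsCompact K)
    {g : ℝ → ℰ n → ℝ}
    (hg : ∀ t ∈ J, ∀ x, ContDiffAt ℝ ∞ (fun p : ℝ × ℰ n => g p.1 p.2) (t, x))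
    (h0 : ∀ t ∈ J, ∀ x ∉ K, g t x = 0) (b : ℝ) (x : ℰ n)
    {σ : ℝ} (hσ : σ ∈ J) (hσb : σ < b) :
    HasDerivAt (fun s => ∫ z, mehler μ (b - s) x z * g s z) (∫ z, mehler μ (b - σ) x z *
        (deriv (fun s => g s z) σ - lapl (g σ) z + μ ^ 2 * ‖z‖ ^ 2 * g σ z)) σ := by
  have hW : ∀ s ∈ J ∩ Iio b, ∀ z, ContDiffAt ℝ ∞
      (fun p : ℝ × ℰ n => mehler μ (b - p.1) x p.2 * g p.1 p.2) (s, z) := by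
    intro s hs z
    have := (contDiffAt_mehler hμ (sub_pos.2 hs.2) x z).comp (s, z)
      (f := fun p : ℝ × ℰ n => (b - p.1, p.2)) (by fun_prop)
    exact this.mul (hg s hs.1 z)
  have h1 := hasDerivAt_integral_of_zero_off (W := fun s z => mehler μ (b - s) x z * g s z)
    (hJ.inter isOpen_Iio) hK (fun s hs z => (hW s hs z).of_le (by exact_mod_cast le_top))
    (fun s hs z hz => by simp [h0 s hs.1 z hz]) ⟨hσ, hσb⟩
  refine h1.congr_deriv ?_
  have hgσ : ContDiff ℝ ∞ (g σ) := contDiff_iff_contDiffAt.2 fun z =>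
    (hg σ hσ z).comp z (f := fun z => (σ, z)) (by fun_prop)
  have hdt : ∀ z, DifferentiableAt ℝ (fun s => g s z) σ := fun z =>
    ((hg σ hσ z).comp σ (f := fun s => (s, z)) (by fun_prop)).differentiableAt (by simp)
  have hk : ContDiff ℝ ∞ (mehler (n := n) μ (b - σ) x) := contDiff_mehler x
  have hpt : ∀ z, deriv (fun s => mehler μ (b - s) x z * g s z) σ = mehler μ (b - σ) x z *
        (deriv (fun s => g s z) σ - lapl (g σ) z + μ ^ 2 * ‖z‖ ^ 2 * g σ z)
        + (mehler μ (b - σ) x z * lapl (g σ) z - lapl (mehler μ (b - σ) x) z * g σ z) := by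
    intro z
    have h2 := (hasDerivAt_mehler hμ (sub_pos.2 hσb) x z).comp σ ((hasDerivAt_id σ).const_sub b)
    have h3 := (h2.mul (hdt z).hasDerivAt).deriv
    simp only [Function.comp_def] at h3
    refine h3.trans ?_
    ring
  have hgσ0 := h0 σ hσ
  have hpd1 := fun i => pd_eq_zero_of_zero_off hK.isClosed hgσ0 i
  have hlz : ∀ z ∉ K, lapl (g σ) z = 0 := fun z hz => by
    rw [lapl_eq_sum_pd]
    exact Finset.sum_eq_zero fun i _ => pd_eq_zero_of_zero_off hK.isClosed (hpd1 i) i z hz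
  have hlc : ∀ f : ℰ n → ℝ, ContDiff ℝ ∞ f → Continuous (lapl f) := by
    intro f hf
    refine continuous_finsetSum _ fun i _ => ?_
    have h4 : ContDiff ℝ 1 (pd i f) := (hf.of_le two_le_smooth).pd i (by norm_num)
    exact (h4.pd (k := 0) i (by norm_num)).continuous
  have hi1 : Integrable fun z => mehler μ (b - σ) x z * lapl (g σ) z :=
    integrable_of_continuous_of_zero_off hK (hk.continuous.mul (hlc _ hgσ))
      fun z hz => by simp [hlz z hz]
  have hi2 : Integrable fun z => lapl (mehler μ (b - σ) x) z * g σ z :=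
    integrable_of_continuous_of_zero_off hK ((hlc _ hk).mul hgσ.continuous)
      fun z hz => by simp [hgσ0 z hz]
  have hdc : Continuous fun z => deriv (fun s => g s z) σ := by
    have e : ∀ z, deriv (fun s => g s z) σ
        = fderiv ℝ (fun p : ℝ × ℰ n => g p.1 p.2) (σ, z) (1, 0) := fun z =>
      (deriv_eq_fderiv_prod ((hg σ hσ z).differentiableAt (by simp))).deriv
    simp only [e]
    refine continuous_iff_continuousAt.2 fun z => ?_
    have : ContinuousAt (fderiv ℝ (fun p : ℝ × ℰ n => g p.1 p.2)) (σ, z) :=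
      ((hg σ hσ z).fderiv_right (m := 0) (by exact_mod_cast le_top)).continuousAt
    exact (this.comp (f := fun z => (σ, z)) (by fun_prop)).clm_apply continuousAt_const
  have hdz : ∀ z ∉ K, deriv (fun s => g s z) σ = 0 := fun z hz => by
    have : (fun s => g s z) =ᶠ[𝓝 σ] fun _ => 0 := by
      filter_upwards [hJ.mem_nhds hσ] with r hr using h0 r hr z hz
    rw [this.deriv_eq, deriv_const]
  have hi3 : Integrable fun z => mehler μ (b - σ) x z *
      (deriv (fun s => g s z) σ - lapl (g σ) z + μ ^ 2 * ‖z‖ ^ 2 * g σ z) :=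
    integrable_of_continuous_of_zero_off hK
      (hk.continuous.mul ((hdc.sub (hlc _ hgσ)).add ((by fun_prop : Continuous fun z :
        ℰ n => μ ^ 2 * ‖z‖ ^ 2).mul hgσ.continuous)))
      fun z hz => by simp [hlz z hz, hgσ0 z hz, hdz z hz]
  simp only [hpt]
  have hi12 : Integrable fun z => mehler μ (b - σ) x z * lapl (g σ) z
      - lapl (mehler μ (b - σ) x) z * g σ z := hi1.sub hi2
  rw [integral_add hi3 hi12, integral_sub hi1 hi2,
    integral_mul_lapl_comm hK (hk.of_le two_le_smooth) (hgσ.of_le two_le_smooth) hgσ0]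
  ring

end Mehler
section MehlerRepresentation

variable {n : ℕ} {μ τ : ℝ}

lemma mehler_eq (hμ : 0 < μ) (hτ : 0 < τ) (x z : ℰ n) :
    mehler μ τ x z = rexp (n / 2 * Real.log (mehlerB μ τ / (2 * π))
      - μ ^ 2 / (4 * mehlerA μ τ) * ‖x‖ ^ 2)
      * rexp (-mehlerA μ τ * ‖z - (mehlerB μ τ / (2 * mehlerA μ τ)) • x‖ ^ 2) := by
  have hA := mehlerA_pos hμ hτ
  rw [mehler, ← Real.exp_add, norm_sub_sq_real, norm_smul, mul_pow, Real.norm_eq_abs, sq_abs,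
    real_inner_smul_right, real_inner_smul_right, ← mehlerA_sq_sub hμ hτ]
  congr 1
  field_simp
  ring

lemma mehlerB_le (hμ : 0 < μ) (hτ : 0 < τ) : mehlerB μ τ ≤ 1 / (2 * τ) := by
  have h : 2 * μ * τ ≤ Real.sinh (2 * μ * τ) := Real.self_le_sinh_iff.2 (by positivity)
  rw [mehlerB, div_le_div_iff₀ (sinh_pos_of_pos hμ hτ) (by positivity)]
  linarith

lemma mehler_le (hμ : 0 < μ) (hτ : 0 < τ) (x z : ℰ n) :
    mehler μ τ x z ≤ rexp (-(n / 2 * Real.log (4 * π * τ))) := by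
  have hA := mehlerA_pos hμ hτ
  have hB := mehlerB_pos hμ hτ
  rw [mehler_eq hμ hτ, ← Real.exp_add, Real.exp_le_exp]
  have h1 : Real.log (mehlerB μ τ / (2 * π)) ≤ - Real.log (4 * π * τ) := by
    rw [← Real.log_inv]
    apply Real.log_le_log (by positivity)
    rw [div_le_iff₀ (by positivity)]
    refine (mehlerB_le hμ hτ).trans_eq ?_
    field_simp
    ring
  have h2 : 0 ≤ μ ^ 2 / (4 * mehlerA μ τ) * ‖x‖ ^ 2 := by positivity
  have h3 : 0 ≤ mehlerA μ τ * ‖z - (mehlerB μ τ / (2 * mehlerA μ τ)) • x‖ ^ 2 := by positivity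
  have h4 := mul_le_mul_of_nonneg_left h1 (by positivity : (0:ℝ) ≤ n / 2)
  linarith

lemma integral_exp_neg_norm_sq : ∫ w : ℰ n, rexp (-‖w‖ ^ 2) = π ^ ((n : ℝ) / 2) := by
  have := GaussianFourier.integral_rexp_neg_mul_sq_norm (V := ℰ n) (b := 1) one_pos
  simpa using this

lemma integrable_exp_neg_norm_sq : Integrable fun w : ℰ n => rexp (-‖w‖ ^ 2) := by
  by_contra h
  have := integral_undef h
  rw [integral_exp_neg_norm_sq] at this
  have h2 : 0 < π ^ ((n : ℝ) / 2) := by positivity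
  linarith

/-- The Mehler kernel, in rescaled variables, is a multiple of a fixed Gaussian. -/
lemma integral_mehler_mul (hμ : 0 < μ) (hτ : 0 < τ) (x : ℰ n) (f : ℰ n → ℝ) :
    ∫ z, mehler μ τ x z * f z = ∫ w : ℰ n,
      (mehlerB μ τ / (2 * mehlerA μ τ)) ^ ((n : ℝ) / 2) * (π ^ ((n : ℝ) / 2))⁻¹
        * rexp (-(μ ^ 2 / (4 * mehlerA μ τ) * ‖x‖ ^ 2)) * rexp (-‖w‖ ^ 2)
        * f ((mehlerB μ τ / (2 * mehlerA μ τ)) • x + (mehlerA μ τ) ^ (-(1/2) : ℝ) • w) := by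
  have hA := mehlerA_pos hμ hτ
  have hB := mehlerB_pos hμ hτ
  set A := mehlerA μ τ
  set B := mehlerB μ τ
  set r : ℝ := A ^ (-(1/2) : ℝ) with hr
  have hr0 : 0 < r := Real.rpow_pos_of_pos hA _
  have hr2 : A * r ^ 2 = 1 := by
    rw [hr, ← Real.rpow_natCast, ← Real.rpow_mul hA.le]
    norm_num [Real.rpow_neg_one, hA.ne']
  set v := (B / (2 * A)) • x
  have h1 := integral_add_left_eq_self (μ := (volume : Measure (ℰ n)))
    (fun z => mehler μ τ x z * f z) v
  have h2 := Measure.integral_comp_smul (volume : Measure (ℰ n))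
    (fun z => mehler μ τ x (v + z) * f (v + z)) r
  rw [h1, finrank_euclideanSpace_fin, abs_of_pos (by positivity), smul_eq_mul] at h2
  have h3 : ∫ z, mehler μ τ x z * f z
      = ∫ w, r ^ n * (mehler μ τ x (v + r • w) * f (v + r • w)) := by
    rw [integral_const_mul, h2]
    field_simp
  rw [h3]
  congr 1
  ext w
  have e1 : ‖v + r • w - v‖ ^ 2 = r ^ 2 * ‖w‖ ^ 2 := by
    rw [add_sub_cancel_left, norm_smul, mul_pow, Real.norm_eq_abs, sq_abs]
  have e2 : -A * (r ^ 2 * ‖w‖ ^ 2) = -‖w‖ ^ 2 := by linear_combination (-‖w‖ ^ 2) * hr2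
  have e3 : r ^ n * rexp (n / 2 * Real.log (B / (2 * π)))
      = (B / (2 * A)) ^ ((n : ℝ) / 2) * (π ^ ((n : ℝ) / 2))⁻¹ := by
    rw [mul_comm ((n : ℝ) / 2), ← Real.rpow_def_of_pos (by positivity), hr, ← Real.rpow_natCast,
      ← Real.rpow_mul hA.le, ← Real.inv_rpow (by positivity), ← Real.mul_rpow (by positivity)
      (by positivity), show -(1/2) * (n : ℝ) = -((n : ℝ) / 2) by ring, Real.rpow_neg hA.le,
      ← Real.inv_rpow hA.le, ← Real.mul_rpow (by positivity) (by positivity)]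
    congr 1
    field_simp
  rw [mehler_eq hμ hτ, e1, e2, sub_eq_add_neg, Real.exp_add, ← e3]
  ring

lemma mehlerB_div_le (hμ : 0 < μ) (hτ : 0 < τ) :
    mehlerB μ τ / (2 * mehlerA μ τ) = 1 / Real.cosh (2 * μ * τ) := by
  rw [mehlerA, mehlerB]
  field_simp

lemma tendsto_mehlerA (hμ : 0 < μ) : Tendsto (mehlerA μ) (𝓝[>] 0) atTop := by
  have h1 : Tendsto (fun τ => 2 * μ * τ) (𝓝[>] 0) (𝓝 0) := by
    have : Continuous fun τ : ℝ => 2 * μ * τ := by fun_prop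
    simpa using (this.tendsto 0).mono_left nhdsWithin_le_nhds
  have hs : Tendsto (fun τ => Real.sinh (2 * μ * τ)) (𝓝[>] 0) (𝓝[>] 0) := by
    refine tendsto_nhdsWithin_iff.2 ⟨?_, ?_⟩
    · simpa [Function.comp_def] using (Real.continuous_sinh.tendsto 0).comp h1
    · filter_upwards [self_mem_nhdsWithin] with τ hτ using sinh_pos_of_pos hμ hτ
  have h2 := hs.inv_tendsto_nhdsGT_zero
  refine tendsto_atTop_mono' _ ?_ (h2.const_mul_atTop (show 0 < μ / 2 by positivity))
  filter_upwards [self_mem_nhdsWithin] with τ hτ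
  have := sinh_pos_of_pos hμ hτ
  have h3 := Real.one_le_cosh (2 * μ * τ)
  simp only [mehlerA, Pi.inv_apply, div_eq_mul_inv]
  have : 0 < (Real.sinh (2 * μ * τ))⁻¹ := by positivity
  nlinarith [mul_pos hμ this]

/-- The Mehler kernel is an approximate identity as `τ → 0⁺`. -/
lemma tendsto_integral_mehler_mul (hμ : 0 < μ) {g : ℝ → ℰ n → ℝ} {b M : ℝ} {x : ℰ n}
    (hc : ContinuousAt (fun p : ℝ × ℰ n => g p.1 p.2) (b, x))
    (hM : ∀ᶠ σ in 𝓝[<] b, ∀ z, |g σ z| ≤ M) (hg : ∀ᶠ σ in 𝓝[<] b, Continuous (g σ)) :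
    Tendsto (fun σ => ∫ z, mehler μ (b - σ) x z * g σ z) (𝓝[<] b) (𝓝 (g b x)) := by
  have hsub : Tendsto (fun σ => b - σ) (𝓝[<] b) (𝓝[>] 0) := by
    refine tendsto_nhdsWithin_iff.2 ⟨?_, ?_⟩
    · have : Continuous fun σ : ℝ => b - σ := by fun_prop
      simpa using (this.tendsto b).mono_left nhdsWithin_le_nhds
    · filter_upwards [self_mem_nhdsWithin] with σ hσ using sub_pos.2 (mem_Iio.1 hσ)
  have hA := (tendsto_mehlerA hμ).comp hsub
  have hq : Tendsto (fun σ => mehlerB μ (b - σ) / (2 * mehlerA μ (b - σ))) (𝓝[<] b) (𝓝 1) := by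
    have : Continuous fun σ : ℝ => 1 / Real.cosh (2 * μ * (b - σ)) := by
      have h0 : ∀ σ : ℝ, Real.cosh (2 * μ * (b - σ)) ≠ 0 := fun σ => (Real.cosh_pos _).ne'
      have h1 : Continuous fun σ : ℝ => Real.cosh (2 * μ * (b - σ)) :=
        Real.continuous_cosh.comp (by fun_prop)
      exact continuous_const.div h1 h0
    have h2 : Tendsto (fun σ : ℝ => 1 / Real.cosh (2 * μ * (b - σ))) (𝓝[<] b) (𝓝 1) := by
      simpa using (this.tendsto b).mono_left nhdsWithin_le_nhds
    refine h2.congr' ?_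
    filter_upwards [self_mem_nhdsWithin] with σ hσ
    exact (mehlerB_div_le hμ (sub_pos.2 (mem_Iio.1 hσ))).symm
  have hr : Tendsto (fun σ => mehlerA μ (b - σ) ^ (-(1/2) : ℝ)) (𝓝[<] b) (𝓝 0) :=
    (tendsto_rpow_neg_atTop (by norm_num)).comp hA
  set c : ℝ → ℝ := fun σ => (mehlerB μ (b - σ) / (2 * mehlerA μ (b - σ))) ^ ((n : ℝ) / 2)
    * (π ^ ((n : ℝ) / 2))⁻¹ * rexp (-(μ ^ 2 / (4 * mehlerA μ (b - σ)) * ‖x‖ ^ 2))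
  have hcl : Tendsto c (𝓝[<] b) (𝓝 (π ^ ((n : ℝ) / 2))⁻¹) := by
    have h1 := hq.rpow_const (p := (n : ℝ) / 2) (Or.inl one_ne_zero)
    have h2 : Tendsto (fun σ => μ ^ 2 / (4 * mehlerA μ (b - σ))) (𝓝[<] b) (𝓝 0) :=
      Tendsto.div_atTop tendsto_const_nhds (hA.const_mul_atTop (by norm_num : (0:ℝ) < 4))
    have h3 : Tendsto (fun σ => rexp (-(μ ^ 2 / (4 * mehlerA μ (b - σ)) * ‖x‖ ^ 2)))
        (𝓝[<] b) (𝓝 1) := by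
      have := (Real.continuous_exp.tendsto _).comp ((h2.mul_const (‖x‖ ^ 2)).neg)
      simpa [Function.comp_def] using this
    have h4 := (h1.mul_const (π ^ ((n : ℝ) / 2))⁻¹).mul h3
    simpa using h4
  have hlim : ∫ w : ℰ n, (π ^ ((n : ℝ) / 2))⁻¹ * rexp (-‖w‖ ^ 2) * g b x = g b x := by
    rw [integral_mul_const, integral_const_mul, integral_exp_neg_norm_sq,
      inv_mul_cancel₀ (by positivity), one_mul]
  rw [← hlim]
  have hcb : ∀ᶠ σ in 𝓝[<] b, |c σ| ≤ (π ^ ((n : ℝ) / 2))⁻¹ + 1 := by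
    have hp : 0 < (π ^ ((n : ℝ) / 2))⁻¹ := by positivity
    have h5 := hcl.abs
    rw [abs_of_pos hp] at h5
    filter_upwards [h5.eventually (gt_mem_nhds (lt_add_one _))] with σ hσ using hσ.le
  have key : Tendsto (fun σ => ∫ w : ℰ n, c σ * rexp (-‖w‖ ^ 2)
      * g σ ((mehlerB μ (b - σ) / (2 * mehlerA μ (b - σ))) • x
        + (mehlerA μ (b - σ)) ^ (-(1/2) : ℝ) • w)) (𝓝[<] b)
      (𝓝 (∫ w : ℰ n, (π ^ ((n : ℝ) / 2))⁻¹ * rexp (-‖w‖ ^ 2) * g b x)) := by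
    refine tendsto_integral_filter_of_dominated_convergence
      (fun w => ((π ^ ((n : ℝ) / 2))⁻¹ + 1) * rexp (-‖w‖ ^ 2) * M) ?_ ?_ ?_ ?_
    · filter_upwards [hg] with σ hσ
      exact (Continuous.mul (by fun_prop) (hσ.comp (by fun_prop))).aestronglyMeasurable
    · filter_upwards [hM, hcb] with σ h1 h2
      refine Eventually.of_forall fun w => ?_
      rw [Real.norm_eq_abs, abs_mul, abs_mul, abs_of_pos (Real.exp_pos _)]
      have := h1 ((mehlerB μ (b - σ) / (2 * mehlerA μ (b - σ))) • x
        + (mehlerA μ (b - σ)) ^ (-(1/2) : ℝ) • w)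
      gcongr
    · exact (integrable_exp_neg_norm_sq.const_mul _).mul_const _
    · refine Eventually.of_forall fun w => ?_
      have hpt : Tendsto (fun σ => (σ, (mehlerB μ (b - σ) / (2 * mehlerA μ (b - σ))) • x
        + (mehlerA μ (b - σ)) ^ (-(1/2) : ℝ) • w)) (𝓝[<] b) (𝓝 (b, x)) := by
        have h6 : Tendsto (fun σ => (mehlerB μ (b - σ) / (2 * mehlerA μ (b - σ))) • x
          + (mehlerA μ (b - σ)) ^ (-(1/2) : ℝ) • w) (𝓝[<] b) (𝓝 x) := by
          simpa using (hq.smul_const x).add (hr.smul_const w)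
        exact (tendsto_id.mono_left nhdsWithin_le_nhds).prodMk_nhds h6
      exact (hcl.mul_const _).mul (hc.tendsto.comp hpt)
  refine key.congr' ?_
  filter_upwards [self_mem_nhdsWithin] with σ hσ
  rw [integral_mehler_mul hμ (sub_pos.2 (mem_Iio.1 hσ))]

/-- One-sided Duhamel estimate: a compactly supported subsolution up to an error is bounded by the
Mehler propagation of its initial value. -/
lemma le_integral_mehler_mul (hμ : 0 < μ) {J : Set ℝ} (hJ : IsOpen J)
    {K : Set (ℰ n)} (hK : IsCompact K)
    {g : ℝ → ℰ n → ℝ}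
    (hg : ∀ t ∈ J, ∀ x, ContDiffAt ℝ ∞ (fun p : ℝ × ℰ n => g p.1 p.2) (t, x))
    (h0 : ∀ t ∈ J, ∀ x ∉ K, g t x = 0) {a b C : ℝ} (hab : a < b) (hJab : Icc a b ⊆ J)
    (x : ℰ n)
    (hC : ∀ σ ∈ Ico a b, ∫ z, mehler μ (b - σ) x z *
        (deriv (fun s => g s z) σ - lapl (g σ) z + μ ^ 2 * ‖z‖ ^ 2 * g σ z) ≤ C) :
    g b x ≤ (∫ z, mehler μ (b - a) x z * g a z) + C * (b - a) := by
  have hb : b ∈ J := hJab (right_mem_Icc.2 hab.le)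
  have hd := fun σ (hσ : σ ∈ Ico a b) => hasDerivAt_integral_mehler_mul hμ hJ hK hg h0 b x
    (hJab (Ico_subset_Icc_self hσ)) hσ.2
  have hcg : ∀ t ∈ J, ∀ z, ContinuousAt (fun p : ℝ × ℰ n => g p.1 p.2) (t, z) :=
    fun t ht z => (hg t ht z).continuousAt
  have hcs : ∀ t ∈ J, Continuous (g t) := fun t ht => continuous_iff_continuousAt.2 fun z =>
    (hcg t ht z).comp (f := fun z => (t, z)) (by fun_prop)
  obtain ⟨M, hM⟩ := ((isCompact_Icc (a := a) (b := b)).prod hK).exists_bound_of_continuousOn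
    (f := fun p : ℝ × ℰ n => g p.1 p.2)
    (fun p hp => (hcg p.1 (hJab hp.1) p.2).continuousWithinAt)
  have hIco : Ico a b ∈ 𝓝[<] b := Ico_mem_nhdsLT hab
  have hlim := tendsto_integral_mehler_mul hμ (M := max M 0) (hcg b hb x) (by
      filter_upwards [hIco] with σ hσ z
      by_cases hz : z ∈ K
      · exact (hM (σ, z) ⟨Ico_subset_Icc_self hσ, hz⟩).trans (le_max_left _ _)
      · simp [h0 σ (hJab (Ico_subset_Icc_self hσ)) z hz])
    (by filter_upwards [hIco] with σ hσ using hcs σ (hJab (Ico_subset_Icc_self hσ)))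
  have hanti : AntitoneOn (fun σ => (∫ z, mehler μ (b - σ) x z * g σ z) - C * σ) (Ico a b) := by
    refine antitoneOn_of_deriv_nonpos (convex_Ico a b) ?_ ?_ ?_
    · exact fun σ hσ => ((hd σ hσ).continuousAt.sub (by fun_prop)).continuousWithinAt
    · intro σ hσ
      rw [interior_Ico] at hσ
      exact ((hd σ (Ioo_subset_Ico_self hσ)).sub
        ((hasDerivAt_id σ).const_mul C)).differentiableAt.differentiableWithinAt
    · intro σ hσ
      rw [interior_Ico] at hσ
      have h1 := ((hd σ (Ioo_subset_Ico_self hσ)).sub ((hasDerivAt_id σ).const_mul C)).deriv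
      have h2 := hC σ (Ioo_subset_Ico_self hσ)
      have e : (fun σ => (∫ z, mehler μ (b - σ) x z * g σ z) - C * σ)
        = (fun s => ∫ z, mehler μ (b - s) x z * g s z) - fun y => C * id y := rfl
      rw [e, h1]
      linarith
  have hlim2 : Tendsto (fun σ => (∫ z, mehler μ (b - σ) x z * g σ z) - C * σ) (𝓝[<] b)
      (𝓝 (g b x - C * b)) :=
    hlim.sub (((by fun_prop : Continuous fun σ : ℝ => C * σ).tendsto b).mono_left
      nhdsWithin_le_nhds)
  have := le_of_tendsto hlim2 (b := (∫ z, mehler μ (b - a) x z * g a z) - C * a) (by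
    filter_upwards [hIco] with σ hσ
    exact hanti (left_mem_Ico.2 hab) hσ hσ.1)
  linarith

end MehlerRepresentation
/-- A smooth convex approximation of the positive part. -/
noncomputable def smoothPos (ε v : ℝ) : ℝ := ∫ w in (0:ℝ)..v, Real.smoothTransition ((w - ε) / ε)

section SmoothPos

variable {ε : ℝ}

lemma continuous_smoothTransition_div (ε : ℝ) :
    Continuous fun w => Real.smoothTransition ((w - ε) / ε) :=
  Real.smoothTransition.continuous.comp (by fun_prop)

lemma hasDerivAt_smoothPos (ε v : ℝ) :
    HasDerivAt (smoothPos ε) (Real.smoothTransition ((v - ε) / ε)) v :=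
  ((continuous_smoothTransition_div ε).integral_hasStrictDerivAt 0 v).hasDerivAt

lemma deriv_smoothPos (ε : ℝ) :
    deriv (smoothPos ε) = fun v => Real.smoothTransition ((v - ε) / ε) :=
  funext fun v => (hasDerivAt_smoothPos ε v).deriv

lemma contDiff_smoothPos (ε : ℝ) : ContDiff ℝ ∞ (smoothPos ε) := by
  rw [contDiff_infty_iff_deriv, deriv_smoothPos]
  exact ⟨fun v => (hasDerivAt_smoothPos ε v).differentiableAt,
    Real.smoothTransition.contDiff.comp (by fun_prop)⟩

lemma smoothPos_eq_zero (hε : 0 < ε) {v : ℝ} (hv : v ≤ ε) : smoothPos ε v = 0 := by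
  rw [smoothPos, intervalIntegral.integral_congr (g := fun _ => 0), intervalIntegral.integral_zero]
  intro w hw
  have : w ≤ ε := hw.2.trans (max_le hε.le hv)
  exact Real.smoothTransition.zero_of_nonpos (div_nonpos_of_nonpos_of_nonneg (by linarith) hε.le)

lemma smoothPos_le (hε : 0 < ε) (v : ℝ) : smoothPos ε v ≤ deriv (smoothPos ε) v * v := by
  rcases le_total v ε with hv | hv
  · rw [smoothPos_eq_zero hε hv, deriv_smoothPos]
    simp [Real.smoothTransition.zero_of_nonpos
      (div_nonpos_of_nonpos_of_nonneg (sub_nonpos.2 hv) hε.le)]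
  · have hv0 : 0 ≤ v := hε.le.trans hv
    rw [deriv_smoothPos, smoothPos]
    refine (intervalIntegral.integral_mono_on (g := fun _ => Real.smoothTransition ((v - ε) / ε))
      hv0 ((continuous_smoothTransition_div ε).intervalIntegrable _ _)
      (continuous_const.intervalIntegrable _ _) fun w hw => ?_).trans_eq ?_
    · exact Real.smoothTransition.monotone (by gcongr; exact hw.2)
    · simp [mul_comm]

lemma deriv_deriv_smoothPos_nonneg (hε : 0 < ε) (v : ℝ) : 0 ≤ deriv (deriv (smoothPos ε)) v := by
  rw [deriv_smoothPos]
  refine Monotone.deriv_nonneg fun a b hab => Real.smoothTransition.monotone ?_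
  gcongr

lemma smoothPos_nonneg (hε : 0 < ε) (v : ℝ) : 0 ≤ smoothPos ε v := by
  rcases le_total v ε with hv | hv
  · rw [smoothPos_eq_zero hε hv]
  · exact intervalIntegral.integral_nonneg (hε.le.trans hv)
      fun w _ => Real.smoothTransition.nonneg _

lemma smoothPos_le_abs (hε : 0 < ε) (v : ℝ) : smoothPos ε v ≤ |v| := by
  refine (smoothPos_le hε v).trans ((le_abs_self _).trans ?_)
  rw [abs_mul, deriv_smoothPos, abs_of_nonneg (Real.smoothTransition.nonneg _)]
  exact mul_le_of_le_one_left (abs_nonneg _) (Real.smoothTransition.le_one _)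

lemma sub_le_smoothPos (hε : 0 < ε) (v : ℝ) : v - 2 * ε ≤ smoothPos ε v := by
  rcases le_total v (2 * ε) with hv | hv
  · exact (sub_nonpos.2 hv).trans (smoothPos_nonneg hε v)
  · have hi := fun a b => (continuous_smoothTransition_div ε).intervalIntegrable (μ := volume) a b
    rw [smoothPos, ← intervalIntegral.integral_add_adjacent_intervals (hi 0 (2 * ε)) (hi (2 * ε) v),
      intervalIntegral.integral_congr (a := 2 * ε) (g := fun _ => 1)]
    · have := intervalIntegral.integral_nonneg (μ := volume) (by positivity : 0 ≤ 2 * ε)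
        fun w _ => Real.smoothTransition.nonneg ((w - ε) / ε)
      simp only [intervalIntegral.integral_const, smul_eq_mul, mul_one]
      linarith
    · intro w hw
      rw [uIcc_of_le hv] at hw
      refine Real.smoothTransition.one_of_one_le ?_
      rw [le_div_iff₀ hε]
      linarith [hw.1]

end SmoothPos

section ZeroExtension

variable {n : ℕ} {R r : ℝ}

lemma contDiffAt_indicator_ball {J : Set ℝ} (hJ : IsOpen J) {f : ℝ → ℰ n → ℝ} (hr : r < R)
    (hf : ∀ t ∈ J, ∀ x ∈ ball 0 R, ContDiffAt ℝ ∞ (fun p : ℝ × ℰ n => f p.1 p.2) (t, x))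
    (h0 : ∀ t ∈ J, ∀ x ∈ ball 0 R, r < ‖x‖ → f t x = 0) :
    ∀ t ∈ J, ∀ x, ContDiffAt ℝ ∞ (fun p : ℝ × ℰ n => (ball 0 R).indicator (f p.1) p.2) (t, x) := by
  intro t ht x
  by_cases hx : x ∈ ball 0 R
  · refine (hf t ht x hx).congr_of_eventuallyEq ?_
    filter_upwards [continuous_snd.continuousAt.preimage_mem_nhds
      (isOpen_ball.mem_nhds hx : ball 0 R ∈ 𝓝 (t, x).2)] with p hp
    exact indicator_of_mem (mem_preimage.1 hp) _
  · refine contDiffAt_const (c := (0:ℝ)).congr_of_eventuallyEq ?_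
    have hx2 : r < ‖x‖ := hr.trans_le (by simpa using hx)
    have h1 : {z : ℰ n | r < ‖z‖} ∈ 𝓝 x := (isOpen_lt continuous_const continuous_norm).mem_nhds hx2
    filter_upwards [continuous_snd.continuousAt.preimage_mem_nhds (h1 : _ ∈ 𝓝 (t, x).2),
      continuous_fst.continuousAt.preimage_mem_nhds (hJ.mem_nhds ht : J ∈ 𝓝 (t, x).1)] with p hp hp2
    by_cases hpb : p.2 ∈ ball 0 R
    · rw [indicator_of_mem hpb, h0 p.1 hp2 p.2 hpb hp]
    · exact indicator_of_notMem hpb _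

lemma eventuallyEq_indicator_ball {f : ℰ n → ℝ}
    {x : ℰ n} (hx : x ∈ ball 0 R) : (ball 0 R).indicator f =ᶠ[𝓝 x] f := by
  filter_upwards [isOpen_ball.mem_nhds hx] with z hz using indicator_of_mem hz _

lemma eventuallyEq_zero_of_zero_off {f : ℰ n → ℝ} (h0 : ∀ x ∉ closedBall 0 r, f x = 0)
    {x : ℰ n} (hx : x ∉ closedBall 0 r) : f =ᶠ[𝓝 x] fun _ => 0 := by
  filter_upwards [isClosed_closedBall.isOpen_compl.mem_nhds hx] with z hz using h0 z hz

end ZeroExtension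

namespace IsHarmonicHeatSolution

variable {n : ℕ} {R μ T : ℝ} {y : ℝ → ℰ n → ℝ}

lemma exists_small_near_boundary (h : IsHarmonicHeatSolution n R μ T y) (hT : 0 < T) (hR : 0 < R)
    {ε : ℝ} (hε : 0 < ε) :
    ∃ r, 0 ≤ r ∧ r < R ∧ ∀ t ∈ Icc 0 T, ∀ x ∈ closedBall 0 R, r < ‖x‖ → |y t x| ≤ ε := by
  set S : Set (ℝ × ℰ n) := Icc 0 T ×ˢ closedBall 0 R
  have hS : IsCompact S := isCompact_Icc.prod (isCompact_closedBall _ _)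
  have hcl : IsClosed (S ∩ (fun p => |y p.1 p.2|) ⁻¹' Ici ε) :=
    (h.continuousOn.abs).preimage_isClosed_of_isClosed hS.isClosed isClosed_Ici
  have hK : IsCompact (S ∩ (fun p => |y p.1 p.2|) ⁻¹' Ici ε) :=
    hS.of_isClosed_subset hcl inter_subset_left
  rcases (S ∩ (fun p => |y p.1 p.2|) ⁻¹' Ici ε).eq_empty_or_nonempty with he | hne
  · refine ⟨0, le_rfl, hR, fun t ht x hx _ => ?_⟩
    by_contra hc
    have : (t, x) ∈ S ∩ (fun p => |y p.1 p.2|) ⁻¹' Ici ε := ⟨⟨ht, hx⟩, (not_le.1 hc).le⟩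
    rw [he] at this
    exact this
  · obtain ⟨p, hp, hmax⟩ := hK.exists_isMaxOn hne (f := fun p => ‖p.2‖) (by fun_prop)
    have hpR : ‖p.2‖ ≤ R := by simpa using hp.1.2
    refine ⟨‖p.2‖, norm_nonneg _, lt_of_le_of_ne hpR fun he => ?_, fun t ht x hx hlt => ?_⟩
    · have := h.boundary_closed hT hp.1.1 (x := p.2) (by simpa using he)
      have h2 : ε ≤ |y p.1 p.2| := hp.2
      rw [this, abs_zero] at h2
      linarith
    · by_contra hc
      have := isMaxOn_iff.1 hmax (t, x) ⟨⟨ht, hx⟩, (not_le.1 hc).le⟩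
      simp only at this
      linarith

lemma integrableOn_sq (h : IsHarmonicHeatSolution n R μ T y) {t : ℝ} (ht : t ∈ Icc 0 T) :
    IntegrableOn (fun x => y t x ^ 2) (ball 0 R) :=
  (((h.continuousOn_slice ht).pow 2).integrableOn_compact (isCompact_closedBall _ _)).mono_set
    ball_subset_closedBall

lemma integrableOn_abs (h : IsHarmonicHeatSolution n R μ T y) {t : ℝ} (ht : t ∈ Icc 0 T) :
    IntegrableOn (fun x => |y t x|) (ball 0 R) :=
  (((h.continuousOn_slice ht).abs).integrableOn_compact (isCompact_closedBall _ _)).mono_set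
    ball_subset_closedBall

lemma le_integral_abs (h : IsHarmonicHeatSolution n R μ T y) (hμ : 0 < μ) (hR : 0 < R)
    {a b : ℝ} (ha : 0 < a) (hab : a < b) (hb : b < T) {x : ℰ n}
    (hx : x ∈ ball 0 R) :
    y b x ≤ rexp (-(n / 2 * Real.log (4 * π * (b - a)))) * ∫ z in ball 0 R, |y a z| := by
  refine le_of_forall_pos_le_add fun ε hε => ?_
  have hε' : 0 < ε / 2 := by positivity
  obtain ⟨r, hr0, hrR, hr⟩ := h.exists_small_near_boundary ((ha.trans hab).trans hb) hR hε'
  set g : ℝ → ℰ n → ℝ := fun t => (ball 0 R).indicator (fun z => smoothPos (ε / 2) (y t z)) with hg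
  have hg0 : ∀ t ∈ Ioo 0 T, ∀ z ∈ ball 0 R, r < ‖z‖ →
      smoothPos (ε / 2) (y t z) = 0 := fun t ht z hz hlt =>
    smoothPos_eq_zero hε' ((le_abs_self _).trans
      (hr t (Ioo_subset_Icc_self ht) z (ball_subset_closedBall hz) hlt))
  have hgs := contDiffAt_indicator_ball (f := fun t z => smoothPos (ε / 2) (y t z)) isOpen_Ioo hrR
    (fun t ht z hz => ContDiffAt.comp (g := smoothPos (ε / 2)) (t, z)
      (contDiff_smoothPos _).contDiffAt (h.contDiffAt ht hz)) hg0
  have hgK : ∀ t ∈ Ioo 0 T, ∀ z ∉ closedBall 0 r, g t z = 0 := by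
    intro t ht z hz
    by_cases hzb : z ∈ ball 0 R
    · rw [hg]
      simp only
      rw [indicator_of_mem hzb]
      exact hg0 t ht z hzb (by simpa using hz)
    · exact indicator_of_notMem hzb _
  have hmain := le_integral_mehler_mul hμ isOpen_Ioo (isCompact_closedBall 0 r) hgs hgK (C := 0)
    hab (fun t ht => ⟨ha.trans_le ht.1, ht.2.trans_lt hb⟩) x (by
      intro σ hσ
      have hσ' : σ ∈ Ioo 0 T := ⟨ha.trans_le hσ.1, hσ.2.trans hb⟩
      refine integral_nonpos fun z => mul_nonpos_of_nonneg_of_nonpos (mehler_pos _ _).le ?_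
      by_cases hzb : z ∈ ball 0 R
      · have e1 : (fun s => g s z) = fun s => smoothPos (ε / 2) (y s z) := by
          funext s; exact indicator_of_mem hzb _
        have e2 : lapl (g σ) z = _ := (lapl_congr (eventuallyEq_indicator_ball hzb)).trans
          (lapl_comp ((contDiff_smoothPos (ε / 2)).of_le two_le_smooth)
            ((h.contDiffAt_space hσ' hzb).of_le two_le_smooth))
        have e3 : g σ z = smoothPos (ε / 2) (y σ z) := indicator_of_mem hzb _
        have e4 := ((hasDerivAt_smoothPos (ε / 2) (y σ z)).comp σ
          (h.differentiableAt_time hσ' hzb).hasDerivAt).deriv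
        simp only [Function.comp_def] at e4
        have h1 := h.eqn σ hσ' z hzb
        have h2 := mul_nonneg (deriv_deriv_smoothPos_nonneg hε' (y σ z))
          (Finset.sum_nonneg fun i (_ : i ∈ Finset.univ) => sq_nonneg (pd i (y σ) z))
        have h3 := mul_le_mul_of_nonneg_left (smoothPos_le hε' (y σ z))
          (by positivity : 0 ≤ μ ^ 2 * ‖z‖ ^ 2)
        change deriv (fun s => g s z) σ - lapl (g σ) z + μ ^ 2 * ‖z‖ ^ 2 * g σ z ≤ 0
        rw [e1, e2, e3, e4, deriv_smoothPos] at *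
        simp only at *
        generalize Real.smoothTransition ((y σ z - ε / 2) / (ε / 2)) = S at *
        have h4 : S * (deriv (fun s => y s z) σ) - S * lapl (y σ) z
          + S * (μ ^ 2 * ‖z‖ ^ 2 * y σ z) = 0 := by linear_combination S * h1
        linarith
      · have hz : z ∉ closedBall 0 r := fun hz => hzb (closedBall_subset_ball hrR hz)
        have e1 : (fun s => g s z) = fun _ => 0 := by funext s; exact indicator_of_notMem hzb _
        have e2 : lapl (g σ) z = 0 :=
          (lapl_congr (eventuallyEq_zero_of_zero_off (hgK σ hσ') hz)).trans (lapl_const 0)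
        have e3 : g σ z = 0 := hgK σ hσ' z hz
        change deriv (fun s => g s z) σ - lapl (g σ) z + μ ^ 2 * ‖z‖ ^ 2 * g σ z ≤ 0
        rw [e1, e2, e3]
        simp)
  have hbx : y b x - ε ≤ g b x := by
    have e : g b x = smoothPos (ε / 2) (y b x) := indicator_of_mem hx _
    rw [e]
    have := sub_le_smoothPos hε' (y b x)
    linarith
  have haI : a ∈ Ioo 0 T := ⟨ha, hab.trans hb⟩
  have hint : ∫ z, mehler μ (b - a) x z * g a z ≤
      rexp (-(n / 2 * Real.log (4 * π * (b - a)))) * ∫ z in ball 0 R, |y a z| := by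
    rw [← integral_indicator measurableSet_ball, ← integral_const_mul]
    have hi := ((integrable_indicator_iff measurableSet_ball).2
      (h.integrableOn_abs (Ioo_subset_Icc_self haI))).const_mul
      (rexp (-(n / 2 * Real.log (4 * π * (b - a)))))
    refine integral_mono_of_nonneg (.of_forall fun z => ?_) hi
      (.of_forall fun z => ?_)
    · exact mul_nonneg (mehler_pos _ _).le (indicator_nonneg (fun z _ => smoothPos_nonneg hε' _) z)
    · by_cases hzb : z ∈ ball 0 R
      · simp only [hg, indicator_of_mem hzb]
        exact mul_le_mul (mehler_le hμ (sub_pos.2 hab) x z) (smoothPos_le_abs hε' _)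
          (smoothPos_nonneg hε' _) (Real.exp_pos _).le
      · simp [hg, indicator_of_notMem hzb]
  linarith

lemma _root_.sq_integral_abs_le {α : Type*} [MeasurableSpace α] {ν : Measure α} [IsFiniteMeasure ν]
    {f : α → ℝ} (hf : Integrable (fun z => |f z|) ν) (hf2 : Integrable (fun z => f z ^ 2) ν) :
    (∫ z, |f z| ∂ν) ^ 2 ≤ ν.real univ * ∫ z, f z ^ 2 ∂ν := by
  set I := ∫ z, |f z| ∂ν
  set V := ν.real univ
  have hV : 0 ≤ V := measureReal_nonneg
  have h1 : 0 ≤ ∫ z, (V * |f z| - I) ^ 2 ∂ν := integral_nonneg fun z => sq_nonneg _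
  have e : ∀ z, (V * |f z| - I) ^ 2 = V ^ 2 * f z ^ 2 - 2 * V * I * |f z| + I ^ 2 := fun z => by
    rw [← sq_abs (f z)]; ring
  have hi : Integrable (fun z => V ^ 2 * f z ^ 2 - 2 * V * I * |f z|) ν :=
    (hf2.const_mul _).sub (hf.const_mul _)
  simp only [e] at h1
  rw [integral_add hi (integrable_const _), integral_sub (hf2.const_mul _) (hf.const_mul _),
    integral_const_mul, integral_const_mul, integral_const, smul_eq_mul] at h1
  rcases hV.eq_or_lt with h0 | h0
  · have : ν = 0 := by
      have := (measureReal_eq_zero_iff (μ := ν) (s := univ)).1 h0.symm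
      simpa using this
    simp [I, this]
  · have h2 : 0 ≤ V * (V * ∫ z, f z ^ 2 ∂ν - I ^ 2) := by
      have e2 : V ^ 2 * (∫ z, f z ^ 2 ∂ν) - 2 * V * I * I + V * I ^ 2
        = V * (V * ∫ z, f z ^ 2 ∂ν - I ^ 2) := by ring
      rw [← e2]; exact h1
    linarith [nonneg_of_mul_nonneg_right h2 h0]

/-- Ultracontractivity: the supremum is controlled by the `L²` norm at an earlier time. -/
lemma sq_le_integral_sq (h : IsHarmonicHeatSolution n R μ T y) (hμ : 0 < μ) (hR : 0 < R)
    {a b : ℝ} (ha : 0 < a) (hab : a < b) (hb : b < T) {x : ℰ n}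
    (hx : x ∈ closedBall 0 R) :
    y b x ^ 2 ≤ rexp (-(n * Real.log (4 * π * (b - a)))) *
      (volume.real (ball (0 : ℰ n) R) * ∫ z in ball 0 R, y a z ^ 2) := by
  have haI : a ∈ Icc 0 T := ⟨ha.le, (hab.trans hb).le⟩
  have hpos : 0 ≤ rexp (-(n * Real.log (4 * π * (b - a)))) *
      (volume.real (ball (0 : ℰ n) R) * ∫ z in ball 0 R, y a z ^ 2) := by
    have : 0 ≤ ∫ z in ball 0 R, y a z ^ 2 := integral_nonneg fun z => sq_nonneg _
    positivity
  rcases (mem_closedBall_zero_iff.1 hx).lt_or_eq with hx' | hx'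
  · have h1 := h.le_integral_abs hμ hR ha hab hb (mem_ball_zero_iff.2 hx')
    have h2 := h.neg.le_integral_abs hμ hR ha hab hb (mem_ball_zero_iff.2 hx')
    simp only [abs_neg] at h2
    have h3 : |y b x| ≤ _ := abs_le'.2 ⟨h1, h2⟩
    have : IsFiniteMeasure (volume.restrict (ball (0 : ℰ n) R)) :=
      ⟨by simpa using measure_ball_lt_top⟩
    have h4 := sq_integral_abs_le (ν := volume.restrict (ball 0 R))
      (h.integrableOn_abs haI) (h.integrableOn_sq haI)
    rw [measureReal_restrict_apply MeasurableSet.univ, univ_inter] at h4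
    calc y b x ^ 2 = |y b x| ^ 2 := (sq_abs _).symm
      _ ≤ _ := pow_le_pow_left₀ (abs_nonneg _) h3 2
      _ ≤ _ := by
        rw [mul_pow, ← Real.exp_nat_mul]
        have e : ((2:ℕ):ℝ) * -(n / 2 * Real.log (4 * π * (b - a)))
          = -(n * Real.log (4 * π * (b - a))) := by push_cast; ring
        rw [e]
        exact mul_le_mul_of_nonneg_left h4 (Real.exp_pos _).le
  · rw [h.boundary_closed ((ha.trans hab).trans hb) ⟨(ha.trans hab).le, hb.le⟩
      (mem_sphere_zero_iff_norm.2 hx')]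
    simpa using hpos

end IsHarmonicHeatSolution
section Elliptic

variable {n : ℕ} {w : ℰ n → ℝ} {R A K : ℝ}

lemma fderiv_eq_sum_pd (f : ℰ n → ℝ) (x v : ℰ n) : fderiv ℝ f x v = ∑ i, v i * pd i f x := by
  conv_lhs => rw [← (EuclideanSpace.basisFun (Fin n) ℝ).sum_repr v]
  rw [map_sum]
  refine Finset.sum_congr rfl fun i _ => ?_
  rw [map_smul, smul_eq_mul, EuclideanSpace.basisFun_repr, EuclideanSpace.basisFun_apply, pd]

lemma pd_comp_add_left (i : Fin n) (f : ℰ n → ℝ)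
    (a x : ℰ n) : pd i (fun z => f (a + z)) x = pd i f (a + x) := by
  simp only [pd, fderiv_comp_add_left]

lemma lapl_comp_add_left (f : ℰ n → ℝ) (a x : ℰ n) :
    lapl (fun z => f (a + z)) x = lapl f (a + x) := by
  rw [lapl_eq_sum_pd, lapl_eq_sum_pd]
  refine Finset.sum_congr rfl fun i _ => ?_
  have : pd i (fun z => f (a + z)) = fun z => pd i f (a + z) :=
    funext fun z => pd_comp_add_left i f a z
  rw [this, pd_comp_add_left]

lemma frontier_ball_subset_sphere (x : ℰ n) (r : ℝ) : frontier (ball x r) ⊆ sphere x r := by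
  intro z hz
  have h1 := closure_ball_subset_closedBall hz.1
  have h2 : z ∉ ball x r := fun h => hz.2 (by rwa [isOpen_ball.interior_eq])
  rw [mem_closedBall] at h1
  rw [mem_ball, not_lt] at h2
  exact le_antisymm h1 h2

/-- The torsion function is a barrier for the Dirichlet problem in a ball. -/
lemma abs_le_torsion [NeZero n] (hc : ContinuousOn w (closedBall 0 R))
    (h2 : ∀ x ∈ ball 0 R, ContDiffAt ℝ 2 w x)
    (hK : ∀ x ∈ ball 0 R, |lapl w x| ≤ K)
    (hb : ∀ x ∈ sphere 0 R, w x = 0) :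
    ∀ x ∈ ball 0 R, |w x| ≤ K / (2 * n) * (R ^ 2 - ‖x‖ ^ 2) := by
  have hn : (0:ℝ) < n := Nat.cast_pos.2 (NeZero.pos n)
  have key : ∀ f : ℰ n → ℝ, ContinuousOn f (closedBall 0 R) →
      (∀ x ∈ ball 0 R, ContDiffAt ℝ 2 f x) →
      (∀ x ∈ ball 0 R, -K ≤ lapl f x) →
      (∀ x ∈ sphere 0 R, f x = 0) →
      ∀ x ∈ ball 0 R, f x ≤ K / (2 * n) * (R ^ 2 - ‖x‖ ^ 2) := by
    intro f hfc hf2 hfK hfb x hx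
    set q : ℰ n → ℝ := fun z => K / (2 * n) * ‖z‖ ^ 2 + inner ℝ z 0 + -(K / (2 * n) * R ^ 2) with hq
    have hqs : ContDiff ℝ 2 q := contDiff_quad _ _ _
    have hle := elliptic_max (Ω := ball 0 R) (f := fun z => f z + q z)
      isOpen_ball isBounded_ball
      ((hfc.mono closure_ball_subset_closedBall).add hqs.continuous.continuousOn)
      (fun z hz => (hf2 z hz).add hqs.contDiffAt)
      (fun z hz => by
        rw [lapl_add (hf2 z hz) hqs.contDiffAt, hq, lapl_quad]
        have := hfK z hz
        have e : 2 * (K / (2 * n)) * n = K := by field_simp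
        linarith)
      (fun z hz => by
        have hz' := frontier_ball_subset_sphere _ _ hz
        rw [hfb z hz']
        have : ‖z‖ = R := by simpa using hz'
        simp [hq, this]) x (subset_closure hx)
    simp only [hq, inner_zero_right] at hle
    linarith
  intro x hx
  refine abs_le'.2 ⟨key w hc h2 (fun z hz => (abs_le.1 (hK z hz)).1) hb x hx,
    key (fun z => - w z) hc.neg (fun z hz => (h2 z hz).neg) (fun z hz => ?_)
      (fun z hz => by simp [hb z hz]) x hx⟩
  rw [lapl_neg]
  linarith [(abs_le.1 (hK z hz)).2]

/-- Interior gradient estimate, by reflection in a hyperplane and a barrier on a half ball. -/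
lemma pd_le_of_abs_le [NeZero n] {δ : ℝ} (hδ : 0 < δ) {x₀ : ℰ n}
    (h2 : ∀ x ∈ closedBall x₀ δ, ContDiffAt ℝ 2 w x) (hA : ∀ x ∈ closedBall x₀ δ, |w x| ≤ A)
    (hK : ∀ x ∈ closedBall x₀ δ, |lapl w x| ≤ K) (i : Fin n) :
    pd i w x₀ ≤ n * A / δ + K * δ / 2 := by
  set e : ℰ n := EuclideanSpace.single i 1 with he
  have hee : ‖e‖ = 1 := by simp [he]
  have hin : ∀ z : ℰ n, inner ℝ z e = z i := fun z => by
    simp [he, EuclideanSpace.inner_single_right]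
  set Q : ℰ n ≃ₗᵢ[ℝ] ℰ n := (ℝ ∙ e)ᗮ.reflection with hQ
  have hQz : ∀ z, Q z = z - (2 * z i) • e := fun z => by
    rw [hQ, Submodule.reflection_orthogonal_apply, Submodule.reflection_singleton_apply,
      real_inner_comm, hin, hee]
    simp only [RCLike.ofReal_one, one_pow, div_one, two_smul]
    rw [two_mul, add_smul]
    abel
  set f : ℰ n → ℝ := fun z => w (x₀ + z) with hf
  have hf2 : ∀ z ∈ closedBall 0 δ, ContDiffAt ℝ 2 f z := fun z hz =>
    ContDiffAt.comp (g := w) z (h2 _ (by simpa using hz)) (by fun_prop)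
  have hfl : ∀ z ∈ closedBall 0 δ, |lapl f z| ≤ K := fun z hz => by
    rw [hf, lapl_comp_add_left]; exact hK _ (by simpa using hz)
  have hfA : ∀ z ∈ closedBall 0 δ, |f z| ≤ A := fun z hz => hA _ (by simpa using hz)
  have hQm : ∀ z ∈ closedBall 0 δ, Q z ∈ closedBall 0 δ := fun z hz => by simpa using hz
  set c : ℝ := n * A / δ ^ 2 + K / 2 with hc
  set q : ℰ n → ℝ := fun z => -(2 * A / δ ^ 2) * ‖z‖ ^ 2 + inner ℝ z (-(2 * c * δ) • e) + 0 with hq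
  have hqs : ContDiff ℝ 2 q := contDiff_quad _ _ _
  set p : ℰ n → ℝ := fun z => z i * z i with hp
  have hps : ContDiff ℝ 2 p := by fun_prop
  have hcoord : ContDiff ℝ 2 (fun z : ℰ n => z i) := by fun_prop
  have hpl : ∀ z, lapl p z = 2 := fun z => by
    have e1 : (fun z : ℰ n => z i) = fun z => inner ℝ z e := funext fun z => (hin z).symm
    rw [hp, lapl_mul hcoord.contDiffAt hcoord.contDiffAt, e1, lapl_inner]
    have : ∀ j, pd j (fun z : ℰ n => (inner ℝ z e : ℝ)) z = e j := fun j => pd_inner j e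
    simp only [this]
    simp [he]
  set Ω : Set (ℰ n) := ball 0 δ ∩ {z | 0 < z i}
  have hcl : closure Ω ⊆ closedBall 0 δ ∩ {z | 0 ≤ z i} := by
    refine closure_minimal (fun z hz => ⟨ball_subset_closedBall hz.1, (show 0 < z i from hz.2).le⟩)
      (isClosed_closedBall.inter (isClosed_le continuous_const (by fun_prop)))
  have hΩo : IsOpen Ω := isOpen_ball.inter (isOpen_lt continuous_const (by fun_prop))
  have hFc : ∀ z ∈ closedBall 0 δ,
      ContDiffAt ℝ 2 (fun z => f z + -f (Q z) + (q z + 2 * c * p z)) z := fun z hz =>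
    ((hf2 z hz).add (ContDiffAt.comp (g := f) z (hf2 _ (hQm z hz))
      Q.toContinuousLinearEquiv.contDiff.contDiffAt).neg).add
      (hqs.contDiffAt.add (contDiffAt_const.mul hps.contDiffAt))
  have hle := elliptic_max (Ω := Ω) (f := fun z => f z + -f (Q z) + (q z + 2 * c * p z))
    hΩo (isBounded_ball.subset inter_subset_left)
    (fun z hz => (hFc z (hcl hz).1).continuousAt.continuousWithinAt)
    (fun z hz => hFc z (ball_subset_closedBall hz.1))
    (fun z hz => by
      have hz' := ball_subset_closedBall hz.1
      have h3 : ContDiffAt ℝ 2 (fun z => f (Q z)) z := ContDiffAt.comp (g := f) z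
        (hf2 _ (hQm z hz')) Q.toContinuousLinearEquiv.contDiff.contDiffAt
      rw [lapl_add ((hf2 z hz').add h3.neg) (hqs.contDiffAt.add (contDiffAt_const.mul hps.contDiffAt)),
        lapl_add (hf2 z hz') h3.neg, lapl_neg, lapl_comp_isometry Q (hf2 _ (hQm z hz')),
        lapl_add hqs.contDiffAt (contDiffAt_const.mul hps.contDiffAt),
        lapl_const_mul _ hps.contDiffAt, hpl, hq, lapl_quad, hc]
      have h4 := (abs_le.1 (hfl z hz')).1
      have h5 := (abs_le.1 (hfl _ (hQm z hz'))).2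
      have e2 : 2 * -(2 * A / δ ^ 2) * n + 2 * (n * A / δ ^ 2 + K / 2) * 2 = 2 * K := by ring
      linarith)
    (fun z hz => by
      have hz1 := (hcl hz.1).1
      have hz2 : 0 ≤ z i := (hcl hz.1).2
      have hzn : ‖z‖ ≤ δ := by simpa using hz1
      have hzi : z i ≤ δ := by
        have h6 : |inner ℝ z e| ≤ ‖z‖ * ‖e‖ := abs_real_inner_le_norm z e
        rw [hin, hee, mul_one] at h6
        exact (le_abs_self _).trans (h6.trans hzn)
      have hA0 : 0 ≤ A := (abs_nonneg _).trans (hfA z hz1)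
      have hK0 : 0 ≤ K := (abs_nonneg _).trans (hfl z hz1)
      have hqp : q z + 2 * c * p z = -(2 * A / δ ^ 2) * ‖z‖ ^ 2 - 2 * c * (z i * (δ - z i)) := by
        simp only [hq, hp, inner_smul_right, hin]
        ring
      have h7 : 0 ≤ 2 * c * (z i * (δ - z i)) :=
        mul_nonneg (by positivity) (mul_nonneg hz2 (sub_nonneg.2 hzi))
      rw [hqp]
      by_cases hz0 : z i = 0
      · have : Q z = z := by rw [hQz, hz0]; simp
        rw [this]
        have : 0 ≤ 2 * A / δ ^ 2 * ‖z‖ ^ 2 := by positivity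
        linarith
      · have hzb : z ∉ ball 0 δ := fun hzb => by
          refine hz.2 ?_
          rw [hΩo.interior_eq]
          exact ⟨hzb, lt_of_le_of_ne hz2 (Ne.symm hz0)⟩
        have hzn' : ‖z‖ = δ := le_antisymm hzn (by simpa using hzb)
        rw [hzn']
        have h8 := (abs_le.1 (hfA z hz1)).2
        have h9 := (abs_le.1 (hfA _ (hQm z hz1))).1
        have : 2 * A / δ ^ 2 * δ ^ 2 = 2 * A := by field_simp
        linarith)
  have hline : ∀ τ ∈ Ioo 0 δ, f (τ • e) - f (-(τ • e)) ≤ 2 * (c * δ) * τ + 2 * A / δ ^ 2 * τ ^ 2 := by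
    intro τ hτ
    have hei : e i = 1 := by simp [he]
    have hA0 : 0 ≤ A := (abs_nonneg _).trans (hA x₀ (mem_closedBall_self hδ.le))
    have hK0 : 0 ≤ K := (abs_nonneg _).trans (hK x₀ (mem_closedBall_self hδ.le))
    have hm : τ • e ∈ Ω := by
      refine ⟨?_, ?_⟩
      · simp [norm_smul, hee, abs_of_pos hτ.1, hτ.2]
      · simp [hei, hτ.1]
    have h10 := hle _ (subset_closure hm)
    have e3 : Q (τ • e) = -(τ • e) := by
      rw [hQz]
      simp only [PiLp.smul_apply, hei, smul_eq_mul, mul_one, mul_smul, two_smul]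
      abel
    rw [e3] at h10
    simp only [hq, hp, norm_smul, hee, inner_smul_right, hin, PiLp.smul_apply, hei, smul_eq_mul,
      mul_one, Real.norm_eq_abs, sq_abs] at h10
    have : 0 ≤ c * τ ^ 2 := by positivity
    linarith
  have hd : HasDerivAt (fun τ : ℝ => f (τ • e) - f (-(τ • e))) (2 * pd i w x₀) 0 := by
    have hdf : DifferentiableAt ℝ f 0 :=
      (hf2 0 (mem_closedBall_self hδ.le)).differentiableAt (by norm_num)
    have hl : HasDerivAt (fun τ : ℝ => τ • e) e 0 := by
      simpa using (hasDerivAt_id (0:ℝ)).smul_const e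
    have h11 : HasDerivAt (fun τ : ℝ => f (τ • e)) (fderiv ℝ f 0 e) 0 := by
      have : HasFDerivAt f (fderiv ℝ f 0) ((0:ℝ) • e) := by simpa using hdf.hasFDerivAt
      exact HasFDerivAt.comp_hasDerivAt (l := f) (f := fun τ : ℝ => τ • e) 0 this hl
    have h12 : HasDerivAt (fun τ : ℝ => f (-(τ • e))) (fderiv ℝ f 0 (-e)) 0 := by
      have : HasFDerivAt f (fderiv ℝ f 0) (-((0:ℝ) • e)) := by simpa using hdf.hasFDerivAt
      exact HasFDerivAt.comp_hasDerivAt (l := f) (f := fun τ : ℝ => -(τ • e)) 0 this hl.fun_neg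
    refine (h11.sub h12).congr_deriv ?_
    have : fderiv ℝ f 0 e = pd i w x₀ := by
      have := pd_comp_add_left i w x₀ 0
      rw [add_zero] at this
      exact this
    rw [map_neg, this]
    ring
  have hslope := hasDerivWithinAt_iff_tendsto_slope.1 (hd.hasDerivWithinAt (s := Ioi 0))
  have h13 : Tendsto (fun τ : ℝ => 2 * (c * δ) + 2 * A / δ ^ 2 * τ) (𝓝[>] 0) (𝓝 (2 * (c * δ))) := by
    have : Continuous fun τ : ℝ => 2 * (c * δ) + 2 * A / δ ^ 2 * τ := by fun_prop
    simpa using (this.tendsto 0).mono_left nhdsWithin_le_nhds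
  have h14 : Ioi (0:ℝ) \ {0} = Ioi 0 := by simp
  rw [h14] at hslope
  have h15 := le_of_tendsto_of_tendsto hslope h13 (by
    filter_upwards [Ioo_mem_nhdsGT hδ] with τ hτ
    rw [slope_def_field, div_le_iff₀ (by linarith [hτ.1])]
    have := hline τ hτ
    simp only [zero_smul, neg_zero, sub_self, sub_zero]
    linarith)
  have h16 : c * δ = n * A / δ + K * δ / 2 := by rw [hc]; field_simp
  linarith

lemma abs_pd_le_of_abs_le [NeZero n] {δ : ℝ} (hδ : 0 < δ) {x₀ : ℰ n}
    (h2 : ∀ x ∈ closedBall x₀ δ, ContDiffAt ℝ 2 w x) (hA : ∀ x ∈ closedBall x₀ δ, |w x| ≤ A)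
    (hK : ∀ x ∈ closedBall x₀ δ, |lapl w x| ≤ K) (i : Fin n) :
    |pd i w x₀| ≤ n * A / δ + K * δ / 2 := by
  refine abs_le'.2 ⟨pd_le_of_abs_le hδ h2 hA hK i, ?_⟩
  have := pd_le_of_abs_le (w := fun z => -w z) hδ (fun x hx => (h2 x hx).neg)
    (fun x hx => by rw [abs_neg]; exact hA x hx)
    (fun x hx => by rw [lapl_neg, abs_neg]; exact hK x hx) i
  simpa [pd] using this

/-- Gradient bound up to the boundary for the Dirichlet problem in a ball. -/
lemma abs_pd_le_of_dirichlet [NeZero n] (hR : 0 < R) (hc : ContinuousOn w (closedBall 0 R))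
    (h2 : ∀ x ∈ ball 0 R, ContDiffAt ℝ 2 w x)
    (hK : ∀ x ∈ ball 0 R, |lapl w x| ≤ K)
    (hb : ∀ x ∈ sphere 0 R, w x = 0) (i : Fin n) :
    ∀ x ∈ ball 0 R, |pd i w x| ≤ 4 * K * R := by
  intro x hx
  have hn : (0:ℝ) < n := Nat.cast_pos.2 (NeZero.pos n)
  have hxR : ‖x‖ < R := by simpa using hx
  have hK0 : 0 ≤ K := (abs_nonneg _).trans (hK x hx)
  set δ := (R - ‖x‖) / 2 with hδd
  have hδ : 0 < δ := by rw [hδd]; linarith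
  have hsub : closedBall x δ ⊆ ball 0 R := fun z hz => by
    have h1 : ‖z - x‖ ≤ δ := by simpa [dist_eq_norm] using hz
    have h3 : ‖z‖ ≤ ‖x‖ + ‖z - x‖ := by simpa using norm_add_le x (z - x)
    rw [mem_ball_zero_iff]
    linarith
  have hw := abs_le_torsion hc h2 hK hb
  have h4 := abs_pd_le_of_abs_le (A := K / (2 * n) * (6 * R * δ)) hδ (fun z hz => h2 z (hsub hz))
    (fun z hz => (hw z (hsub hz)).trans (by
      have h1 : ‖z - x‖ ≤ δ := by simpa [dist_eq_norm] using hz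
      have h3 : ‖x‖ ≤ ‖z‖ + ‖z - x‖ := by
        have := norm_sub_le z (z - x)
        simpa using this
      have h5 : ‖z‖ < R := by simpa using hsub hz
      have h6 : R ^ 2 - ‖z‖ ^ 2 = (R - ‖z‖) * (R + ‖z‖) := by ring
      have h7 : (R - ‖z‖) * (R + ‖z‖) ≤ (3 * δ) * (2 * R) :=
        mul_le_mul (by linarith) (by linarith) (by positivity) (by positivity)
      have h8 : 0 ≤ K / (2 * n) := by positivity
      have := mul_le_mul_of_nonneg_left h7 h8
      rw [h6]
      linarith)) (fun z hz => hK z (hsub hz)) i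
  refine h4.trans ?_
  have e : (n:ℝ) * (K / (2 * n) * (6 * R * δ)) / δ = 3 * K * R := by field_simp; ring
  rw [e]
  have : K * δ ≤ K * R := mul_le_mul_of_nonneg_left (by rw [hδd]; linarith [norm_nonneg x]) hK0
  nlinarith

lemma reflection_orthogonal_unit {a : ℰ n} (ha : ‖a‖ = 1) (z : ℰ n) :
    (ℝ ∙ a)ᗮ.reflection z = z - (2 * inner ℝ z a) • a := by
  rw [Submodule.reflection_orthogonal_apply, Submodule.reflection_singleton_apply,
    real_inner_comm, ha]
  simp only [RCLike.ofReal_one, one_pow, div_one, two_smul]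
  rw [two_mul, add_smul]
  abel

lemma norm_reflection_sub_le {a b : ℰ n} (ha : ‖a‖ = 1) (hb : ‖b‖ = 1) (z : ℰ n) :
    ‖(ℝ ∙ a)ᗮ.reflection ((ℝ ∙ b)ᗮ.reflection z) - z‖ ≤ 4 * ‖a - b‖ * ‖z‖ := by
  set z' := (ℝ ∙ b)ᗮ.reflection z with hz'
  have h1 : z = (ℝ ∙ b)ᗮ.reflection z' := by rw [hz', Submodule.reflection_reflection]
  have h2 : ‖z'‖ = ‖z‖ := by rw [hz', LinearIsometryEquiv.norm_map]
  rw [← h2]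
  conv_lhs => rw [h1]
  rw [reflection_orthogonal_unit ha, reflection_orthogonal_unit hb]
  have h3 : z' - (2 * inner ℝ z' a) • a - (z' - (2 * inner ℝ z' b) • b)
      = -(2 * inner ℝ z' (a - b)) • a - (2 * inner ℝ z' b) • (a - b) := by
    rw [inner_sub_right]
    module
  rw [h3]
  refine (norm_sub_le _ _).trans ?_
  rw [norm_smul, norm_smul, ha]
  have h4 := abs_real_inner_le_norm z' (a - b)
  have h5 := abs_real_inner_le_norm z' b
  rw [hb] at h5
  simp only [Real.norm_eq_abs, abs_neg, abs_mul, abs_two]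
  have := mul_le_mul_of_nonneg_right h5 (norm_nonneg (a - b))
  linarith

/-- Tangential derivatives of the solution of a Dirichlet problem in a ball, with Lipschitz
right-hand side, vanish at the boundary to first order. -/
lemma abs_fderiv_tangential_le [NeZero n] (hR : 0 < R) (hc : ContinuousOn w (closedBall 0 R))
    (h2 : ∀ x ∈ ball 0 R, ContDiffAt ℝ 2 w x) {L : ℝ} (hL0 : 0 ≤ L)
    (hL : ∀ x ∈ ball 0 R, ∀ x' ∈ ball 0 R,
      |lapl w x - lapl w x'| ≤ L * ‖x - x'‖)
    (hb : ∀ x ∈ sphere 0 R, w x = 0)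
    {x : ℰ n} (hx : x ∈ ball 0 R)
    {v : ℰ n} (hxv : inner ℝ x v = 0) :
    ‖x‖ * |fderiv ℝ w x v| ≤ 2 * L * R * (R ^ 2 - ‖x‖ ^ 2) * ‖v‖ := by
  have hn : (1:ℝ) ≤ n := by exact_mod_cast NeZero.one_le (n := n)
  have hxR : ‖x‖ < R := by simpa using hx
  have hb0 : 0 ≤ R ^ 2 - ‖x‖ ^ 2 := by nlinarith [norm_nonneg x]
  rcases eq_or_ne x 0 with rfl | hx0
  · simp only [norm_zero, zero_mul] at hb0 ⊢; positivity
  rcases eq_or_ne v 0 with rfl | hv0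
  · simp
  have hxn : 0 < ‖x‖ := norm_pos_iff.2 hx0
  have hvn : 0 < ‖v‖ := norm_pos_iff.2 hv0
  set ξ : ℰ n := ‖x‖⁻¹ • x with hξ
  set e : ℰ n := ‖v‖⁻¹ • v with he
  have hξ1 : ‖ξ‖ = 1 := by rw [hξ, norm_smul, norm_inv, norm_norm, inv_mul_cancel₀ hxn.ne']
  have he1 : ‖e‖ = 1 := by rw [he, norm_smul, norm_inv, norm_norm, inv_mul_cancel₀ hvn.ne']
  have hxe : inner ℝ x e = 0 := by rw [he, inner_smul_right, hxv, mul_zero]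
  have hξe : inner ℝ ξ e = 0 := by rw [hξ, real_inner_smul_left, hxe, mul_zero]
  have hxξ : inner ℝ x ξ = ‖x‖ := by
    rw [hξ, inner_smul_right, real_inner_self_eq_norm_sq]; field_simp
  have hve : v = ‖v‖ • e := by rw [he, smul_smul, mul_inv_cancel₀ hvn.ne', one_smul]
  clear_value e ξ
  set a : ℝ → ℰ n := fun θ => Real.cos θ • e + Real.sin θ • ξ with ha
  have ha1 : ∀ θ, ‖a θ‖ = 1 := fun θ => by
    have : ‖a θ‖ ^ 2 = 1 := by
      rw [ha, norm_add_sq_real, norm_smul, norm_smul, he1, hξ1, inner_smul_left, inner_smul_right,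
        real_inner_comm, hξe]
      simp
    exact (pow_eq_one_iff_of_nonneg (norm_nonneg _) two_ne_zero).1 this
  have hae : ∀ θ, ‖a θ - e‖ ≤ 2 * |θ| := fun θ => by
    have h : a θ - e = (Real.cos θ - Real.cos 0) • e + (Real.sin θ - Real.sin 0) • ξ := by
      rw [ha, Real.cos_zero, Real.sin_zero]; module
    rw [h]
    refine (norm_add_le _ _).trans ?_
    rw [norm_smul, norm_smul, he1, hξ1, Real.norm_eq_abs, Real.norm_eq_abs]
    have h1 := Real.abs_cos_sub_cos_le θ 0
    have h2 := Real.abs_sin_sub_sin_le θ 0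
    rw [sub_zero] at h1 h2
    linarith
  set Q : ℝ → ℰ n ≃ₗᵢ[ℝ] ℰ n := fun θ => ((ℝ ∙ e)ᗮ.reflection).trans ((ℝ ∙ a θ)ᗮ.reflection) with hQ
  have hQz : ∀ θ z, ‖Q θ z - z‖ ≤ 8 * |θ| * ‖z‖ := fun θ z =>
    (norm_reflection_sub_le (ha1 θ) he1 z).trans
      (mul_le_mul_of_nonneg_right (by linarith [hae θ]) (norm_nonneg z))
  have hQx : ∀ θ, Q θ x = x - (2 * (Real.sin θ * ‖x‖)) • a θ := fun θ => by
    rw [hQ]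
    simp only [LinearIsometryEquiv.trans_apply]
    rw [reflection_orthogonal_unit he1, hxe, mul_zero, zero_smul, sub_zero,
      reflection_orthogonal_unit (ha1 θ)]
    congr 3
    rw [ha, inner_add_right, inner_smul_right, inner_smul_right, hxe, hxξ]
    ring
  have hmemb : ∀ θ, ∀ z ∈ ball 0 R, Q θ z ∈ ball 0 R := fun θ z hz => by simpa using hz
  have hcomp : ∀ θ, ∀ z ∈ ball 0 R, ContDiffAt ℝ 2 (fun z => w (Q θ z)) z := fun θ z hz =>
    ContDiffAt.comp (g := w) z (h2 _ (hmemb θ z hz))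
      (Q θ).toContinuousLinearEquiv.contDiff.contDiffAt
  have hdiff : ∀ θ, |w (Q θ x) - w x| ≤ 4 * L * R * (R ^ 2 - ‖x‖ ^ 2) * |θ| := fun θ => by
    have h := abs_le_torsion (w := fun z => w (Q θ z) + -w z) (K := 8 * L * R * |θ|)
      (ContinuousOn.add (ContinuousOn.comp (g := w) hc (Q θ).continuous.continuousOn
        (fun z hz => by simpa using hz)) hc.neg)
      (fun z hz => (hcomp θ z hz).add (h2 z hz).neg)
      (fun z hz => by
        rw [lapl_add (hcomp θ z hz) (h2 z hz).neg, lapl_neg,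
          lapl_comp_isometry (Q θ) (h2 _ (hmemb θ z hz)), ← sub_eq_add_neg]
        refine (hL _ (hmemb θ z hz) z hz).trans ?_
        have hz' : ‖z‖ ≤ R := by simpa using (ball_subset_closedBall hz)
        have h1 : 8 * |θ| * ‖z‖ ≤ 8 * |θ| * R := mul_le_mul_of_nonneg_left hz' (by positivity)
        have := mul_le_mul_of_nonneg_left ((hQz θ z).trans h1) hL0
        linarith)
      (fun z hz => by rw [hb z hz, hb _ (by simpa using hz)]; simp) x hx
    rw [← sub_eq_add_neg] at h
    refine h.trans ?_
    have h3 : 8 * L * R * |θ| / (2 * n) ≤ 8 * L * R * |θ| / 2 :=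
      div_le_div_of_nonneg_left (by positivity) (by norm_num) (by linarith)
    have := mul_le_mul_of_nonneg_right h3 hb0
    linarith
  have hder : HasDerivAt (fun θ => w (Q θ x)) (fderiv ℝ w x (-(2 * ‖x‖) • e)) 0 := by
    have hcurve : HasDerivAt (fun θ => Q θ x) (-(2 * ‖x‖) • e) 0 := by
      simp only [hQx]
      have h1 : HasDerivAt a ξ 0 := by
        have := ((Real.hasDerivAt_cos 0).smul_const e).fun_add ((Real.hasDerivAt_sin 0).smul_const ξ)
        simpa using this
      have h3 : HasDerivAt (fun θ => 2 * (Real.sin θ * ‖x‖)) (2 * ‖x‖) 0 := by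
        simpa using ((Real.hasDerivAt_sin 0).mul_const ‖x‖).const_mul 2
      have h4 := (hasDerivAt_const (0:ℝ) x).fun_sub (h3.fun_smul h1)
      refine h4.congr_deriv ?_
      simp [ha]
    have hw : HasFDerivAt w (fderiv ℝ w x) (Q 0 x) := by
      rw [hQx]
      simpa using ((h2 x hx).differentiableAt (by norm_num)).hasFDerivAt
    exact HasFDerivAt.comp_hasDerivAt (l := w) (f := fun θ => Q θ x) 0 hw hcurve
  have hslope := hasDerivAt_iff_tendsto_slope.1 hder
  have hQ0 : Q 0 x = x := by rw [hQx]; simp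
  have hle := le_of_tendsto hslope.abs (b := 4 * L * R * (R ^ 2 - ‖x‖ ^ 2)) (by
    filter_upwards [self_mem_nhdsWithin] with θ hθ
    have hθ0 : 0 < |θ| := abs_pos.2 hθ
    rw [slope_def_field, hQ0, sub_zero, abs_div, div_le_iff₀ hθ0]
    exact hdiff θ)
  rw [map_smul, smul_eq_mul, abs_mul, abs_neg, abs_of_pos (by positivity : 0 < 2 * ‖x‖)] at hle
  rw [hve, map_smul, smul_eq_mul, abs_mul, abs_of_pos hvn, norm_smul, he1, norm_norm, mul_one]
  have := mul_le_mul_of_nonneg_right hle hvn.le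
  linarith

end Elliptic
section Steklov

variable {H : Type} [NormedAddCommGroup H] [NormedSpace ℝ H] [ProperSpace H] {U : Set H} {e : H}
  {k : ℝ}

lemma exists_bound_add_smul {F : Type} [NormedAddCommGroup F] {f : H → F} (hU : IsOpen U)
    (hf : ContinuousOn f U) {p : H} (hp : ∀ r ∈ Icc 0 k, p + r • e ∈ U) :
    ∃ δ > 0, ∃ C, ∀ q ∈ ball p δ, ∀ r ∈ Icc 0 k, q + r • e ∈ U ∧ ‖f (q + r • e)‖ ≤ C := by
  have hK : IsCompact ((fun r : ℝ => p + r • e) '' Icc 0 k) := isCompact_Icc.image (by fun_prop)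
  obtain ⟨δ, hδ, hsub⟩ := hK.exists_cthickening_subset_open hU (by
    rintro _ ⟨r, hr, rfl⟩; exact hp r hr)
  obtain ⟨C, hC⟩ := (hK.cthickening (r := δ)).exists_bound_of_continuousOn (hf.mono hsub)
  have hm : ∀ q ∈ ball p δ, ∀ r ∈ Icc 0 k,
      q + r • e ∈ cthickening δ ((fun r : ℝ => p + r • e) '' Icc 0 k) := fun q hq r hr =>
    mem_cthickening_of_dist_le _ (p + r • e) _ _ ⟨r, hr, rfl⟩ (by
      rw [dist_add_right]; exact (mem_ball.1 hq).le)
  exact ⟨δ, hδ, C, fun q hq r hr => ⟨hsub (hm q hq r hr), hC _ (hm q hq r hr)⟩⟩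

lemma aestronglyMeasurable_add_smul {F : Type} [NormedAddCommGroup F] {f : H → F}
    (hf : ContinuousOn f U) (hk : 0 ≤ k) {p : H} (hp : ∀ r ∈ Icc 0 k, p + r • e ∈ U) :
    AEStronglyMeasurable (fun r : ℝ => f (p + r • e)) (volume.restrict (uIoc 0 k)) := by
  rw [uIoc_of_le hk]
  have : ContinuousOn (fun r : ℝ => f (p + r • e)) (Icc 0 k) :=
    hf.comp (f := fun r : ℝ => p + r • e) (by fun_prop) hp
  exact (this.mono Ioc_subset_Icc_self).aestronglyMeasurable measurableSet_Ioc

lemma continuousAt_intervalIntegral_add_smul {F : Type} [NormedAddCommGroup F] [NormedSpace ℝ F]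
    {f : H → F} (hU : IsOpen U) (hf : ContinuousOn f U) (hk : 0 ≤ k) {p : H}
    (hp : ∀ r ∈ Icc 0 k, p + r • e ∈ U) :
    ContinuousAt (fun q => ∫ r in (0:ℝ)..k, f (q + r • e)) p := by
  obtain ⟨δ, hδ, C, hC⟩ := exists_bound_add_smul hU hf hp
  refine intervalIntegral.continuousAt_of_dominated_interval (bound := fun _ => C) ?_ ?_
    intervalIntegrable_const (ae_of_all _ fun r hr => ?_)
  · filter_upwards [ball_mem_nhds p hδ] with q hq
    exact aestronglyMeasurable_add_smul hf hk fun r hr => (hC q hq r hr).1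
  · filter_upwards [ball_mem_nhds p hδ] with q hq
    refine ae_of_all _ fun r hr => ?_
    rw [uIoc_of_le hk] at hr
    exact (hC q hq r (Ioc_subset_Icc_self hr)).2
  · rw [uIoc_of_le hk] at hr
    exact ContinuousAt.comp (g := f) (f := fun q => q + r • e)
      (hf.continuousAt (hU.mem_nhds (hp r (Ioc_subset_Icc_self hr)))) (by fun_prop)

lemma hasFDerivAt_intervalIntegral_add_smul {F : Type} [NormedAddCommGroup F] [NormedSpace ℝ F]
    {f : H → F} (hU : IsOpen U) (hf : ContDiffOn ℝ 1 f U) (hk : 0 ≤ k) {p : H}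
    (hp : ∀ r ∈ Icc 0 k, p + r • e ∈ U) :
    HasFDerivAt (fun q => ∫ r in (0:ℝ)..k, f (q + r • e))
      (∫ r in (0:ℝ)..k, fderiv ℝ f (p + r • e)) p := by
  have hf' : ContinuousOn (fderiv ℝ f) U := hf.continuousOn_fderiv_of_isOpen hU le_rfl
  obtain ⟨δ, hδ, C, hC⟩ := exists_bound_add_smul hU hf' hp
  refine intervalIntegral.hasFDerivAt_integral_of_dominated_of_fderiv_le
    (F := fun q r => f (q + r • e)) (F' := fun q r => fderiv ℝ f (q + r • e)) (bound := fun _ => C)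
    (ball_mem_nhds p hδ) ?_ ?_ (aestronglyMeasurable_add_smul hf' hk hp)
    (ae_of_all _ fun r hr q hq => ?_) intervalIntegrable_const (ae_of_all _ fun r hr q hq => ?_)
  · filter_upwards [ball_mem_nhds p hδ] with q hq
    exact aestronglyMeasurable_add_smul hf.continuousOn hk fun r hr => (hC q hq r hr).1
  · refine ContinuousOn.intervalIntegrable ?_
    rw [uIcc_of_le hk]
    exact hf.continuousOn.comp (f := fun r : ℝ => p + r • e) (by fun_prop) hp
  · rw [uIoc_of_le hk] at hr
    exact (hC q hq r (Ioc_subset_Icc_self hr)).2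
  · rw [uIoc_of_le hk] at hr
    have h1 : DifferentiableAt ℝ f (q + r • e) :=
      (hf.contDiffAt (hU.mem_nhds (hC q hq r (Ioc_subset_Icc_self hr)).1)).differentiableAt
        one_ne_zero
    exact (hasFDerivAt_comp_add_right (r • e)).2 h1.hasFDerivAt

lemma contDiffOn_intervalIntegral_add_smul_nat (hU : IsOpen U) (hk : 0 ≤ k) {U' : Set H}
    (hU' : IsOpen U') (hp : ∀ p ∈ U', ∀ r ∈ Icc 0 k, p + r • e ∈ U) (N : ℕ) :
    ∀ {F : Type} [NormedAddCommGroup F] [NormedSpace ℝ F] {f : H → F}, ContDiffOn ℝ N f U →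
      ContDiffOn ℝ N (fun q => ∫ r in (0:ℝ)..k, f (q + r • e)) U' := by
  induction N with
  | zero =>
    intro F _ _ f hf
    refine contDiffOn_zero.2 fun p hp' => ContinuousAt.continuousWithinAt ?_
    exact continuousAt_intervalIntegral_add_smul hU (contDiffOn_zero.1 hf) hk (hp p hp')
  | succ N ih =>
    intro F _ _ f hf
    have h1 : ContDiffOn ℝ 1 f U := hf.of_le (by exact_mod_cast Nat.le_add_left 1 N)
    have hd : ∀ p ∈ U', HasFDerivAt (fun q => ∫ r in (0:ℝ)..k, f (q + r • e))
        (∫ r in (0:ℝ)..k, fderiv ℝ f (p + r • e)) p := fun p hp' =>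
      hasFDerivAt_intervalIntegral_add_smul hU h1 hk (hp p hp')
    push_cast at hf ⊢
    rw [contDiffOn_succ_iff_fderiv_of_isOpen hU] at hf
    rw [contDiffOn_succ_iff_fderiv_of_isOpen hU']
    refine ⟨fun p hp' => (hd p hp').differentiableAt.differentiableWithinAt, by simp, ?_⟩
    exact (ih hf.2.2).congr fun p hp' => (hd p hp').fderiv

lemma contDiffOn_intervalIntegral_add_smul (hU : IsOpen U) (hk : 0 ≤ k) {U' : Set H}
    (hU' : IsOpen U') (hp : ∀ p ∈ U', ∀ r ∈ Icc 0 k, p + r • e ∈ U)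
    {F : Type} [NormedAddCommGroup F] [NormedSpace ℝ F] {f : H → F} (hf : ContDiffOn ℝ ∞ f U) :
    ContDiffOn ℝ ∞ (fun q => ∫ r in (0:ℝ)..k, f (q + r • e)) U' :=
  contDiffOn_infty.2 fun N => contDiffOn_intervalIntegral_add_smul_nat hU hk hU' hp N
    (contDiffOn_infty.1 hf N)

end Steklov

/-- Steklov average in time. -/
noncomputable def steklov {n : ℕ} (k : ℝ) (y : ℝ → ℰ n → ℝ) (t : ℝ)
    (x : ℰ n) : ℝ := ∫ r in (0:ℝ)..k, y (t + r) x

section Steklov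

variable {n : ℕ} {R T k t : ℝ} {x : ℰ n} {y : ℝ → ℰ n → ℝ}

lemma steklov_eq (p : ℝ × ℰ n) :
    steklov k y p.1 p.2 = ∫ r in (0:ℝ)..k, (fun q : ℝ × ℰ n => y q.1 q.2)
      (p + r • ((1:ℝ), 0)) := by
  simp [steklov]

lemma contDiffOn_steklov (hk : 0 ≤ k) (hy : ContDiffOn ℝ ∞ (fun p : ℝ × ℰ n => y p.1 p.2)
      (Ioo 0 T ×ˢ ball 0 R)) :
    ContDiffOn ℝ ∞ (fun p : ℝ × ℰ n => steklov k y p.1 p.2) (Ioo 0 (T - k) ×ˢ ball 0 R) := by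
  simp only [steklov_eq]
  refine contDiffOn_intervalIntegral_add_smul (isOpen_Ioo.prod isOpen_ball) hk
    (isOpen_Ioo.prod isOpen_ball) (fun p hp r hr => ?_) hy
  simpa using ⟨⟨by linarith [hp.1.1, hr.1], by linarith [hp.1.2, hr.2]⟩, mem_ball_zero_iff.1 hp.2⟩

lemma differentiableAt_steklov (hk : 0 ≤ k) (hy : ContDiffOn ℝ ∞ (fun p : ℝ × ℰ n => y p.1 p.2)
      (Ioo 0 T ×ˢ ball 0 R)) (ht : t ∈ Ioo 0 (T - k)) (hx : x ∈ ball 0 R) :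
    DifferentiableAt ℝ (fun p : ℝ × ℰ n => steklov k y p.1 p.2) (t, x) := by
  have h1 := contDiffOn_steklov hk hy
  have h2 : Ioo 0 (T - k) ×ˢ ball 0 R ∈ 𝓝 (t, x) :=
    (isOpen_Ioo.prod isOpen_ball).mem_nhds ⟨ht, hx⟩
  exact (h1.contDiffAt h2).differentiableAt (by simp)

lemma fderiv_steklov (hk : 0 ≤ k) (hy : ContDiffOn ℝ ∞ (fun p : ℝ × ℰ n => y p.1 p.2)
      (Ioo 0 T ×ˢ ball 0 R)) (ht : t ∈ Ioo 0 (T - k)) (hx : x ∈ ball 0 R)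
    (v : ℝ × ℰ n) :
    fderiv ℝ (fun p : ℝ × ℰ n => steklov k y p.1 p.2) (t, x) v =
      ∫ r in (0:ℝ)..k, fderiv ℝ (fun p : ℝ × ℰ n => y p.1 p.2) (t + r, x) v := by
  have hm : ∀ r ∈ Icc 0 k, (t, x) + r • ((1:ℝ), 0) ∈
      Ioo 0 T ×ˢ ball 0 R := fun r hr => by
    simpa using ⟨⟨by linarith [ht.1, hr.1], by linarith [ht.2, hr.2]⟩, mem_ball_zero_iff.1 hx⟩
  have h := hasFDerivAt_intervalIntegral_add_smul (isOpen_Ioo.prod isOpen_ball)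
    (hy.of_le (by simp)) hk hm
  simp only [← steklov_eq] at h
  rw [h.fderiv, ← ContinuousLinearMap.intervalIntegral_apply]
  · simp
  · refine ContinuousOn.intervalIntegrable ?_
    rw [uIcc_of_le hk]
    have := (hy.continuousOn_fderiv_of_isOpen (isOpen_Ioo.prod isOpen_ball) (by simp)).comp
      (f := fun r : ℝ => (t, x) + r • ((1:ℝ), 0)) (by fun_prop) hm
    exact this.congr fun r _ => by simp

lemma pd_steklov (hk : 0 ≤ k) (hy : ContDiffOn ℝ ∞ (fun p : ℝ × ℰ n => y p.1 p.2)
      (Ioo 0 T ×ˢ ball 0 R)) (ht : t ∈ Ioo 0 (T - k)) (hx : x ∈ ball 0 R) (i : Fin n) :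
    pd i (steklov k y t) x = steklov k (fun s => pd i (y s)) t x := by
  have hd := differentiableAt_steklov hk hy ht hx
  rw [pd_eq_fderiv_prod i hd, fderiv_steklov hk hy ht hx, steklov]
  refine intervalIntegral.integral_congr fun r hr => ?_
  rw [uIcc_of_le hk] at hr
  have h1 : t + r ∈ Ioo 0 T := ⟨by linarith [ht.1, hr.1], by linarith [ht.2, hr.2]⟩
  have h2 : Ioo 0 T ×ˢ ball 0 R ∈ 𝓝 (t + r, x) :=
    (isOpen_Ioo.prod isOpen_ball).mem_nhds ⟨h1, hx⟩
  have h3 : DifferentiableAt ℝ (fun p : ℝ × ℰ n => y p.1 p.2) (t + r, x) :=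
    (hy.contDiffAt h2).differentiableAt (by simp)
  exact (pd_eq_fderiv_prod i h3).symm

lemma contDiffOn_pd (hy : ContDiffOn ℝ ∞ (fun p : ℝ × ℰ n => y p.1 p.2)
      (Ioo 0 T ×ˢ ball 0 R)) (i : Fin n) :
    ContDiffOn ℝ ∞ (fun p : ℝ × ℰ n => pd i (y p.1) p.2) (Ioo 0 T ×ˢ ball 0 R) := by
  have h := (hy.fderiv_of_isOpen (isOpen_Ioo.prod isOpen_ball) (m := ∞) (by simp)).clm_apply
    (contDiffOn_const (c := ((0:ℝ), EuclideanSpace.single i (1:ℝ))))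
  refine h.congr fun p hp => pd_eq_fderiv_prod i ?_
  exact (hy.contDiffAt ((isOpen_Ioo.prod isOpen_ball).mem_nhds hp)).differentiableAt (by simp)

lemma intervalIntegrable_add (hk : 0 ≤ k) (hy : ContinuousOn (fun p : ℝ × ℰ n => y p.1 p.2)
      (Ioo 0 T ×ˢ ball 0 R)) (ht : t ∈ Ioo 0 (T - k)) (hx : x ∈ ball 0 R) :
    IntervalIntegrable (fun r => y (t + r) x) volume 0 k := by
  refine ContinuousOn.intervalIntegrable ?_
  rw [uIcc_of_le hk]
  exact hy.comp (f := fun r => (t + r, x)) (by fun_prop) fun r hr =>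
    ⟨⟨by linarith [ht.1, hr.1], by linarith [ht.2, hr.2]⟩, hx⟩

lemma lapl_steklov (hk : 0 ≤ k) (hy : ContDiffOn ℝ ∞ (fun p : ℝ × ℰ n => y p.1 p.2)
      (Ioo 0 T ×ˢ ball 0 R)) (ht : t ∈ Ioo 0 (T - k)) (hx : x ∈ ball 0 R) :
    lapl (steklov k y t) x = steklov k (fun s => lapl (y s)) t x := by
  have e : (fun s => lapl (y s)) = fun s z => ∑ i, pd i (pd i (y s)) z :=
    funext fun s => funext fun z => lapl_eq_sum_pd
  rw [e, lapl_eq_sum_pd, steklov, intervalIntegral.integral_finsetSum fun i _ =>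
    intervalIntegrable_add (y := fun s => pd i (pd i (y s))) hk
      (contDiffOn_pd (y := fun s => pd i (y s)) (contDiffOn_pd hy i) i).continuousOn ht hx]
  refine Finset.sum_congr rfl fun i _ => ?_
  have h1 := pd_steklov (y := fun s => pd i (y s)) hk (contDiffOn_pd hy i) ht hx i
  rw [steklov] at h1
  rw [← h1]
  refine pd_congr i ?_
  filter_upwards [isOpen_ball.mem_nhds hx] with z hz
  exact pd_steklov hk hy ht hz i

namespace IsHarmonicHeatSolution

variable {μ : ℝ}

lemma hasDerivAt_steklov (h : IsHarmonicHeatSolution n R μ T y) (hk : 0 ≤ k)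
    (ht : t ∈ Ioo 0 (T - k)) (hx : x ∈ ball 0 R) :
    HasDerivAt (fun s => steklov k y s x) (y (t + k) x - y t x) t := by
  have hd := differentiableAt_steklov hk h.smoothOn ht hx
  refine (deriv_eq_fderiv_prod hd).congr_deriv ?_
  have hmem : ∀ r ∈ Icc 0 k, t + r ∈ Ioo 0 T := fun r hr =>
    ⟨by linarith [ht.1, hr.1], by linarith [ht.2, hr.2]⟩
  have hd' : ∀ r ∈ Icc 0 k, HasDerivAt (fun r => y (t + r) x)
      (fderiv ℝ (fun p : ℝ × ℰ n => y p.1 p.2) (t + r, x) (1, 0)) r :=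
    fun r hr => (deriv_eq_fderiv_prod
      ((h.contDiffAt (hmem r hr) hx).differentiableAt (by simp))).comp_const_add t r
  rw [fderiv_steklov hk h.smoothOn ht hx, intervalIntegral.integral_eq_sub_of_hasDerivAt
    (f := fun r => y (t + r) x)]
  · simp
  · intro r hr
    rw [uIcc_of_le hk] at hr
    exact hd' r hr
  · refine ContinuousOn.intervalIntegrable ?_
    rw [uIcc_of_le hk]
    have := ((h.smoothOn.continuousOn_fderiv_of_isOpen (isOpen_Ioo.prod isOpen_ball)
      (by simp)).clm_apply (continuousOn_const (c := ((1:ℝ), 0)))).comp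
      (f := fun r => (t + r, x)) (s := Icc 0 k) (by fun_prop) fun r hr => ⟨hmem r hr, hx⟩
    exact this

lemma steklov (h : IsHarmonicHeatSolution n R μ T y) (hk : 0 ≤ k) :
    IsHarmonicHeatSolution n R μ (T - k) (steklov k y) where
  continuousOn := by
    obtain ⟨C, hC⟩ := (isCompact_Icc.prod (isCompact_closedBall
      0 R)).exists_bound_of_continuousOn h.continuousOn
    have hmem : ∀ p ∈ Icc 0 (T - k) ×ˢ closedBall 0 R, ∀ r ∈ Icc 0 k,
        (p.1 + r, p.2) ∈ Icc 0 T ×ˢ closedBall (0 : ℰ n) R := fun p hp r hr =>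
      ⟨⟨by linarith [hp.1.1, hr.1], by linarith [hp.1.2, hr.2]⟩, hp.2⟩
    intro p hp
    refine intervalIntegral.continuousWithinAt_of_dominated_interval (bound := fun _ => C) ?_ ?_
      intervalIntegrable_const (ae_of_all _ fun r hr => ?_)
    · filter_upwards [self_mem_nhdsWithin] with q hq
      rw [uIoc_of_le hk]
      refine ContinuousOn.aestronglyMeasurable ?_ measurableSet_Ioc
      exact h.continuousOn.comp (f := fun r => (q.1 + r, q.2)) (by fun_prop)
        fun r hr => hmem q hq r (Ioc_subset_Icc_self hr)
    · filter_upwards [self_mem_nhdsWithin] with q hq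
      refine ae_of_all _ fun r hr => ?_
      rw [uIoc_of_le hk] at hr
      exact hC _ (hmem q hq r (Ioc_subset_Icc_self hr))
    · rw [uIoc_of_le hk] at hr
      exact (h.continuousOn.comp (f := fun q : ℝ × ℰ n => (q.1 + r, q.2))
        (by fun_prop) fun q hq => hmem q hq r (Ioc_subset_Icc_self hr)) p hp
  smoothOn := contDiffOn_steklov hk h.smoothOn
  eqn t ht x hx := by
    have hmem : ∀ r ∈ Icc 0 k, t + r ∈ Ioo 0 T := fun r hr =>
      ⟨by linarith [ht.1, hr.1], by linarith [ht.2, hr.2]⟩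
    have e : ∀ r ∈ Icc 0 k, deriv (fun s => y s x) (t + r) =
        lapl (y (t + r)) x - μ ^ 2 * ‖x‖ ^ 2 * y (t + r) x := fun r hr => by
      linarith [h.eqn _ (hmem r hr) x hx]
    have hl : ContinuousOn (fun p : ℝ × ℰ n => lapl (y p.1) p.2) (Ioo 0 T ×ˢ ball 0 R) := by
      simp only [lapl_eq_sum_pd]
      exact continuousOn_finsetSum _ fun i _ =>
        (contDiffOn_pd (y := fun s => pd i (y s)) (contDiffOn_pd h.smoothOn i) i).continuousOn
    have h1 := intervalIntegrable_add (y := fun s => lapl (y s)) hk hl ht hx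
    have h2 := intervalIntegrable_add hk h.smoothOn.continuousOn ht hx
    rw [(h.hasDerivAt_steklov hk ht hx).deriv, lapl_steklov hk h.smoothOn ht hx]
    have h3 : (∫ r in (0:ℝ)..k, (lapl (y (t + r)) x - μ ^ 2 * ‖x‖ ^ 2 * y (t + r) x))
        = y (t + k) x - y t x := by
      rw [intervalIntegral.integral_eq_sub_of_hasDerivAt (f := fun r => y (t + r) x)]
      · simp
      · intro r hr
        rw [uIcc_of_le hk] at hr
        rw [← e r hr]
        exact (h.differentiableAt_time (hmem r hr) hx).hasDerivAt.comp_const_add t r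
      · exact h1.sub (h2.const_mul _)
    rw [intervalIntegral.integral_sub h1 (h2.const_mul _), intervalIntegral.integral_const_mul] at h3
    simp only [_root_.steklov]
    linarith
  boundary t ht x hx := by
    rw [_root_.steklov]
    refine intervalIntegral.integral_zero_ae (ae_of_all _ fun r hr => ?_)
    rw [uIoc_of_le hk] at hr
    rcases lt_or_eq_of_le (show t + r ≤ T by linarith [ht.2, hr.2]) with h1 | h1
    · exact h.boundary _ ⟨by linarith [ht.1, hr.1], h1⟩ x hx
    · linarith [ht.2, hr.2]

end IsHarmonicHeatSolution

end Steklov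
section WeightedDivergence

variable {n : ℕ} {x x₀ : ℰ n} {a c μ : ℝ}

lemma pd_finsetSum {ι : Type*} (s : Finset ι) {f : ι → ℰ n → ℝ} (i : Fin n)
    (hf : ∀ j ∈ s, DifferentiableAt ℝ (f j) x) :
    pd i (fun z => ∑ j ∈ s, f j z) x = ∑ j ∈ s, pd i (f j) x := by
  simp only [pd]
  rw [fderiv_fun_sum hf]
  simp

lemma pd_const_mul (i : Fin n) (k : ℝ) {f : ℰ n → ℝ}
    (hf : DifferentiableAt ℝ f x) : pd i (fun z => k * f z) x = k * pd i f x := by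
  rw [pd_mul i (differentiableAt_const _) hf, pd_const]; ring

lemma pd_comm {f : ℰ n → ℝ} (hf : ContDiffAt ℝ 2 f x) (i j : Fin n) :
    pd i (pd j f) x = pd j (pd i f) x := by
  have hs : IsSymmSndFDerivAt ℝ f x := hf.isSymmSndFDerivAt (by simp)
  have hd : DifferentiableAt ℝ (fderiv ℝ f) x :=
    (hf.fderiv_right (m := 1) (by norm_num)).differentiableAt one_ne_zero
  have h : ∀ i j : Fin n, pd i (pd j f) x =
      fderiv ℝ (fderiv ℝ f) x (EuclideanSpace.single i 1) (EuclideanSpace.single j 1) := by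
    intro i j
    have : pd j f = fun z => fderiv ℝ f z (EuclideanSpace.single j 1) := rfl
    rw [this, pd, fderiv_clm_apply hd (differentiableAt_const _)]
    simp
  rw [h, h, hs.eq]

/-- The Gaussian weight `exp (-(a/2)‖z - x₀‖² + c)`. -/
noncomputable def gauss (a c : ℝ) (x₀ z : ℰ n) : ℝ := rexp (-(a / 2) * ‖z - x₀‖ ^ 2 + c)

/-- The derivative of `U` along the dilation field centred at `x₀`. -/
noncomputable def dilation (x₀ : ℰ n) (U : ℰ n → ℝ) (z : ℰ n) : ℝ := ∑ j, (z j - x₀ j) * pd j U z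

/-- The energy density `|∇U|² + μ²‖z‖²U²`. -/
noncomputable def energyDensity (μ : ℝ) (U : ℰ n → ℝ)
    (z : ℰ n) : ℝ := ∑ j, pd j U z ^ 2 + μ ^ 2 * ‖z‖ ^ 2 * U z ^ 2

lemma gauss_pos (z : ℰ n) : 0 < gauss a c x₀ z := Real.exp_pos _

lemma contDiff_gauss : ContDiff ℝ ∞ (gauss a c x₀) := by
  have : ContDiff ℝ ∞ (fun z : ℰ n => ‖z - x₀‖ ^ 2) :=
    contDiff_norm_sq_euclidean.comp (f := fun z => z - x₀) (by fun_prop)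
  unfold gauss
  fun_prop

lemma pd_gauss (i : Fin n) : pd i (gauss a c x₀) x = -a * (x i - x₀ i) * gauss a c x₀ x := by
  have h1 : HasFDerivAt (fun z : ℰ n => ‖z - x₀‖ ^ 2)
      (2 • (innerSL ℝ (x - x₀)).comp (ContinuousLinearMap.id ℝ _)) x :=
    HasFDerivAt.comp (g := fun w : ℰ n => ‖w‖ ^ 2) (f := fun z => z - x₀) x
      (hasStrictFDerivAt_norm_sq (x - x₀)).hasFDerivAt ((hasFDerivAt_id x).sub_const x₀)
  have h2 := ((h1.const_mul (-(a / 2))).add_const c).exp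
  have h3 : HasFDerivAt (gauss a c x₀) _ x := h2
  rw [pd, h3.fderiv]
  simp [gauss, EuclideanSpace.inner_single_right]
  ring

lemma norm_sub_sq_eq_sum (z : ℰ n) : ∑ i, (z i - x₀ i) * (z i - x₀ i) = ‖z - x₀‖ ^ 2 := by
  rw [EuclideanSpace.norm_sq_eq]
  exact Finset.sum_congr rfl fun i _ => by simp [sq]

lemma sum_pd_mul_gauss {χ : ℰ n → ℝ} {h : Fin n → ℰ n → ℝ}
    (hχ : DifferentiableAt ℝ χ x) (hh : ∀ i, DifferentiableAt ℝ (h i) x) :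
    ∑ i, pd i (fun z => χ z * h i z * gauss a c x₀ z) x =
      ((∑ i, pd i χ x * h i x) + χ x * (∑ i, pd i (h i) x)
        - a * χ x * ∑ i, (x i - x₀ i) * h i x) * gauss a c x₀ x := by
  have hg : DifferentiableAt ℝ (gauss a c x₀) x := contDiff_gauss.differentiable (by simp) x
  have : ∀ i, pd i (fun z => χ z * h i z * gauss a c x₀ z) x =
      (pd i χ x * h i x + χ x * pd i (h i) x - a * χ x * ((x i - x₀ i) * h i x)) * gauss a c x₀ x :=
    fun i => by rw [pd_mul i (hχ.fun_mul (hh i)) hg, pd_mul i hχ (hh i), pd_gauss]; ring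
  simp only [this]
  rw [← Finset.sum_mul, Finset.sum_sub_distrib, Finset.sum_add_distrib, Finset.mul_sum,
    Finset.mul_sum]

variable {χ U Z : ℰ n → ℝ}

lemma pd_sub_coord (i : Fin n) : pd i (fun z : ℰ n => z i - x₀ i) x = 1 := by
  rw [pd_sub i (by fun_prop) (differentiableAt_const _), pd_coord, pd_const]; simp

lemma contDiff_dilation (hU : ContDiff ℝ ∞ U) : ContDiff ℝ ∞ (dilation x₀ U) := by
  have := fun j => hU.pd (k := ∞) j (by simp)
  unfold dilation
  fun_prop

lemma contDiff_energyDensity (hU : ContDiff ℝ ∞ U) : ContDiff ℝ ∞ (energyDensity μ U) := by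
  have := fun j => hU.pd (k := ∞) j (by simp)
  have h2 : ContDiff ℝ ∞ (fun z : ℰ n => ‖z‖ ^ 2) := contDiff_norm_sq_euclidean
  unfold energyDensity
  fun_prop

lemma mass_divergence (hχ : DifferentiableAt ℝ χ x) (hU : ContDiff ℝ ∞ U) (z : ℝ) :
    χ x * (2 * U x * z) * gauss a c x₀ x
        + χ x * U x ^ 2 * ((n * a - a ^ 2 * ‖x - x₀‖ ^ 2) * gauss a c x₀ x) =
      ∑ i, pd i (fun z => χ z * (a * U z ^ 2 * (z i - x₀ i)) * gauss a c x₀ z) x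
        + (2 * (χ x * U x * (z - a * dilation x₀ U x) * gauss a c x₀ x)
          - a * (∑ i, pd i χ x * (x i - x₀ i)) * U x ^ 2 * gauss a c x₀ x) := by
  have hUd : DifferentiableAt ℝ U x := hU.differentiable (by simp) x
  have hU2 : DifferentiableAt ℝ (fun z => U z ^ 2) x := by fun_prop
  have e1 : ∀ i, pd i (fun z => a * U z ^ 2 * (z i - x₀ i)) x =
      2 * a * U x * ((x i - x₀ i) * pd i U x) + a * U x ^ 2 := fun i => by
    rw [pd_mul i (by fun_prop) (by fun_prop), pd_sub_coord, pd_const_mul i a hU2]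
    have : (fun z => U z ^ 2) = fun z => U z * U z := funext fun z => sq _
    rw [this, pd_mul i hUd hUd]
    ring
  rw [sum_pd_mul_gauss hχ (fun i => by fun_prop)]
  simp only [e1]
  rw [Finset.sum_add_distrib, ← Finset.mul_sum]
  have e2 : ∑ i, pd i χ x * (a * U x ^ 2 * (x i - x₀ i)) =
      a * U x ^ 2 * ∑ i, pd i χ x * (x i - x₀ i) := by
    rw [Finset.mul_sum]; exact Finset.sum_congr rfl fun i _ => by ring
  have e3 : ∑ i, (x i - x₀ i) * (a * U x ^ 2 * (x i - x₀ i)) = a * U x ^ 2 * ‖x - x₀‖ ^ 2 := by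
    rw [← norm_sub_sq_eq_sum, Finset.mul_sum]; exact Finset.sum_congr rfl fun i _ => by ring
  rw [e2, e3]
  simp only [Finset.sum_const, Finset.card_univ, Fintype.card_fin, nsmul_eq_mul, dilation]
  ring

lemma energy_divergence (hχ : DifferentiableAt ℝ χ x) (hU : ContDiff ℝ ∞ U) {z : ℝ}
    (heq : lapl U x = z + μ ^ 2 * ‖x‖ ^ 2 * U x ∨ χ x = 0) :
    χ x * energyDensity μ U x * gauss a c x₀ x
        + χ x * U x * (z - a * dilation x₀ U x) * gauss a c x₀ x =
      ∑ i, pd i (fun z => χ z * (U z * pd i U z) * gauss a c x₀ z) x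
        + -(U x * (∑ i, pd i χ x * pd i U x) * gauss a c x₀ x) := by
  have hUd : DifferentiableAt ℝ U x := hU.differentiable (by simp) x
  have hUi : ∀ i, DifferentiableAt ℝ (pd i U) x := fun i =>
    (hU.pd (k := ∞) i (by simp)).differentiable (by simp) x
  rw [sum_pd_mul_gauss hχ (fun i => hUd.fun_mul (hUi i))]
  have e1 : ∀ i, pd i (fun z => U z * pd i U z) x = pd i U x ^ 2 + U x * pd i (pd i U) x :=
    fun i => by rw [pd_mul i hUd (hUi i)]; ring
  simp only [e1]
  rw [Finset.sum_add_distrib, ← Finset.mul_sum, ← lapl_eq_sum_pd]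
  have e2 : ∑ i, pd i χ x * (U x * pd i U x) = U x * ∑ i, pd i χ x * pd i U x := by
    rw [Finset.mul_sum]; exact Finset.sum_congr rfl fun i _ => by ring
  have e3 : ∑ i, (x i - x₀ i) * (U x * pd i U x) = U x * dilation x₀ U x := by
    rw [dilation, Finset.mul_sum]; exact Finset.sum_congr rfl fun i _ => by ring
  rw [e2, e3, energyDensity]
  rcases heq with h | h
  · rw [h]; ring
  · rw [h]; ring

/-- The vector field whose divergence yields the derivative of the weighted Dirichlet energy. -/
noncomputable def energyField (a μ : ℝ) (x₀ : ℰ n) (U Z : ℰ n → ℝ) (i : Fin n) (z : ℰ n) : ℝ :=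
  2 * (Z z * pd i U z) - 2 * a * (dilation x₀ U z * pd i U z)
    + a * (energyDensity μ U z * (z i - x₀ i))

lemma contDiff_energyField (hU : ContDiff ℝ ∞ U) (hZ : ContDiff ℝ ∞ Z) (i : Fin n) :
    ContDiff ℝ ∞ (energyField a μ x₀ U Z i) := by
  have h1 := fun j => hU.pd (k := ∞) j (by simp)
  have h2 := contDiff_dilation (x₀ := x₀) hU
  have h3 := contDiff_energyDensity (μ := μ) hU
  unfold energyField
  fun_prop

lemma pd_dilation (hU : ContDiff ℝ ∞ U) (i : Fin n) :
    pd i (dilation x₀ U) x = pd i U x + ∑ j, (x j - x₀ j) * pd j (pd i U) x := by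
  have hUi : ∀ i, DifferentiableAt ℝ (pd i U) x := fun i =>
    (hU.pd (k := ∞) i (by simp)).differentiable (by simp) x
  unfold dilation
  rw [pd_finsetSum _ i fun j _ => by have := hUi j; fun_prop]
  have : ∀ j, pd i (fun z => (z j - x₀ j) * pd j U z) x =
      (if j = i then pd j U x else 0) + (x j - x₀ j) * pd j (pd i U) x := fun j => by
    rw [pd_mul i (by fun_prop) (hUi j), pd_sub i (by fun_prop) (differentiableAt_const _),
      pd_coord, pd_const, pd_comm (hU.contDiffAt.of_le two_le_smooth) i j]
    split_ifs <;> ring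
  simp only [this]
  rw [Finset.sum_add_distrib, Finset.sum_ite_eq' Finset.univ i]
  simp

lemma pd_energyDensity (hU : ContDiff ℝ ∞ U) (i : Fin n) :
    pd i (energyDensity μ U) x = 2 * ∑ j, pd j U x * pd i (pd j U) x
      + 2 * μ ^ 2 * x i * U x ^ 2 + 2 * μ ^ 2 * ‖x‖ ^ 2 * U x * pd i U x := by
  have hUd : DifferentiableAt ℝ U x := hU.differentiable (by simp) x
  have hUi : ∀ i, DifferentiableAt ℝ (pd i U) x := fun i =>
    (hU.pd (k := ∞) i (by simp)).differentiable (by simp) x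
  have hn : DifferentiableAt ℝ (fun z : ℰ n => ‖z‖ ^ 2) x := differentiable_norm_sq_euclidean x
  have hsq : ∀ {f : ℰ n → ℝ}, DifferentiableAt ℝ f x →
      pd i (fun z => f z ^ 2) x = 2 * (f x * pd i f x) := fun {f} hf => by
    have : (fun z => f z ^ 2) = fun z => f z * f z := funext fun z => sq _
    rw [this, pd_mul i hf hf]; ring
  unfold energyDensity
  rw [pd_add i (DifferentiableAt.fun_sum fun j _ => (hUi j).fun_pow 2)
    ((hn.const_mul (μ ^ 2)).fun_mul (hUd.fun_pow 2)),
    pd_finsetSum _ i fun j _ => (hUi j).fun_pow 2, pd_mul i (hn.const_mul (μ ^ 2)) (hUd.fun_pow 2),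
    pd_const_mul i _ hn, pd_norm_sq, hsq hUd]
  simp only [fun j => hsq (hUi j)]
  rw [← Finset.mul_sum]
  ring

lemma dirichlet_divergence (hχ : DifferentiableAt ℝ χ x) (hU : ContDiff ℝ ∞ U)
    (hZ : ContDiff ℝ ∞ Z) (heq : lapl U x = Z x + μ ^ 2 * ‖x‖ ^ 2 * U x ∨ χ x = 0) :
    χ x * (2 * (∑ i, pd i U x * pd i Z x) + 2 * (μ ^ 2 * ‖x‖ ^ 2) * U x * Z x) * gauss a c x₀ x
        + χ x * energyDensity μ U x * ((n * a - a ^ 2 * ‖x - x₀‖ ^ 2) * gauss a c x₀ x) =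
      ∑ i, pd i (fun z => χ z * energyField a μ x₀ U Z i z * gauss a c x₀ z) x
        + (χ x * (-2 * (Z x - a * dilation x₀ U x) ^ 2 + 2 * a * (∑ i, pd i U x ^ 2)
            - 2 * a * μ ^ 2 * (∑ i, (x i - x₀ i) * x i) * U x ^ 2) * gauss a c x₀ x
          - (∑ i, pd i χ x * energyField a μ x₀ U Z i x) * gauss a c x₀ x) := by
  have hZd : DifferentiableAt ℝ Z x := hZ.differentiable (by simp) x
  have hUi : ∀ i, DifferentiableAt ℝ (pd i U) x := fun i =>
    (hU.pd (k := ∞) i (by simp)).differentiable (by simp) x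
  have hQ : DifferentiableAt ℝ (dilation x₀ U) x :=
    (contDiff_dilation hU).differentiable (by simp) x
  have hE : DifferentiableAt ℝ (energyDensity μ U) x :=
    (contDiff_energyDensity hU).differentiable (by simp) x
  rw [sum_pd_mul_gauss hχ (fun i => (contDiff_energyField hU hZ i).differentiable (by simp) x)]
  have e1 : ∀ i, pd i (energyField a μ x₀ U Z i) x =
      2 * (pd i U x * pd i Z x) + 2 * Z x * pd i (pd i U) x
        - 2 * a * (pd i (dilation x₀ U) x * pd i U x) - 2 * a * dilation x₀ U x * pd i (pd i U) x
        + a * ((x i - x₀ i) * pd i (energyDensity μ U) x) + a * energyDensity μ U x := fun i => by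
    have h1 := hUi i
    unfold energyField
    rw [pd_add i (by fun_prop) (by fun_prop), pd_sub i (by fun_prop) (by fun_prop),
      pd_const_mul i _ (by fun_prop), pd_const_mul i _ (by fun_prop),
      pd_const_mul i _ (by fun_prop), pd_mul i hZd h1, pd_mul i hQ h1,
      pd_mul i hE (by fun_prop), pd_sub_coord]
    ring
  simp only [e1, Finset.sum_add_distrib, Finset.sum_sub_distrib, ← Finset.mul_sum, ← lapl_eq_sum_pd]
  set S := ∑ i, ∑ j, pd i U x * ((x j - x₀ j) * pd j (pd i U) x) with hS
  have e2 : ∑ i, pd i (dilation x₀ U) x * pd i U x = ∑ i, pd i U x ^ 2 + S := by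
    rw [hS, ← Finset.sum_add_distrib]
    refine Finset.sum_congr rfl fun i _ => ?_
    rw [pd_dilation hU, ← Finset.mul_sum]
    ring
  have e3 : ∑ i, (x i - x₀ i) * pd i (energyDensity μ U) x = 2 * S
      + 2 * μ ^ 2 * (∑ i, (x i - x₀ i) * x i) * U x ^ 2
      + 2 * μ ^ 2 * ‖x‖ ^ 2 * U x * dilation x₀ U x := by
    rw [hS, Finset.sum_comm, dilation]
    simp only [Finset.mul_sum, Finset.sum_mul, ← Finset.sum_add_distrib]
    refine Finset.sum_congr rfl fun i _ => ?_
    rw [pd_energyDensity hU, Finset.mul_sum, mul_add, mul_add, Finset.mul_sum]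
    congr 1
    · congr 1
      · exact Finset.sum_congr rfl fun j _ => by ring
      · ring
    · ring
  have e4 : ∑ i, (x i - x₀ i) * energyField a μ x₀ U Z i x =
      2 * Z x * dilation x₀ U x - 2 * a * dilation x₀ U x ^ 2
        + a * energyDensity μ U x * ‖x - x₀‖ ^ 2 := by
    have : ∀ i, (x i - x₀ i) * energyField a μ x₀ U Z i x =
        2 * Z x * ((x i - x₀ i) * pd i U x) - 2 * a * dilation x₀ U x * ((x i - x₀ i) * pd i U x)
          + a * energyDensity μ U x * ((x i - x₀ i) * (x i - x₀ i)) := fun i => by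
      unfold energyField; ring
    simp only [this, Finset.sum_add_distrib, Finset.sum_sub_distrib, ← Finset.mul_sum,
      norm_sub_sq_eq_sum]
    rw [← dilation]
    ring
  rw [e2, e3, e4]
  simp only [Finset.sum_const, Finset.card_univ, Fintype.card_fin, nsmul_eq_mul]
  rcases heq with h | h
  · rw [h]; ring
  · rw [h]; ring

end WeightedDivergence
/-- Uniform boundary regularity on `J × B_R`: vanishing to first order of `u`, of its time
derivative and of its tangential gradient at the sphere, and boundedness of the gradient. -/
structure BoundaryRegular (n : ℕ) (R C : ℝ) (J : Set ℝ) (u : ℝ → ℰ n → ℝ) : Prop where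
  abs_le : ∀ t ∈ J, ∀ x ∈ ball 0 R, |u t x| ≤ C * (R ^ 2 - ‖x‖ ^ 2)
  abs_deriv_le : ∀ t ∈ J, ∀ x ∈ ball 0 R,
    |deriv (fun s => u s x) t| ≤ C * (R ^ 2 - ‖x‖ ^ 2)
  abs_pd_le : ∀ t ∈ J, ∀ x ∈ ball 0 R, ∀ i, |pd i (u t) x| ≤ C
  abs_tangential_le : ∀ t ∈ J, ∀ x ∈ ball 0 R, ∀ v : ℰ n, inner ℝ x v = 0 →
      ‖x‖ * |fderiv ℝ (u t) x v| ≤ C * (R ^ 2 - ‖x‖ ^ 2) * ‖v‖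

namespace IsHarmonicHeatSolution

variable {n : ℕ} {R μ T : ℝ} {y : ℝ → ℰ n → ℝ}

lemma lapl_eq (h : IsHarmonicHeatSolution n R μ T y) {t : ℝ} (ht : t ∈ Ioo 0 T)
    {x : ℰ n} (hx : x ∈ ball 0 R) :
    lapl (y t) x = deriv (fun s => y s x) t + μ ^ 2 * ‖x‖ ^ 2 * y t x := by
  linarith [h.eqn t ht x hx]

lemma exists_abs_le (h : IsHarmonicHeatSolution n R μ T y) :
    ∃ M, 0 ≤ M ∧ ∀ t ∈ Icc 0 T, ∀ x ∈ closedBall 0 R, |y t x| ≤ M := by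
  obtain ⟨C, hC⟩ := (isCompact_Icc.prod (isCompact_closedBall
    0 R)).exists_bound_of_continuousOn h.continuousOn
  exact ⟨max C 0, le_max_right _ _, fun t ht x hx => (hC (t, x) ⟨ht, hx⟩).trans (le_max_left _ _)⟩

lemma exists_boundaryRegular_steklov [NeZero n] (h : IsHarmonicHeatSolution n R μ T y)
    (hR : 0 < R) {k k' : ℝ} (hk : 0 < k) (hk' : 0 < k') :
    ∃ C, 0 ≤ C ∧ BoundaryRegular n R C (Ioo 0 (T - k' - k)) (_root_.steklov k (_root_.steklov k' y)) := by
  set w := _root_.steklov k' y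
  set u := _root_.steklov k w
  have hw : IsHarmonicHeatSolution n R μ (T - k') w := h.steklov hk'.le
  have hu : IsHarmonicHeatSolution n R μ (T - k' - k) u := hw.steklov hk.le
  have hnR : (0:ℝ) < n := Nat.cast_pos.2 (NeZero.pos n)
  obtain ⟨My, hMy0, hMy⟩ := h.exists_abs_le
  obtain ⟨Mw, hMw0, hMw⟩ := hw.exists_abs_le
  obtain ⟨Mu, hMu0, hMu⟩ := hu.exists_abs_le
  have hVle : ∀ x ∈ ball (0 : ℰ n) R, μ ^ 2 * ‖x‖ ^ 2 ≤ μ ^ 2 * R ^ 2 := fun x hx => by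
      have : ‖x‖ < R := by simpa using hx
      gcongr
  have hmul : ∀ x ∈ ball (0 : ℰ n) R, ∀ z M : ℝ, |z| ≤ M →
      |μ ^ 2 * ‖x‖ ^ 2 * z| ≤ μ ^ 2 * R ^ 2 * M := fun x hx z M hz => by
    rw [abs_mul, abs_of_nonneg (by positivity : 0 ≤ μ ^ 2 * ‖x‖ ^ 2)]
    exact mul_le_mul (hVle x hx) hz (abs_nonneg _) (by positivity)
  have hwl : ∀ t ∈ Ioo 0 (T - k'), ∀ x ∈ ball 0 R,
      |lapl (w t) x| ≤ 2 * My + μ ^ 2 * R ^ 2 * Mw := fun t ht x hx => by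
    rw [hw.lapl_eq ht hx, (h.hasDerivAt_steklov hk'.le ht hx).deriv]
    have h1 := hMy (t + k') ⟨by linarith [ht.1], by linarith [ht.2]⟩ x (ball_subset_closedBall hx)
    have h2 := hMy t ⟨by linarith [ht.1], by linarith [ht.2]⟩ x (ball_subset_closedBall hx)
    have h3 := hmul x hx _ _ (hMw t (Ioo_subset_Icc_self ht) x (ball_subset_closedBall hx))
    have h4 := abs_add_le (y (t + k') x - y t x) (μ ^ 2 * ‖x‖ ^ 2 * w t x)
    have h5 := abs_sub (y (t + k') x) (y t x)
    linarith
  set K₁ := 2 * (2 * My + μ ^ 2 * R ^ 2 * Mw)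
  set K₂ := 2 * Mw + μ ^ 2 * R ^ 2 * Mu
  set L := n * (4 * K₁ * R + 2 * μ ^ 2 * R * Mu + μ ^ 2 * R ^ 2 * (4 * K₂ * R)) with hL
  have hL0 : 0 ≤ L := by positivity
  set C := K₁ / (2 * n) + K₂ / (2 * n) + 4 * K₂ * R + 2 * L * R
  have key : ∀ t ∈ Ioo 0 (T - k' - k), ∀ x ∈ ball 0 R,
      |u t x| ≤ K₂ / (2 * n) * (R ^ 2 - ‖x‖ ^ 2) ∧
      |deriv (fun s => u s x) t| ≤ K₁ / (2 * n) * (R ^ 2 - ‖x‖ ^ 2) ∧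
      (∀ i, |pd i (u t) x| ≤ 4 * K₂ * R) ∧ ∀ v : ℰ n, inner ℝ x v = 0 →
        ‖x‖ * |fderiv ℝ (u t) x v| ≤ 2 * L * R * (R ^ 2 - ‖x‖ ^ 2) * ‖v‖ := by
    intro t ht
    have ht1 : t ∈ Ioo 0 (T - k') := ⟨ht.1, by linarith [ht.2]⟩
    have ht2 : t + k ∈ Ioo 0 (T - k') := ⟨by linarith [ht.1], by linarith [ht.2]⟩
    set v : ℰ n → ℝ := fun x => w (t + k) x - w t x with hv
    have hvs : ∀ x ∈ ball 0 R, ContDiffAt ℝ ∞ v x := fun x hx =>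
      (hw.contDiffAt_space ht2 hx).sub (hw.contDiffAt_space ht1 hx)
    have hvc : ContinuousOn v (closedBall 0 R) :=
      (hw.continuousOn_slice (Ioo_subset_Icc_self ht2)).sub
        (hw.continuousOn_slice (Ioo_subset_Icc_self ht1))
    have hvl : ∀ x ∈ ball 0 R, |lapl v x| ≤ K₁ := fun x hx => by
      rw [hv, lapl_sub ((hw.contDiffAt_space ht2 hx).of_le two_le_smooth)
        ((hw.contDiffAt_space ht1 hx).of_le two_le_smooth)]
      linarith [abs_sub (lapl (w (t + k)) x) (lapl (w t) x), hwl _ ht2 x hx, hwl _ ht1 x hx]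
    have hvb : ∀ x ∈ sphere 0 R, v x = 0 := fun x hx => by
      rw [hv]; simp only []; rw [hw.boundary _ ht2 x hx, hw.boundary _ ht1 x hx, sub_zero]
    have hus : ∀ x ∈ ball 0 R, ContDiffAt ℝ ∞ (u t) x := fun x hx =>
      hu.contDiffAt_space ht hx
    have hut : ∀ x ∈ ball 0 R, deriv (fun s => u s x) t = v x :=
      fun x hx => (hw.hasDerivAt_steklov hk.le ht hx).deriv
    have hul : ∀ x ∈ ball 0 R,
        lapl (u t) x = v x + μ ^ 2 * ‖x‖ ^ 2 * u t x := fun x hx => by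
      rw [hu.lapl_eq ht hx, hut x hx]
    have hulb : ∀ x ∈ ball 0 R, |lapl (u t) x| ≤ K₂ := fun x hx => by
      rw [hul x hx]
      have h1 := hMw (t + k) (Ioo_subset_Icc_self ht2) x (ball_subset_closedBall hx)
      have h2 := hMw t (Ioo_subset_Icc_self ht1) x (ball_subset_closedBall hx)
      have h3 := hmul x hx _ _ (hMu t (Ioo_subset_Icc_self ht) x (ball_subset_closedBall hx))
      have h4 := abs_add_le (v x) (μ ^ 2 * ‖x‖ ^ 2 * u t x)
      have h5 := abs_sub (w (t + k) x) (w t x)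
      linarith
    have hupd := fun i => abs_pd_le_of_dirichlet hR (hu.continuousOn_slice (Ioo_subset_Icc_self ht))
      (fun x hx => (hus x hx).of_le two_le_smooth) hulb (fun x hx => hu.boundary t ht x hx) i
    have hvpd := fun i => abs_pd_le_of_dirichlet hR hvc
      (fun x hx => (hvs x hx).of_le two_le_smooth) hvl hvb i
    have hfd : ∀ x ∈ ball 0 R, DifferentiableAt ℝ
        (fun x => v x + μ ^ 2 * ‖x‖ ^ 2 * u t x) x := fun x hx =>
      ((hvs x hx).differentiableAt (by simp)).add
        (((differentiable_norm_sq_euclidean x).const_mul _).mul ((hus x hx).differentiableAt (by simp)))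
    have hfpd : ∀ x ∈ ball 0 R, ∀ i,
        |pd i (fun x => v x + μ ^ 2 * ‖x‖ ^ 2 * u t x) x| ≤ L / n := by
      intro x hx i
      have hn : DifferentiableAt ℝ (fun z : ℰ n => ‖z‖ ^ 2) x := differentiable_norm_sq_euclidean x
      have hxR : ‖x‖ < R := by simpa using hx
      rw [pd_add i ((hvs x hx).differentiableAt (by simp))
        ((hn.const_mul _).fun_mul ((hus x hx).differentiableAt (by simp))),
        pd_mul i (hn.const_mul _) ((hus x hx).differentiableAt (by simp)), pd_const_mul i _ hn,
        pd_norm_sq]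
      have h1 := hvpd i x hx
      have h2 := hmul x hx _ _ (hupd i x hx)
      have h3 : |μ ^ 2 * (2 * x i) * u t x| ≤ 2 * μ ^ 2 * R * Mu := by
        rw [abs_mul, abs_mul, abs_mul, abs_of_nonneg (sq_nonneg μ), abs_two]
        have h4 : |x i| ≤ R := (PiLp.norm_apply_le x i).trans hxR.le
        calc μ ^ 2 * (2 * |x i|) * |u t x| ≤ μ ^ 2 * (2 * R) * Mu := by
              gcongr
              exact hMu t (Ioo_subset_Icc_self ht) x (ball_subset_closedBall hx)
          _ = _ := by ring
      have e : L / n = 4 * K₁ * R + 2 * μ ^ 2 * R * Mu + μ ^ 2 * R ^ 2 * (4 * K₂ * R) := by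
        rw [hL]; field_simp
      rw [e]
      refine (abs_add_le _ _).trans ?_
      linarith [abs_add_le (μ ^ 2 * (2 * x i) * u t x) (μ ^ 2 * ‖x‖ ^ 2 * pd i (u t) x)]
    have hLip : ∀ x ∈ ball 0 R, ∀ x' ∈ ball 0 R,
        |lapl (u t) x - lapl (u t) x'| ≤ L * ‖x - x'‖ := by
      intro x hx x' hx'
      rw [hul x hx, hul x' hx']
      refine (convex_ball 0 R).norm_image_sub_le_of_norm_fderiv_le
        (𝕜 := ℝ) (f := fun x => v x + μ ^ 2 * ‖x‖ ^ 2 * u t x) hfd (fun z hz => ?_) hx' hx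
      refine ContinuousLinearMap.opNorm_le_bound _ hL0 fun e => ?_
      rw [fderiv_eq_sum_pd]
      calc ‖∑ i, e i * pd i (fun x => v x + μ ^ 2 * ‖x‖ ^ 2 * u t x) z‖
          ≤ ∑ i : Fin n, ‖e‖ * (L / n) := norm_sum_le_of_le _ fun i _ => by
            rw [norm_mul]
            exact mul_le_mul (PiLp.norm_apply_le e i) (hfpd z hz i) (norm_nonneg _) (norm_nonneg _)
        _ = L * ‖e‖ := by
            rw [Finset.sum_const, Finset.card_univ, Fintype.card_fin, nsmul_eq_mul]
            field_simp
    intro x hx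
    refine ⟨abs_le_torsion (hu.continuousOn_slice (Ioo_subset_Icc_self ht))
      (fun x hx => (hus x hx).of_le two_le_smooth) hulb (fun x hx => hu.boundary t ht x hx) x hx, ?_,
      fun i => hupd i x hx, fun e he => abs_fderiv_tangential_le hR
      (hu.continuousOn_slice (Ioo_subset_Icc_self ht)) (fun x hx => (hus x hx).of_le two_le_smooth)
      hL0 hLip (fun x hx => hu.boundary t ht x hx) hx he⟩
    rw [hut x hx]
    exact abs_le_torsion hvc (fun x hx => (hvs x hx).of_le two_le_smooth) hvl hvb x hx
  have p1 : 0 ≤ K₁ / (2 * n) := by positivity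
  have p2 : 0 ≤ K₂ / (2 * n) := by positivity
  have p3 : 0 ≤ 4 * K₂ * R := by positivity
  have p4 : 0 ≤ 2 * L * R := by positivity
  have hpos : ∀ x ∈ ball (0 : ℰ n) R, 0 ≤ R ^ 2 - ‖x‖ ^ 2 := fun x hx => by
    have : ‖x‖ < R := by simpa using hx
    nlinarith [norm_nonneg x]
  refine ⟨C, by positivity, ⟨fun t ht x hx => (key t ht x hx).1.trans ?_,
    fun t ht x hx => (key t ht x hx).2.1.trans ?_,
    fun t ht x hx i => ((key t ht x hx).2.2.1 i).trans ?_,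
    fun t ht x hx v hv => ((key t ht x hx).2.2.2 v hv).trans ?_⟩⟩
  · exact mul_le_mul_of_nonneg_right (by linarith) (hpos x hx)
  · exact mul_le_mul_of_nonneg_right (by linarith) (hpos x hx)
  · linarith
  · exact mul_le_mul_of_nonneg_right (mul_le_mul_of_nonneg_right (by linarith) (hpos x hx))
      (norm_nonneg _)

end IsHarmonicHeatSolution
section WeightedIntegrals

variable {n : ℕ} {x₀ : ℰ n} {a c μ ε : ℝ} {K : Set (ℰ n)} {χ U Z : ℰ n → ℝ}

lemma integral_eq_of_eq_divergence_add (hK : IsCompact K) {A B : ℰ n → ℝ}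
    {H : Fin n → ℰ n → ℝ} (hH : ∀ i, ContDiff ℝ 1 (H i))
    (h0 : ∀ i, ∀ x, x ∉ K → H i x = 0) (hB : Integrable B)
    (h : ∀ x, A x = ∑ i, pd i (H i) x + B x) : ∫ x, A x = ∫ x, B x := by
  have hi : ∀ i, Integrable (pd i (H i)) := fun i =>
    integrable_of_continuous_of_zero_off hK ((hH i).pd (k := 0) i (by simp)).continuous
      (pd_eq_zero_of_zero_off hK.isClosed (h0 i) i)
  simp only [h]
  rw [integral_add (integrable_finsetSum _ fun i _ => hi i) hB, integral_finsetSum _ fun i _ => hi i]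
  simp [integral_pd_eq_zero hK (hH _) (h0 _)]

lemma dilation_sq_le (x : ℰ n) : dilation x₀ U x ^ 2 ≤ ‖x - x₀‖ ^ 2 * ∑ i, pd i U x ^ 2 := by
  rw [EuclideanSpace.norm_sq_eq, dilation]
  simpa using Finset.sum_mul_sq_le_sq_mul_sq Finset.univ (fun i => x i - x₀ i) (fun i => pd i U x)

lemma sum_mul_nonneg_bound (x : ℰ n) : -(∑ i, (x i - x₀ i) * x i) ≤ ‖x‖ ^ 2 + ‖x₀‖ ^ 2 / 8 := by
  rw [EuclideanSpace.norm_sq_eq, EuclideanSpace.norm_sq_eq, Finset.sum_div, ← Finset.sum_add_distrib,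
    ← Finset.sum_neg_distrib]
  refine Finset.sum_le_sum fun i _ => ?_
  simp only [Real.norm_eq_abs, sq_abs]
  nlinarith [sq_nonneg (4 * x i - x₀ i)]

lemma mul_dilation_le (ha : 0 ≤ a) (x : ℰ n) : 2 * a * U x * dilation x₀ U x ≤
      a ^ 2 / 2 * (U x ^ 2 * ‖x - x₀‖ ^ 2) + 2 * energyDensity μ U x := by
  have hle : ∑ i, pd i U x ^ 2 ≤ energyDensity μ U x := le_add_of_nonneg_right (by positivity)
  have hs : 0 ≤ ∑ i, pd i U x ^ 2 := Finset.sum_nonneg fun i _ => sq_nonneg _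
  have hss : Real.sqrt (∑ i, pd i U x ^ 2) ^ 2 = ∑ i, pd i U x ^ 2 := Real.sq_sqrt hs
  have hs0 := Real.sqrt_nonneg (∑ i, pd i U x ^ 2)
  have hq : |dilation x₀ U x| ≤ ‖x - x₀‖ * Real.sqrt (∑ i, pd i U x ^ 2) :=
    abs_le_of_sq_le_sq (by rw [mul_pow, hss]; exact dilation_sq_le x) (by positivity)
  generalize Real.sqrt (∑ i, pd i U x ^ 2) = s at hss hq hs0
  calc 2 * a * U x * dilation x₀ U x ≤ 2 * a * |U x| * |dilation x₀ U x| := by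
        have := le_abs_self (U x * dilation x₀ U x)
        rw [abs_mul] at this
        nlinarith
    _ ≤ 2 * a * |U x| * (‖x - x₀‖ * s) := by gcongr
    _ ≤ a ^ 2 / 2 * (U x ^ 2 * ‖x - x₀‖ ^ 2) + 2 * s ^ 2 := by
        rw [← sq_abs (U x)]
        nlinarith [sq_nonneg (a * |U x| * ‖x - x₀‖ - 2 * s)]
    _ ≤ _ := by rw [hss]; linarith

set_option maxHeartbeats 600000 in
/-- The relations between the weighted mass, the weighted Dirichlet energy and their time derivatives
that govern the frequency function, up to cutoff errors of size `ε`. -/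
lemma frequency_relations (hK : IsCompact K) (hχ : ContDiff ℝ ∞ χ) (hχ0 : ∀ x, x ∉ K → χ x = 0)
    (hχn : ∀ x, 0 ≤ χ x) (hU : ContDiff ℝ ∞ U) (hZ : ContDiff ℝ ∞ Z) (ha : 0 ≤ a)
    (heq : ∀ x, lapl U x = Z x + μ ^ 2 * ‖x‖ ^ 2 * U x ∨ χ x = 0)
    (h1 : |∫ x, a * (∑ i, pd i χ x * (x i - x₀ i)) * U x ^ 2 * gauss a c x₀ x| ≤ ε)
    (h2 : |∫ x, U x * (∑ i, pd i χ x * pd i U x) * gauss a c x₀ x| ≤ ε)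
    (h3 : -∫ x, (∑ i, pd i χ x * energyField a μ x₀ U Z i x) * gauss a c x₀ x ≤ ε)
    {F D F' D' : ℝ} (hF : F = ∫ x, χ x * U x ^ 2 * gauss a c x₀ x)
    (hD : D = ∫ x, χ x * energyDensity μ U x * gauss a c x₀ x)
    (hF' : F' = ∫ x, (χ x * (2 * U x * Z x) * gauss a c x₀ x
        + χ x * U x ^ 2 * ((n * a - a ^ 2 * ‖x - x₀‖ ^ 2) * gauss a c x₀ x)))
    (hD' : D' = ∫ x, (χ x * (2 * (∑ i, pd i U x * pd i Z x) + 2 * (μ ^ 2 * ‖x‖ ^ 2) * U x * Z x)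
          * gauss a c x₀ x
        + χ x * energyDensity μ U x * ((n * a - a ^ 2 * ‖x - x₀‖ ^ 2) * gauss a c x₀ x))) :
    |F' + 2 * D| ≤ 3 * ε ∧
    D' * F - D * F' ≤ 2 * a * (F * D + μ ^ 2 * ‖x₀‖ ^ 2 / 8 * F ^ 2) + ε * (F + 3 * D + 4 * ε) ∧
    a ^ 2 / 2 * (∫ x, χ x * U x ^ 2 * ‖x - x₀‖ ^ 2 * gauss a c x₀ x) ≤ n * a * F + 2 * D + ε := by
  have hUi := fun i => (hU.pd (k := ∞) i (by simp))
  have hχi := fun i => (hχ.pd (k := ∞) i (by simp))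
  have hg : ContDiff ℝ ∞ (gauss a c x₀) := contDiff_gauss
  have hQ := contDiff_dilation (x₀ := x₀) hU
  have hE := contDiff_energyDensity (μ := μ) hU
  have hEF := fun i => contDiff_energyField (a := a) (μ := μ) (x₀ := x₀) hU hZ i
  have hχi0 : ∀ i, ∀ x, x ∉ K → pd i χ x = 0 := fun i => pd_eq_zero_of_zero_off hK.isClosed hχ0 i
  have cU := hU.continuous
  have cZ := hZ.continuous
  have cχ := hχ.continuous
  have cg := hg.continuous
  have cQ := hQ.continuous
  have cE := hE.continuous
  have cUi := fun i => (hUi i).continuous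
  have cχi := fun i => (hχi i).continuous
  have cEF := fun i => (hEF i).continuous
  have int : ∀ f : ℰ n → ℝ, Continuous f → Integrable fun x => χ x * f x * gauss a c x₀ x :=
    fun f hf => integrable_of_continuous_of_zero_off hK (by fun_prop) fun x hx => by simp [hχ0 x hx]
  have intF : Integrable fun x => χ x * U x ^ 2 * gauss a c x₀ x := int (fun x => U x ^ 2) (by fun_prop)
  have intD : Integrable fun x => χ x * energyDensity μ U x * gauss a c x₀ x := int _ cE
  have intP : Integrable fun x => χ x * U x * (Z x - a * dilation x₀ U x) * gauss a c x₀ x := by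
    simpa only [mul_assoc] using int (fun x => U x * (Z x - a * dilation x₀ U x)) (by fun_prop)
  have intS : Integrable fun x => χ x * (Z x - a * dilation x₀ U x) ^ 2 * gauss a c x₀ x :=
    int (fun x => (Z x - a * dilation x₀ U x) ^ 2) (by fun_prop)
  have i1 : Integrable fun x => a * (∑ i, pd i χ x * (x i - x₀ i)) * U x ^ 2 * gauss a c x₀ x :=
    integrable_of_continuous_of_zero_off hK (by fun_prop) fun x hx => by simp [hχi0 _ x hx]
  have i2 : Integrable fun x => U x * (∑ i, pd i χ x * pd i U x) * gauss a c x₀ x :=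
    integrable_of_continuous_of_zero_off hK (by fun_prop) fun x hx => by simp [hχi0 _ x hx]
  have i3 : Integrable fun x => (∑ i, pd i χ x * energyField a μ x₀ U Z i x) * gauss a c x₀ x :=
    integrable_of_continuous_of_zero_off hK (by fun_prop) fun x hx => by simp [hχi0 _ x hx]
  set P := ∫ x, χ x * U x * (Z x - a * dilation x₀ U x) * gauss a c x₀ x with hP
  set S := ∫ x, χ x * (Z x - a * dilation x₀ U x) ^ 2 * gauss a c x₀ x with hS
  set E₁ := ∫ x, a * (∑ i, pd i χ x * (x i - x₀ i)) * U x ^ 2 * gauss a c x₀ x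
  set E₂ := ∫ x, U x * (∑ i, pd i χ x * pd i U x) * gauss a c x₀ x with hE₂
  set E₃ := ∫ x, (∑ i, pd i χ x * energyField a μ x₀ U Z i x) * gauss a c x₀ x with hE₃
  have hχd : ∀ x, DifferentiableAt ℝ χ x := hχ.differentiable (by simp)
  have mass : ∀ Z : ℰ n → ℝ, Continuous Z → ∫ x, (χ x * (2 * U x * Z x) * gauss a c x₀ x
        + χ x * U x ^ 2 * ((n * a - a ^ 2 * ‖x - x₀‖ ^ 2) * gauss a c x₀ x)) =
      2 * (∫ x, χ x * U x * (Z x - a * dilation x₀ U x) * gauss a c x₀ x) - E₁ := fun Z hZ => by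
    have intP : Integrable fun x => χ x * U x * (Z x - a * dilation x₀ U x) * gauss a c x₀ x := by
      simpa only [mul_assoc] using int (fun x => U x * (Z x - a * dilation x₀ U x)) (by fun_prop)
    rw [integral_eq_of_eq_divergence_add hK
      (H := fun i z => χ z * (a * U z ^ 2 * (z i - x₀ i)) * gauss a c x₀ z)
      (fun i => ContDiff.of_le (n := ∞) (by fun_prop) (by simp)) (fun i x hx => by simp [hχ0 x hx])
      ((intP.const_mul 2).sub i1) (fun x => mass_divergence (hχd x) hU (Z x)), integral_sub'
      (intP.const_mul 2) i1, integral_const_mul]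
  have hmass : F' = 2 * P - E₁ := by rw [hF', mass Z cZ]
  have henergy : D + P = -E₂ := by
    rw [hD, hP, ← integral_add intD intP, hE₂, ← integral_neg]
    exact integral_eq_of_eq_divergence_add hK
      (H := fun i z => χ z * (U z * pd i U z) * gauss a c x₀ z)
      (fun i => ContDiff.of_le (n := ∞) (by have := hUi i; fun_prop) (by simp))
      (fun i x hx => by simp [hχ0 x hx]) i2.neg
      (fun x => energy_divergence (hχd x) hU (heq x))
  have i4 : Integrable fun x => χ x * (-2 * (Z x - a * dilation x₀ U x) ^ 2
      + 2 * a * (∑ i, pd i U x ^ 2)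
      - 2 * a * μ ^ 2 * (∑ i, (x i - x₀ i) * x i) * U x ^ 2) * gauss a c x₀ x :=
    int (fun x => -2 * (Z x - a * dilation x₀ U x) ^ 2 + 2 * a * (∑ i, pd i U x ^ 2)
      - 2 * a * μ ^ 2 * (∑ i, (x i - x₀ i) * x i) * U x ^ 2) (by fun_prop)
  have hdir : D' ≤ -2 * S + 2 * a * D + 2 * a * (μ ^ 2 * ‖x₀‖ ^ 2 / 8) * F - E₃ := by
    rw [hD', integral_eq_of_eq_divergence_add hK
      (H := fun i z => χ z * energyField a μ x₀ U Z i z * gauss a c x₀ z)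
      (fun i => ContDiff.of_le (n := ∞) (by have := hEF i; fun_prop) (by simp))
      (fun i x hx => by simp [hχ0 x hx])
      (i4.sub i3) (fun x => dirichlet_divergence (hχd x) hU hZ (heq x)), integral_sub' i4 i3, ← hE₃]
    refine sub_le_sub_right ?_ _
    have i7 : Integrable fun x => -2 * (χ x * (Z x - a * dilation x₀ U x) ^ 2 * gauss a c x₀ x)
        + 2 * a * (χ x * energyDensity μ U x * gauss a c x₀ x) :=
      (intS.const_mul _).add (intD.const_mul _)
    rw [hS, hD, hF, ← integral_const_mul, ← integral_const_mul, ← integral_const_mul,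
      ← integral_add (intS.const_mul _) (intD.const_mul _),
      ← integral_add i7 (intF.const_mul _)]
    refine integral_mono i4 (i7.add (intF.const_mul _)) fun x => ?_
    have hw : 0 ≤ χ x * gauss a c x₀ x := mul_nonneg (hχn x) (gauss_pos x).le
    have hb := sum_mul_nonneg_bound (x₀ := x₀) x
    have hk : 0 ≤ χ x * gauss a c x₀ x * (2 * a * μ ^ 2 * U x ^ 2) := by positivity
    have := mul_le_mul_of_nonneg_left hb hk
    simp only [energyDensity]
    nlinarith
  have hF0 : 0 ≤ F := by
    rw [hF]
    exact integral_nonneg fun x => mul_nonneg (mul_nonneg (hχn x) (sq_nonneg _)) (gauss_pos x).le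
  have hD0 : 0 ≤ D := by
    rw [hD]
    refine integral_nonneg fun x => mul_nonneg (mul_nonneg (hχn x) ?_) (gauss_pos x).le
    rw [energyDensity]; positivity
  have hcs : P ^ 2 ≤ S * F := by
    have hq : ∀ l : ℝ, 0 ≤ F * (l * l) + (2 * P) * l + S := fun l => by
      have i7 : Integrable fun x => l * l * (χ x * U x ^ 2 * gauss a c x₀ x)
          + 2 * l * (χ x * U x * (Z x - a * dilation x₀ U x) * gauss a c x₀ x) :=
        (intF.const_mul _).add (intP.const_mul _)
      have : F * (l * l) + (2 * P) * l + S =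
          ∫ x, χ x * (l * U x + (Z x - a * dilation x₀ U x)) ^ 2 * gauss a c x₀ x := by
        rw [show F * (l * l) + 2 * P * l + S = l * l * F + 2 * l * P + S by ring, hF, hP, hS,
          ← integral_const_mul, ← integral_const_mul,
          ← integral_add (intF.const_mul _) (intP.const_mul _), ← integral_add i7 intS]
        refine integral_congr_ae (ae_of_all _ fun x => ?_)
        simp only []
        ring
      rw [this]
      exact integral_nonneg fun x => mul_nonneg (mul_nonneg (hχn x) (sq_nonneg _)) (gauss_pos x).le
    have := discrim_le_zero hq
    rw [discrim] at this
    nlinarith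
  rw [abs_le] at h1 h2
  refine ⟨?_, ?_, ?_⟩
  · rw [abs_le]
    constructor <;> linarith [h1.1, h1.2, h2.1, h2.2]
  · have hPe : P = -D - E₂ := by linarith
    have e1 : D' * F ≤ (-2 * S + 2 * a * D + 2 * a * (μ ^ 2 * ‖x₀‖ ^ 2 / 8) * F + ε) * F :=
      mul_le_mul_of_nonneg_right (by linarith) hF0
    have e2 : -(D * F') ≤ 2 * P ^ 2 + ε * (3 * D + 4 * ε) := by
      have : -(D * F') = 2 * P ^ 2 + D * (E₁ - 2 * E₂) - 2 * E₂ ^ 2 := by rw [hmass, hPe]; ring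
      have b1 : D * (E₁ - 2 * E₂) ≤ D * (3 * ε) :=
        mul_le_mul_of_nonneg_left (by linarith [h1.2, h2.1]) hD0
      nlinarith [sq_nonneg E₂, sq_nonneg ε]
    nlinarith
  · have hm0 := mass (fun _ => 0) continuous_const
    have i5 : Integrable fun x => χ x * U x * (0 - a * dilation x₀ U x) * gauss a c x₀ x := by
      simpa only [mul_assoc] using int (fun x => U x * (0 - a * dilation x₀ U x)) (by fun_prop)
    have i6 : Integrable fun x => χ x * U x ^ 2 * ‖x - x₀‖ ^ 2 * gauss a c x₀ x :=
      integrable_of_continuous_of_zero_off hK (by fun_prop) fun x hx => by simp [hχ0 x hx]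
    have e1 : ∫ x, (χ x * (2 * U x * 0) * gauss a c x₀ x
        + χ x * U x ^ 2 * ((n * a - a ^ 2 * ‖x - x₀‖ ^ 2) * gauss a c x₀ x)) =
        n * a * F - a ^ 2 * ∫ x, χ x * U x ^ 2 * ‖x - x₀‖ ^ 2 * gauss a c x₀ x := by
      rw [hF, ← integral_const_mul, ← integral_const_mul,
        ← integral_sub (intF.const_mul _) (i6.const_mul _)]
      refine integral_congr_ae (ae_of_all _ fun x => ?_)
      simp only []
      ring
    have e2 : -2 * (∫ x, χ x * U x * (0 - a * dilation x₀ U x) * gauss a c x₀ x) ≤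
        a ^ 2 / 2 * (∫ x, χ x * U x ^ 2 * ‖x - x₀‖ ^ 2 * gauss a c x₀ x) + 2 * D := by
      rw [hD, ← integral_const_mul, ← integral_const_mul, ← integral_const_mul,
        ← integral_add (i6.const_mul _) (intD.const_mul _)]
      refine integral_mono (i5.const_mul _) ((i6.const_mul _).add (intD.const_mul _)) fun x => ?_
      have hw : 0 ≤ χ x * gauss a c x₀ x := mul_nonneg (hχn x) (gauss_pos x).le
      have hk := mul_dilation_le (x₀ := x₀) (μ := μ) (U := U) ha x
      have := mul_le_mul_of_nonneg_left hk hw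
      simp only []
      linarith
    rw [e1] at hm0
    linarith [h1.1, h1.2]

end WeightedIntegrals
section TimeDerivatives

variable {n : ℕ} {x₀ : ℰ n} {μ τ t : ℝ} {K : Set (ℰ n)} {χ : ℰ n → ℝ} {Y : ℝ → ℰ n → ℝ} {J : Set ℝ}

/-- The backward heat kernel centred at `x₀` with final time `τ`, up to normalization. -/
noncomputable def backwardKernel (τ : ℝ) (x₀ : ℰ n) (t : ℝ) : ℰ n → ℝ :=
  gauss (1 / (2 * (τ - t))) (-(n / 2) * Real.log (τ - t)) x₀

lemma hasDerivAt_backwardKernel (ht : t < τ) (x : ℰ n) :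
    HasDerivAt (fun s => backwardKernel τ x₀ s x)
      ((n * (1 / (2 * (τ - t))) - (1 / (2 * (τ - t))) ^ 2 * ‖x - x₀‖ ^ 2) *
        backwardKernel τ x₀ t x) t := by
  have hs : τ - t ≠ 0 := (sub_pos.2 ht).ne'
  have h0 : HasDerivAt (fun s => τ - s) (-1) t := by simpa using (hasDerivAt_id t).const_sub τ
  have h1 : HasDerivAt (fun s => 2 * (τ - s)) (2 * -1) t := h0.const_mul 2
  have h2 := h1.fun_inv (mul_ne_zero two_ne_zero hs)
  have h3 := h0.log hs
  have h4 := (((h2.div_const 2).neg.mul_const (‖x - x₀‖ ^ 2)).add (h3.const_mul (-((n:ℝ) / 2)))).exp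
  refine HasDerivAt.congr_deriv (f := fun s => backwardKernel τ x₀ s x) (h4.congr_of_eventuallyEq ?_) ?_
  · exact Eventually.of_forall fun s => by simp [backwardKernel, gauss, one_div]
  · simp only [backwardKernel, gauss, one_div, Pi.add_apply, Pi.neg_apply]
    field_simp
    ring

lemma contDiffAt_backwardKernel (ht : t < τ) (x : ℰ n) :
    ContDiffAt ℝ ∞ (fun p : ℝ × ℰ n => backwardKernel τ x₀ p.1 p.2) (t, x) := by
  have hs : τ - t ≠ 0 := (sub_pos.2 ht).ne'
  have h1 : ContDiffAt ℝ ∞ (fun p : ℝ × ℰ n => τ - p.1) (t, x) := by fun_prop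
  have h2 : ContDiffAt ℝ ∞ (fun p : ℝ × ℰ n => 1 / (2 * (τ - p.1))) (t, x) := by
    simp only [one_div]
    exact (contDiffAt_const.mul h1).inv (mul_ne_zero two_ne_zero hs)
  have h4 : ContDiffAt ℝ ∞ (fun p : ℝ × ℰ n => ‖p.2 - x₀‖ ^ 2) (t, x) :=
    (contDiff_norm_sq_euclidean.comp (f := fun p : ℝ × ℰ n => p.2 - x₀) (by fun_prop)).contDiffAt
  unfold backwardKernel gauss
  fun_prop

lemma contDiff_slice (hY : ∀ t ∈ J, ∀ x,
      ContDiffAt ℝ ∞ (fun p : ℝ × ℰ n => Y p.1 p.2) (t, x)) (ht : t ∈ J) :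
    ContDiff ℝ ∞ (Y t) :=
  contDiff_iff_contDiffAt.2 fun x => (hY t ht x).comp x (f := fun z => (t, z)) (by fun_prop)

lemma contDiffAt_pd_slice (hJ : IsOpen J) (hY : ∀ t ∈ J, ∀ x,
      ContDiffAt ℝ ∞ (fun p : ℝ × ℰ n => Y p.1 p.2) (t, x)) (i : Fin n) :
    ∀ t ∈ J, ∀ x, ContDiffAt ℝ ∞ (fun p : ℝ × ℰ n => pd i (Y p.1) p.2) (t, x) := by
  intro t ht x
  refine ContDiffAt.congr_of_eventuallyEq (((hY t ht x).fderiv_right (m := ∞) (by simp)).clm_apply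
      (contDiffAt_const (c := ((0:ℝ), EuclideanSpace.single i (1:ℝ))))) ?_
  filter_upwards [(hJ.preimage continuous_fst).mem_nhds ht] with p hp
  exact pd_eq_fderiv_prod i ((hY p.1 hp p.2).differentiableAt (by simp))

lemma contDiffAt_deriv_slice (hJ : IsOpen J) (hY : ∀ t ∈ J, ∀ x,
      ContDiffAt ℝ ∞ (fun p : ℝ × ℰ n => Y p.1 p.2) (t, x)) :
    ∀ t ∈ J, ∀ x, ContDiffAt ℝ ∞ (fun p : ℝ × ℰ n => deriv (fun s => Y s p.2) p.1) (t, x) := by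
  intro t ht x
  refine ContDiffAt.congr_of_eventuallyEq (((hY t ht x).fderiv_right (m := ∞) (by simp)).clm_apply
      (contDiffAt_const (c := ((1:ℝ), 0)))) ?_
  filter_upwards [(hJ.preimage continuous_fst).mem_nhds ht] with p hp
  exact (deriv_eq_fderiv_prod ((hY p.1 hp p.2).differentiableAt (by simp))).deriv

lemma hasDerivAt_slice (hY : ∀ t ∈ J, ∀ x,
      ContDiffAt ℝ ∞ (fun p : ℝ × ℰ n => Y p.1 p.2) (t, x)) (ht : t ∈ J)
    (x : ℰ n) :
    HasDerivAt (fun s => Y s x) (deriv (fun s => Y s x) t) t :=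
  (deriv_eq_fderiv_prod ((hY t ht x).differentiableAt (by simp))).differentiableAt.hasDerivAt

lemma hasDerivAt_pd_slice (hJ : IsOpen J) (hY : ∀ t ∈ J, ∀ x,
      ContDiffAt ℝ ∞ (fun p : ℝ × ℰ n => Y p.1 p.2) (t, x)) (ht : t ∈ J)
    (i : Fin n) (x : ℰ n) :
    HasDerivAt (fun s => pd i (Y s) x) (pd i (fun z => deriv (fun s => Y s z) t) x) t := by
  have hY2 : ContDiffAt ℝ 2 (fun p : ℝ × ℰ n => Y p.1 p.2) (t, x) := (hY t ht x).of_le two_le_smooth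
  have hsym : IsSymmSndFDerivAt ℝ (fun p : ℝ × ℰ n => Y p.1 p.2) (t, x) :=
    hY2.isSymmSndFDerivAt (by simp)
  have hd : DifferentiableAt ℝ (fderiv ℝ (fun p : ℝ × ℰ n => Y p.1 p.2)) (t, x) :=
    (hY2.fderiv_right (m := 1) (by norm_num)).differentiableAt one_ne_zero
  have h1 := deriv_eq_fderiv_prod (W := fun s => pd i (Y s))
    ((contDiffAt_pd_slice hJ hY i t ht x).differentiableAt (by simp))
  have h2 := pd_eq_fderiv_prod (W := fun t z => deriv (fun s => Y s z) t) i
    ((contDiffAt_deriv_slice hJ hY t ht x).differentiableAt (by simp))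
  have e1 : (fun p : ℝ × ℰ n => pd i (Y p.1) p.2) =ᶠ[𝓝 (t, x)]
      fun p => fderiv ℝ (fun p : ℝ × ℰ n => Y p.1 p.2) p (0, EuclideanSpace.single i 1) := by
    filter_upwards [(hJ.preimage continuous_fst).mem_nhds ht] with p hp
    exact pd_eq_fderiv_prod i ((hY p.1 hp p.2).differentiableAt (by simp))
  have e2 : (fun p : ℝ × ℰ n => deriv (fun s => Y s p.2) p.1) =ᶠ[𝓝 (t, x)]
      fun p => fderiv ℝ (fun p : ℝ × ℰ n => Y p.1 p.2) p (1, 0) := by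
    filter_upwards [(hJ.preimage continuous_fst).mem_nhds ht] with p hp
    exact (deriv_eq_fderiv_prod ((hY p.1 hp p.2).differentiableAt (by simp))).deriv
  rw [e1.fderiv_eq, fderiv_clm_apply hd (differentiableAt_const _)] at h1
  rw [e2.fderiv_eq, fderiv_clm_apply hd (differentiableAt_const _)] at h2
  refine h1.congr_deriv ?_
  rw [h2]
  simp [hsym.eq]

lemma hasDerivAt_weighted_mass (hJ : IsOpen J) (hJτ : ∀ t ∈ J, t < τ) (hK : IsCompact K)
    (hχ : ContDiff ℝ ∞ χ) (hχ0 : ∀ x, x ∉ K → χ x = 0)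
    (hY : ∀ t ∈ J, ∀ x, ContDiffAt ℝ ∞ (fun p : ℝ × ℰ n => Y p.1 p.2) (t, x))
    (ht : t ∈ J) :
    HasDerivAt (fun s => ∫ x, χ x * Y s x ^ 2 * backwardKernel τ x₀ s x)
      (∫ x, (χ x * (2 * Y t x * deriv (fun s => Y s x) t) * backwardKernel τ x₀ t x
        + χ x * Y t x ^ 2 * ((n * (1 / (2 * (τ - t))) - (1 / (2 * (τ - t))) ^ 2 * ‖x - x₀‖ ^ 2) *
          backwardKernel τ x₀ t x))) t := by
  have hχ' : ContDiff ℝ ∞ (fun p : ℝ × ℰ n => χ p.2) := hχ.comp contDiff_snd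
  refine (hasDerivAt_integral_of_zero_off (W := fun s x => χ x * Y s x ^ 2 * backwardKernel τ x₀ s x)
    hJ hK (fun t ht x => ?_) (fun t _ x hx => by simp [hχ0 x hx]) ht).congr_deriv
    (integral_congr_ae (ae_of_all _ fun x => ?_))
  · exact ((hχ'.contDiffAt.mul ((hY t ht x).pow 2)).mul
      (contDiffAt_backwardKernel (hJτ t ht) x)).of_le (by simp)
  · have h1 := (((hasDerivAt_slice hY ht x).fun_pow 2).const_mul (χ x)).fun_mul
      (hasDerivAt_backwardKernel (x₀ := x₀) (hJτ t ht) x)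
    refine h1.deriv.trans ?_
    simp

lemma hasDerivAt_weighted_energy (hJ : IsOpen J) (hJτ : ∀ t ∈ J, t < τ) (hK : IsCompact K)
    (hχ : ContDiff ℝ ∞ χ) (hχ0 : ∀ x, x ∉ K → χ x = 0)
    (hY : ∀ t ∈ J, ∀ x, ContDiffAt ℝ ∞ (fun p : ℝ × ℰ n => Y p.1 p.2) (t, x))
    (ht : t ∈ J) :
    HasDerivAt (fun s => ∫ x, χ x * energyDensity μ (Y s) x * backwardKernel τ x₀ s x)
      (∫ x, (χ x * (2 * (∑ i, pd i (Y t) x * pd i (fun z => deriv (fun s => Y s z) t) x)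
          + 2 * (μ ^ 2 * ‖x‖ ^ 2) * Y t x * deriv (fun s => Y s x) t) * backwardKernel τ x₀ t x
        + χ x * energyDensity μ (Y t) x * ((n * (1 / (2 * (τ - t)))
          - (1 / (2 * (τ - t))) ^ 2 * ‖x - x₀‖ ^ 2) * backwardKernel τ x₀ t x))) t := by
  have hχ' : ContDiff ℝ ∞ (fun p : ℝ × ℰ n => χ p.2) := hχ.comp contDiff_snd
  have hn : ContDiff ℝ ∞ (fun p : ℝ × ℰ n => ‖p.2‖ ^ 2) :=
    contDiff_norm_sq_euclidean.comp contDiff_snd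
  refine (hasDerivAt_integral_of_zero_off
    (W := fun s x => χ x * energyDensity μ (Y s) x * backwardKernel τ x₀ s x)
    hJ hK (fun t ht x => ?_) (fun t _ x hx => by simp [hχ0 x hx]) ht).congr_deriv
    (integral_congr_ae (ae_of_all _ fun x => ?_))
  · have h1 : ContDiffAt ℝ ∞ (fun p : ℝ × ℰ n => energyDensity μ (Y p.1) p.2) (t, x) := by
      unfold energyDensity
      exact (ContDiffAt.sum fun i _ => (contDiffAt_pd_slice hJ hY i t ht x).pow 2).add
        ((contDiffAt_const.mul hn.contDiffAt).mul ((hY t ht x).pow 2))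
    exact ((hχ'.contDiffAt.mul h1).mul (contDiffAt_backwardKernel (hJτ t ht) x)).of_le (by simp)
  · have h0 : HasDerivAt (fun s => energyDensity μ (Y s) x)
        (2 * (∑ i, pd i (Y t) x * pd i (fun z => deriv (fun s => Y s z) t) x)
          + 2 * (μ ^ 2 * ‖x‖ ^ 2) * Y t x * deriv (fun s => Y s x) t) t := by
      unfold energyDensity
      refine ((HasDerivAt.fun_sum fun i _ => (hasDerivAt_pd_slice hJ hY ht i x).fun_pow 2).fun_add
        (((hasDerivAt_slice hY ht x).fun_pow 2).const_mul (μ ^ 2 * ‖x‖ ^ 2))).congr_deriv ?_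
      rw [Finset.mul_sum]
      congr 1
      · exact Finset.sum_congr rfl fun i _ => by norm_num; ring
      · norm_num; ring
    exact ((h0.const_mul (χ x)).fun_mul (hasDerivAt_backwardKernel (x₀ := x₀) (hJτ t ht) x)).deriv

end TimeDerivatives

section RadialCutoff

variable {n : ℕ} {R η : ℝ} {x : ℰ n}

/-- A radial cutoff vanishing where `R² - ‖x‖² ≤ η` and equal to `1` where `2η ≤ R² - ‖x‖²`. -/
noncomputable def radialCutoff (R η : ℝ) (x : ℰ n) : ℝ :=
  Real.smoothTransition ((R ^ 2 - ‖x‖ ^ 2) / η - 1)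

lemma contDiff_radialCutoff : ContDiff ℝ ∞ (radialCutoff (n := n) R η) := by
  have := contDiff_norm_sq_euclidean (n := n) (m := ∞)
  exact Real.smoothTransition.contDiff.comp (by fun_prop)

lemma radialCutoff_nonneg : 0 ≤ radialCutoff R η x := Real.smoothTransition.nonneg _

lemma radialCutoff_le_one : radialCutoff R η x ≤ 1 := Real.smoothTransition.le_one _

lemma radialCutoff_eq_zero (hη : 0 < η) (hx : R ^ 2 - ‖x‖ ^ 2 ≤ η) : radialCutoff R η x = 0 := by
  refine Real.smoothTransition.zero_of_nonpos (sub_nonpos.2 ?_)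
  rwa [div_le_one hη]

lemma radialCutoff_eq_one (hη : 0 < η) (hx : 2 * η ≤ R ^ 2 - ‖x‖ ^ 2) : radialCutoff R η x = 1 := by
  refine Real.smoothTransition.one_of_one_le ?_
  have : 2 ≤ (R ^ 2 - ‖x‖ ^ 2) / η := by rwa [le_div_iff₀ hη]
  linarith

lemma exists_deriv_smoothTransition_le : ∃ C₀, 0 ≤ C₀ ∧ ∀ v,
    0 ≤ deriv Real.smoothTransition v ∧ deriv Real.smoothTransition v ≤ C₀ ∧
      (v ∉ Icc (0:ℝ) 1 → deriv Real.smoothTransition v = 0) := by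
  have hc : Continuous (deriv Real.smoothTransition) :=
    (Real.smoothTransition.contDiff (n := 1)).continuous_deriv le_rfl
  obtain ⟨C₀, hC₀⟩ := (isCompact_Icc (a := (0:ℝ)) (b := 1)).exists_bound_of_continuousOn hc.continuousOn
  have h0 : 0 ≤ C₀ := (norm_nonneg _).trans (hC₀ 0 (by simp))
  have hz : ∀ v ∉ Icc (0:ℝ) 1, deriv Real.smoothTransition v = 0 := fun v hv => by
    rcases lt_or_ge v 0 with h | h
    · have : Real.smoothTransition =ᶠ[𝓝 v] fun _ => 0 := by
        filter_upwards [Iio_mem_nhds h] with w hw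
        exact Real.smoothTransition.zero_of_nonpos (mem_Iio.1 hw).le
      rw [this.deriv_eq]; simp
    · have h1 : 1 < v := not_le.1 fun h1 => hv ⟨h, h1⟩
      have : Real.smoothTransition =ᶠ[𝓝 v] fun _ => 1 := by
        filter_upwards [Ioi_mem_nhds h1] with w hw
        exact Real.smoothTransition.one_of_one_le (mem_Ioi.1 hw).le
      rw [this.deriv_eq]; simp
  refine ⟨C₀, h0, fun v => ⟨Real.smoothTransition.monotone.deriv_nonneg, ?_, hz v⟩⟩
  by_cases hv : v ∈ Icc (0:ℝ) 1
  · exact (le_abs_self _).trans (hC₀ v hv)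
  · rw [hz v hv]; exact h0

lemma exists_pd_radialCutoff (n : ℕ) : ∃ C₀, 0 ≤ C₀ ∧ ∀ R η : ℝ, 0 < η → ∀ x : ℰ n,
    ∃ q, 0 ≤ q ∧ q ≤ C₀ ∧ (∀ i, pd i (radialCutoff R η) x = -(2 * q / η) * x i) ∧
      (¬ (η ≤ R ^ 2 - ‖x‖ ^ 2 ∧ R ^ 2 - ‖x‖ ^ 2 ≤ 2 * η) → q = 0) := by
  obtain ⟨C₀, h0, hC⟩ := exists_deriv_smoothTransition_le
  refine ⟨C₀, h0, fun R η hη x => ⟨_, (hC ((R ^ 2 - ‖x‖ ^ 2) / η - 1)).1, (hC _).2.1, fun i => ?_,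
    fun hx => (hC _).2.2 fun hv => hx ?_⟩⟩
  · have hn := differentiable_norm_sq_euclidean x
    have hd : DifferentiableAt ℝ (fun z : ℰ n => (R ^ 2 - ‖z‖ ^ 2) / η - 1) x := by fun_prop
    have e : (fun z : ℰ n => (R ^ 2 - ‖z‖ ^ 2) / η - 1) =
        fun z => (R ^ 2 / η - 1) - 1 / η * ‖z‖ ^ 2 := by
      ext z; field_simp; ring
    have e2 : pd i (fun z : ℰ n => (R ^ 2 - ‖z‖ ^ 2) / η - 1) x = -(1 / η * (2 * x i)) := by
      rw [e, pd_sub i (differentiableAt_const _) (hn.const_mul _), pd_const, pd_const_mul i _ hn,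
        pd_norm_sq]
      ring
    rw [show radialCutoff R η = fun z : ℰ n =>
      Real.smoothTransition ((R ^ 2 - ‖z‖ ^ 2) / η - 1) from rfl,
      pd_comp i ((Real.smoothTransition.contDiff (n := 1)).differentiable one_ne_zero _) hd, e2]
    ring
  · have h1 : 1 ≤ (R ^ 2 - ‖x‖ ^ 2) / η := by linarith [hv.1]
    have h2 : (R ^ 2 - ‖x‖ ^ 2) / η ≤ 2 := by linarith [hv.2]
    exact ⟨by rwa [le_div_iff₀ hη, one_mul] at h1, by rwa [div_le_iff₀ hη] at h2⟩

end RadialCutoff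

section BoundaryTerms

variable {n : ℕ} {R η a A μ C C₀ q : ℝ} {x x₀ : ℰ n} {χ U Z : ℰ n → ℝ}

lemma sum_coord_mul_eq_inner (v w : ℰ n) : ∑ i, v i * w i = inner ℝ v w := by
  rw [PiLp.inner_apply]
  exact Finset.sum_congr rfl fun i _ => by simp [mul_comm]

lemma boundary_algebra {X u z s w P α b a η A M : ℝ} (hR : 0 < R) (hx : X < R) (hx' : 0 ≤ X)
    (hη : 0 < η) (hη1 : η ≤ 1) (hw : R ^ 2 - X ^ 2 ≤ 2 * η) (hC : 0 ≤ C)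
    (hU : |u| ≤ C * (R ^ 2 - X ^ 2)) (hZ : |z| ≤ C * (R ^ 2 - X ^ 2))
    (hg : |s| ≤ M) (ha : 0 ≤ a) (haA : a ≤ A) (hT : w ≤ 4 * C * η / R) (hw0 : 0 ≤ w)
    (hxp : 0 ≤ P) (hxp2 : P ≤ 2 * R ^ 2) (hpw : |b| ≤ 2 * R * (4 * C * η / R))
    (hαs : 0 ≤ α * s) (hM : 0 ≤ M) :
    2 * z * s + a * (-2 * (α * P + b) * s + (α * s + w ^ 2 + μ ^ 2 * X ^ 2 * u ^ 2) * P) ≤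
      η * (4 * C * M + A * (16 * M * C + 32 * C ^ 2 + 8 * μ ^ 2 * R ^ 4 * C ^ 2)) := by
  have hU2 : u ^ 2 ≤ 4 * C ^ 2 * η := by
    have h1 : |u| ≤ 2 * C * η := hU.trans (by nlinarith)
    have h2 : u ^ 2 ≤ (2 * C * η) ^ 2 := by
      rw [← sq_abs u]; exact pow_le_pow_left₀ (abs_nonneg _) h1 2
    have h3 : (2 * C * η) ^ 2 ≤ 4 * C ^ 2 * η := by
      have : η * η ≤ η := by nlinarith
      nlinarith [mul_nonneg (sq_nonneg C) hη.le, mul_le_mul_of_nonneg_left this (sq_nonneg C)]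
    exact h2.trans h3
  have t1 : 2 * z * s ≤ η * (4 * C * M) := by
    calc 2 * z * s ≤ |2 * z * s| := le_abs_self _
      _ = 2 * |z| * |s| := by rw [abs_mul, abs_mul, abs_two]
      _ ≤ 2 * (2 * C * η) * M := by
        have : |z| ≤ 2 * C * η := hZ.trans (by nlinarith)
        gcongr
      _ = _ := by ring
  have t2 : -2 * b * s ≤ η * (16 * M * C) := by
    calc -2 * b * s ≤ |-2 * b * s| := le_abs_self _
      _ = 2 * |b| * |s| := by rw [abs_mul, abs_mul]; norm_num
      _ ≤ 2 * (2 * R * (4 * C * η / R)) * M := by gcongr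
      _ = _ := by field_simp; ring
  have t3 : w ^ 2 * P ≤ η * (32 * C ^ 2) := by
    calc w ^ 2 * P ≤ (4 * C * η / R) ^ 2 * (2 * R ^ 2) := by gcongr
      _ = 32 * C ^ 2 * (η * η) := by field_simp; ring
      _ ≤ 32 * C ^ 2 * (η * 1) := by gcongr
      _ = _ := by ring
  have t4 : μ ^ 2 * X ^ 2 * u ^ 2 * P ≤ η * (8 * μ ^ 2 * R ^ 4 * C ^ 2) := by
    calc μ ^ 2 * X ^ 2 * u ^ 2 * P ≤ μ ^ 2 * R ^ 2 * (4 * C ^ 2 * η) * (2 * R ^ 2) := by gcongr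
      _ = _ := by ring
  have t5 : -2 * (α * P + b) * s + (α * s + w ^ 2 + μ ^ 2 * X ^ 2 * u ^ 2) * P ≤
      η * (16 * M * C + 32 * C ^ 2 + 8 * μ ^ 2 * R ^ 4 * C ^ 2) := by
    nlinarith [mul_nonneg hαs hxp]
  calc _ ≤ η * (4 * C * M) + a * (η * (16 * M * C + 32 * C ^ 2 + 8 * μ ^ 2 * R ^ 4 * C ^ 2)) :=
      add_le_add t1 (mul_le_mul_of_nonneg_left t5 ha)
    _ ≤ η * (4 * C * M) + A * (η * (16 * M * C + 32 * C ^ 2 + 8 * μ ^ 2 * R ^ 4 * C ^ 2)) := by gcongr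
    _ = _ := by ring

/-- A bound for the normal component of `energyField` near the boundary. -/
lemma sum_mul_energyField_le (hR : 0 < R) (hx : ‖x‖ < R) (hx2 : R / 2 ≤ ‖x‖) (hx0 : ‖x₀‖ ≤ ‖x‖)
    (hη : 0 < η) (hη1 : η ≤ 1) (hw : R ^ 2 - ‖x‖ ^ 2 ≤ 2 * η) (hC : 0 ≤ C)
    (hU : |U x| ≤ C * (R ^ 2 - ‖x‖ ^ 2)) (hZ : |Z x| ≤ C * (R ^ 2 - ‖x‖ ^ 2))
    (hg : |∑ i, x i * pd i U x| ≤ n * R * C)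
    (htan : ∀ v : ℰ n, inner ℝ x v = 0 → ‖x‖ * |fderiv ℝ U x v| ≤ C * (R ^ 2 - ‖x‖ ^ 2) * ‖v‖)
    (ha : 0 ≤ a) (haA : a ≤ A) :
    ∑ i, x i * energyField a μ x₀ U Z i x ≤ η * (4 * C * (n * R * C)
      + A * (16 * (n * R * C) * C + 32 * C ^ 2 + 8 * μ ^ 2 * R ^ 4 * C ^ 2)) := by
  have hxpos : 0 < ‖x‖ := by linarith
  set g : ℰ n := WithLp.toLp 2 (fun i => pd i U x)
  have hgi : ∀ i, g i = pd i U x := fun i => rfl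
  have hgx : ∑ i, x i * pd i U x = inner ℝ x g := by rw [← sum_coord_mul_eq_inner]
  set α := inner ℝ x g / ‖x‖ ^ 2 with hα
  set w := g - α • x with hwdef
  have hxw : inner ℝ x w = 0 := by
    rw [hwdef, inner_sub_right, inner_smul_right, real_inner_self_eq_norm_sq, hα]
    field_simp; ring
  have hgw : g = α • x + w := by rw [hwdef]; abel
  have hfw : fderiv ℝ U x w = ‖w‖ ^ 2 := by
    rw [fderiv_eq_sum_pd]
    calc ∑ i, w i * pd i U x = inner ℝ w g := by rw [← sum_coord_mul_eq_inner]
      _ = ‖w‖ ^ 2 := by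
        rw [hgw, inner_add_right, inner_smul_right, real_inner_comm, hxw,
          real_inner_self_eq_norm_sq]; ring
  have hT : ‖w‖ ≤ 4 * C * η / R := by
    have h1 := htan w hxw
    rw [hfw, abs_of_nonneg (sq_nonneg _)] at h1
    have h2 : C * (R ^ 2 - ‖x‖ ^ 2) * ‖w‖ ≤ 2 * C * η * ‖w‖ :=
      mul_le_mul_of_nonneg_right (by nlinarith) (norm_nonneg _)
    have h3 : R / 2 * ‖w‖ ^ 2 ≤ ‖x‖ * ‖w‖ ^ 2 := mul_le_mul_of_nonneg_right hx2 (sq_nonneg _)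
    rcases (norm_nonneg w).eq_or_lt with h0 | h0
    · rw [← h0]; positivity
    · rw [le_div_iff₀ hR]
      have : (R / 2 * ‖w‖) * ‖w‖ ≤ (2 * C * η) * ‖w‖ := by nlinarith
      have := le_of_mul_le_mul_right this h0
      linarith
  set p := x - x₀ with hp
  have hpR : ‖p‖ ≤ 2 * R := (norm_sub_le _ _).trans (by linarith)
  have hxp : 0 ≤ inner ℝ x p := by
    rw [hp, inner_sub_right, real_inner_self_eq_norm_sq]
    have := real_inner_le_norm x x₀
    nlinarith
  have hxp2 : inner ℝ x p ≤ 2 * R ^ 2 := by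
    refine (real_inner_le_norm x p).trans ?_
    nlinarith [norm_nonneg p, norm_nonneg x]
  have hdil : dilation x₀ U x = α * inner ℝ x p + inner ℝ p w := by
    calc dilation x₀ U x = ∑ i, p i * g i := rfl
      _ = inner ℝ p g := sum_coord_mul_eq_inner p g
      _ = _ := by rw [hgw, inner_add_right, inner_smul_right, real_inner_comm p x]
  have hen : energyDensity μ U x = α * inner ℝ x g + ‖w‖ ^ 2 + μ ^ 2 * ‖x‖ ^ 2 * U x ^ 2 := by
    have : ∑ i, pd i U x ^ 2 = inner ℝ g g := by
      rw [← sum_coord_mul_eq_inner]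
      exact Finset.sum_congr rfl fun i _ => by rw [hgi, sq]
    rw [energyDensity, this]
    have : inner ℝ g g = α * inner ℝ x g + ‖w‖ ^ 2 := by
      conv_lhs => rw [hgw]
      rw [hgw]
      simp only [inner_add_left, inner_add_right, inner_smul_left, inner_smul_right,
        real_inner_comm x w, hxw, real_inner_self_eq_norm_sq]
      simp
    rw [this]
  have hαs : 0 ≤ α * inner ℝ x g := by
    rw [hα, div_mul_eq_mul_div]
    exact div_nonneg (mul_self_nonneg _) (sq_nonneg _)
  have hsum : ∑ i, x i * energyField a μ x₀ U Z i x =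
      2 * Z x * inner ℝ x g + a * (-2 * dilation x₀ U x * inner ℝ x g
        + energyDensity μ U x * inner ℝ x p) := by
    rw [← hgx, ← sum_coord_mul_eq_inner, Finset.mul_sum, Finset.mul_sum, Finset.mul_sum,
      ← Finset.sum_add_distrib, Finset.mul_sum, ← Finset.sum_add_distrib]
    refine Finset.sum_congr rfl fun i _ => ?_
    rw [energyField, hp]
    simp only [PiLp.sub_apply]
    ring
  rw [hgx] at hg
  rw [hsum, hdil, hen]
  clear hsum hdil hen hfw hgw hxw hgx htan
  have hpw : |inner ℝ p w| ≤ 2 * R * (4 * C * η / R) :=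
    (abs_real_inner_le_norm p w).trans (mul_le_mul hpR hT (norm_nonneg _) (by positivity))
  exact boundary_algebra hR hx (norm_nonneg x) hη hη1 hw hC hU hZ hg ha haA hT (norm_nonneg w) hxp hxp2 hpw hαs
    (by positivity)

/-- The three boundary terms created by a radial cutoff are bounded independently of its width. -/
lemma boundary_terms_le (hR : 0 < R) (hx : ‖x‖ < R) (hx2 : R / 2 ≤ ‖x‖) (hx0 : ‖x₀‖ ≤ ‖x‖)
    (hη : 0 < η) (hη1 : η ≤ 1) (hw : R ^ 2 - ‖x‖ ^ 2 ≤ 2 * η) (hC : 0 ≤ C)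
    (hU : |U x| ≤ C * (R ^ 2 - ‖x‖ ^ 2)) (hZ : |Z x| ≤ C * (R ^ 2 - ‖x‖ ^ 2))
    (hpd : ∀ i, |pd i U x| ≤ C)
    (htan : ∀ v : ℰ n, inner ℝ x v = 0 → ‖x‖ * |fderiv ℝ U x v| ≤ C * (R ^ 2 - ‖x‖ ^ 2) * ‖v‖)
    (ha : 0 ≤ a) (haA : a ≤ A) (hq : 0 ≤ q) (hqC : q ≤ C₀)
    (hχ : ∀ i, pd i χ x = -(2 * q / η) * x i) :
    |a * (∑ i, pd i χ x * (x i - x₀ i)) * U x ^ 2| ≤ 16 * A * C₀ * R ^ 2 * C ^ 2 ∧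
    |U x * (∑ i, pd i χ x * pd i U x)| ≤ 4 * C₀ * C * (n * R * C) ∧
    -(∑ i, pd i χ x * energyField a μ x₀ U Z i x) ≤ 2 * C₀ * (4 * C * (n * R * C)
      + A * (16 * (n * R * C) * C + 32 * C ^ 2 + 8 * μ ^ 2 * R ^ 4 * C ^ 2)) := by
  have hg : |∑ i, x i * pd i U x| ≤ n * R * C := by
    refine (Finset.abs_sum_le_sum_abs _ _).trans ((Finset.sum_le_card_nsmul _ _ (R * C) ?_).trans_eq ?_)
    · intro i _
      rw [abs_mul]
      exact mul_le_mul ((PiLp.norm_apply_le x i).trans hx.le) (hpd i) (abs_nonneg _) hR.le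
    · simp; ring
  have hsum : ∀ f : Fin n → ℝ, ∑ i, pd i χ x * f i = -(2 * q / η) * ∑ i, x i * f i := fun f => by
    rw [Finset.mul_sum]
    exact Finset.sum_congr rfl fun i _ => by rw [hχ]; ring
  have hU1 : |U x| ≤ 2 * C * η := hU.trans (by nlinarith)
  have hA : 0 ≤ A := ha.trans haA
  have hC₀ : 0 ≤ C₀ := hq.trans hqC
  refine ⟨?_, ?_, ?_⟩
  · rw [hsum]
    have hxp : |∑ i, x i * (x i - x₀ i)| ≤ 2 * R ^ 2 := by
      have : ∑ i, x i * (x i - x₀ i) = inner ℝ x (x - x₀) := by rw [← sum_coord_mul_eq_inner]; rfl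
      rw [this]
      refine (abs_real_inner_le_norm _ _).trans ?_
      have := norm_sub_le x x₀
      nlinarith [norm_nonneg x, norm_nonneg (x - x₀)]
    calc |a * (-(2 * q / η) * ∑ i, x i * (x i - x₀ i)) * U x ^ 2|
        = a * (2 * q / η * |∑ i, x i * (x i - x₀ i)|) * |U x| ^ 2 := by
          rw [abs_mul, abs_mul, abs_mul, abs_neg, abs_of_nonneg ha,
            abs_of_nonneg (by positivity : 0 ≤ 2 * q / η), abs_pow]
      _ ≤ A * (2 * C₀ / η * (2 * R ^ 2)) * (2 * C * η) ^ 2 := by gcongr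
      _ = 16 * A * C₀ * R ^ 2 * C ^ 2 * η := by field_simp; ring
      _ ≤ 16 * A * C₀ * R ^ 2 * C ^ 2 * 1 := by gcongr
      _ = _ := mul_one _
  · rw [hsum]
    calc |U x * (-(2 * q / η) * ∑ i, x i * pd i U x)|
        = |U x| * (2 * q / η * |∑ i, x i * pd i U x|) := by
          rw [abs_mul, abs_mul, abs_neg, abs_of_nonneg (by positivity : 0 ≤ 2 * q / η)]
      _ ≤ (2 * C * η) * (2 * C₀ / η * (n * R * C)) := by gcongr
      _ = _ := by field_simp; ring
  · rw [hsum]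
    have := sum_mul_energyField_le (μ := μ) hR hx hx2 hx0 hη hη1 hw hC hU hZ hg htan ha haA
    calc -(-(2 * q / η) * ∑ i, x i * energyField a μ x₀ U Z i x)
        = 2 * q / η * ∑ i, x i * energyField a μ x₀ U Z i x := by ring
      _ ≤ 2 * q / η * (η * (4 * C * (n * R * C)
          + A * (16 * (n * R * C) * C + 32 * C ^ 2 + 8 * μ ^ 2 * R ^ 4 * C ^ 2))) := by gcongr
      _ = 2 * q * (4 * C * (n * R * C)
          + A * (16 * (n * R * C) * C + 32 * C ^ 2 + 8 * μ ^ 2 * R ^ 4 * C ^ 2)) := by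
          field_simp
      _ ≤ _ := by gcongr

end BoundaryTerms

section ShellVolume

lemma integral_le_mul_volume {α : Type*} [MeasurableSpace α] {ν : Measure α} {S : Set α}
    (hS : MeasurableSet S) (hSf : ν S ≠ ⊤) {f : α → ℝ} {B : ℝ} (hB : 0 ≤ B) (hf : ∀ x ∈ S, f x ≤ B)
    (hf0 : ∀ x ∉ S, f x = 0) : ∫ x, f x ∂ν ≤ B * ν.real S := by
  by_cases hi : Integrable f ν
  · have hB' : Integrable (S.indicator fun _ => B) ν :=
      (integrable_indicator_iff hS).2 (integrableOn_const hSf)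
    refine (integral_mono hi hB' fun x => ?_).trans_eq ?_
    · by_cases hx : x ∈ S
      · rw [indicator_of_mem hx]; exact hf x hx
      · rw [indicator_of_notMem hx, hf0 x hx]
    · rw [integral_indicator_const _ hS, smul_eq_mul, mul_comm]
  · rw [integral_undef hi]; positivity

variable {n : ℕ}

lemma exists_volume_shell_le (n : ℕ) (R : ℝ) {ε : ℝ} (hε : 0 < ε) : ∃ η₀ > 0, ∀ η, 0 < η → η ≤ η₀ →
    volume.real {x : ℰ n | 0 < R ^ 2 - ‖x‖ ^ 2 ∧ R ^ 2 - ‖x‖ ^ 2 ≤ 2 * η} ≤ ε := by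
  set S : ℝ → Set (ℰ n) := fun η => {x | 0 < R ^ 2 - ‖x‖ ^ 2 ∧ R ^ 2 - ‖x‖ ^ 2 ≤ 2 * η}
  have hfin : ∀ η, volume (S η) ≠ ⊤ := fun η => by
    refine ne_top_of_le_ne_top (isCompact_closedBall 0 |R|).measure_ne_top
      (measure_mono fun x hx => ?_)
    rw [mem_closedBall_zero_iff]
    have h1 : ‖x‖ ^ 2 < R ^ 2 := by linarith [hx.1]
    exact (abs_norm x ▸ (sq_lt_sq.1 h1).le)
  have hmeas : ∀ η, MeasurableSet (S η) := fun η => by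
    have h : Continuous fun x : ℰ n => R ^ 2 - ‖x‖ ^ 2 := by fun_prop
    exact (measurableSet_lt measurable_const h.measurable).inter
      (measurableSet_le h.measurable measurable_const)
  have hmono : ∀ i j : ℝ, 0 < i → i ≤ j → S i ⊆ S j := fun i j _ hij x hx =>
    ⟨hx.1, hx.2.trans (by linarith)⟩
  have := tendsto_measure_biInter_gt (μ := volume) (a := (0:ℝ))
    (fun r _ => (hmeas r).nullMeasurableSet) hmono ⟨1, one_pos, hfin 1⟩
  have hempty : ⋂ r > (0:ℝ), S r = ∅ := by
    refine eq_empty_of_forall_notMem fun x hx => ?_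
    simp only [mem_iInter] at hx
    have h1 := (hx 1 one_pos).1
    have h2 := (hx ((R ^ 2 - ‖x‖ ^ 2) / 4) (by positivity)).2
    linarith
  rw [hempty, measure_empty] at this
  have h2 := this.eventually (ge_mem_nhds (ENNReal.ofReal_pos.2 hε))
  obtain ⟨η₀, hη₀, h3⟩ := (mem_nhdsGT_iff_exists_Ioc_subset).1 h2
  exact ⟨η₀, hη₀, fun η hη hη' => ENNReal.toReal_le_of_le_ofReal hε.le (h3 ⟨hη, hη'⟩)⟩

end ShellVolume

section FrequencyMonotonicity

/-- An integrated form of the almost monotonicity of a frequency function `D / F`. -/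
lemma frequency_le {t₁ t₂ h κ : ℝ} {F D F' D' : ℝ → ℝ} (ht : t₁ < t₂) (hL : t₂ - t₁ ≤ 1) (hh : 0 < h)
    (hhL : h ≤ t₂ - t₁) (hκ : 0 ≤ κ) (hF : ∀ t ∈ Icc t₁ t₂, HasDerivAt F (F' t) t)
    (hD : ∀ t ∈ Icc t₁ t₂, HasDerivAt D (D' t) t) (hFp : ∀ t ∈ Icc t₁ t₂, 0 < F t)
    (hDp : ∀ t ∈ Icc t₁ t₂, 0 ≤ D t) (h1 : ∀ t ∈ Icc t₁ t₂, |F' t + 2 * D t| ≤ F t)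
    (h2 : ∀ t ∈ Icc t₁ t₂, D' t * F t - D t * F' t ≤
      (F t * D t + κ * F t ^ 2) / (t₂ - t + h) + F t ^ 2) :
    h * (D t₂ / F t₂) ≤
      κ * (t₂ - t₁) + 3 * (t₂ - t₁) + 2 * Real.log (F t₁ / F ((t₁ + t₂) / 2)) := by
  set L := t₂ - t₁ with hLdef
  have hm1 : t₁ ≤ (t₁ + t₂) / 2 := by linarith
  have hm2 : (t₁ + t₂) / 2 ≤ t₂ := by linarith
  set N : ℝ → ℝ := fun t => D t / F t with hN
  have hNd : ∀ t ∈ Icc t₁ t₂, HasDerivAt (fun t => (t₂ - t + h) * N t)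
      (-1 * N t + (t₂ - t + h) * ((D' t * F t - D t * F' t) / F t ^ 2)) t := fun t ht => by
    have e : HasDerivAt (fun t => t₂ - t + h) (-1) t := by
      simpa using ((hasDerivAt_id t).const_sub t₂).add_const h
    exact e.fun_mul ((hD t ht).fun_div (hF t ht) (hFp t ht).ne')
  have hNle : ∀ t ∈ Icc t₁ t₂,
      -1 * N t + (t₂ - t + h) * ((D' t * F t - D t * F' t) / F t ^ 2) ≤ κ + 2 * L := fun t ht => by
    have hF0 := hFp t ht
    have hs : 0 < t₂ - t + h := by linarith [ht.2]
    have h3 : (D' t * F t - D t * F' t) / F t ^ 2 ≤ (N t + κ) / (t₂ - t + h) + 1 := by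
      rw [div_le_iff₀ (by positivity)]
      refine (h2 t ht).trans_eq ?_
      simp only [hN]
      field_simp
    have h4 := mul_le_mul_of_nonneg_left h3 hs.le
    rw [mul_add, mul_div_cancel₀ _ hs.ne'] at h4
    linarith [ht.1]
  have hstep : ∀ t ∈ Icc t₁ t₂, h * N t₂ ≤ (t₂ - t + h) * N t + (κ + 2 * L) * L := fun t ht' => by
    have := Convex.image_sub_le_mul_sub_of_deriv_le (convex_Icc t₁ t₂)
      (fun s hs => (hNd s hs).continuousAt.continuousWithinAt)
      (fun s hs => (hNd s (interior_subset hs)).differentiableAt.differentiableWithinAt)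
      (fun s hs => by rw [(hNd s (interior_subset hs)).deriv]; exact hNle s (interior_subset hs))
      t ht' t₂ ⟨ht.le, le_rfl⟩ ht'.2
    have h5 : (κ + 2 * L) * (t₂ - t) ≤ (κ + 2 * L) * L :=
      mul_le_mul_of_nonneg_left (by linarith [ht'.1]) (by positivity)
    simp only [sub_self, zero_add] at this
    linarith
  set m := max (h * N t₂ - (κ + 2 * L) * L) 0 / (2 * L) with hm
  have hmN : ∀ t ∈ Icc t₁ t₂, m ≤ N t := fun t ht' => by
    have hN0 : 0 ≤ N t := div_nonneg (hDp t ht') (hFp t ht').le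
    rw [hm, div_le_iff₀ (by positivity)]
    refine max_le ?_ (by positivity)
    have : (t₂ - t + h) * N t ≤ 2 * L * N t := mul_le_mul_of_nonneg_right (by linarith [ht'.1]) hN0
    linarith [hstep t ht']
  have hlog : ∀ t ∈ Icc t₁ t₂, HasDerivAt (fun t => Real.log (F t)) (F' t / F t) t := fun t ht' =>
    (hF t ht').log (hFp t ht').ne'
  have hlogle : ∀ t ∈ Icc t₁ t₂, F' t / F t ≤ -2 * m + 1 := fun t ht' => by
    have hF0 := hFp t ht'
    have h6 := hmN t ht'
    rw [hN, le_div_iff₀ hF0] at h6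
    rw [div_le_iff₀ hF0]
    linarith [(abs_le.1 (h1 t ht')).2]
  have hmem1 : t₁ ∈ Icc t₁ t₂ := ⟨le_rfl, ht.le⟩
  have hmem2 : (t₁ + t₂) / 2 ∈ Icc t₁ t₂ := ⟨hm1, hm2⟩
  have hfin := Convex.image_sub_le_mul_sub_of_deriv_le (convex_Icc t₁ t₂)
      (fun s hs => (hlog s hs).continuousAt.continuousWithinAt)
      (fun s hs => (hlog s (interior_subset hs)).differentiableAt.differentiableWithinAt)
      (fun s hs => by rw [(hlog s (interior_subset hs)).deriv]; exact hlogle s (interior_subset hs))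
      t₁ hmem1 _ hmem2 hm1
  rw [Real.log_div (hFp _ hmem1).ne' (hFp _ hmem2).ne']
  have hmL : h * N t₂ - (κ + 2 * L) * L ≤ m * (2 * L) := by
    rw [hm, div_mul_cancel₀ _ (by positivity)]
    exact le_max_left _ _
  have h7 : (t₁ + t₂) / 2 - t₁ = L / 2 := by rw [hLdef]; ring
  rw [h7] at hfin
  have : L * L ≤ L := by nlinarith
  nlinarith

end FrequencyMonotonicity

section CutoffSolution

variable {n : ℕ} {R μ T C η : ℝ} {u : ℝ → ℰ n → ℝ} {x₀ : ℰ n}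

/-- The solution `u` cut off near the boundary of the ball and extended by zero. -/
noncomputable def cutoffExtension (R η : ℝ) (u : ℝ → ℰ n → ℝ) (t : ℝ) : ℰ n → ℝ :=
  (ball 0 R).indicator fun x => radialCutoff R (η / 4) x * u t x

lemma mem_ball_of_sq_lt (hR : 0 < R) {x : ℰ n} (hx : 0 < R ^ 2 - ‖x‖ ^ 2) :
    x ∈ ball 0 R := by
  rw [mem_ball_zero_iff]
  nlinarith [norm_nonneg x]

lemma cutoffExtension_eq (hR : 0 < R) (hη : 0 < η) {x : ℰ n}
    (hx : η / 2 ≤ R ^ 2 - ‖x‖ ^ 2) (t : ℝ) : cutoffExtension R η u t x = u t x := by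
  rw [cutoffExtension, indicator_of_mem (mem_ball_of_sq_lt hR (by linarith)),
    radialCutoff_eq_one (by positivity) (by linarith), one_mul]

lemma cutoffExtension_eventuallyEq (hR : 0 < R) (hη : 0 < η) {x : ℰ n}
    (hx : η ≤ R ^ 2 - ‖x‖ ^ 2) (t : ℝ) : cutoffExtension R η u t =ᶠ[𝓝 x] u t := by
  have hc : Continuous fun z : ℰ n => R ^ 2 - ‖z‖ ^ 2 := by fun_prop
  filter_upwards [hc.continuousAt.eventually (lt_mem_nhds (show η / 2 < R ^ 2 - ‖x‖ ^ 2 by linarith))]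
    with z hz using cutoffExtension_eq hR hη hz.le t

lemma contDiffAt_cutoffExtension (hR : 0 < R) (hη : 0 < η) (hη' : η ≤ R ^ 2)
    {J : Set ℝ} (hJ : IsOpen J) (hu : ∀ t ∈ J, ∀ x ∈ ball 0 R,
      ContDiffAt ℝ ∞ (fun p : ℝ × ℰ n => u p.1 p.2) (t, x)) :
    ∀ t ∈ J, ∀ x, ContDiffAt ℝ ∞ (fun p : ℝ × ℰ n => cutoffExtension R η u p.1 p.2) (t, x) := by
  have hr : √(R ^ 2 - η / 4) < R := by rw [Real.sqrt_lt' hR]; linarith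
  refine contDiffAt_indicator_ball (f := fun t x => radialCutoff R (η / 4) x * u t x) hJ hr
    (fun t ht x hx => ?_) fun t _ x _ hx => ?_
  · exact (contDiff_radialCutoff.comp contDiff_snd).contDiffAt.mul (hu t ht x hx)
  · rw [radialCutoff_eq_zero (by positivity), zero_mul]
    have : R ^ 2 - η / 4 < ‖x‖ ^ 2 := (Real.sqrt_lt (by linarith) (norm_nonneg x)).1 hx
    linarith

lemma radialCutoff_mul_cutoffExtension (hR : 0 < R) (hη : 0 < η) (t : ℝ) (x : ℰ n) :
    radialCutoff R η x * cutoffExtension R η u t x ^ 2 =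
      (ball 0 R).indicator (fun x => radialCutoff R η x * u t x ^ 2) x := by
  rcases lt_or_ge η (R ^ 2 - ‖x‖ ^ 2) with hx | hx
  · rw [cutoffExtension_eq hR hη (by linarith), indicator_of_mem (mem_ball_of_sq_lt hR (by linarith))]
  · rw [radialCutoff_eq_zero hη hx, zero_mul]
    by_cases h : x ∈ ball 0 R
    · rw [indicator_of_mem h, radialCutoff_eq_zero hη hx, zero_mul]
    · rw [indicator_of_notMem h]

lemma BoundaryRegular.exists_error_le (hR : 0 < R) {J : Set ℝ} (hB : BoundaryRegular n R C J u)
    (hC : 0 ≤ C) (hx₀ : ‖x₀‖ < R) {A G ε : ℝ} (hA : 0 ≤ A) (hG : 0 ≤ G) (hε : 0 < ε) (μ : ℝ) :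
    ∃ η₀ > 0, η₀ ≤ 1 ∧ ∀ η, 0 < η → η ≤ η₀ → ∀ t ∈ J, ∀ a c, 0 ≤ a → a ≤ A →
      (∀ z, gauss a c x₀ z ≤ G) → ∀ U Z : ℰ n → ℝ,
      (∀ x, η ≤ R ^ 2 - ‖x‖ ^ 2 → U =ᶠ[𝓝 x] u t ∧ Z x = deriv (fun s => u s x) t) →
      |∫ x, a * (∑ i, pd i (radialCutoff R η) x * (x i - x₀ i)) * U x ^ 2 * gauss a c x₀ x| ≤ ε ∧
      |∫ x, U x * (∑ i, pd i (radialCutoff R η) x * pd i U x) * gauss a c x₀ x| ≤ ε ∧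
      -∫ x, (∑ i, pd i (radialCutoff R η) x * energyField a μ x₀ U Z i x) * gauss a c x₀ x ≤ ε := by
  obtain ⟨C₀, hC₀, hcut⟩ := exists_pd_radialCutoff n
  set b₁ := 16 * A * C₀ * R ^ 2 * C ^ 2
  set b₂ := 4 * C₀ * C * (n * R * C)
  set b₃ := 2 * C₀ * (4 * C * (n * R * C)
      + A * (16 * (n * R * C) * C + 32 * C ^ 2 + 8 * μ ^ 2 * R ^ 4 * C ^ 2))
  have p₁ : 0 ≤ b₁ := by positivity
  have p₂ : 0 ≤ b₂ := by positivity
  have p₃ : 0 ≤ b₃ := by positivity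
  set b := (b₁ + b₂ + b₃) * G
  have pb : 0 ≤ b := by positivity
  obtain ⟨η₁, hη₁, hvol⟩ := exists_volume_shell_le n R (show 0 < ε / (b + 1) by positivity)
  have hgap : 0 < (R ^ 2 - (max ‖x₀‖ (R / 2)) ^ 2) / 2 := by
    have : max ‖x₀‖ (R / 2) < R := max_lt hx₀ (by linarith)
    have h0 : 0 ≤ max ‖x₀‖ (R / 2) := (norm_nonneg _).trans (le_max_left _ _)
    nlinarith
  refine ⟨min (min η₁ 1) ((R ^ 2 - (max ‖x₀‖ (R / 2)) ^ 2) / 2), by positivity,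
    (min_le_left _ _).trans (min_le_right _ _), fun η hη hη' t ht a c ha haA hgG U Z hUZ => ?_⟩
  have hη1 : η ≤ 1 := hη'.trans ((min_le_left _ _).trans (min_le_right _ _))
  have hηg := hη'.trans (min_le_right _ _)
  set S : Set (ℰ n) := {x | 0 < R ^ 2 - ‖x‖ ^ 2 ∧ R ^ 2 - ‖x‖ ^ 2 ≤ 2 * η} with hSdef
  have hSv := hvol η hη (hη'.trans ((min_le_left _ _).trans (min_le_left _ _)))
  rw [← hSdef] at hSv
  have hSm : MeasurableSet S := by
    have h : Continuous fun x : ℰ n => R ^ 2 - ‖x‖ ^ 2 := by fun_prop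
    exact (measurableSet_lt measurable_const h.measurable).inter
      (measurableSet_le h.measurable measurable_const)
  have hSf : volume S ≠ ⊤ := by
    refine ne_top_of_le_ne_top (isCompact_closedBall 0 R).measure_ne_top
      (measure_mono fun x hx => ?_)
    exact ball_subset_closedBall (mem_ball_of_sq_lt hR hx.1)
  have hpt : ∀ x ∈ S,
      |a * (∑ i, pd i (radialCutoff R η) x * (x i - x₀ i)) * U x ^ 2| ≤ b₁ ∧
      |U x * (∑ i, pd i (radialCutoff R η) x * pd i U x)| ≤ b₂ ∧
      -(∑ i, pd i (radialCutoff R η) x * energyField a μ x₀ U Z i x) ≤ b₃ := fun x hx => by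
    obtain ⟨q, hq, hqC, hqpd, hq0⟩ := hcut R η hη x
    by_cases hlow : η ≤ R ^ 2 - ‖x‖ ^ 2
    · obtain ⟨hU, hZ⟩ := hUZ x hlow
      have hxb := mem_ball_of_sq_lt hR hx.1
      have hxm : max ‖x₀‖ (R / 2) ≤ ‖x‖ := by
        have h2 : max ‖x₀‖ (R / 2) ^ 2 ≤ ‖x‖ ^ 2 := by linarith [hx.2]
        exact le_of_sq_le_sq h2 (norm_nonneg x)
      refine boundary_terms_le hR (mem_ball_zero_iff.1 hxb) ((le_max_right _ _).trans hxm)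
        ((le_max_left _ _).trans hxm) hη hη1 hx.2 hC ?_ ?_ ?_ ?_ ha haA hq hqC hqpd
      · rw [hU.eq_of_nhds]; exact hB.abs_le t ht x hxb
      · rw [hZ]; exact hB.abs_deriv_le t ht x hxb
      · intro i; rw [pd_congr i hU]; exact hB.abs_pd_le t ht x hxb i
      · intro v hv; rw [hU.fderiv_eq]; exact hB.abs_tangential_le t ht x hxb v hv
    · have h0 : ∀ i, pd i (radialCutoff R η) x = 0 := fun i => by
        rw [hqpd, hq0 fun h => hlow h.1]; simp
      simp [h0, p₁, p₂, p₃]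
  have hout : ∀ x ∉ S, ∀ i, pd i (radialCutoff R η) x = 0 := fun x hx i => by
    obtain ⟨q, -, -, hqpd, hq0⟩ := hcut R η hη x
    rw [hqpd, hq0 fun h => hx ⟨hη.trans_le h.1, h.2⟩]; simp
  have hkey : ∀ (f : ℰ n → ℝ) (β : ℝ), 0 ≤ β → β ≤ b₁ + b₂ + b₃ →
      (∀ x ∈ S, f x ≤ β) → (∀ x ∉ S, f x = 0) → ∫ x, f x * gauss a c x₀ x ≤ ε := by
    intro f β hβ hβb hf hf0
    refine (integral_le_mul_volume (B := b) hSm hSf pb (fun x hx => ?_)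
      (fun x hx => by rw [hf0 x hx, zero_mul])).trans ?_
    · exact (mul_le_mul_of_nonneg_right ((hf x hx).trans hβb) (gauss_pos x).le).trans
        (mul_le_mul_of_nonneg_left (hgG x) (by positivity))
    · calc b * volume.real S ≤ b * (ε / (b + 1)) := by gcongr
        _ = (b / (b + 1)) * ε := by ring
        _ ≤ 1 * ε := by
          gcongr
          rw [div_le_one (by positivity)]; linarith
        _ = ε := one_mul _
  have hneg : ∀ f : ℰ n → ℝ, -∫ x, f x * gauss a c x₀ x = ∫ x, -f x * gauss a c x₀ x := fun f => by
    rw [← integral_neg]; exact integral_congr_ae (ae_of_all _ fun x => by simp)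
  refine ⟨_root_.abs_le.2 ⟨?_, ?_⟩, _root_.abs_le.2 ⟨?_, ?_⟩, ?_⟩
  · rw [neg_le, hneg]
    exact hkey _ b₁ p₁ (by linarith) (fun x hx => (neg_le_abs _).trans (hpt x hx).1)
      fun x hx => by simp [hout x hx]
  · exact hkey _ b₁ p₁ (by linarith) (fun x hx => (le_abs_self _).trans (hpt x hx).1)
      fun x hx => by simp [hout x hx]
  · rw [neg_le, hneg]
    exact hkey _ b₂ p₂ (by linarith) (fun x hx => (neg_le_abs _).trans (hpt x hx).2.1)
      fun x hx => by simp [hout x hx]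
  · exact hkey _ b₂ p₂ (by linarith) (fun x hx => (le_abs_self _).trans (hpt x hx).2.1)
      fun x hx => by simp [hout x hx]
  · rw [hneg]
    exact hkey _ b₃ p₃ (by linarith) (fun x hx => (hpt x hx).2.2) fun x hx => by simp [hout x hx]

lemma BoundaryRegular.exists_mass_le (hR : 0 < R) {J : Set ℝ} (hB : BoundaryRegular n R C J u)
    (hC : 0 ≤ C) {c₀ : ℝ} (hc₀ : 0 < c₀)
    (hint : ∀ t ∈ J, IntegrableOn (fun x => u t x ^ 2) (ball 0 R))
    (hlow : ∀ t ∈ J, c₀ ≤ ∫ x in ball 0 R, u t x ^ 2) :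
    ∃ η₀ > 0, ∀ η, 0 < η → η ≤ η₀ → ∀ t ∈ J, (∫ x in ball 0 R, u t x ^ 2) / 2 ≤
        ∫ x, radialCutoff R η x * cutoffExtension R η u t x ^ 2 := by
  set b := (C * R ^ 2) ^ 2
  obtain ⟨η₀, hη₀, hvol⟩ := exists_volume_shell_le n R (show 0 < c₀ / 2 / (b + 1) by positivity)
  refine ⟨η₀, hη₀, fun η hη hη' t ht => ?_⟩
  have hSv := hvol η hη hη'
  set S : Set (ℰ n) := {x | 0 < R ^ 2 - ‖x‖ ^ 2 ∧ R ^ 2 - ‖x‖ ^ 2 ≤ 2 * η}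
  have hSm : MeasurableSet S := by
    have h : Continuous fun x : ℰ n => R ^ 2 - ‖x‖ ^ 2 := by fun_prop
    exact (measurableSet_lt measurable_const h.measurable).inter
      (measurableSet_le h.measurable measurable_const)
  have hSf : volume S ≠ ⊤ := by
    refine ne_top_of_le_ne_top (isCompact_closedBall 0 R).measure_ne_top
      (measure_mono fun x hx => ?_)
    exact ball_subset_closedBall (mem_ball_of_sq_lt hR hx.1)
  have hi2 : IntegrableOn (fun x => radialCutoff R η x * u t x ^ 2) (ball 0 R) :=
    Integrable.bdd_mul (c := 1) (hint t ht) contDiff_radialCutoff.continuous.aestronglyMeasurable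
      (ae_of_all _ fun x => by
        rw [Real.norm_of_nonneg radialCutoff_nonneg]; exact radialCutoff_le_one)
  have e1 : ∫ x, radialCutoff R η x * cutoffExtension R η u t x ^ 2 =
      ∫ x in ball 0 R, radialCutoff R η x * u t x ^ 2 := by
    rw [← integral_indicator measurableSet_ball]
    exact integral_congr_ae (ae_of_all _ fun x => radialCutoff_mul_cutoffExtension hR hη t x)
  have e2 : (∫ x in ball 0 R, u t x ^ 2)
      - ∫ x in ball 0 R, radialCutoff R η x * u t x ^ 2 ≤ c₀ / 2 := by
    rw [← integral_sub (hint t ht) hi2, ← integral_indicator measurableSet_ball]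
    refine (integral_le_mul_volume (B := b) hSm hSf (sq_nonneg _) (fun x hx => ?_)
      (fun x hx => ?_)).trans ?_
    · have hxb := mem_ball_of_sq_lt hR hx.1
      rw [indicator_of_mem hxb]
      have h1 : |u t x| ≤ C * R ^ 2 := (hB.abs_le t ht x hxb).trans
        (mul_le_mul_of_nonneg_left (by nlinarith [sq_nonneg ‖x‖]) hC)
      have h2 : u t x ^ 2 ≤ b := by rw [← sq_abs]; exact pow_le_pow_left₀ (abs_nonneg _) h1 2
      nlinarith [mul_nonneg (radialCutoff_nonneg (R := R) (η := η) (x := x)) (sq_nonneg (u t x))]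
    · by_cases hxb : x ∈ ball 0 R
      · rw [indicator_of_mem hxb, radialCutoff_eq_one hη, one_mul, sub_self]
        have h0 : 0 < R ^ 2 - ‖x‖ ^ 2 := by
          have := mem_ball_zero_iff.1 hxb
          nlinarith [norm_nonneg x]
        exact (not_le.1 fun h => hx ⟨h0, h⟩).le
      · exact indicator_of_notMem hxb _
    · calc b * volume.real S ≤ b * (c₀ / 2 / (b + 1)) := by
            refine mul_le_mul_of_nonneg_left hSv (sq_nonneg _)
        _ = (b / (b + 1)) * (c₀ / 2) := by ring
        _ ≤ 1 * (c₀ / 2) := by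
          refine mul_le_mul_of_nonneg_right ?_ (by positivity)
          rw [div_le_one (by positivity)]; linarith
        _ = c₀ / 2 := one_mul _
  rw [e1]
  linarith [hlow t ht]

lemma IsHarmonicHeatSolution.exists_integral_sq_ge (h : IsHarmonicHeatSolution n R μ T u)
    (hμ : 0 < μ) (hR : 0 < R) {t₁ t₂ : ℝ} (ht₁ : 0 < t₁) (ht : t₁ < t₂) (ht₂ : t₂ < T)
    (hne : 0 < ∫ x in ball 0 R, u t₂ x ^ 2) :
    ∃ c₀ > 0, ∀ t ∈ Icc t₁ t₂, c₀ ≤ ∫ x in ball 0 R, u t x ^ 2 := by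
  obtain ⟨x, hx, hux⟩ : ∃ x ∈ ball 0 R, u t₂ x ≠ 0 := by
    by_contra! hcon
    refine hne.ne' ((setIntegral_congr_fun measurableSet_ball fun x hx => ?_).trans
      (integral_zero _ _))
    simp [hcon x hx]
  have hcont : ContinuousAt (fun s => u s x) t₂ :=
    (h.differentiableAt_time ⟨ht₁.trans ht, ht₂⟩ hx).continuousAt
  obtain ⟨t₃, h3, h3x⟩ : ∃ t₃ ∈ Ioo t₂ T, u t₃ x ≠ 0 := by
    have e1 : ∀ᶠ s in 𝓝[>] t₂, u s x ≠ 0 := (hcont.eventually_ne hux).filter_mono nhdsWithin_le_nhds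
    obtain ⟨s, hs, hs'⟩ := (e1.and (Ioo_mem_nhdsGT ht₂)).exists
    exact ⟨s, hs', hs⟩
  set V := volume.real (ball (0 : ℰ n) R) with hV
  have hVp : 0 < V := by
    rw [hV, measureReal_def]
    exact ENNReal.toReal_pos (measure_ball_pos _ _ hR).ne' measure_ball_lt_top.ne
  set e := rexp (-(n * Real.log (4 * π * (t₃ - t₂))))
  refine ⟨u t₃ x ^ 2 / (e * V), by positivity, fun t ht' => ?_⟩
  rw [div_le_iff₀ (by positivity)]
  have h1 := h.sq_le_integral_sq hμ hR (ht₁.trans_le ht'.1) (ht'.2.trans_lt h3.1) h3.2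
    (ball_subset_closedBall hx)
  have hle : rexp (-(n * Real.log (4 * π * (t₃ - t)))) ≤ e := by
    have h0 : 0 < t₃ - t₂ := sub_pos.2 h3.1
    refine Real.exp_le_exp.2 (neg_le_neg (mul_le_mul_of_nonneg_left (Real.log_le_log (by positivity) ?_)
      (Nat.cast_nonneg _)))
    exact mul_le_mul_of_nonneg_left (by linarith [ht'.2]) (by positivity)
  calc u t₃ x ^ 2 ≤ _ := h1
    _ ≤ e * (V * ∫ x in ball 0 R, u t x ^ 2) :=
      mul_le_mul_of_nonneg_right hle (by positivity)
    _ = _ := by ring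

end CutoffSolution

section FrequencyBound

variable {n : ℕ} {R μ T C : ℝ} {u : ℝ → ℰ n → ℝ} {x₀ : ℰ n}

lemma backwardKernel_le {τ t : ℝ} (ht : t < τ) (z : ℰ n) :
    backwardKernel τ x₀ t z ≤ rexp (-(n / 2) * Real.log (τ - t)) := by
  have : 0 < τ - t := sub_pos.2 ht
  refine Real.exp_le_exp.2 (add_le_of_nonpos_left ?_)
  rw [neg_mul, neg_nonpos]
  positivity

lemma le_backwardKernel {τ t : ℝ} (ht : t < τ) (hx₀ : ‖x₀‖ < R) {z : ℰ n} (hz : ‖z‖ < R) :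
    rexp (-(R ^ 2 / (τ - t)) + -(n / 2) * Real.log (τ - t)) ≤ backwardKernel τ x₀ t z := by
  have hs : 0 < τ - t := sub_pos.2 ht
  have h1 : ‖z - x₀‖ ^ 2 ≤ (2 * R) ^ 2 :=
    pow_le_pow_left₀ (norm_nonneg _) ((norm_sub_le _ _).trans (by linarith)) 2
  refine Real.exp_le_exp.2 (add_le_add ?_ le_rfl)
  rw [neg_mul, neg_le_neg_iff, show R ^ 2 / (τ - t) = 1 / (2 * (τ - t)) / 2 * (2 * R) ^ 2 by
    field_simp]
  gcongr

set_option maxHeartbeats 400000 in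
lemma IsHarmonicHeatSolution.exists_frequency_bound (h : IsHarmonicHeatSolution n R μ T u)
    (hB : BoundaryRegular n R C (Ioo 0 T) u) (hμ : 0 < μ) (hR : 0 < R) (hC : 0 ≤ C)
    (hx₀ : ‖x₀‖ < R) {t₁ t₂ l : ℝ} (ht₁ : 0 < t₁) (ht : t₁ < t₂) (ht₂ : t₂ < T) (hL : t₂ - t₁ ≤ 1)
    (hl : 0 < l) (hlL : l ≤ t₂ - t₁)
    (hne : 0 < ∫ x in ball 0 R, u t₂ x ^ 2) :
    ∃ w : ℝ → ℰ n → ℝ, ∃ N : ℝ, 0 ≤ N ∧ (∀ t ∈ Icc t₁ t₂, Continuous (w t) ∧ (∀ x, 0 ≤ w t x) ∧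
        (∀ x, w t x ≤ (ball 0 R).indicator (fun x => u t x ^ 2) x) ∧
        (∫ x in ball 0 R, u t x ^ 2) / 2 ≤ ∫ x, w t x) ∧
      l * N ≤ μ ^ 2 * ‖x₀‖ ^ 2 / 8 * (t₂ - t₁) + 3 * (t₂ - t₁)
        + 2 * Real.log ((∫ x, w t₁ x * backwardKernel (t₂ + l) x₀ t₁ x) /
          ∫ x, w ((t₁ + t₂) / 2) x * backwardKernel (t₂ + l) x₀ ((t₁ + t₂) / 2) x) ∧
      (1 / (2 * l)) ^ 2 / 2 * (∫ x, w t₂ x * ‖x - x₀‖ ^ 2 * backwardKernel (t₂ + l) x₀ t₂ x) ≤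
        (n * (1 / (2 * l)) + 2 * N + 1) * ∫ x, w t₂ x * backwardKernel (t₂ + l) x₀ t₂ x := by
  obtain ⟨c₀, hc₀, hlow⟩ := h.exists_integral_sq_ge hμ hR ht₁ ht ht₂ hne
  set τ := t₂ + l with hτ
  set B := ball (0 : ℰ n) R with hBdef
  set V := volume.real B
  have hsub : Icc t₁ t₂ ⊆ Ioo 0 T := fun t ht' => ⟨ht₁.trans_le ht'.1, ht'.2.trans_lt ht₂⟩
  have hs : ∀ t ∈ Icc t₁ t₂, l ≤ τ - t ∧ τ - t ≤ t₂ - t₁ + l := fun t ht' =>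
    ⟨by linarith [ht'.2], by linarith [ht'.1]⟩
  set G := rexp (-(n / 2) * Real.log l)
  have hgG : ∀ t ∈ Icc t₁ t₂, ∀ z, backwardKernel τ x₀ t z ≤ G := fun t ht' z => by
    refine (backwardKernel_le (by linarith [(hs t ht').1]) z).trans (Real.exp_le_exp.2 ?_)
    rw [neg_mul, neg_mul, neg_le_neg_iff]
    exact mul_le_mul_of_nonneg_left (Real.log_le_log hl (hs t ht').1) (by positivity)
  set g := rexp (-(R ^ 2 / l) + -(n / 2) * Real.log (t₂ - t₁ + l))
  have hgg : ∀ t ∈ Icc t₁ t₂, ∀ z ∈ B, g ≤ backwardKernel τ x₀ t z := fun t ht' z hz => by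
    obtain ⟨h1, h2⟩ := hs t ht'
    have h3 : 0 < τ - t := hl.trans_le h1
    refine le_trans (Real.exp_le_exp.2 (add_le_add (neg_le_neg ?_) ?_))
      (le_backwardKernel (by linarith) hx₀ (mem_ball_zero_iff.1 hz))
    · gcongr
    · rw [neg_mul, neg_mul, neg_le_neg_iff]
      exact mul_le_mul_of_nonneg_left (Real.log_le_log h3 h2) (by positivity)
  set E₀ := n * C ^ 2 + μ ^ 2 * R ^ 2 * (C * R ^ 2) ^ 2
  set Dm := E₀ * G * V
  set Fm := (C * R ^ 2) ^ 2 * G * V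
  have hG0 : 0 < G := Real.exp_pos _
  have hE0 : 0 ≤ E₀ := by positivity
  set c := g * (c₀ / 2)
  have hc0 : 0 < c := mul_pos (Real.exp_pos _) (by positivity)
  obtain ⟨ε, hε, hε1, hε2⟩ : ∃ ε > 0, 3 * ε ≤ c ∧ ε * (Fm + 3 * Dm + 4 * ε) ≤ c ^ 2 := by
    refine ⟨min (c / 3) (c ^ 2 / (Fm + 3 * Dm + 4 * c)), by positivity, ?_, ?_⟩
    · linarith [min_le_left (c / 3) (c ^ 2 / (Fm + 3 * Dm + 4 * c))]
    · set ε := min (c / 3) (c ^ 2 / (Fm + 3 * Dm + 4 * c))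
      have h1 : ε ≤ c := (min_le_left _ _).trans (by linarith)
      have h2 : ε ≤ c ^ 2 / (Fm + 3 * Dm + 4 * c) := min_le_right _ _
      have h0 : 0 ≤ ε := by positivity
      rw [le_div_iff₀ (by positivity)] at h2
      nlinarith
  obtain ⟨η₁, hη₁, hη₁1, herr⟩ := hB.exists_error_le hR hC hx₀ (A := 1 / (2 * l)) (by positivity)
    hG0.le hε μ
  have hB' : BoundaryRegular n R C (Icc t₁ t₂) u :=
    ⟨fun t ht' => hB.abs_le t (hsub ht'), fun t ht' => hB.abs_deriv_le t (hsub ht'),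
      fun t ht' => hB.abs_pd_le t (hsub ht'), fun t ht' => hB.abs_tangential_le t (hsub ht')⟩
  obtain ⟨η₂, hη₂, hmass⟩ := hB'.exists_mass_le hR hC hc₀
    (fun t ht' => h.integrableOn_sq (Ioo_subset_Icc_self (hsub ht'))) hlow
  set η := min (min η₁ η₂) (R ^ 2)
  have hη : 0 < η := by positivity
  have hηa : η ≤ η₁ := (min_le_left _ _).trans (min_le_left _ _)
  have hηb : η ≤ η₂ := (min_le_left _ _).trans (min_le_right _ _)
  have hηc : η ≤ R ^ 2 := min_le_right _ _
  set χ : ℰ n → ℝ := radialCutoff R η with hχ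
  set Y := cutoffExtension R η u with hY
  set J := Ioo 0 T ∩ Iio τ
  have hJ : IsOpen J := isOpen_Ioo.inter isOpen_Iio
  have hIJ : Icc t₁ t₂ ⊆ J := fun t ht' => ⟨hsub ht', mem_Iio.2 (by linarith [(hs t ht').1])⟩
  have hYs : ∀ t ∈ J, ∀ x, ContDiffAt ℝ ∞ (fun p : ℝ × ℰ n => Y p.1 p.2) (t, x) :=
    contDiffAt_cutoffExtension hR hη hηc hJ fun t ht' x hx => h.contDiffAt ht'.1 hx
  have hχs : ContDiff ℝ ∞ χ := contDiff_radialCutoff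
  have hK : IsCompact (closedBall (0 : ℰ n) R) := isCompact_closedBall _ _
  have hχ0 : ∀ x, x ∉ closedBall 0 R → χ x = 0 := fun x hx => by
    refine radialCutoff_eq_zero hη ?_
    rw [mem_closedBall_zero_iff, not_le] at hx
    nlinarith
  have hχn : ∀ x, 0 ≤ χ x := fun x => radialCutoff_nonneg
  have hχ1 : ∀ x, χ x ≤ 1 := fun x => radialCutoff_le_one
  have hZ : ∀ t x, η ≤ R ^ 2 - ‖x‖ ^ 2 → deriv (fun s => Y s x) t = deriv (fun s => u s x) t :=
    fun t x hx => by congr 1; ext s; exact cutoffExtension_eq hR hη (by linarith) s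
  have hYc : ∀ t ∈ Icc t₁ t₂, ContDiff ℝ ∞ (Y t) := fun t ht' => contDiff_slice hYs (hIJ ht')
  have hker : ∀ t, Continuous (backwardKernel τ x₀ t) := fun t => contDiff_gauss.continuous
  set F : ℝ → ℝ := fun t => ∫ x, χ x * Y t x ^ 2 * backwardKernel τ x₀ t x
  set D : ℝ → ℝ := fun t => ∫ x, χ x * energyDensity μ (Y t) x * backwardKernel τ x₀ t x
  have hYsup : ∀ t ∈ Icc t₁ t₂, ∀ x, χ x * Y t x ^ 2 ≤ (C * R ^ 2) ^ 2 ∧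
      χ x * energyDensity μ (Y t) x ≤ E₀ := fun t ht' x => by
    rcases lt_or_ge η (R ^ 2 - ‖x‖ ^ 2) with hx | hx
    · have hxb := mem_ball_of_sq_lt hR (hη.trans hx)
      have hev := cutoffExtension_eventuallyEq (u := u) hR hη hx.le t
      have hu1 : |Y t x| ≤ C * R ^ 2 := by
        rw [hY, hev.eq_of_nhds]
        exact (hB.abs_le t (hsub ht') x hxb).trans
          (mul_le_mul_of_nonneg_left (by nlinarith [sq_nonneg ‖x‖]) hC)
      have hu2 : Y t x ^ 2 ≤ (C * R ^ 2) ^ 2 := by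
        rw [← sq_abs]; exact pow_le_pow_left₀ (abs_nonneg _) hu1 2
      have he : energyDensity μ (Y t) x ≤ E₀ := by
        refine add_le_add ?_ ?_
        · refine (Finset.sum_le_card_nsmul _ _ (C ^ 2) fun i _ => ?_).trans_eq (by simp)
          rw [hY, pd_congr i hev, ← sq_abs]
          exact pow_le_pow_left₀ (abs_nonneg _) (hB.abs_pd_le t (hsub ht') x hxb i) 2
        · have := mem_ball_zero_iff.1 hxb
          gcongr
      have he0 : 0 ≤ energyDensity μ (Y t) x := by rw [energyDensity]; positivity
      exact ⟨(mul_le_of_le_one_left (sq_nonneg _) (hχ1 x)).trans hu2,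
        (mul_le_of_le_one_left he0 (hχ1 x)).trans he⟩
    · rw [hχ, radialCutoff_eq_zero hη hx, zero_mul, zero_mul]
      exact ⟨sq_nonneg _, hE0⟩
  have hχB : ∀ x ∉ B, χ x = 0 := fun x hx => by
    refine radialCutoff_eq_zero hη ?_
    rw [hBdef, mem_ball_zero_iff, not_lt] at hx
    nlinarith
  have hFle : ∀ t ∈ Icc t₁ t₂, F t ≤ Fm := fun t ht' =>
    integral_le_mul_volume measurableSet_ball measure_ball_lt_top.ne (by positivity)
      (fun x _ => mul_le_mul (hYsup t ht' x).1 (hgG t ht' x) (gauss_pos x).le (sq_nonneg _))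
      fun x hx => by rw [hχB x hx, zero_mul, zero_mul]
  have hDle : ∀ t ∈ Icc t₁ t₂, D t ≤ Dm := fun t ht' =>
    integral_le_mul_volume measurableSet_ball measure_ball_lt_top.ne (by positivity)
      (fun x _ => mul_le_mul (hYsup t ht' x).2 (hgG t ht' x) (gauss_pos x).le hE0)
      fun x hx => by rw [hχB x hx, zero_mul, zero_mul]
  have hD0 : ∀ t, 0 ≤ D t := fun t => integral_nonneg fun x =>
    mul_nonneg (mul_nonneg (hχn x) (by rw [energyDensity]; positivity)) (gauss_pos x).le
  have hFge : ∀ t ∈ Icc t₁ t₂, c ≤ F t := fun t ht' => by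
    have hYt := (hYc t ht').continuous
    have hχc := hχs.continuous
    have h1 : c ≤ g * ∫ x, χ x * Y t x ^ 2 :=
      mul_le_mul_of_nonneg_left ((div_le_div_of_nonneg_right (hlow t ht') (by norm_num)).trans
        (hmass η hη hηb t ht')) (Real.exp_pos _).le
    refine h1.trans ?_
    rw [← integral_const_mul]
    refine integral_mono (Integrable.const_mul (integrable_of_continuous_of_zero_off hK (by fun_prop)
      fun x hx => by rw [hχ0 x hx, zero_mul]) g) (integrable_of_continuous_of_zero_off hK
      (by have := hker t; fun_prop) fun x hx => by rw [hχ0 x hx, zero_mul, zero_mul]) fun x => ?_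
    by_cases hx : x ∈ B
    · simp only []
      rw [mul_comm g]
      exact mul_le_mul_of_nonneg_left (hgg t ht' x hx) (mul_nonneg (hχn x) (sq_nonneg _))
    · simp [hχB x hx]
  set F' : ℝ → ℝ := fun t => ∫ x, (χ x * (2 * Y t x * deriv (fun s => Y s x) t)
      * backwardKernel τ x₀ t x + χ x * Y t x ^ 2 * ((n * (1 / (2 * (τ - t)))
        - (1 / (2 * (τ - t))) ^ 2 * ‖x - x₀‖ ^ 2) * backwardKernel τ x₀ t x))
  set D' : ℝ → ℝ := fun t => ∫ x, (χ x * (2 * (∑ i, pd i (Y t) x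
      * pd i (fun z => deriv (fun s => Y s z) t) x)
      + 2 * (μ ^ 2 * ‖x‖ ^ 2) * Y t x * deriv (fun s => Y s x) t) * backwardKernel τ x₀ t x
        + χ x * energyDensity μ (Y t) x * ((n * (1 / (2 * (τ - t)))
          - (1 / (2 * (τ - t))) ^ 2 * ‖x - x₀‖ ^ 2) * backwardKernel τ x₀ t x))
  have hrel : ∀ t ∈ Icc t₁ t₂, |F' t + 2 * D t| ≤ 3 * ε ∧
      D' t * F t - D t * F' t ≤ 2 * (1 / (2 * (τ - t))) *
        (F t * D t + μ ^ 2 * ‖x₀‖ ^ 2 / 8 * F t ^ 2) + ε * (F t + 3 * D t + 4 * ε) ∧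
      (1 / (2 * (τ - t))) ^ 2 / 2 * (∫ x, χ x * Y t x ^ 2 * ‖x - x₀‖ ^ 2
        * backwardKernel τ x₀ t x) ≤ n * (1 / (2 * (τ - t))) * F t + 2 * D t + ε := by
    intro t ht'
    have hτt : 0 < τ - t := hl.trans_le (hs t ht').1
    have hZt := contDiff_slice (Y := fun t z => deriv (fun s => Y s z) t)
      (contDiffAt_deriv_slice hJ hYs) (hIJ ht')
    have hUZ : ∀ x, η ≤ R ^ 2 - ‖x‖ ^ 2 → Y t =ᶠ[𝓝 x] u t ∧
        (fun z => deriv (fun s => Y s z) t) x = deriv (fun s => u s x) t := fun x hx =>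
      ⟨cutoffExtension_eventuallyEq hR hη hx t, hZ t x hx⟩
    have he := herr η hη hηa t (hsub ht') (1 / (2 * (τ - t))) (-(n / 2) * Real.log (τ - t))
      (by positivity) (one_div_le_one_div_of_le (by positivity) (by linarith [(hs t ht').1]))
      (hgG t ht') (Y t) (fun z => deriv (fun s => Y s z) t) hUZ
    have heq : ∀ x, lapl (Y t) x = (fun z => deriv (fun s => Y s z) t) x + μ ^ 2 * ‖x‖ ^ 2 * Y t x ∨
        χ x = 0 := fun x => by
      rcases le_or_gt (R ^ 2 - ‖x‖ ^ 2) η with hx | hx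
      · exact Or.inr (radialCutoff_eq_zero hη hx)
      · left
        have hev := cutoffExtension_eventuallyEq (u := u) hR hη hx.le t
        have h1 := h.lapl_eq (hsub ht') (mem_ball_of_sq_lt hR (hη.trans hx))
        simp only []
        rw [hZ t x hx.le, hY, lapl_congr hev, hev.eq_of_nhds, h1]
    have ha : 0 ≤ 1 / (2 * (τ - t)) := by positivity
    exact frequency_relations hK hχs hχ0 hχn (hYc t ht') hZt ha heq he.1 he.2.1 he.2.2
      (F := F t) (D := D t) (F' := F' t) (D' := D' t) rfl rfl rfl rfl
  have hFd : ∀ t ∈ Icc t₁ t₂, HasDerivAt F (F' t) t := fun t ht' => hasDerivAt_weighted_mass (x₀ := x₀) hJ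
    (fun t ht => ht.2) hK hχs hχ0 hYs (hIJ ht')
  have hDd : ∀ t ∈ Icc t₁ t₂, HasDerivAt D (D' t) t := fun t ht' => hasDerivAt_weighted_energy (μ := μ) (x₀ := x₀) hJ
    (fun t ht => ht.2) hK hχs hχ0 hYs (hIJ ht')
  have hFp : ∀ t ∈ Icc t₁ t₂, 0 < F t := fun t ht' => hc0.trans_le (hFge t ht')
  have ht2 : t₂ ∈ Icc t₁ t₂ := ⟨ht.le, le_rfl⟩
  have hfin := frequency_le (κ := μ ^ 2 * ‖x₀‖ ^ 2 / 8) ht hL hl hlL (by positivity) hFd hDd hFp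
    (fun t _ => hD0 t)
    (fun t ht' => (hrel t ht').1.trans (hε1.trans (hFge t ht')))
    (fun t ht' => by
      have h1 := (hrel t ht').2.1
      have hτt : 0 < τ - t := hl.trans_le (hs t ht').1
      refine h1.trans (add_le_add (le_of_eq ?_) ?_)
      · rw [show t₂ - t + l = τ - t by rw [hτ]; ring]
        field_simp
      · calc ε * (F t + 3 * D t + 4 * ε) ≤ ε * (Fm + 3 * Dm + 4 * ε) := by
              have := hFle t ht'; have := hDle t ht'; gcongr
          _ ≤ c ^ 2 := hε2
          _ ≤ F t ^ 2 := pow_le_pow_left₀ hc0.le (hFge t ht') 2)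
  refine ⟨fun t x => χ x * Y t x ^ 2, D t₂ / F t₂, div_nonneg (hD0 _) (hFp _ ht2).le,
    fun t ht' => ⟨?_, fun x => mul_nonneg (hχn x) (sq_nonneg _), fun x => ?_, hmass η hη hηb t ht'⟩,
    hfin, ?_⟩
  · have hYt := (hYc t ht').continuous
    have hχc := hχs.continuous
    fun_prop
  · simp only [hχ, hY]
    rw [radialCutoff_mul_cutoffExtension hR hη]
    refine indicator_le_indicator ?_
    exact mul_le_of_le_one_left (sq_nonneg _) radialCutoff_le_one
  · have h3 := (hrel t₂ ht2).2.2
    rw [show τ - t₂ = l by rw [hτ]; ring] at h3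
    refine (le_of_eq ?_).trans (h3.trans ?_)
    · congr 2
    · have hF2 := hFp t₂ ht2
      have : (n * (1 / (2 * l)) + 2 * (D t₂ / F t₂) + 1) * F t₂ =
          n * (1 / (2 * l)) * F t₂ + 2 * D t₂ + F t₂ := by field_simp
      refine le_trans ?_ this.ge
      have := hFge t₂ ht2
      linarith

section Weight

variable {w v G : ℰ n → ℝ}

lemma eq_zero_of_le_indicator (hw0 : ∀ x, 0 ≤ w x)
    (hwv : ∀ x, w x ≤ (ball 0 R).indicator (fun x => v x ^ 2) x)
    {x : ℰ n} (hx : x ∉ ball 0 R) : w x = 0 :=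
  le_antisymm ((hwv x).trans (by rw [indicator_of_notMem hx])) (hw0 x)

lemma integrable_of_le_indicator (hw : Continuous w) (hw0 : ∀ x, 0 ≤ w x)
    (hwv : ∀ x, w x ≤ (ball 0 R).indicator (fun x => v x ^ 2) x)
    {f : ℰ n → ℝ} (hf : Continuous f) : Integrable fun x => w x * f x :=
  integrable_of_continuous_of_zero_off (isCompact_closedBall 0 R)
    (by fun_prop) fun x hx => by
      rw [eq_zero_of_le_indicator hw0 hwv fun h => hx (ball_subset_closedBall h), zero_mul]

lemma mul_integral_le_integral_mul (hw : Continuous w) (hw0 : ∀ x, 0 ≤ w x)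
    (hwv : ∀ x, w x ≤ (ball 0 R).indicator (fun x => v x ^ 2) x)
    (hG : Continuous G) {g : ℝ} (hg : ∀ x ∈ ball 0 R, g ≤ G x) :
    g * (∫ x, w x) ≤ ∫ x, w x * G x := by
  rw [mul_comm, ← integral_mul_const]
  refine integral_mono (integrable_of_le_indicator hw hw0 hwv continuous_const)
    (integrable_of_le_indicator hw hw0 hwv hG) fun x => ?_
  by_cases hx : x ∈ ball 0 R
  · exact mul_le_mul_of_nonneg_left (hg x hx) (hw0 x)
  · simp [eq_zero_of_le_indicator hw0 hwv hx]

lemma integral_mul_le_mul_integral (hw : Continuous w) (hw0 : ∀ x, 0 ≤ w x)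
    (hwv : ∀ x, w x ≤ (ball 0 R).indicator (fun x => v x ^ 2) x)
    (hv : IntegrableOn (fun x => v x ^ 2) (ball 0 R))
    (hG : Continuous G) {c : ℝ} (hc : ∀ x, G x ≤ c) (hc0 : 0 ≤ c) :
    ∫ x, w x * G x ≤ c * ∫ x in ball 0 R, v x ^ 2 := by
  rw [← integral_indicator measurableSet_ball, mul_comm, ← integral_mul_const]
  refine integral_mono (integrable_of_le_indicator hw hw0 hwv hG)
    ((hv.integrable_indicator measurableSet_ball).mul_const c) fun x => ?_
  exact (mul_le_mul_of_nonneg_left (hc x) (hw0 x)).trans (mul_le_mul_of_nonneg_right (hwv x) hc0)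

lemma integral_mul_le_localised (hw : Continuous w) (hw0 : ∀ x, 0 ≤ w x)
    (hwv : ∀ x, w x ≤ (ball 0 R).indicator (fun x => v x ^ 2) x)
    (hv : IntegrableOn (fun x => v x ^ 2) (ball 0 R))
    (hG : Continuous G) (hG0 : ∀ x, 0 ≤ G x) {c ρ : ℝ} (hc : ∀ x, G x ≤ c) (hc0 : 0 ≤ c)
    (hρ : 0 < ρ) (hsub : ball x₀ ρ ⊆ ball 0 R) :
    ∫ x, w x * G x ≤ c * (∫ x in ball x₀ ρ, v x ^ 2) + (∫ x, w x * ‖x - x₀‖ ^ 2 * G x) / ρ ^ 2 := by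
  have hI : Integrable fun x => w x * ‖x - x₀‖ ^ 2 * G x := by
    have := integrable_of_le_indicator hw hw0 hwv (f := fun x => ‖x - x₀‖ ^ 2 * G x) (by fun_prop)
    simpa only [mul_assoc] using this
  have hv' := ((hv.mono_set hsub).integrable_indicator measurableSet_ball)
  rw [← integral_indicator measurableSet_ball, mul_comm c, ← integral_mul_const,
    ← integral_div, ← integral_add (hv'.mul_const c) (hI.div_const _)]
  refine integral_mono (integrable_of_le_indicator hw hw0 hwv hG)
    ((hv'.mul_const c).add (hI.div_const _)) fun x => ?_
  have hwG := mul_nonneg (hw0 x) (hG0 x)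
  by_cases hx : x ∈ ball x₀ ρ
  · have h1 := (mul_le_mul_of_nonneg_left (hc x) (hw0 x)).trans
      (mul_le_mul_of_nonneg_right (hwv x) hc0)
    simp only [indicator_of_mem hx, indicator_of_mem (hsub hx)] at h1 ⊢
    have h2 : 0 ≤ w x * ‖x - x₀‖ ^ 2 * G x / ρ ^ 2 := by have := hw0 x; have := hG0 x; positivity
    linarith
  · rw [mem_ball_iff_norm, not_lt] at hx
    have hx' : x ∉ ball x₀ ρ := by rwa [mem_ball_iff_norm, not_lt]
    simp only [indicator_of_notMem hx', zero_mul, zero_add]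
    rw [le_div_iff₀ (by positivity)]
    nlinarith [pow_le_pow_left₀ hρ.le hx 2]

end Weight

set_option maxHeartbeats 400000 in
lemma IsHarmonicHeatSolution.integral_sq_mul_pow_le (h : IsHarmonicHeatSolution n R μ T u)
    (hB : BoundaryRegular n R C (Ioo 0 T) u) (hμ : 0 < μ) (hR : 0 < R) (hC : 0 ≤ C)
    (hx₀ : ‖x₀‖ < R) {ρ : ℝ} (hρ : 0 < ρ) (hρR : ρ ≤ R) (hsub : ball x₀ ρ ⊆ ball 0 R)
    {t₁ t₂ : ℝ} (ht₁ : 0 < t₁) (ht : t₁ < t₂) (ht₂ : t₂ < T) (hL : t₂ - t₁ ≤ 1)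
    {k : ℕ} (hk : 64 * R ^ 2 / ρ ^ 2 ≤ k) :
    (∫ x in ball 0 R, u t₂ x ^ 2) * (∫ x in ball 0 R, u ((t₁ + t₂) / 2) x ^ 2) ^ k ≤
      4 * rexp (8 * R ^ 2 / ρ ^ 2 * (n + 2 + 4 * (μ ^ 2 * ‖x₀‖ ^ 2 / 8 * (t₂ - t₁)
          + 3 * (t₂ - t₁) + 4 * R ^ 2 / (t₂ - t₁)))) *
        ((∫ x in ball 0 R, u ((t₁ + t₂) / 2) x ^ 2) +
          2 * ∫ x in ball 0 R, u t₁ x ^ 2) ^ k *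
        ∫ x in ball x₀ ρ, u t₂ x ^ 2 := by
  set I : ℝ → ℝ := fun t => ∫ x in ball 0 R, u t x ^ 2 with hI
  set tm := (t₁ + t₂) / 2 with htm
  set L := t₂ - t₁ with hLd
  have hL0 : 0 < L := sub_pos.2 ht
  have hI0 : ∀ t, 0 ≤ I t := fun t => integral_nonneg fun x => sq_nonneg _
  rcases (hI0 t₂).eq_or_lt with h0 | hne
  · have h0' : ∫ x in ball 0 R, u t₂ x ^ 2 = 0 := h0.symm
    have h1 := hI0 t₁
    have h2 := hI0 tm
    simp only [hI] at h1 h2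
    rw [h0', zero_mul]
    positivity
  obtain ⟨c₀, hc₀, hlow⟩ := h.exists_integral_sq_ge hμ hR ht₁ ht ht₂ hne
  have hm1 : t₁ ≤ tm := by rw [htm]; linarith
  have hm2 : tm ≤ t₂ := by rw [htm]; linarith
  have e1 : t₁ ∈ Icc t₁ t₂ := ⟨le_rfl, ht.le⟩
  have em : tm ∈ Icc t₁ t₂ := ⟨hm1, hm2⟩
  have e2 : t₂ ∈ Icc t₁ t₂ := ⟨ht.le, le_rfl⟩
  have hIm : 0 < I tm := hc₀.trans_le (hlow tm em)
  have hI1 : 0 < I t₁ := hc₀.trans_le (hlow t₁ e1)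
  set Q := 1 + 2 * I t₁ / I tm with hQ
  have hQ1 : 1 ≤ Q := le_add_of_nonneg_right (by positivity)
  set Λ₀ := μ ^ 2 * ‖x₀‖ ^ 2 / 8 * L + 3 * L + 4 * R ^ 2 / L with hΛ₀
  set Λ := Λ₀ + 2 * Real.log Q with hΛ
  have hlog : 0 ≤ Real.log Q := Real.log_nonneg hQ1
  have hΛ₀R : 4 * R ^ 2 / L ≤ Λ₀ := le_add_of_nonneg_left (by positivity)
  set l := ρ ^ 2 / (8 * (n + 2 + 4 * Λ)) with hl
  have hl0 : 0 < l := by positivity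
  have hlmul : l * (8 * (n + 2 + 4 * Λ)) = ρ ^ 2 := div_mul_cancel₀ _ (by positivity)
  have hlL : l ≤ L := by
    have h1 : 4 * R ^ 2 / L ≤ Λ := hΛ₀R.trans (le_add_of_nonneg_right (by positivity))
    rw [div_le_iff₀ hL0] at h1
    rw [hl, div_le_iff₀ (by positivity)]
    have : 0 ≤ L * (n + 2 : ℝ) := by positivity
    nlinarith
  obtain ⟨w, N, hN, hw, hlN, hM⟩ := h.exists_frequency_bound hB hμ hR hC hx₀ ht₁ ht ht₂ hL hl0 hlL hne
  have hint : ∀ t ∈ Icc t₁ t₂, IntegrableOn (fun x => u t x ^ 2) (ball 0 R) := fun t ht' =>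
    h.integrableOn_sq ⟨ht₁.le.trans ht'.1, ht'.2.trans ht₂.le⟩
  have hker : ∀ t, Continuous (backwardKernel (t₂ + l) x₀ t) := fun t => contDiff_gauss.continuous
  have hup : ∀ t ∈ Icc t₁ t₂, ∫ x, w t x * backwardKernel (t₂ + l) x₀ t x ≤
      rexp (-(n / 2) * Real.log (t₂ + l - t)) * I t := fun t ht' =>
    integral_mul_le_mul_integral (hw t ht').1 (hw t ht').2.1 (hw t ht').2.2.1 (hint t ht') (hker t)
      (backwardKernel_le (by linarith [ht'.2])) (Real.exp_pos _).le
  have hdn : ∀ t ∈ Icc t₁ t₂, rexp (-(R ^ 2 / (t₂ + l - t)) + -(n / 2) * Real.log (t₂ + l - t))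
      * (I t / 2) ≤ ∫ x, w t x * backwardKernel (t₂ + l) x₀ t x := fun t ht' =>
    (mul_le_mul_of_nonneg_left (hw t ht').2.2.2 (Real.exp_pos _).le).trans
      (mul_integral_le_integral_mul (hw t ht').1 (hw t ht').2.1 (hw t ht').2.2.1 (hker t)
        fun x hx => le_backwardKernel (by linarith [ht'.2]) hx₀ (mem_ball_zero_iff.1 hx))
  set F : ℝ → ℝ := fun t => ∫ x, w t x * backwardKernel (t₂ + l) x₀ t x
  have hF1 : 0 < F t₁ := lt_of_lt_of_le (by positivity) (hdn t₁ e1)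
  have hFm : 0 < F tm := lt_of_lt_of_le (by positivity) (hdn tm em)
  have hratio : Real.log (F t₁ / F tm) ≤ 2 * R ^ 2 / L + Real.log Q := by
    rw [← Real.log_exp (2 * R ^ 2 / L), ← Real.log_mul (Real.exp_pos _).ne' (by positivity)]
    refine Real.log_le_log (by positivity) ((div_le_iff₀ hFm).2 ((hup t₁ e1).trans ?_))
    have h1 : t₂ + l - t₁ = L + l := by rw [hLd]; ring
    have h2 : t₂ + l - tm = L / 2 + l := by rw [hLd, htm]; ring
    have h3 := hdn tm em
    rw [h2] at h3
    rw [h1]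
    have h4 : rexp (-(n / 2) * Real.log (L + l)) ≤ rexp (2 * R ^ 2 / L) *
        rexp (-(R ^ 2 / (L / 2 + l)) + -(n / 2) * Real.log (L / 2 + l)) := by
      rw [← Real.exp_add]
      refine Real.exp_le_exp.2 ?_
      have h5 : R ^ 2 / (L / 2 + l) ≤ 2 * R ^ 2 / L := by
        rw [show 2 * R ^ 2 / L = R ^ 2 / (L / 2) by field_simp]
        gcongr
        linarith
      have h6 : (n / 2 : ℝ) * Real.log (L / 2 + l) ≤ n / 2 * Real.log (L + l) := by gcongr; linarith
      linarith
    have h7 : I t₁ ≤ Q * (I tm / 2) := by rw [hQ]; field_simp; linarith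
    calc rexp (-(n / 2) * Real.log (L + l)) * I t₁ ≤ (rexp (2 * R ^ 2 / L) *
          rexp (-(R ^ 2 / (L / 2 + l)) + -(n / 2) * Real.log (L / 2 + l))) *
          (Q * (I tm / 2)) := mul_le_mul h4 h7 hI1.le (by positivity)
      _ = rexp (2 * R ^ 2 / L) * Q * (rexp (-(R ^ 2 / (L / 2 + l)) +
          -(n / 2) * Real.log (L / 2 + l)) * (I tm / 2)) := by ring
      _ ≤ _ := mul_le_mul_of_nonneg_left h3 (by positivity)
  have hlN' : l * N ≤ Λ := by
    refine hlN.trans ?_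
    rw [hΛ, hΛ₀, show 4 * R ^ 2 / L = 2 * (2 * R ^ 2 / L) by ring]
    linarith
  have hM2 : (∫ x, w t₂ x * ‖x - x₀‖ ^ 2 * backwardKernel (t₂ + l) x₀ t₂ x) ≤ ρ ^ 2 / 2 * F t₂ := by
    have hF2 : 0 ≤ F t₂ := le_trans (by have := hI0 t₂; positivity) (hdn t₂ e2)
    set M2 := ∫ x, w t₂ x * ‖x - x₀‖ ^ 2 * backwardKernel (t₂ + l) x₀ t₂ x
    have h1 : M2 = 8 * l ^ 2 * ((1 / (2 * l)) ^ 2 / 2 * M2) := by field_simp; ring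
    have h2 : 8 * l ^ 2 * ((n * (1 / (2 * l)) + 2 * N + 1) * F t₂) =
        l * (4 * n + 16 * (l * N) + 8 * l) * F t₂ := by field_simp; ring
    rw [h1]
    refine (mul_le_mul_of_nonneg_left hM (by positivity)).trans (h2.le.trans ?_)
    refine mul_le_mul_of_nonneg_right ?_ hF2
    rw [← hlmul]
    rw [mul_div_assoc]
    refine mul_le_mul_of_nonneg_left ?_ hl0.le
    linarith
  have hloc : F t₂ ≤ _ := integral_mul_le_localised (x₀ := x₀) (hw t₂ e2).1 (hw t₂ e2).2.1
    (hw t₂ e2).2.2.1 (hint t₂ e2) (hker t₂) (fun x => (gauss_pos x).le)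
    (backwardKernel_le (by linarith)) (Real.exp_pos _).le hρ hsub
  have hd2 := hdn t₂ e2
  rw [add_sub_cancel_left] at hloc hd2
  have hfin : I t₂ ≤ 4 * rexp (R ^ 2 / l) * ∫ x in ball x₀ ρ, u t₂ x ^ 2 := by
    have h1 : (∫ x, w t₂ x * ‖x - x₀‖ ^ 2 * backwardKernel (t₂ + l) x₀ t₂ x) / ρ ^ 2 ≤ F t₂ / 2 := by
      rw [div_le_iff₀ (by positivity)]; linarith
    have h2 : rexp (-(R ^ 2 / l) + -(n / 2) * Real.log l) * (I t₂ / 2) ≤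
        2 * (rexp (-(n / 2) * Real.log l) * ∫ x in ball x₀ ρ, u t₂ x ^ 2) := by
      have h3 : rexp (-(R ^ 2 / l) + -(n / 2) * Real.log l) * (I t₂ / 2) ≤ F t₂ := hd2
      linarith
    rw [Real.exp_add, Real.exp_neg] at h2
    have e : 0 < rexp (-(n / 2) * Real.log l) := Real.exp_pos _
    have e' : 0 < rexp (R ^ 2 / l) := Real.exp_pos _
    set a := rexp (-(n / 2) * Real.log l)
    set b := rexp (R ^ 2 / l)
    set z := ∫ x in ball x₀ ρ, u t₂ x ^ 2
    have h4 : b⁻¹ * a * (I t₂ / 2) = a * I t₂ / (2 * b) := by field_simp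
    rw [h4, div_le_iff₀ (by positivity)] at h2
    have h5 : a * I t₂ ≤ a * (4 * b * z) := by linarith
    exact le_of_mul_le_mul_left h5 e
  have hexp : rexp (R ^ 2 / l) ≤ rexp (8 * R ^ 2 / ρ ^ 2 * (n + 2 + 4 * Λ₀)) * Q ^ k := by
    rw [← Real.rpow_natCast Q, Real.rpow_def_of_pos (show 0 < Q by positivity), ← Real.exp_add]
    refine Real.exp_le_exp.2 ?_
    have : R ^ 2 / l = 8 * R ^ 2 / ρ ^ 2 * (n + 2 + 4 * Λ₀) +
        Real.log Q * (64 * R ^ 2 / ρ ^ 2) := by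
      rw [hl, hΛ]; field_simp; ring
    rw [this]
    gcongr
  have hQk : Q ^ k * I tm ^ k = (I tm + 2 * I t₁) ^ k := by
    rw [← mul_pow]; congr 1; rw [hQ]; field_simp
  calc I t₂ * I tm ^ k ≤ (4 * (rexp (8 * R ^ 2 / ρ ^ 2 * (n + 2 + 4 * Λ₀)) * Q ^ k) *
        ∫ x in ball x₀ ρ, u t₂ x ^ 2) * I tm ^ k := by
        refine mul_le_mul_of_nonneg_right (hfin.trans ?_) (by positivity)
        gcongr
    _ = 4 * rexp (8 * R ^ 2 / ρ ^ 2 * (n + 2 + 4 * Λ₀)) * (Q ^ k * I tm ^ k) *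
        ∫ x in ball x₀ ρ, u t₂ x ^ 2 := by ring
    _ = _ := by rw [hQk]

end FrequencyBound

section SteklovLimit

variable {n : ℕ} {R μ T : ℝ} {y : ℝ → ℰ n → ℝ}

lemma abs_steklov_sub_le {k t c η : ℝ} {x : ℰ n} (hk : 0 ≤ k)
    (hf : ContinuousOn (fun s => y s x) (Icc t (t + k)))
    (hc : ∀ s ∈ Icc t (t + k), |y s x - c| ≤ η) : |steklov k y t x - k * c| ≤ k * η := by
  have hmap : MapsTo (fun r => t + r) (Icc 0 k) (Icc t (t + k)) := fun r hr =>
    ⟨by linarith [hr.1], by linarith [hr.2]⟩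
  have hI : IntervalIntegrable (fun r => y (t + r) x) volume 0 k := by
    refine ContinuousOn.intervalIntegrable ?_
    rw [uIcc_of_le hk]
    exact hf.comp (by fun_prop) hmap
  have h1 : steklov k y t x - k * c = ∫ r in (0:ℝ)..k, (y (t + r) x - c) := by
    rw [intervalIntegral.integral_sub hI intervalIntegrable_const,
      intervalIntegral.integral_const, sub_zero, smul_eq_mul, steklov]
  rw [h1, ← Real.norm_eq_abs]
  refine (intervalIntegral.norm_integral_le_of_norm_le_const (C := η) fun r hr => ?_).trans_eq ?_
  · rw [uIoc_of_le hk] at hr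
    exact hc _ (hmap (Ioc_subset_Icc_self hr))
  · rw [sub_zero, abs_of_nonneg hk, mul_comm]

namespace IsHarmonicHeatSolution

lemma continuousOn_time (h : IsHarmonicHeatSolution n R μ T y) {x : ℰ n}
    (hx : x ∈ closedBall 0 R) : ContinuousOn (fun t => y t x) (Icc 0 T) :=
  h.continuousOn.comp (f := fun t => (t, x)) (by fun_prop) fun _ ht => ⟨ht, hx⟩

lemma abs_steklov_steklov_sub_le (h : IsHarmonicHeatSolution n R μ T y) {k t c η : ℝ}
    {x : ℰ n} (hk : 0 ≤ k) (ht : 0 ≤ t) (htT : t + 2 * k ≤ T)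
    (hx : x ∈ closedBall 0 R) (hc : ∀ s ∈ Icc t (t + 2 * k), |y s x - c| ≤ η) :
    |_root_.steklov k (_root_.steklov k y) t x - k ^ 2 * c| ≤ k ^ 2 * η := by
  rw [pow_two, mul_assoc, mul_assoc]
  refine abs_steklov_sub_le hk (((h.steklov hk).continuousOn_time hx).mono
    (Icc_subset_Icc ht (by linarith))) fun s hs => abs_steklov_sub_le hk
      ((h.continuousOn_time hx).mono
      (Icc_subset_Icc (ht.trans hs.1) (by linarith [hs.2]))) fun r hr =>
      hc r ⟨hs.1.trans hr.1, by linarith [hr.2, hs.2]⟩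

lemma tendsto_steklov_steklov_div (h : IsHarmonicHeatSolution n R μ T y) {t : ℝ} (ht : t ∈ Ioo 0 T)
    {x : ℰ n} (hx : x ∈ closedBall 0 R) :
    Tendsto (fun k => _root_.steklov k (_root_.steklov k y) t x / k ^ 2) (𝓝[>] 0) (𝓝 (y t x)) := by
  rw [Metric.tendsto_nhds]
  intro η hη
  have hcont : ContinuousAt (fun s => y s x) t :=
    (h.continuousOn_time hx).continuousAt (Icc_mem_nhds ht.1 ht.2)
  obtain ⟨δ, hδ, hball⟩ := Metric.continuousAt_iff.1 hcont (η / 2) (by positivity)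
  have hpos : 0 < min (δ / 2) ((T - t) / 2) := lt_min (by positivity) (by linarith [ht.2])
  filter_upwards [Ioo_mem_nhdsGT hpos] with k hk
  have h1 : k < δ / 2 := hk.2.trans_le (min_le_left _ _)
  have h2 : k < (T - t) / 2 := hk.2.trans_le (min_le_right _ _)
  have hk2 : 0 < k ^ 2 := pow_pos hk.1 2
  have h3 := h.abs_steklov_steklov_sub_le (c := y t x) (η := η / 2) hk.1.le ht.1.le (by linarith) hx
    fun s hs => (hball (x := s) (by
      rw [Real.dist_eq, abs_of_nonneg (by linarith [hs.1])]; linarith [hs.2])).le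
  rw [Real.dist_eq, show _root_.steklov k (_root_.steklov k y) t x / k ^ 2 - y t x =
    (_root_.steklov k (_root_.steklov k y) t x - k ^ 2 * y t x) / k ^ 2 by
      rw [sub_div, mul_div_cancel_left₀ _ hk2.ne'], abs_div,
    abs_of_pos hk2, div_lt_iff₀ hk2]
  refine h3.trans_lt ?_
  rw [mul_comm]
  exact mul_lt_mul_of_pos_right (by linarith) hk2

lemma tendsto_integral_sq_steklov (h : IsHarmonicHeatSolution n R μ T y) {t : ℝ}
    (ht : t ∈ Ioo 0 T) {S : Set (ℰ n)} (hS : MeasurableSet S)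
    (hSR : S ⊆ ball 0 R) :
    Tendsto (fun k => (∫ x in S, _root_.steklov k (_root_.steklov k y) t x ^ 2) / k ^ 4) (𝓝[>] 0)
      (𝓝 (∫ x in S, y t x ^ 2)) := by
  obtain ⟨M, hM0, hM⟩ := h.exists_abs_le
  have hSf : volume S ≠ ⊤ := ((measure_mono hSR).trans_lt measure_ball_lt_top).ne
  have hcl : S ⊆ closedBall 0 R := hSR.trans ball_subset_closedBall
  have hpos : 0 < (T - t) / 2 := by linarith [ht.2]
  have hev : ∀ᶠ k in 𝓝[>] (0:ℝ), 0 < k ∧ k < (T - t) / 2 := Ioo_mem_nhdsGT hpos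
  have heq : (fun k => (∫ x in S, _root_.steklov k (_root_.steklov k y) t x ^ 2) / k ^ 4) =
      fun k => ∫ x in S, (_root_.steklov k (_root_.steklov k y) t x / k ^ 2) ^ 2 := by
    ext k
    rw [← integral_div]
    congr 1; ext x
    rw [div_pow, ← pow_mul]
  rw [heq]
  refine tendsto_integral_filter_of_dominated_convergence (fun _ => M ^ 2) ?_ ?_ ?_ ?_
  · filter_upwards [hev] with k hk
    refine ContinuousOn.aestronglyMeasurable (s := S) ?_ hS
    exact ((((h.steklov hk.1.le).steklov hk.1.le).continuousOn_slice
      ⟨ht.1.le, by linarith [hk.2]⟩).mono hcl |>.div_const _).pow 2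
  · filter_upwards [hev] with k hk
    refine (ae_restrict_mem hS).mono fun x hx => ?_
    have hk2 : 0 < k ^ 2 := pow_pos hk.1 2
    have h3 := h.abs_steklov_steklov_sub_le (c := 0) (η := M) hk.1.le ht.1.le (by linarith [hk.2])
      (hcl hx) fun s hs => by
        rw [sub_zero]
        exact hM s ⟨ht.1.le.trans hs.1, by linarith [hs.2, hk.2]⟩ x (hcl hx)
    rw [mul_zero, sub_zero] at h3
    rw [Real.norm_eq_abs, abs_pow, abs_div, abs_of_pos hk2]
    refine pow_le_pow_left₀ (by positivity) ?_ 2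
    rw [div_le_iff₀ hk2, mul_comm]
    exact h3
  · have : IsFiniteMeasure (volume.restrict S) := ⟨by
      rw [Measure.restrict_apply_univ]; exact hSf.lt_top⟩
    exact integrable_const _
  · exact (ae_restrict_mem hS).mono fun x hx => (h.tendsto_steklov_steklov_div ht (hcl hx)).pow 2

lemma integral_sq_mul_pow_le_of_lt [NeZero n] (h : IsHarmonicHeatSolution n R μ T y) (hμ : 0 < μ)
    (hR : 0 < R) {x₀ : ℰ n} {ρ : ℝ} (hρ : 0 < ρ) (hx₀ : ‖x₀‖ < R)
    (hρR : ρ ≤ R) (hsub : ball x₀ ρ ⊆ ball 0 R)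
    {t₁ t₂ : ℝ} (ht₁ : 0 < t₁) (ht : t₁ < t₂) (ht₂ : t₂ < T) (hL : t₂ - t₁ ≤ 1)
    {k : ℕ} (hk : 64 * R ^ 2 / ρ ^ 2 ≤ k) :
    (∫ x in ball 0 R, y t₂ x ^ 2) * (∫ x in ball 0 R, y ((t₁ + t₂) / 2) x ^ 2) ^ k ≤
      4 * rexp (8 * R ^ 2 / ρ ^ 2 * (n + 2 + 4 * (μ ^ 2 * ‖x₀‖ ^ 2 / 8 * (t₂ - t₁)
          + 3 * (t₂ - t₁) + 4 * R ^ 2 / (t₂ - t₁)))) *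
        ((∫ x in ball 0 R, y ((t₁ + t₂) / 2) x ^ 2) +
          2 * ∫ x in ball 0 R, y t₁ x ^ 2) ^ k *
        ∫ x in ball x₀ ρ, y t₂ x ^ 2 := by
  set P := rexp (8 * R ^ 2 / ρ ^ 2 * (n + 2 + 4 * (μ ^ 2 * ‖x₀‖ ^ 2 / 8 * (t₂ - t₁)
          + 3 * (t₂ - t₁) + 4 * R ^ 2 / (t₂ - t₁)))) with hP
  have lim : ∀ t ∈ Ioo 0 T, Tendsto (fun ε => (∫ x in ball 0 R,
      _root_.steklov ε (_root_.steklov ε y) t x ^ 2) / ε ^ 4) (𝓝[>] 0)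
      (𝓝 (∫ x in ball 0 R, y t x ^ 2)) := fun t ht =>
    h.tendsto_integral_sq_steklov ht measurableSet_ball subset_rfl
  have l1 := lim t₁ ⟨ht₁, ht.trans ht₂⟩
  have l2 := lim t₂ ⟨ht₁.trans ht, ht₂⟩
  have lm := lim ((t₁ + t₂) / 2) ⟨by linarith, by linarith⟩
  have lB := h.tendsto_integral_sq_steklov (t := t₂) ⟨ht₁.trans ht, ht₂⟩ measurableSet_ball hsub
  refine le_of_tendsto_of_tendsto (l2.mul (lm.pow k))
    ((((lm.add (l1.const_mul 2)).pow k).const_mul (4 * P)).mul lB) ?_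
  have hpos : 0 < (T - t₂) / 2 := by linarith
  filter_upwards [Ioo_mem_nhdsGT hpos] with ε hε
  obtain ⟨C, hC, hB⟩ := h.exists_boundaryRegular_steklov hR hε.1 hε.1
  have key := ((h.steklov hε.1.le).steklov hε.1.le).integral_sq_mul_pow_le hB hμ hR hC hx₀ hρ hρR hsub
    ht₁ ht (by linarith [hε.2]) hL hk
  rw [← hP] at key
  have hε4 : 0 < ε ^ 4 := pow_pos hε.1 4
  set v := _root_.steklov ε (_root_.steklov ε y)
  set e := ε ^ 4
  set a := ∫ x in ball 0 R, v t₂ x ^ 2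
  set b := ∫ x in ball 0 R, v ((t₁ + t₂) / 2) x ^ 2
  set c := ∫ x in ball 0 R, v t₁ x ^ 2
  set z := ∫ x in ball x₀ ρ, v t₂ x ^ 2
  have e1 : a / e * (b / e) ^ k = a * b ^ k / (e * e ^ k) := by rw [div_pow]; field_simp
  have e2 : 4 * P * (b / e + 2 * (c / e)) ^ k * (z / e) =
      4 * P * (b + 2 * c) ^ k * z / (e * e ^ k) := by
    rw [show b / e + 2 * (c / e) = (b + 2 * c) / e by ring, div_pow]; field_simp
  rw [e1, e2]
  gcongr

end IsHarmonicHeatSolution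

/-- The supremum of `v²` over the closed ball of radius `R`. -/
noncomputable def supSq (R : ℝ) (v : ℰ n → ℝ) : ℝ := sSup ((fun x => v x ^ 2) '' closedBall 0 R)

lemma supSq_nonneg (v : ℰ n → ℝ) : 0 ≤ supSq R v :=
  Real.sSup_nonneg (by rintro _ ⟨x, _, rfl⟩; exact sq_nonneg _)

lemma supSq_le (hR : 0 ≤ R) {v : ℰ n → ℝ} {c : ℝ}
    (h : ∀ x ∈ closedBall 0 R, v x ^ 2 ≤ c) : supSq R v ≤ c :=
  csSup_le ((nonempty_closedBall.2 hR).image _) (by rintro _ ⟨x, hx, rfl⟩; exact h x hx)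

namespace IsHarmonicHeatSolution

lemma sq_le_supSq (h : IsHarmonicHeatSolution n R μ T y) {t : ℝ} (ht : t ∈ Icc 0 T)
    {x : ℰ n} (hx : x ∈ closedBall 0 R) : y t x ^ 2 ≤ supSq R (y t) :=
  le_csSup ((isCompact_closedBall _ _).bddAbove_image ((h.continuousOn_slice ht).pow 2))
    ⟨x, hx, rfl⟩

lemma abs_le_sqrt_supSq (h : IsHarmonicHeatSolution n R μ T y) {t : ℝ} (ht : t ∈ Icc 0 T)
    {x : ℰ n} (hx : x ∈ closedBall 0 R) : |y t x| ≤ √(supSq R (y t)) :=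
  Real.abs_le_sqrt (h.sq_le_supSq ht hx)

lemma supSq_antitone (h : IsHarmonicHeatSolution n R μ T y) (hR : 0 ≤ R) {s t : ℝ} (hs : 0 ≤ s)
    (hst : s ≤ t) (ht : t ≤ T) : supSq R (y t) ≤ supSq R (y s) := by
  refine supSq_le hR fun x hx => ?_
  have h1 := (h.shift hs le_rfl).abs_le (Real.sqrt_nonneg (supSq R (y s)))
    (fun z hz => by simpa using h.abs_le_sqrt_supSq ⟨hs, hst.trans ht⟩ hz) (t - s)
    ⟨by linarith, by linarith⟩ x hx
  rw [add_sub_cancel] at h1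
  rw [← sq_abs, ← Real.sq_sqrt (supSq_nonneg (R := R) (y s))]
  exact pow_le_pow_left₀ (abs_nonneg _) h1 2

lemma integral_sq_le_supSq (h : IsHarmonicHeatSolution n R μ T y) {t : ℝ} (ht : t ∈ Icc 0 T)
    {S : Set (ℰ n)} (hS : S ⊆ ball 0 R) :
    ∫ x in S, y t x ^ 2 ≤ volume.real (ball (0 : ℰ n) R) * supSq R (y t) := by
  refine (setIntegral_mono_set (h.integrableOn_sq ht) (ae_of_all _ fun x => sq_nonneg _)
    hS.eventuallyLE).trans ?_
  have h1 := setIntegral_mono_on (h.integrableOn_sq ht)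
    (integrableOn_const (C := supSq R (y t)) (measure_ball_lt_top (x := 0)
      (r := R)).ne) measurableSet_ball fun x hx => h.sq_le_supSq ht (ball_subset_closedBall hx)
  simpa using h1

lemma continuousOn_integral_sq (h : IsHarmonicHeatSolution n R μ T y)
    {S : Set (ℰ n)} (hS : MeasurableSet S) (hSR : S ⊆ ball 0 R) :
    ContinuousOn (fun t => ∫ x in S, y t x ^ 2) (Icc 0 T) := by
  obtain ⟨M, hM0, hM⟩ := h.exists_abs_le
  have hcl : S ⊆ closedBall 0 R := hSR.trans ball_subset_closedBall
  refine continuousOn_of_dominated (bound := fun _ => M ^ 2) (fun t ht => ?_) (fun t ht => ?_) ?_ ?_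
  · exact (((h.continuousOn_slice ht).mono hcl).pow 2).aestronglyMeasurable hS
  · refine (ae_restrict_mem hS).mono fun x hx => ?_
    rw [Real.norm_eq_abs, abs_pow]
    exact pow_le_pow_left₀ (abs_nonneg _) (hM t ht x (hcl hx)) 2
  · exact integrableOn_const ((measure_mono hSR).trans_lt measure_ball_lt_top).ne
  · exact (ae_restrict_mem hS).mono fun x hx => (h.continuousOn_time (hcl hx)).pow 2

lemma mul_le_integral_of_le (h : IsHarmonicHeatSolution n R μ T y)
    {S : Set (ℰ n)} (hS : MeasurableSet S) (hSR : S ⊆ ball 0 R)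
    {t₁ t₂ a b c D : ℝ} (ht₁ : 0 ≤ t₁) (ht₂ : t₂ ≤ T) (ha : t₁ ≤ a) (hab : a ≤ b) (hb : b ≤ t₂)
    (hD : 0 ≤ D) (hc : ∀ s ∈ Icc a b, c ≤ D * ∫ x in S, y s x ^ 2) :
    (b - a) * c ≤ D * ∫ s in t₁..t₂, ∫ x in S, y s x ^ 2 := by
  have hint : ∀ p q, t₁ ≤ p → p ≤ q → q ≤ t₂ →
      IntervalIntegrable (fun s => ∫ x in S, y s x ^ 2) volume p q := fun p q hp hpq hq => by
    refine ContinuousOn.intervalIntegrable ?_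
    rw [uIcc_of_le hpq]
    exact (h.continuousOn_integral_sq hS hSR).mono (Icc_subset_Icc (ht₁.trans hp) (hq.trans ht₂))
  have h1 := intervalIntegral.integral_mono_on hab intervalIntegrable_const
    ((hint a b ha hab hb).const_mul D) hc
  rw [intervalIntegral.integral_const, smul_eq_mul, intervalIntegral.integral_const_mul] at h1
  refine h1.trans (mul_le_mul_of_nonneg_left ?_ hD)
  exact intervalIntegral.integral_mono_interval ha hab hb
    (ae_of_all _ fun s => integral_nonneg fun x => sq_nonneg _)
    (hint t₁ t₂ le_rfl (ha.trans (hab.trans hb)) le_rfl)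

lemma supSq_le_exp_mul_integral (h : IsHarmonicHeatSolution n R μ T y) (hμ : 0 < μ) (hR : 0 < R)
    {a b L : ℝ} (ha : 0 < a) (hL : 0 < L) (hab : L / 4 ≤ b - a) (hb : b < T) :
    supSq R (y b) ≤ rexp (n / L) *
      (volume.real (ball (0 : ℰ n) R) * ∫ z in ball 0 R, y a z ^ 2) := by
  refine supSq_le hR.le fun x hx => (h.sq_le_integral_sq hμ hR ha (by linarith) hb hx).trans ?_
  have h0 : 0 ≤ volume.real (ball (0 : ℰ n) R) * ∫ z in ball 0 R, y a z ^ 2 :=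
    mul_nonneg measureReal_nonneg (integral_nonneg fun x => sq_nonneg _)
  refine mul_le_mul_of_nonneg_right (Real.exp_le_exp.2 ?_) h0
  have h1 : L ≤ 4 * π * (b - a) := by
    nlinarith [Real.pi_gt_three, mul_nonneg (show 0 ≤ π - 1 by linarith [Real.pi_gt_three])
      (show 0 ≤ b - a by linarith)]
  have h2 : 1 - 1 / L ≤ Real.log (4 * π * (b - a)) := by
    have := Real.one_sub_inv_le_log_of_pos hL
    rw [one_div]
    exact this.trans (Real.log_le_log hL h1)
  have h3 : (n : ℝ) * (-Real.log (4 * π * (b - a))) ≤ n * (1 / L) :=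
    mul_le_mul_of_nonneg_left (by linarith) n.cast_nonneg
  rw [mul_one_div] at h3
  linarith

end IsHarmonicHeatSolution

lemma interpolation_exponent_le {R μ L l x c N : ℝ} (hL : 0 < L) (hL1 : L ≤ 1) (hμ : 0 < μ)
    (hμL : μ * L ≤ 1) (hl : L / 2 ≤ l) (hlL : l ≤ L) (hx : 0 ≤ x) (hxR : x ≤ R) (hc : 0 ≤ c)
    (hN : 0 ≤ N) :
    c * (N + 2 + 4 * (μ ^ 2 * x ^ 2 / 8 * l + 3 * l + 4 * R ^ 2 / l)) ≤
      c * (N + 14 + 36 * R ^ 2) / L := by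
  have hl0 : 0 < l := by linarith
  rw [mul_div_assoc c]
  refine mul_le_mul_of_nonneg_left ?_ hc
  rw [le_div_iff₀ hL]
  have h1 : 4 * R ^ 2 / l * L ≤ 8 * R ^ 2 := by
    rw [div_mul_eq_mul_div, div_le_iff₀ hl0]
    nlinarith [sq_nonneg R]
  have h2 : μ ^ 2 * x ^ 2 / 8 * l * L ≤ R ^ 2 := by
    have h3 : (μ * L) ^ 2 ≤ 1 := pow_le_one₀ (by positivity) hμL
    have h4 : x ^ 2 ≤ R ^ 2 := pow_le_pow_left₀ hx hxR 2
    calc μ ^ 2 * x ^ 2 / 8 * l * L ≤ μ ^ 2 * R ^ 2 / 1 * L * L := by gcongr; norm_num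
      _ = (μ * L) ^ 2 * R ^ 2 := by ring
      _ ≤ R ^ 2 := mul_le_of_le_one_left (sq_nonneg _) h3
  have h5 : l * L ≤ 1 := mul_le_one₀ (hlL.trans hL1) hL.le hL1
  nlinarith

namespace IsHarmonicHeatSolution

/-- Interpolation between the observation on a small ball and the size at an earlier time. -/
lemma exists_interpolation [NeZero n] (hR : 0 < R) {x₀ : ℰ n} {ρ : ℝ}
    (hρ : 0 < ρ) (hx₀ : ‖x₀‖ < R) (hρR : ρ ≤ R) (hsub : ball x₀ ρ ⊆ ball 0 R) :
    ∃ C : ℝ, 0 ≤ C ∧ ∃ k : ℕ, 0 < k ∧ ∀ (μ T : ℝ) (y : ℝ → ℰ n → ℝ),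
      IsHarmonicHeatSolution n R μ T y → 0 < μ → ∀ t₁ t₂, 0 < t₁ → t₁ < t₂ → t₂ < T →
      t₂ - t₁ ≤ 1 → μ * (t₂ - t₁) ≤ 1 →
      supSq R (y t₂) ^ (k + 1) ≤ rexp (C / (t₂ - t₁)) * supSq R (y t₁) ^ k *
        ∫ s in t₁..t₂, ∫ x in ball x₀ ρ, y s x ^ 2 := by
  obtain ⟨k, hk⟩ := exists_nat_ge (64 * R ^ 2 / ρ ^ 2)
  have hk0 : 0 < k := by
    have : (0:ℝ) < k := lt_of_lt_of_le (by positivity) hk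
    exact_mod_cast this
  set V := volume.real (ball (0 : ℰ n) R)
  have hV0 : 0 ≤ V := measureReal_nonneg
  set C₁ := 8 * R ^ 2 / ρ ^ 2 * (n + 14 + 36 * R ^ 2) with hC₁
  set K := V ^ (k + 1) * 4 * (3 * V) ^ k with hK
  have hK0 : 0 ≤ K := by positivity
  refine ⟨(k + 1) * n + C₁ + K + 4, by positivity, k, hk0,
    fun μ T y h hμ t₁ t₂ ht₁ ht ht₂ hL hμL => ?_⟩
  set L := t₂ - t₁
  have hL0 : 0 < L := sub_pos.2 ht
  have hIn : ∀ {c : ℝ}, 0 ≤ c → c ≤ c / L := fun hc => le_div_self hc hL0 hL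
  set m₁ := supSq R (y t₁)
  set m₂ := supSq R (y t₂)
  have hm₁0 : 0 ≤ m₁ := supSq_nonneg _
  have hm₂0 : 0 ≤ m₂ := supSq_nonneg _
  set D := rexp (((k + 1) * n + C₁ + K) / L) * m₁ ^ k with hD
  have hD0 : 0 ≤ D := by positivity
  have hs : ∀ s ∈ Icc (t₁ + L / 2) (t₁ + 3 * L / 4), m₂ ^ (k + 1) ≤
      D * ∫ x in ball x₀ ρ, y s x ^ 2 := fun s hs => by
    have hs1 := hs.1
    have hs2 := hs.2
    have hkey := h.integral_sq_mul_pow_le_of_lt hμ hR hρ hx₀ hρR hsub ht₁ (t₂ := s) (by linarith)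
      (by linarith) (by linarith) hk
    have hup : ∀ t ∈ Icc t₁ t₂, ∫ x in ball 0 R, y t x ^ 2 ≤ V * m₁ :=
      fun t ht => (h.integral_sq_le_supSq ⟨by linarith [ht.1], by linarith [ht.2]⟩ subset_rfl).trans
        (mul_le_mul_of_nonneg_left (h.supSq_antitone hR.le ht₁.le ht.1 (by linarith [ht.2])) hV0)
    have hdn1 := h.supSq_le_exp_mul_integral hμ hR (a := s) (b := t₂) (L := L) (by linarith) hL0
      (by linarith) ht₂
    have hdn2 := h.supSq_le_exp_mul_integral hμ hR (a := (t₁ + s) / 2) (b := t₂) (L := L)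
      (by linarith) hL0 (by linarith) ht₂
    have hu1 := hup t₁ ⟨le_rfl, ht.le⟩
    have hu2 := hup ((t₁ + s) / 2) ⟨by linarith, by linarith⟩
    have hP := interpolation_exponent_le hL0 hL hμ hμL (l := s - t₁) (by linarith) (by linarith)
      (norm_nonneg x₀) hx₀.le (show 0 ≤ 8 * R ^ 2 / ρ ^ 2 by positivity) n.cast_nonneg
    rw [← hC₁] at hP
    set z := ∫ x in ball x₀ ρ, y s x ^ 2
    set I₁ := ∫ x in ball 0 R, y t₁ x ^ 2
    set I₂ := ∫ x in ball 0 R, y s x ^ 2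
    set I₃ := ∫ x in ball 0 R, y ((t₁ + s) / 2) x ^ 2
    set P := 8 * R ^ 2 / ρ ^ 2 * (n + 2 + 4 * (μ ^ 2 * ‖x₀‖ ^ 2 / 8 * (s - t₁)
          + 3 * (s - t₁) + 4 * R ^ 2 / (s - t₁)))
    have hKe : K ≤ rexp (K / L) :=
      (hIn hK0).trans ((le_add_of_nonneg_right zero_le_one).trans (Real.add_one_le_exp _))
    calc m₂ ^ (k + 1) = m₂ * m₂ ^ k := pow_succ' _ _
      _ ≤ (rexp (n / L) * (V * I₂)) * (rexp (n / L) * (V * I₃)) ^ k :=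
          mul_le_mul hdn1 (pow_le_pow_left₀ hm₂0 hdn2 k) (by positivity) (by positivity)
      _ = rexp (n / L) ^ (k + 1) * V ^ (k + 1) * (I₂ * I₃ ^ k) := by rw [mul_pow, mul_pow]; ring
      _ ≤ rexp (n / L) ^ (k + 1) * V ^ (k + 1) *
          (4 * rexp (C₁ / L) * (V * m₁ + 2 * (V * m₁)) ^ k * z) := by
          refine mul_le_mul_of_nonneg_left (hkey.trans ?_) (by positivity)
          gcongr
      _ = K * (rexp (n / L) ^ (k + 1) * rexp (C₁ / L)) * m₁ ^ k * z := by
          rw [hK, show V * m₁ + 2 * (V * m₁) = 3 * V * m₁ by ring, mul_pow (3 * V)]; ring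
      _ ≤ rexp (K / L) * (rexp (n / L) ^ (k + 1) * rexp (C₁ / L)) * m₁ ^ k * z := by
          gcongr
      _ = D * z := by
          rw [hD, ← Real.exp_nat_mul, ← Real.exp_add, ← Real.exp_add]
          congr 3
          push_cast
          ring
  have hfin := h.mul_le_integral_of_le measurableSet_ball hsub ht₁.le ht₂.le
    (by linarith) (by linarith) (by linarith) hD0 hs
  rw [show t₁ + 3 * L / 4 - (t₁ + L / 2) = L / 4 by ring] at hfin
  have h4 : 1 ≤ rexp (4 / L) * (L / 4) := by
    have := Real.add_one_le_exp (4 / L)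
    calc (1:ℝ) = 4 / L * (L / 4) := by field_simp
      _ ≤ rexp (4 / L) * (L / 4) := by gcongr; linarith
  calc m₂ ^ (k + 1) ≤ (rexp (4 / L) * (L / 4)) * m₂ ^ (k + 1) :=
        le_mul_of_one_le_left (by positivity) h4
    _ = rexp (4 / L) * (L / 4 * m₂ ^ (k + 1)) := by ring
    _ ≤ rexp (4 / L) * (D * ∫ s in t₁..t₂, ∫ x in ball x₀ ρ, y s x ^ 2) :=
        mul_le_mul_of_nonneg_left hfin (Real.exp_pos _).le
    _ = _ := by
        rw [hD, ← mul_assoc, ← mul_assoc, ← Real.exp_add]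
        congr 3
        ring

end IsHarmonicHeatSolution

end SteklovLimit

lemma le_one_of_pow_succ_le {b : ℕ → ℝ} {M : ℝ} (hb : ∀ j, 0 ≤ b j) (hM : ∀ j, b j ≤ M) {k : ℕ}
    (hk : 0 < k) (h : ∀ j, b j ^ (k + 1) ≤ b (j + 1) ^ k) : b 0 ≤ 1 := by
  by_contra! h1
  have key : ∀ j, b 0 ≤ b j ∧ b 0 ^ j ≤ b j ^ k := by
    intro j
    induction j with
    | zero => exact ⟨le_rfl, by rw [pow_zero]; exact one_le_pow₀ h1.le⟩
    | succ j ih =>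
      have hj1 : 1 ≤ b j := h1.le.trans ih.1
      constructor
      · refine ih.1.trans (le_of_pow_le_pow_left₀ hk.ne' (hb _) (le_trans ?_ (h j)))
        exact pow_le_pow_right₀ hj1 k.le_succ
      · rw [pow_succ]
        refine le_trans ?_ (h j)
        rw [pow_succ]
        exact mul_le_mul ih.2 ih.1 (hb _) (pow_nonneg (hb _) _)
  obtain ⟨j, hj⟩ := pow_unbounded_of_one_lt (M ^ k) h1
  exact absurd ((key j).2.trans (pow_le_pow_left₀ (hb j) (hM j) k)) (not_le.2 hj)

lemma le_exp_mul_of_interpolation {C M O t₀ : ℝ} {m : ℝ → ℝ} {k : ℕ} (hk : 0 < k) (hC : 0 ≤ C)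
    (ht₀ : 0 < t₀) (hO : 0 ≤ O) (hm : ∀ t, 0 ≤ m t) (hM : ∀ t ∈ Ioc 0 t₀, m t ≤ M)
    (h : ∀ t₁ t₂, 0 < t₁ → t₁ < t₂ → t₂ ≤ t₀ →
      m t₂ ^ (k + 1) ≤ rexp (C / (t₂ - t₁)) * m t₁ ^ k * O) :
    m t₀ ≤ rexp (2 * C * (2 * k + 1) / t₀) * O := by
  rcases hO.eq_or_lt with hO | hO
  · have h1 := h (t₀ / 2) t₀ (by linarith) (by linarith) le_rfl
    rw [← hO, mul_zero] at h1 ⊢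
    exact (pow_eq_zero_iff (n := k + 1) (by simp)).1 (le_antisymm h1 (pow_nonneg (hm _) _)) |>.le
  set q : ℝ := 2 * k / (2 * k + 1) with hq
  have hq0 : 0 < q := by positivity
  have hq1 : q < 1 := by rw [hq, div_lt_one (by positivity)]; linarith
  set B := 2 * C * (2 * k + 1) with hB
  have hB0 : 0 ≤ B := by positivity
  set t : ℕ → ℝ := fun j => t₀ * q ^ j with ht
  have htpos : ∀ j, 0 < t j := fun j => by positivity
  have htle : ∀ j, t j ≤ t₀ := fun j => mul_le_of_le_one_right ht₀.le (pow_le_one₀ hq0.le hq1.le)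
  set b : ℕ → ℝ := fun j => m (t j) / (rexp (B / t j) * O) with hb
  have hstep : ∀ j, b j ^ (k + 1) ≤ b (j + 1) ^ k := fun j => by
    have hts : t (j + 1) = t j * q := by simp only [ht]; ring
    have hlt : t (j + 1) < t j := by rw [hts]; exact mul_lt_of_lt_one_right (htpos j) hq1
    have h1 := h (t (j + 1)) (t j) (htpos _) hlt (htle j)
    have hexp : rexp (C / (t j - t (j + 1))) * rexp (B / t (j + 1)) ^ k =
        rexp (B / t j) ^ (k + 1) := by
      rw [← Real.exp_nat_mul, ← Real.exp_nat_mul, ← Real.exp_add, hts, hB, hq]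
      congr 1
      have := htpos j
      have h2 : t j - t j * (2 * k / (2 * k + 1)) = t j / (2 * k + 1) := by field_simp; ring
      rw [h2]
      push_cast
      field_simp
      ring
    simp only [hb]
    rw [div_pow, div_pow, div_le_div_iff₀ (by positivity) (by positivity), mul_pow, mul_pow, ← hexp]
    calc m (t j) ^ (k + 1) * (rexp (B / t (j + 1)) ^ k * O ^ k) ≤
        rexp (C / (t j - t (j + 1))) * m (t (j + 1)) ^ k * O *
          (rexp (B / t (j + 1)) ^ k * O ^ k) := by gcongr
      _ = _ := by ring
  have hbM : ∀ j, b j ≤ M / O := fun j => by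
    have h1 : 1 ≤ rexp (B / t j) := Real.one_le_exp (div_nonneg hB0 (htpos j).le)
    have h2 := hM (t j) ⟨htpos j, htle j⟩
    exact div_le_div₀ ((hm _).trans h2) h2 hO (le_mul_of_one_le_left hO.le h1)
  have h0 := le_one_of_pow_succ_le (fun j => div_nonneg (hm _) (by positivity)) hbM hk hstep
  simp only [ht, pow_zero, mul_one] at h0
  rwa [div_le_one (by positivity)] at h0

/-- Observability at short times. -/
lemma IsHarmonicHeatSolution.exists_supSq_le_of_short_time {n : ℕ} [NeZero n] {R : ℝ} (hR : 0 < R)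
    {x₀ : ℰ n} {ρ : ℝ} (hρ : 0 < ρ) (hx₀ : ‖x₀‖ < R) (hρR : ρ ≤ R)
    (hsub : ball x₀ ρ ⊆ ball 0 R) :
    ∃ C : ℝ, 0 ≤ C ∧ ∀ (μ T : ℝ) (y : ℝ → ℰ n → ℝ),
      IsHarmonicHeatSolution n R μ T y → 0 < μ → ∀ t₀, 0 < t₀ → t₀ < T → t₀ ≤ 1 → μ * t₀ ≤ 1 →
      supSq R (y t₀) ≤ rexp (C / t₀) * ∫ s in (0:ℝ)..t₀, ∫ x in ball x₀ ρ, y s x ^ 2 := by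
  obtain ⟨C, hC, k, hk, hint⟩ := exists_interpolation (n := n) hR hρ hx₀ hρR hsub
  refine ⟨2 * C * (2 * k + 1), by positivity, fun μ T y h hμ t₀ ht₀ ht₀T ht₀1 hμt => ?_⟩
  have hI : IntervalIntegrable (fun s => ∫ x in ball x₀ ρ, y s x ^ 2) volume 0 t₀ := by
    refine ContinuousOn.intervalIntegrable ?_
    rw [uIcc_of_le ht₀.le]
    exact (h.continuousOn_integral_sq measurableSet_ball hsub).mono (Icc_subset_Icc le_rfl ht₀T.le)
  have hz : ∀ s, 0 ≤ ∫ x in ball x₀ ρ, y s x ^ 2 := fun s => integral_nonneg fun x => sq_nonneg _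
  refine le_exp_mul_of_interpolation (m := fun t => supSq R (y t)) (M := supSq R (y 0)) hk hC ht₀
    (intervalIntegral.integral_nonneg ht₀.le fun s _ => hz s) (fun t => supSq_nonneg _)
    (fun t ht => h.supSq_antitone hR.le le_rfl ht.1.le (ht.2.trans ht₀T.le)) fun t₁ t₂ h1 h2 h3 => ?_
  refine (hint μ T y h hμ t₁ t₂ h1 h2 (h3.trans_lt ht₀T) (by linarith) ?_).trans ?_
  · exact (mul_le_mul_of_nonneg_left (by linarith) hμ.le).trans hμt
  · refine mul_le_mul_of_nonneg_left ?_ (mul_nonneg (Real.exp_pos _).le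
      (pow_nonneg (supSq_nonneg _) _))
    exact intervalIntegral.integral_mono_interval h1.le h2.le h3 (ae_of_all _ hz) hI

/-- Lagrange extrapolation weights at the origin for the nodes `1 + κ j / N`, `0 ≤ j ≤ N`. -/
lemma exists_extrapolation_weights {N : ℕ} (hN : 1 ≤ N) {κ : ℝ} (hκ : 0 < κ) (hκ1 : κ ≤ 1) :
    ∃ w : ℕ → ℝ, (∀ k ≤ N, ∑ j ∈ Finset.range (N + 1), w j * (1 + κ * j / N) ^ k = 0 ^ k) ∧
        ∀ j ∈ Finset.range (N + 1), |w j| ≤ (2 * N / κ) ^ N := by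
  have hN0 : (0 : ℝ) < N := by exact_mod_cast hN
  set v : ℕ → ℝ := fun j => 1 + κ * j / N with hv
  have hvdiff : ∀ i j : ℕ, v j - v i = κ / N * ((j : ℝ) - i) := by
    intro i j
    simp only [hv]
    field_simp
    ring
  have hinj : InjOn v (Finset.range (N + 1)) := by
    intro i _ j _ hij
    have h := hvdiff i j
    rw [hij, sub_self] at h
    have h2 : (j : ℝ) - i = 0 := by
      rcases mul_eq_zero.1 h.symm with h | h
      · exact absurd h (by positivity)
      · exact h
    exact_mod_cast (sub_eq_zero.1 h2).symm
  refine ⟨fun j => (Lagrange.basis (Finset.range (N + 1)) v j).eval 0, fun k hk => ?_,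
    fun j hj => ?_⟩
  · have h := Lagrange.eq_interpolate (f := (Polynomial.X : Polynomial ℝ) ^ k) hinj (by
      rw [Polynomial.degree_X_pow, Finset.card_range]
      exact_mod_cast Nat.lt_succ_of_le hk)
    have h2 := congrArg (Polynomial.eval 0) h
    rw [Lagrange.interpolate_apply, Polynomial.eval_finsetSum] at h2
    simp only [Polynomial.eval_pow, Polynomial.eval_X, Polynomial.eval_mul, Polynomial.eval_C] at h2
    rw [h2]
    exact Finset.sum_congr rfl fun j _ => mul_comm _ _
  · have hcard : ((Finset.range (N + 1)).erase j).card = N := by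
      rw [Finset.card_erase_of_mem hj, Finset.card_range, Nat.add_sub_cancel]
    simp only [Lagrange.basis]
    rw [Polynomial.eval_prod, Finset.abs_prod]
    refine (Finset.prod_le_prod (g := fun _ => 2 * N / κ) (fun i _ => abs_nonneg _)
      fun i hi => ?_).trans_eq (by rw [Finset.prod_const, hcard])
    obtain ⟨hij, hi⟩ := Finset.mem_erase.1 hi
    have hiN : (i : ℝ) ≤ N := by exact_mod_cast Nat.lt_succ_iff.1 (Finset.mem_range.1 hi)
    have h1 : (1 : ℝ) ≤ |(j : ℝ) - i| := by
      have : (1 : ℤ) ≤ |(j : ℤ) - i| := Int.one_le_abs (by omega)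
      exact_mod_cast this
    have hvi : |v i| ≤ 2 := by
      have h0 : 0 ≤ κ * i / N := by positivity
      have h3 : κ * i / N ≤ 1 := by
        rw [div_le_one hN0]
        nlinarith [(Nat.cast_nonneg i : (0 : ℝ) ≤ i)]
      rw [abs_le]
      constructor <;> simp only [hv] <;> linarith
    simp only [Lagrange.basisDivisor, Polynomial.eval_mul, Polynomial.eval_C, Polynomial.eval_sub,
      Polynomial.eval_X, zero_sub, abs_mul, abs_neg, abs_inv]
    rw [hvdiff, abs_mul, abs_of_pos (by positivity : 0 < κ / N), inv_mul_eq_div,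
      div_le_iff₀ (by positivity)]
    refine hvi.trans ?_
    have : 2 * (N : ℝ) / κ * (κ / N * |(j : ℝ) - i|) = 2 * |(j : ℝ) - i| := by field_simp
    rw [this]
    linarith

/-- If extrapolation weights reproduce polynomials of degree at most `N` at the origin, they
almost reproduce slowly varying exponentials. -/
lemma abs_one_sub_sum_exp_le {N : ℕ} {w τ : ℕ → ℝ}
    (hw : ∀ k ≤ N, ∑ j ∈ Finset.range (N + 1), w j * τ j ^ k = 0 ^ k) {Λ : ℝ}
    (hΛ : ∑ j ∈ Finset.range (N + 1), |w j| ≤ Λ)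
    (hτ : ∀ j ∈ Finset.range (N + 1), |τ j| ≤ 2) {β : ℝ} (hβ : 2 * |β| ≤ 1) :
    |1 - ∑ j ∈ Finset.range (N + 1), w j * rexp (β * τ j)| ≤ Λ * (2 * (2 * |β|) ^ (N + 1)) := by
  have hrem : ∀ j ∈ Finset.range (N + 1), |rexp (β * τ j) -
      ∑ m ∈ Finset.range (N + 1), (β * τ j) ^ m / (m.factorial : ℝ)| ≤ 2 * (2 * |β|) ^ (N + 1) := by
    intro j hj
    have h1 : |β * τ j| ≤ 2 * |β| := by
      rw [abs_mul]
      nlinarith [hτ j hj, abs_nonneg β]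
    refine (Real.exp_bound (h1.trans hβ) (Nat.succ_pos N)).trans ?_
    have h2 : |β * τ j| ^ (N + 1) ≤ (2 * |β|) ^ (N + 1) := pow_le_pow_left₀ (abs_nonneg _) h1 _
    have h3 : ((N + 1).succ : ℝ) / (((N + 1).factorial : ℝ) * ((N + 1 : ℕ) : ℝ)) ≤ 2 := by
      have hf : (1 : ℝ) ≤ ((N + 1).factorial : ℝ) := by exact_mod_cast Nat.factorial_pos _
      rw [div_le_iff₀ (by positivity)]
      push_cast
      nlinarith [(Nat.cast_nonneg N : (0 : ℝ) ≤ N)]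
    rw [mul_comm]
    exact mul_le_mul h3 h2 (by positivity) (by norm_num)
  have hmain : ∑ j ∈ Finset.range (N + 1), w j *
      ∑ m ∈ Finset.range (N + 1), (β * τ j) ^ m / (m.factorial : ℝ) = 1 := by
    calc _ = ∑ m ∈ Finset.range (N + 1), β ^ m / (m.factorial : ℝ) *
          ∑ j ∈ Finset.range (N + 1), w j * τ j ^ m := by
          simp only [Finset.mul_sum]
          rw [Finset.sum_comm]
          exact Finset.sum_congr rfl fun m _ => Finset.sum_congr rfl fun j _ => by
            rw [mul_pow]; ring
      _ = ∑ m ∈ Finset.range (N + 1), β ^ m / (m.factorial : ℝ) * 0 ^ m :=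
          Finset.sum_congr rfl fun m hm => by rw [hw m (Nat.lt_succ_iff.1 (Finset.mem_range.1 hm))]
      _ = 1 := by
          rw [Finset.sum_eq_single_of_mem 0 (by simp) fun m _ hm => by simp [hm]]
          simp
  have heq : 1 - ∑ j ∈ Finset.range (N + 1), w j * rexp (β * τ j) =
      -∑ j ∈ Finset.range (N + 1), w j * (rexp (β * τ j) -
        ∑ m ∈ Finset.range (N + 1), (β * τ j) ^ m / (m.factorial : ℝ)) := by
    simp only [mul_sub, Finset.sum_sub_distrib]
    rw [hmain]
    ring
  rw [heq, abs_neg]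
  refine (Finset.abs_sum_le_sum_abs _ _).trans ?_
  calc _ ≤ ∑ j ∈ Finset.range (N + 1), |w j| * (2 * (2 * |β|) ^ (N + 1)) :=
        Finset.sum_le_sum fun j hj => by
          rw [abs_mul]
          exact mul_le_mul_of_nonneg_left (hrem j hj) (abs_nonneg _)
    _ = (∑ j ∈ Finset.range (N + 1), |w j|) * (2 * (2 * |β|) ^ (N + 1)) :=
        (Finset.sum_mul _ _ _).symm
    _ ≤ _ := mul_le_mul_of_nonneg_right hΛ (by positivity)

section ExpTransform

variable {n : ℕ} {R B : ℝ} {f : ℰ n → ℝ}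

/-- The bilateral Laplace transform of `f`, at frequency `B • p`. -/
noncomputable def expTransform (B : ℝ) (f : ℰ n → ℝ)
    (p : ℰ n) : ℝ := ∫ z, rexp (B * inner ℝ z p) * f z

lemma integrable_exp_mul (hf : Continuous f) (hf0 : ∀ z ∉ closedBall 0 R, f z = 0)
    (p : ℰ n) : Integrable fun z => rexp (B * inner ℝ z p) * f z :=
  integrable_of_continuous_of_zero_off (isCompact_closedBall 0 R)
    (by fun_prop) fun z hz => by rw [hf0 z hz, mul_zero]

lemma continuous_expTransform (hf : Continuous f) (hf0 : ∀ z ∉ closedBall 0 R, f z = 0) :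
    Continuous (expTransform B f) := by
  have h : ∀ p, expTransform B f p =
      ∫ z in closedBall 0 R, rexp (B * inner ℝ z p) * f z :=
    fun p => (setIntegral_eq_integral_of_forall_compl_eq_zero fun z hz => by
      rw [hf0 z hz, mul_zero]).symm
  rw [funext h]
  exact continuous_parametric_integral_of_continuous (by fun_prop) (isCompact_closedBall 0 R)

lemma abs_expTransform_sub_sum_le (hf : Continuous f) (hf0 : ∀ z ∉ closedBall 0 R, f z = 0)
    (hB : 0 ≤ B) (hR : 0 ≤ R) (hBR : 4 * (B * R ^ 2) ≤ 1) {N : ℕ} {w τ : ℕ → ℝ}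
    (hw : ∀ k ≤ N, ∑ j ∈ Finset.range (N + 1), w j * τ j ^ k = 0 ^ k) {Λ : ℝ}
    (hΛ : ∑ j ∈ Finset.range (N + 1), |w j| ≤ Λ)
    (hτ : ∀ j ∈ Finset.range (N + 1), |τ j| ≤ 2) {x q : ℰ n}
    (hx : ‖x‖ ≤ R) (hq : ‖q‖ ≤ R) :
    |expTransform B f x - ∑ j ∈ Finset.range (N + 1), w j * expTransform B f (x + τ j • (q - x))| ≤
      rexp (B * R ^ 2) * (Λ * (2 * (4 * (B * R ^ 2)) ^ (N + 1))) * ∫ z, |f z| := by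
  have hΛ0 : 0 ≤ Λ := (Finset.sum_nonneg fun _ _ => abs_nonneg _).trans hΛ
  have hint := fun p => integrable_exp_mul (B := B) hf hf0 p
  have heq : expTransform B f x -
      ∑ j ∈ Finset.range (N + 1), w j * expTransform B f (x + τ j • (q - x)) =
      ∫ z, rexp (B * inner ℝ z x) * (1 - ∑ j ∈ Finset.range (N + 1), w j *
        rexp (B * inner ℝ z (q - x) * τ j)) * f z := by
    simp only [expTransform]
    simp_rw [← integral_const_mul]
    rw [← integral_finsetSum _ fun j _ => (hint _).const_mul _,
      ← integral_sub (hint x) (integrable_finsetSum _ fun j _ => (hint _).const_mul _)]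
    refine integral_congr_ae (.of_forall fun z => ?_)
    simp only [mul_sub, sub_mul, Finset.mul_sum, Finset.sum_mul, mul_one]
    congr 1
    refine Finset.sum_congr rfl fun j _ => ?_
    rw [inner_add_right, inner_smul_right, mul_add, Real.exp_add]
    ring_nf
  rw [heq, ← integral_const_mul]
  refine abs_integral_le_integral_abs.trans (integral_mono_of_nonneg
    (.of_forall fun z => abs_nonneg _)
    (((integrable_of_continuous_of_zero_off (isCompact_closedBall 0 R) hf hf0).abs).const_mul _)
    (.of_forall fun z => ?_))
  by_cases hz : z ∈ closedBall 0 R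
  · have hz' : ‖z‖ ≤ R := mem_closedBall_zero_iff.1 hz
    have h1 : B * inner ℝ z x ≤ B * R ^ 2 := by
      refine mul_le_mul_of_nonneg_left ((real_inner_le_norm z x).trans ?_) hB
      rw [sq]
      exact mul_le_mul hz' hx (norm_nonneg _) hR
    have h2 : |B * inner ℝ z (q - x)| ≤ 2 * (B * R ^ 2) := by
      rw [abs_mul, abs_of_nonneg hB]
      have : |inner ℝ z (q - x)| ≤ R * (2 * R) := (abs_real_inner_le_norm _ _).trans
        (mul_le_mul hz' ((norm_sub_le _ _).trans (by linarith)) (norm_nonneg _) hR)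
      calc _ ≤ B * (R * (2 * R)) := mul_le_mul_of_nonneg_left this hB
        _ = _ := by ring
    have h3 := abs_one_sub_sum_exp_le hw hΛ hτ (β := B * inner ℝ z (q - x)) (by linarith)
    have h4 : (2 * |B * inner ℝ z (q - x)|) ^ (N + 1) ≤ (4 * (B * R ^ 2)) ^ (N + 1) :=
      pow_le_pow_left₀ (by positivity) (by linarith) _
    simp only [abs_mul, abs_of_pos (Real.exp_pos _)]
    refine mul_le_mul_of_nonneg_right (mul_le_mul (Real.exp_le_exp.2 h1) (h3.trans ?_)
      (abs_nonneg _) (Real.exp_pos _).le) (abs_nonneg _)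
    exact mul_le_mul_of_nonneg_left (by linarith) hΛ0
  · simp [hf0 z hz]

lemma integral_abs_dilation_le {F : ℰ n → ℝ} (hF : Continuous F)
    {x x₀ : ℰ n} {ρ τ : ℝ} (hτ : 1 ≤ τ)
    (hτρ : (τ - 1) * (ρ / 2 + ‖x₀ - x‖) ≤ ρ / 2) :
    ∫ q in ball x₀ (ρ / 2), |F (x + τ • (q - x))| ≤ ∫ q in ball x₀ ρ, |F q| := by
  set G := (ball x₀ ρ).indicator fun q => |F q| with hG
  have hGint : Integrable G := (integrable_indicator_iff measurableSet_ball).2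
    ((hF.abs.continuousOn.integrableOn_compact (isCompact_closedBall x₀ ρ)).mono_set
      ball_subset_closedBall)
  have hG0 : ∀ q, 0 ≤ G q := fun q => indicator_nonneg (fun q _ => abs_nonneg _) q
  have hp : ∀ q, x + τ • (q - x) = τ • q + (x - τ • x) := fun q => by rw [smul_sub]; abel
  have hcomp : Integrable fun q => G (x + τ • (q - x)) := by
    simp_rw [hp]
    exact (hGint.comp_add_right (x - τ • x)).comp_smul (by positivity : τ ≠ 0)
  rw [← integral_indicator measurableSet_ball, ← integral_indicator measurableSet_ball]
  calc ∫ q, (ball x₀ (ρ / 2)).indicator (fun q => |F (x + τ • (q - x))|) q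
      ≤ ∫ q, G (x + τ • (q - x)) := by
        refine integral_mono_of_nonneg (.of_forall fun q =>
          indicator_nonneg (fun q _ => abs_nonneg _) q) hcomp (.of_forall fun q => ?_)
        by_cases hq : q ∈ ball x₀ (ρ / 2)
        · have hq' : ‖q - x₀‖ < ρ / 2 := mem_ball_iff_norm.1 hq
          have hmem : x + τ • (q - x) ∈ ball x₀ ρ := by
            rw [mem_ball_iff_norm]
            have : x + τ • (q - x) - x₀ = (q - x₀) + (τ - 1) • ((q - x₀) + (x₀ - x)) := by
              simp only [smul_sub, smul_add, sub_smul, one_smul]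
              abel
            rw [this]
            refine (norm_add_le _ _).trans_lt ?_
            rw [norm_smul, Real.norm_of_nonneg (by linarith)]
            have h2 : (τ - 1) * ‖q - x₀ + (x₀ - x)‖ ≤ (τ - 1) * (ρ / 2 + ‖x₀ - x‖) :=
              mul_le_mul_of_nonneg_left ((norm_add_le _ _).trans (by linarith)) (by linarith)
            linarith
          simp only [hG]
          rw [indicator_of_mem hq, indicator_of_mem hmem]
        · simp only
          rw [indicator_of_notMem hq]
          exact hG0 _
    _ = |(τ ^ n)⁻¹| * ∫ q, G q := by
        simp_rw [hp]
        rw [Measure.integral_comp_smul volume (fun q => G (q + (x - τ • x))),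
          integral_add_right_eq_self, finrank_euclideanSpace_fin, smul_eq_mul]
    _ ≤ ∫ q, G q := by
        refine mul_le_of_le_one_left (integral_nonneg hG0) ?_
        rw [abs_of_nonneg (by positivity)]
        exact inv_le_one_of_one_le₀ (one_le_pow₀ hτ)

/-- A Laplace transform of low frequency is controlled by its mean over a small ball. -/
lemma abs_expTransform_le (hf : Continuous f) (hf0 : ∀ z ∉ closedBall 0 R, f z = 0)
    (hB : 0 ≤ B) (hR : 0 < R) (hBR : 4 * (B * R ^ 2) ≤ 1) {N : ℕ} (hN : 1 ≤ N)
    {x x₀ : ℰ n} {ρ : ℝ} (hx : ‖x‖ ≤ R) (hρ : 0 < ρ) (hρR : ρ ≤ R)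
    (hsub : ball x₀ ρ ⊆ ball 0 R) :
    volume.real (ball x₀ (ρ / 2)) * |expTransform B f x| ≤
      (N + 1) * (16 * R * N / ρ) ^ N * ((∫ q in ball x₀ ρ, |expTransform B f q|) +
        volume.real (ball x₀ (ρ / 2)) *
          (2 * rexp (B * R ^ 2) * (4 * (B * R ^ 2)) ^ (N + 1) * ∫ z, |f z|)) := by
  have hN0 : (0 : ℝ) < N := by exact_mod_cast hN
  set κ := ρ / (8 * R) with hκ
  have hκ0 : 0 < κ := by positivity
  have hκ1 : κ ≤ 1 := by rw [hκ, div_le_one (by positivity)]; linarith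
  obtain ⟨w, hw, hwle⟩ := exists_extrapolation_weights hN hκ0 hκ1
  set τ : ℕ → ℝ := fun j => 1 + κ * j / N with hτ
  set Λ : ℝ := (N + 1) * (16 * R * N / ρ) ^ N with hΛ
  have hbase : 2 * N / κ = 16 * R * N / ρ := by rw [hκ]; field_simp; norm_num
  have hΛle : ∑ j ∈ Finset.range (N + 1), |w j| ≤ Λ := by
    refine (Finset.sum_le_sum hwle).trans_eq ?_
    rw [Finset.sum_const, Finset.card_range, nsmul_eq_mul, hΛ, hbase]
    push_cast
    ring
  have hτ1 : ∀ j ∈ Finset.range (N + 1), 1 ≤ τ j ∧ τ j - 1 ≤ κ := by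
    intro j hj
    have hjN : (j : ℝ) ≤ N := by exact_mod_cast Nat.lt_succ_iff.1 (Finset.mem_range.1 hj)
    have h0 : 0 ≤ κ * j / N := by positivity
    have h1 : κ * j / N ≤ κ := by
      rw [div_le_iff₀ hN0]
      exact mul_le_mul_of_nonneg_left hjN hκ0.le
    constructor <;> simp only [hτ] <;> linarith
  have hτ2 : ∀ j ∈ Finset.range (N + 1), |τ j| ≤ 2 := fun j hj => by
    obtain ⟨h1, h2⟩ := hτ1 j hj
    rw [abs_of_nonneg (by linarith)]
    linarith
  have hx₀ : ‖x₀‖ < R := mem_ball_zero_iff.1 (hsub (mem_ball_self hρ))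
  have hWc := continuous_expTransform (B := B) hf hf0
  set E := rexp (B * R ^ 2) * (Λ * (2 * (4 * (B * R ^ 2)) ^ (N + 1))) * ∫ z, |f z| with hE
  have hpt : ∀ q ∈ ball x₀ (ρ / 2), |expTransform B f x| ≤
      (∑ j ∈ Finset.range (N + 1), |w j| * |expTransform B f (x + τ j • (q - x))|) + E := by
    intro q hq
    have hq' : ‖q‖ ≤ R := (mem_ball_zero_iff.1 (hsub (ball_subset_ball (by linarith) hq))).le
    have h := abs_expTransform_sub_sum_le hf hf0 hB hR.le hBR hw hΛle hτ2 hx hq'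
    have h2 : |∑ j ∈ Finset.range (N + 1), w j * expTransform B f (x + τ j • (q - x))| ≤
        ∑ j ∈ Finset.range (N + 1), |w j| * |expTransform B f (x + τ j • (q - x))| :=
      (Finset.abs_sum_le_sum_abs _ _).trans_eq (Finset.sum_congr rfl fun j _ => abs_mul _ _)
    have h3 := abs_sub_abs_le_abs_sub (expTransform B f x)
      (∑ j ∈ Finset.range (N + 1), w j * expTransform B f (x + τ j • (q - x)))
    linarith
  have hfin : volume (ball x₀ (ρ / 2)) ≠ ⊤ := measure_ball_lt_top.ne
  have hint : ∀ j, IntegrableOn (fun q => |w j| * |expTransform B f (x + τ j • (q - x))|)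
      (ball x₀ (ρ / 2)) := fun j =>
    ((Continuous.continuousOn (by fun_prop)).integrableOn_compact
      (isCompact_closedBall x₀ (ρ / 2))).mono_set ball_subset_closedBall
  have hcI : IntegrableOn (fun _ => E) (ball x₀ (ρ / 2)) := integrableOn_const hfin
  have hI := setIntegral_mono_on (f := fun _ => |expTransform B f x|) (integrableOn_const hfin)
    ((integrable_finsetSum _ fun j _ => hint j).add hcI) measurableSet_ball hpt
  rw [setIntegral_const, smul_eq_mul] at hI
  refine hI.trans ?_
  simp only [Pi.add_apply]
  rw [integral_add (integrable_finsetSum _ fun j _ => hint j) hcI, setIntegral_const, smul_eq_mul,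
    integral_finsetSum _ fun j _ => hint j]
  have hsum : ∑ j ∈ Finset.range (N + 1),
      ∫ q in ball x₀ (ρ / 2), |w j| * |expTransform B f (x + τ j • (q - x))| ≤
      Λ * ∫ q in ball x₀ ρ, |expTransform B f q| := by
    calc _ ≤ ∑ j ∈ Finset.range (N + 1), |w j| * ∫ q in ball x₀ ρ, |expTransform B f q| := by
          refine Finset.sum_le_sum fun j hj => ?_
          rw [integral_const_mul]
          obtain ⟨h1, h2⟩ := hτ1 j hj
          refine mul_le_mul_of_nonneg_left (integral_abs_dilation_le hWc h1 ?_) (abs_nonneg _)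
          have h3 : ‖x₀ - x‖ ≤ 2 * R := (norm_sub_le _ _).trans (by linarith)
          calc (τ j - 1) * (ρ / 2 + ‖x₀ - x‖) ≤ κ * (4 * R) :=
                mul_le_mul h2 (by linarith) (by positivity) hκ0.le
            _ = ρ / 2 := by rw [hκ]; field_simp; norm_num
      _ = (∑ j ∈ Finset.range (N + 1), |w j|) * ∫ q in ball x₀ ρ, |expTransform B f q| :=
          (Finset.sum_mul _ _ _).symm
      _ ≤ _ := mul_le_mul_of_nonneg_right hΛle (integral_nonneg fun _ => abs_nonneg _)
  refine (add_le_add_left hsum _).trans_eq ?_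
  rw [hE]
  ring

end ExpTransform

section MehlerShell

variable {n : ℕ} {μ τ : ℝ}

lemma mehlerA_le (hμ : 0 < μ) (hτ : 0 < τ) : mehlerA μ τ ≤ μ / 2 + 1 / (4 * τ) := by
  have hs := sinh_pos_of_pos hμ hτ
  have h1 : 2 * μ * τ ≤ Real.sinh (2 * μ * τ) := Real.self_le_sinh_iff.2 (by positivity)
  have h2 : Real.cosh (2 * μ * τ) ≤ Real.sinh (2 * μ * τ) + 1 := by
    have := Real.cosh_sub_sinh (2 * μ * τ)
    have h3 : rexp (-(2 * μ * τ)) ≤ 1 := Real.exp_le_one_iff.2 (by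
      have : 0 < 2 * μ * τ := by positivity
      linarith)
    linarith
  have h4 : Real.cosh (2 * μ * τ) / Real.sinh (2 * μ * τ) ≤ 1 + 1 / (2 * μ * τ) := by
    calc _ ≤ (Real.sinh (2 * μ * τ) + 1) / Real.sinh (2 * μ * τ) := by gcongr
      _ = 1 + 1 / Real.sinh (2 * μ * τ) := by rw [add_div, div_self hs.ne']
      _ ≤ _ := by gcongr
  rw [mehlerA]
  calc _ ≤ μ / 2 * (1 + 1 / (2 * μ * τ)) := by gcongr
    _ = _ := by field_simp; ring

lemma le_mehlerA (hμ : 0 < μ) (hτ : 0 < τ) : 1 / (8 * τ) ≤ mehlerA μ τ := by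
  have hs := sinh_pos_of_pos hμ hτ
  have h1 : Real.sinh (2 * μ * τ) ≤ 4 * μ * τ * Real.cosh (2 * μ * τ) := by
    set z := 2 * μ * τ with hz
    have h2 : 1 - 2 * z ≤ rexp (-z) * rexp (-z) := by
      rw [← Real.exp_add]
      have := Real.add_one_le_exp (-z + -z)
      linarith
    have h3 : rexp z * rexp (-z) = 1 := by rw [← Real.exp_add]; simp
    have h4 : 4 * μ * τ = 2 * z := by rw [hz]; ring
    rw [h4, Real.sinh_eq, Real.cosh_eq]
    have h5 : rexp z * (1 - 2 * z) ≤ rexp (-z) := by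
      calc _ ≤ rexp z * (rexp (-z) * rexp (-z)) := by gcongr
        _ = _ := by rw [← mul_assoc, h3, one_mul]
    have h6 : 0 ≤ z * rexp (-z) := by positivity
    nlinarith
  rw [mehlerA, ← mul_div_assoc, div_le_div_iff₀ (by positivity) hs]
  linarith

lemma pd_mehler (x z : ℰ n) (i : Fin n) :
    pd i (mehler μ τ x) z = mehler μ τ x z * (mehlerB μ τ * x i - 2 * mehlerA μ τ * z i) := by
  have hd : DifferentiableAt ℝ (fun z : ℰ n => ‖z‖ ^ 2) z :=
    (contDiff_norm_sq_euclidean (m := 1)).differentiable (by norm_num) z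
  have hi : DifferentiableAt ℝ (fun z => inner ℝ z (mehlerB μ τ • x)) z := by fun_prop
  have h1 : pd i (mehler μ τ x) z = _ :=
    pd_comp (φ := rexp) (f := fun z => -mehlerA μ τ * ‖z‖ ^ 2 + inner ℝ z (mehlerB μ τ • x)
      + (n / 2 * Real.log (mehlerB μ τ / (2 * π)) - mehlerA μ τ * ‖x‖ ^ 2)) i
      Real.differentiableAt_exp (((hd.const_mul _).fun_add hi).fun_add (differentiableAt_const _))
  rw [h1, Real.deriv_exp, pd_add i ((hd.const_mul _).fun_add hi) (differentiableAt_const _),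
    pd_add i (hd.const_mul _) hi, pd_mul i (differentiableAt_const _) hd, pd_const, pd_const,
    pd_norm_sq, pd_inner, mehler]
  simp only [PiLp.smul_apply, smul_eq_mul]
  ring

/-- Off the diagonal the Mehler kernel beats any power of the inverse time. -/
lemma exists_mehler_off_diagonal_le (n : ℕ) {δ : ℝ} (hδ : 0 < δ) :
    ∃ C : ℝ, 0 ≤ C ∧ ∀ μ τ : ℝ, 0 < μ → 0 < τ → ∀ x z : ℰ n,
      ‖x‖ + δ ≤ ‖z‖ → (1 + 1 / τ) * mehler μ τ x z ≤ C := by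
  set c := δ ^ 2 / 8 with hc
  have hc0 : 0 < c := by positivity
  refine ⟨rexp c * ((n + 1).factorial / c ^ (n + 1)), by positivity, fun μ τ hμ hτ x z hxz => ?_⟩
  have hA := mehlerA_pos hμ hτ
  have hB := mehlerB_pos hμ hτ
  set w := 1 + 1 / τ with hw
  have hw1 : 1 ≤ w := by rw [hw]; linarith [one_div_pos.2 hτ]
  have hlog : Real.log (mehlerB μ τ / (2 * π)) ≤ Real.log w := by
    refine Real.log_le_log (by positivity) ?_
    have h1 := mehlerB_le hμ hτ
    have h2 : mehlerB μ τ / (2 * π) ≤ mehlerB μ τ :=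
      div_le_self hB.le (by linarith [Real.pi_gt_three])
    have h3 : 1 / (2 * τ) ≤ 1 / τ := by gcongr; linarith
    linarith
  have hnorm : δ ≤ ‖z - (mehlerB μ τ / (2 * mehlerA μ τ)) • x‖ := by
    have h1 : ‖(mehlerB μ τ / (2 * mehlerA μ τ)) • x‖ ≤ ‖x‖ := by
      rw [norm_smul, Real.norm_of_nonneg (by positivity), mehlerB_div_le hμ hτ]
      refine mul_le_of_le_one_left (norm_nonneg _) ?_
      rw [div_le_one (Real.cosh_pos _)]
      exact Real.one_le_cosh _
    have := norm_sub_norm_le z ((mehlerB μ τ / (2 * mehlerA μ τ)) • x)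
    linarith
  have hexp : c * (w - 1) ≤ mehlerA μ τ * ‖z - (mehlerB μ τ / (2 * mehlerA μ τ)) • x‖ ^ 2 := by
    calc c * (w - 1) = 1 / (8 * τ) * δ ^ 2 := by rw [hc, hw]; field_simp; ring
      _ ≤ _ := mul_le_mul (le_mehlerA hμ hτ) (pow_le_pow_left₀ hδ.le hnorm 2) (by positivity) hA.le
  have hk : mehler μ τ x z ≤ w ^ n * rexp (-(c * (w - 1))) := by
    have h1 : w ^ n = rexp (n * Real.log w) := by
      rw [mul_comm, Real.exp_mul, Real.exp_log (by linarith), Real.rpow_natCast]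
    rw [mehler_eq hμ hτ, h1]
    refine mul_le_mul (Real.exp_le_exp.2 ?_) (Real.exp_le_exp.2 (by linarith))
      (Real.exp_pos _).le (Real.exp_pos _).le
    have h2 : 0 ≤ μ ^ 2 / (4 * mehlerA μ τ) * ‖x‖ ^ 2 := by positivity
    have h3 := Real.log_nonneg hw1
    have h4 : (n : ℝ) / 2 * Real.log (mehlerB μ τ / (2 * π)) ≤ n / 2 * Real.log w := by gcongr
    have h5 : 0 ≤ (n : ℝ) / 2 * Real.log w := by positivity
    linarith
  have hpow := Real.pow_div_factorial_le_exp (c * w) (by positivity) (n + 1)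
  calc w * mehler μ τ x z ≤ w * (w ^ n * rexp (-(c * (w - 1)))) := by gcongr
    _ = (c * w) ^ (n + 1) / ((n + 1).factorial : ℝ) * rexp (-(c * w)) *
        (rexp c * ((n + 1).factorial / c ^ (n + 1))) := by
      rw [show -(c * (w - 1)) = -(c * w) + c by ring, Real.exp_add, mul_pow]
      field_simp
      ring
    _ ≤ rexp (c * w) * rexp (-(c * w)) *
        (rexp c * ((n + 1).factorial / c ^ (n + 1))) := by gcongr
    _ = _ := by rw [← Real.exp_add]; simp

end MehlerShell

section ShellEstimate

variable {n : ℕ} {R μ T η : ℝ} {y : ℝ → ℰ n → ℝ}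

lemma radialCutoff_mul_cutoffExtension_eq (hR : 0 < R) (hη : 0 < η) (t : ℝ)
    (u : ℝ → ℰ n → ℝ) (z : ℰ n) :
    cutoffExtension R η u t z = radialCutoff R (η / 4) z * cutoffExtension R (η / 4) u t z := by
  by_cases hz : η / 4 ≤ R ^ 2 - ‖z‖ ^ 2
  · rw [cutoffExtension_eq (η := η / 4) hR (by positivity) (by linarith), cutoffExtension,
      indicator_of_mem (mem_ball_of_sq_lt hR (by linarith))]
  · rw [radialCutoff_eq_zero (by positivity) (by linarith), zero_mul, cutoffExtension]
    by_cases hb : z ∈ ball 0 R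
    · rw [indicator_of_mem hb, radialCutoff_eq_zero (by positivity) (by linarith), zero_mul]
    · rw [indicator_of_notMem hb]

lemma cutoffExtension_eq_zero {u : ℝ → ℰ n → ℝ} {t : ℝ}
    {z : ℰ n} (hz : z ∉ closedBall 0 R) :
    cutoffExtension R η u t z = 0 :=
  indicator_of_notMem (fun h => hz (ball_subset_closedBall h)) _

lemma abs_cutoffExtension_le {u : ℝ → ℰ n → ℝ} {t Y : ℝ} (hY : 0 ≤ Y)
    {z : ℰ n} (hz : z ∈ ball 0 R → |u t z| ≤ Y) :
    |cutoffExtension R η u t z| ≤ Y := by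
  rw [cutoffExtension]
  by_cases hb : z ∈ ball 0 R
  · rw [indicator_of_mem hb, abs_mul, abs_of_nonneg radialCutoff_nonneg]
    exact (mul_le_of_le_one_left (abs_nonneg _) radialCutoff_le_one).trans (hz hb)
  · rw [indicator_of_notMem hb, abs_zero]
    exact hY

namespace IsHarmonicHeatSolution

/-- The heat operator applied to the cut off solution, tested against a smooth function. -/
lemma integral_mul_heat_cutoffExtension (h : IsHarmonicHeatSolution n R μ T y) (hR : 0 < R)
    (hη : 0 < η) (hη' : η ≤ R ^ 2) {σ : ℝ} (hσ : σ ∈ Ioo 0 T)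
    {k : ℰ n → ℝ} (hk : ContDiff ℝ ∞ k) :
    ∫ z, k z * (deriv (fun s => cutoffExtension R η y s z) σ - lapl (cutoffExtension R η y σ) z
        + μ ^ 2 * ‖z‖ ^ 2 * cutoffExtension R η y σ z) =
      ∫ z, (2 * ∑ i, pd i k z * pd i (radialCutoff R (η / 4)) z
        + k z * lapl (radialCutoff R (η / 4)) z) * cutoffExtension R (η / 4) y σ z := by
  set χ := radialCutoff (n := n) R (η / 4)
  set u := cutoffExtension R (η / 4) y σ
  have hχs : ContDiff ℝ ∞ χ := contDiff_radialCutoff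
  have hus : ContDiff ℝ ∞ u := contDiff_iff_contDiffAt.2 fun z =>
    (contDiffAt_cutoffExtension hR (by positivity) (by linarith) isOpen_Ioo
      (fun t ht x hx => h.contDiffAt ht hx) σ hσ z).comp z (f := fun z => (σ, z)) (by fun_prop)
  have hK := isCompact_closedBall (0 : ℰ n) R
  have hu0 : ∀ z ∉ closedBall 0 R, u z = 0 := fun z hz => cutoffExtension_eq_zero hz
  have hg : cutoffExtension R η y σ = fun z => χ z * u z :=
    funext fun z => radialCutoff_mul_cutoffExtension_eq hR hη σ y z
  have hgs : ContDiff ℝ ∞ (fun z => χ z * u z) := hχs.mul hus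
  have hg0 : ∀ z ∉ closedBall 0 R, χ z * u z = 0 := fun z hz => by rw [hu0 z hz, mul_zero]
  have h2 : (2 : WithTop ℕ∞) ≤ ∞ := two_le_smooth
  have hpde : ∀ z, deriv (fun s => cutoffExtension R η y s z) σ + μ ^ 2 * ‖z‖ ^ 2 * (χ z * u z) =
      χ z * lapl u z := by
    intro z
    have hd : deriv (fun s => cutoffExtension R η y s z) σ =
        χ z * deriv (fun s => cutoffExtension R (η / 4) y s z) σ := by
      rw [← deriv_const_mul_field]
      exact congrArg (fun f => deriv f σ)
        (funext fun s => radialCutoff_mul_cutoffExtension_eq hR hη s y z)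
    by_cases hz : η / 4 ≤ R ^ 2 - ‖z‖ ^ 2
    · have h1 : (fun s => cutoffExtension R (η / 4) y s z) = fun s => y s z :=
        funext fun s => cutoffExtension_eq hR (by positivity) (by linarith) s
      have h3 : lapl u z = lapl (y σ) z :=
        lapl_congr (cutoffExtension_eventuallyEq hR (by positivity) hz σ)
      have h4 := h.eqn σ hσ z (mem_ball_of_sq_lt hR (by linarith))
      have h5 : u z = y σ z := congrFun h1 σ
      rw [hd, h1, h3, h5]
      linear_combination χ z * h4
    · have h0 : χ z = 0 := radialCutoff_eq_zero (by positivity) (by linarith)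
      rw [hd, h0]
      ring
  have hlk : Continuous (lapl k) := by
    have : lapl k = fun z => ∑ i, pd i (pd i k) z := funext fun z => lapl_eq_sum_pd
    rw [this]
    exact continuous_finsetSum _ fun i _ =>
      ((hk.pd (k := 1) i (by norm_cast)).pd (k := 0) i (by norm_num)).continuous
  have hcont : ∀ f g : ℰ n → ℝ, ContDiff ℝ ∞ g → Continuous f →
      (∀ z ∉ closedBall 0 R, g z = 0) →
      Integrable (fun z => f z * lapl g z) ∧ Integrable (fun z => f z * g z) := by
    intro f g hgs' hf hg0'
    have hlg : Continuous (lapl g) := by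
      have : lapl g = fun z => ∑ i, pd i (pd i g) z := funext fun z => lapl_eq_sum_pd
      rw [this]
      exact continuous_finsetSum _ fun i _ =>
        ((hgs'.pd (k := 1) i (by norm_cast)).pd (k := 0) i (by norm_num)).continuous
    refine ⟨integrable_of_continuous_of_zero_off hK (hf.mul hlg) fun z hz => ?_,
      integrable_of_continuous_of_zero_off hK (hf.mul hgs'.continuous) fun z hz => ?_⟩
    · rw [lapl_eq_sum_pd, Finset.sum_eq_zero fun i _ =>
        pd_eq_zero_of_zero_off hK.isClosed
          (pd_eq_zero_of_zero_off hK.isClosed hg0' i) i z hz, mul_zero]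
    · rw [hg0' z hz, mul_zero]
  have hkχ : ContDiff ℝ ∞ fun z => k z * χ z := hk.mul hχs
  calc ∫ z, k z * (deriv (fun s => cutoffExtension R η y s z) σ - lapl (cutoffExtension R η y σ) z
        + μ ^ 2 * ‖z‖ ^ 2 * cutoffExtension R η y σ z)
      = ∫ z, (k z * χ z * lapl u z - k z * lapl (fun z => χ z * u z) z) := by
        refine integral_congr_ae (.of_forall fun z => ?_)
        simp only [hg]
        linear_combination k z * hpde z
    _ = (∫ z, k z * χ z * lapl u z) - ∫ z, k z * lapl (fun z => χ z * u z) z :=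
        integral_sub (hcont (fun z => k z * χ z) u hus hkχ.continuous hu0).1
          (hcont k _ hgs hk.continuous hg0).1
    _ = (∫ z, lapl (fun z => k z * χ z) z * u z) - ∫ z, lapl k z * (χ z * u z) := by
        rw [integral_mul_lapl_comm hK (hkχ.of_le h2) (hus.of_le h2) hu0,
          integral_mul_lapl_comm hK (hk.of_le h2) (hgs.of_le h2) hg0]
    _ = ∫ z, (lapl (fun z => k z * χ z) z * u z - lapl k z * (χ z * u z)) := by
        refine (integral_sub ?_ (hcont (lapl k) _ hgs hlk hg0).2).symm
        refine (hcont (lapl fun z => k z * χ z) u hus ?_ hu0).2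
        have : (lapl fun z => k z * χ z) = fun z => ∑ i, pd i (pd i fun z => k z * χ z) z :=
          funext fun z => lapl_eq_sum_pd
        rw [this]
        exact continuous_finsetSum _ fun i _ =>
          ((hkχ.pd (k := 1) i (by norm_cast)).pd (k := 0) i (by norm_num)).continuous
    _ = _ := by
        refine integral_congr_ae (.of_forall fun z => ?_)
        simp only
        rw [lapl_mul (hk.of_le h2).contDiffAt (hχs.of_le h2).contDiffAt]
        ring

end IsHarmonicHeatSolution

lemma abs_pd_mehler_le {τ : ℝ} (hμ : 0 < μ) (hτ : 0 < τ) {x z : ℰ n}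
    (hx : ‖x‖ ≤ R) (hz : ‖z‖ ≤ R) (i : Fin n) :
    |pd i (mehler μ τ x) z| ≤ mehler μ τ x z * (R * (μ + 1 / τ)) := by
  have hA := mehlerA_pos hμ hτ
  have hB := mehlerB_pos hμ hτ
  have hxi : |x i| ≤ R := (PiLp.norm_apply_le x i).trans hx
  have hzi : |z i| ≤ R := (PiLp.norm_apply_le z i).trans hz
  have h1 := mehlerB_le hμ hτ
  have h2 := mehlerA_le hμ hτ
  rw [pd_mehler, abs_mul, abs_of_pos (mehler_pos x z)]
  refine mul_le_mul_of_nonneg_left ?_ (mehler_pos x z).le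
  calc |mehlerB μ τ * x i - 2 * mehlerA μ τ * z i|
      ≤ |mehlerB μ τ * x i| + |2 * mehlerA μ τ * z i| := abs_sub _ _
    _ = mehlerB μ τ * |x i| + 2 * mehlerA μ τ * |z i| := by
        rw [abs_mul (mehlerB μ τ), abs_mul (2 * mehlerA μ τ), abs_of_pos hB,
          abs_of_pos (by positivity : 0 < 2 * mehlerA μ τ)]
    _ ≤ 1 / (2 * τ) * R + 2 * (μ / 2 + 1 / (4 * τ)) * R := by gcongr
    _ = _ := by field_simp; ring

namespace IsHarmonicHeatSolution

/-- In the interior, a solution is the Mehler propagation of its cut off up to an error governed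
by its size near the boundary. -/
lemma exists_abs_sub_integral_mehler_le (n : ℕ) {R R₂ δ : ℝ} (hR₂ : 0 < R₂) (h₂R : R₂ < R)
    (hδ : 0 < δ) :
    ∃ C : ℝ, 0 ≤ C ∧ ∀ (μ T : ℝ) (y : ℝ → ℰ n → ℝ),
      IsHarmonicHeatSolution n R μ T y → 0 < μ → ∀ a b, 0 < a → a < b → b < T →
      ∀ Y, 0 ≤ Y → (∀ σ ∈ Ico a b, ∀ z ∈ ball 0 R, R₂ ≤ ‖z‖ →
        |y σ z| ≤ Y) → ∀ x, ‖x‖ + δ ≤ R₂ →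
      |y b x - ∫ z, mehler μ (b - a) x z * cutoffExtension R (R ^ 2 - R₂ ^ 2) y a z| ≤
        C * (1 + μ) * Y * (b - a) := by
  have hR : 0 < R := hR₂.trans h₂R
  set η := R ^ 2 - R₂ ^ 2 with hη
  have hη0 : 0 < η := by rw [hη]; nlinarith
  have hη' : η ≤ R ^ 2 := by rw [hη]; nlinarith
  set χ := radialCutoff (n := n) R (η / 4)
  have hχs : ContDiff ℝ ∞ χ := contDiff_radialCutoff
  have hK := isCompact_closedBall (0 : ℰ n) R
  have hpc : ∀ i, Continuous (pd i χ) := fun i => (hχs.pd (k := 0) i (by norm_num)).continuous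
  have hlc : Continuous (lapl χ) := by
    have : lapl χ = fun z => ∑ i, pd i (pd i χ) z := funext fun z => lapl_eq_sum_pd
    rw [this]
    exact continuous_finsetSum _ fun i _ =>
      ((hχs.pd (k := 1) i (by norm_cast)).pd (k := 0) i (by norm_num)).continuous
  obtain ⟨X₁, hX₁⟩ := hK.exists_bound_of_continuousOn (f := fun z => ∑ i, |pd i χ z|)
    (continuous_finsetSum _ fun i _ => (hpc i).abs).continuousOn
  obtain ⟨X₂, hX₂⟩ := hK.exists_bound_of_continuousOn hlc.continuousOn
  have h0K : (0 : ℰ n) ∈ closedBall 0 R := mem_closedBall_self hR.le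
  have hX₁0 : 0 ≤ X₁ := (norm_nonneg _).trans (hX₁ 0 h0K)
  have hX₂0 : 0 ≤ X₂ := (norm_nonneg _).trans (hX₂ 0 h0K)
  obtain ⟨C₀, hC₀, hk⟩ := exists_mehler_off_diagonal_le n hδ
  set V := volume.real (closedBall (0 : ℰ n) R)
  refine ⟨C₀ * (2 * R * X₁ + X₂) * V, by positivity,
    fun μ T y h hμ a b ha hab hb Y hY hyY x hx => ?_⟩
  have hxR : ‖x‖ ≤ R := by linarith
  set D := C₀ * (2 * R * X₁ + X₂) * (1 + μ) * Y with hD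
  have hD0 : 0 ≤ D := by positivity
  have key : ∀ u : ℝ → ℰ n → ℝ, IsHarmonicHeatSolution n R μ T u →
      (∀ σ ∈ Ico a b, ∀ z ∈ ball 0 R, R₂ ≤ ‖z‖ → |u σ z| ≤ Y) →
      u b x ≤ (∫ z, mehler μ (b - a) x z * cutoffExtension R η u a z) + D * V * (b - a) := by
    intro u hu huY
    have hub : cutoffExtension R η u b x = u b x := by
      refine cutoffExtension_eq hR hη0 ?_ b
      have : ‖x‖ ^ 2 ≤ R₂ ^ 2 := by gcongr; linarith
      linarith
    rw [← hub]
    refine le_integral_mehler_mul hμ isOpen_Ioo hK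
      (contDiffAt_cutoffExtension hR hη0 hη' isOpen_Ioo fun t ht x hx => hu.contDiffAt ht hx)
      (fun t _ z hz => cutoffExtension_eq_zero hz) hab
      (fun t ht => ⟨ha.trans_le ht.1, ht.2.trans_lt hb⟩) x fun σ hσ => ?_
    have hτ : 0 < b - σ := sub_pos.2 hσ.2
    rw [hu.integral_mul_heat_cutoffExtension hR hη0 hη' ⟨ha.trans_le hσ.1, hσ.2.trans hb⟩
      (contDiff_mehler x)]
    set u₂ := cutoffExtension R (η / 4) u σ with hu₂
    set F := fun z => (2 * ∑ i, pd i (mehler μ (b - σ) x) z * pd i χ z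
      + mehler μ (b - σ) x z * lapl χ z) * u₂ z with hF
    have hF0 : ∀ z ∉ closedBall 0 R, F z = 0 := fun z hz => by
      simp only [hF, hu₂]
      rw [cutoffExtension_eq_zero hz, mul_zero]
    have hFle : ∀ z ∈ closedBall 0 R, ‖F z‖ ≤ D := by
      intro z hz
      have hzR : ‖z‖ ≤ R := mem_closedBall_zero_iff.1 hz
      rcases lt_or_ge (η / 2) (R ^ 2 - ‖z‖ ^ 2) with hc | hc
      · have h1 : χ =ᶠ[𝓝 z] fun _ => 1 := by
          have hcc : Continuous fun z : ℰ n => R ^ 2 - ‖z‖ ^ 2 := by fun_prop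
          filter_upwards [hcc.continuousAt.eventually (lt_mem_nhds hc)] with w hw
          exact radialCutoff_eq_one (by positivity) (by linarith)
        have h2 : F z = 0 := by
          simp only [hF]
          rw [lapl_congr h1, lapl_const]
          simp only [pd_congr _ h1, pd_const, mul_zero, Finset.sum_const_zero, add_zero, zero_mul]
        rw [h2, norm_zero]
        exact hD0
      · have hz2 : R₂ ≤ ‖z‖ := by
          refine le_of_sq_le_sq ?_ (norm_nonneg z)
          rw [hη] at hc hη0
          linarith
        have hu2 : |u₂ z| ≤ Y := abs_cutoffExtension_le hY fun hzb => huY σ hσ z hzb hz2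
        have hm := mehler_pos (μ := μ) (τ := b - σ) x z
        have hsum : |∑ i, pd i (mehler μ (b - σ) x) z * pd i χ z| ≤
            mehler μ (b - σ) x z * (R * (μ + 1 / (b - σ))) * X₁ := by
          refine (Finset.abs_sum_le_sum_abs _ _).trans ?_
          calc _ ≤ ∑ i, mehler μ (b - σ) x z * (R * (μ + 1 / (b - σ))) * |pd i χ z| :=
                Finset.sum_le_sum fun i _ => by
                  rw [abs_mul]
                  exact mul_le_mul_of_nonneg_right (abs_pd_mehler_le hμ hτ hxR hzR i) (abs_nonneg _)
            _ = mehler μ (b - σ) x z * (R * (μ + 1 / (b - σ))) * ∑ i, |pd i χ z| :=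
                (Finset.mul_sum _ _ _).symm
            _ ≤ _ := by
                have := (le_abs_self _).trans (hX₁ z hz)
                gcongr
        have hlap : |mehler μ (b - σ) x z * lapl χ z| ≤ mehler μ (b - σ) x z * X₂ := by
          rw [abs_mul, abs_of_pos hm]
          exact mul_le_mul_of_nonneg_left (hX₂ z hz) hm.le
        have hq : 0 < 1 / (b - σ) := by positivity
        have hkb := hk μ (b - σ) hμ hτ x z (hx.trans hz2)
        rw [Real.norm_eq_abs, hF, abs_mul]
        refine mul_le_mul ?_ hu2 (abs_nonneg _) (by positivity)
        calc |2 * ∑ i, pd i (mehler μ (b - σ) x) z * pd i χ z + mehler μ (b - σ) x z * lapl χ z|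
            ≤ 2 * (mehler μ (b - σ) x z * (R * (μ + 1 / (b - σ))) * X₁)
              + mehler μ (b - σ) x z * X₂ := by
              refine (abs_add_le _ _).trans (add_le_add ?_ hlap)
              rw [abs_mul, abs_two]
              linarith
          _ ≤ (1 + 1 / (b - σ)) * mehler μ (b - σ) x z * ((2 * R * X₁ + X₂) * (1 + μ)) := by
              have e1 : μ + 1 / (b - σ) ≤ (1 + 1 / (b - σ)) * (1 + μ) := by nlinarith
              have e2 : 1 ≤ (1 + 1 / (b - σ)) * (1 + μ) := by nlinarith
              calc _ ≤ 2 * (mehler μ (b - σ) x z * (R * ((1 + 1 / (b - σ)) * (1 + μ))) * X₁)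
                  + mehler μ (b - σ) x z * (((1 + 1 / (b - σ)) * (1 + μ)) * X₂) := by
                    gcongr
                    exact le_mul_of_one_le_left hX₂0 e2
                _ = _ := by ring
          _ ≤ C₀ * ((2 * R * X₁ + X₂) * (1 + μ)) := by gcongr
          _ = _ := by ring
    calc ∫ z, F z = ∫ z in closedBall 0 R, F z :=
          (setIntegral_eq_integral_of_forall_compl_eq_zero hF0).symm
      _ ≤ ‖∫ z in closedBall 0 R, F z‖ := Real.le_norm_self _
      _ ≤ D * V := norm_setIntegral_le_of_norm_le_const hK.measure_lt_top hFle
  have h1 := key y h hyY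
  have h2 := key _ h.neg fun σ hσ z hz hz2 => by rw [abs_neg]; exact hyY σ hσ z hz hz2
  have h3 : ∫ z, mehler μ (b - a) x z * cutoffExtension R η (fun t x => -y t x) a z =
      -∫ z, mehler μ (b - a) x z * cutoffExtension R η y a z := by
    rw [← integral_neg]
    refine integral_congr_ae (.of_forall fun z => ?_)
    simp only [cutoffExtension]
    by_cases hz : z ∈ ball 0 R
    · simp only [indicator_of_mem hz]; ring
    · simp only [indicator_of_notMem hz]; ring
  rw [h3] at h2
  have h4 : C₀ * (2 * R * X₁ + X₂) * V * (1 + μ) * Y * (b - a) = D * V * (b - a) := by rw [hD]; ring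
  rw [h4, _root_.abs_le]
  constructor <;> linarith

end IsHarmonicHeatSolution

end ShellEstimate

section MehlerObservation

variable {n : ℕ} {R μ s : ℝ} {g : ℰ n → ℝ}

lemma expTransform_mehler (x : ℰ n) : ∫ z, mehler μ s x z * g z =
      rexp (-(mehlerA μ s * ‖x‖ ^ 2)) *
        expTransform (mehlerB μ s) (fun z => mehler μ s 0 z * g z) x := by
  rw [expTransform, ← integral_const_mul]
  refine integral_congr_ae (.of_forall fun z => ?_)
  simp only [mehler, smul_zero, inner_zero_right, norm_zero]
  rw [← mul_assoc, ← mul_assoc, ← Real.exp_add, ← Real.exp_add, inner_smul_right]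
  ring_nf

/-- A function close to a Mehler propagation is controlled everywhere by its mean over a
small ball. -/
lemma abs_le_of_abs_sub_mehler_le (hμ : 0 < μ) (hs : 0 < s) (hg : Continuous g)
    (hg0 : ∀ z ∉ closedBall 0 R, g z = 0) {M : ℝ}
    (hM : 0 ≤ M) (hgM : ∀ z, |g z| ≤ M) {u : ℰ n → ℝ}
    (hu : ContinuousOn u (closedBall 0 R)) (hR : 0 < R) {r S : ℝ} (hrR : r ≤ R)
    (hS : ∀ p, ‖p‖ ≤ r → |u p - ∫ z, mehler μ s p z * g z| ≤ S)
    (hBR : 4 * (mehlerB μ s * R ^ 2) ≤ 1) {N : ℕ} (hN : 1 ≤ N)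
    {x₀ : ℰ n} {ρ : ℝ} (hρ : 0 < ρ) (hρR : ρ ≤ R)
    (hsub : ball x₀ ρ ⊆ closedBall 0 r) (hsubR : ball x₀ ρ ⊆ ball 0 R)
    {x : ℰ n} (hx : ‖x‖ ≤ r) :
    volume.real (ball x₀ (ρ / 2)) * |u x| ≤ volume.real (ball x₀ (ρ / 2)) * S +
      (N + 1) * (16 * R * N / ρ) ^ N * (rexp (mehlerA μ s * r ^ 2) *
          ((∫ q in ball x₀ ρ, |u q|) + volume.real (ball x₀ ρ) * S) +
        volume.real (ball x₀ (ρ / 2)) *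
          (2 * rexp (mehlerB μ s * R ^ 2) * (4 * (mehlerB μ s * R ^ 2)) ^ (N + 1) *
            (rexp (-(n / 2 * Real.log (4 * π * s))) * M *
              volume.real (closedBall (0 : ℰ n) R)))) := by
  have hA := mehlerA_pos hμ hs
  have hB := mehlerB_pos hμ hs
  set A := mehlerA μ s
  set B := mehlerB μ s
  set f : ℰ n → ℝ := fun z => mehler μ s 0 z * g z with hf
  have hfc : Continuous f := (contDiff_mehler 0).continuous.mul hg
  have hf0 : ∀ z ∉ closedBall 0 R, f z = 0 := fun z hz => by
    simp only [hf]; rw [hg0 z hz, mul_zero]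
  have hK := isCompact_closedBall (0 : ℰ n) R
  have hfint : ∫ z, |f z| ≤ rexp (-(n / 2 * Real.log (4 * π * s))) * M *
      volume.real (closedBall (0 : ℰ n) R) := by
    refine integral_le_mul_volume measurableSet_closedBall hK.measure_lt_top.ne (by positivity)
      (fun z _ => ?_) fun z hz => by rw [hf0 z hz, abs_zero]
    rw [hf, abs_mul, abs_of_pos (mehler_pos 0 z)]
    exact mul_le_mul (mehler_le hμ hs 0 z) (hgM z) (abs_nonneg _) (Real.exp_pos _).le
  have hmain := abs_expTransform_le (B := B) hfc hf0 hB.le hR hBR hN (hx.trans hrR) hρ hρR hsubR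
  have huint : IntegrableOn (fun q => |u q|) (ball x₀ ρ) :=
    (hu.abs.integrableOn_compact hK).mono_set (hsubR.trans ball_subset_closedBall)
  have hW : ∫ q in ball x₀ ρ, |expTransform B f q| ≤
      rexp (A * r ^ 2) * ((∫ q in ball x₀ ρ, |u q|) + volume.real (ball x₀ ρ) * S) := by
    have hcI : IntegrableOn (fun _ => S) (ball x₀ ρ) := integrableOn_const measure_ball_lt_top.ne
    have h1 : ∫ q in ball x₀ ρ, (|u q| + S) =
        (∫ q in ball x₀ ρ, |u q|) + volume.real (ball x₀ ρ) * S := by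
      rw [integral_add huint hcI, setIntegral_const, smul_eq_mul]
    rw [← h1, ← integral_const_mul]
    refine setIntegral_mono_on
      (((continuous_expTransform hfc hf0).abs.continuousOn.integrableOn_compact
        (isCompact_closedBall x₀ ρ)).mono_set ball_subset_closedBall)
      ((huint.add hcI).const_mul _) measurableSet_ball fun q hq => ?_
    have hqr : ‖q‖ ≤ r := mem_closedBall_zero_iff.1 (hsub hq)
    have h2 := hS q hqr
    rw [expTransform_mehler] at h2
    have h3 : |rexp (-(A * ‖q‖ ^ 2)) * expTransform B f q| ≤ |u q| + S := by
      have := abs_sub_abs_le_abs_sub (rexp (-(A * ‖q‖ ^ 2)) * expTransform B f q) (u q)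
      rw [abs_sub_comm] at this
      linarith
    rw [abs_mul, abs_of_pos (Real.exp_pos _)] at h3
    calc |expTransform B f q| = rexp (A * ‖q‖ ^ 2) *
          (rexp (-(A * ‖q‖ ^ 2)) * |expTransform B f q|) := by
          rw [← mul_assoc, ← Real.exp_add]; simp
      _ ≤ rexp (A * r ^ 2) * (|u q| + S) :=
          mul_le_mul (Real.exp_le_exp.2 (by gcongr)) h3 (by positivity) (Real.exp_pos _).le
  have hux : |u x| ≤ S + |expTransform B f x| := by
    have h2 := hS x hx
    rw [expTransform_mehler] at h2
    have h3 := abs_sub_abs_le_abs_sub (u x) (rexp (-(A * ‖x‖ ^ 2)) * expTransform B f x)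
    have h4 : |rexp (-(A * ‖x‖ ^ 2)) * expTransform B f x| ≤ |expTransform B f x| := by
      rw [abs_mul, abs_of_pos (Real.exp_pos _)]
      refine mul_le_of_le_one_left (abs_nonneg _) (Real.exp_le_one_iff.2 ?_)
      have : 0 ≤ A * ‖x‖ ^ 2 := by positivity
      linarith
    linarith
  calc _ ≤ volume.real (ball x₀ (ρ / 2)) * (S + |expTransform B f x|) := by gcongr
    _ = volume.real (ball x₀ (ρ / 2)) * S + volume.real (ball x₀ (ρ / 2)) * |expTransform B f x| :=
        mul_add _ _ _
    _ ≤ _ := by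
        refine add_le_add le_rfl (hmain.trans ?_)
        gcongr

end MehlerObservation

lemma le_exp_mul_sq {K v : ℝ} (hK : 0 ≤ K) (hv : 1 ≤ v) : K ≤ rexp (K * v ^ 2) := by
  have h1 : K ≤ K * v ^ 2 := le_mul_of_one_le_right hK (one_le_pow₀ hv)
  linarith [Real.add_one_le_exp (K * v ^ 2)]

lemma pow_le_exp_mul_sq (n : ℕ) {v : ℝ} (hv : 1 ≤ v) : v ^ n ≤ rexp (n * v ^ 2) := by
  rw [Real.exp_nat_mul]
  refine pow_le_pow_left₀ (by linarith) ?_ n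
  nlinarith [Real.add_one_le_exp (v ^ 2)]

lemma exists_extrapolation_factor_le {R ρ₀ : ℝ} (hR : 0 < R) (hρ₀ : 0 < ρ₀) :
    ∃ C : ℝ, 0 ≤ C ∧ ∀ v : ℝ, 1 ≤ v →
      ((⌈v⌉₊ : ℝ) + 1) * (16 * R * ⌈v⌉₊ / (ρ₀ / v)) ^ ⌈v⌉₊ ≤ rexp (C * v ^ 2) := by
  set K := 32 * R / ρ₀ with hK
  refine ⟨2 * K + 7, by positivity, fun v hv => ?_⟩
  have hv0 : 0 < v := by linarith
  have hN : (⌈v⌉₊ : ℝ) ≤ 2 * v := by linarith [Nat.ceil_lt_add_one hv0.le]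
  have h1 : 16 * R * ⌈v⌉₊ / (ρ₀ / v) ≤ rexp (K + 2 * v) := by
    calc _ ≤ 16 * R * (2 * v) / (ρ₀ / v) := by gcongr
      _ = K * v * v := by rw [hK]; field_simp; norm_num
      _ ≤ rexp K * rexp v * rexp v := by
        have e1 : K ≤ rexp K := by linarith [Real.add_one_le_exp K]
        have e2 : v ≤ rexp v := by linarith [Real.add_one_le_exp v]
        gcongr
      _ = _ := by rw [← Real.exp_add, ← Real.exp_add]; ring_nf
  have h2 : (⌈v⌉₊ : ℝ) + 1 ≤ rexp (3 * v) := by linarith [Real.add_one_le_exp (3 * v)]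
  calc _ ≤ rexp (3 * v) * rexp (K + 2 * v) ^ ⌈v⌉₊ := by gcongr
    _ = rexp (3 * v + ⌈v⌉₊ * (K + 2 * v)) := by rw [← Real.exp_nat_mul, ← Real.exp_add]
    _ ≤ _ := by
      apply Real.exp_le_exp.2
      have : (⌈v⌉₊ : ℝ) * (K + 2 * v) ≤ 2 * v * (K + 2 * v) := by gcongr
      have hvv : v ≤ v ^ 2 := by nlinarith
      have : K * v ≤ K * v ^ 2 := by gcongr
      linarith

lemma mehlerB_cube_le {R v : ℝ} (hv : 1 ≤ v) (hvR : 32 * R ^ 2 ≤ v) :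
    4 * (mehlerB (v ^ 3) (1 / v) * R ^ 2) ≤ rexp (-v ^ 2) := by
  have harg : 2 * v ^ 3 * (1 / v) = 2 * v ^ 2 := by field_simp
  have hv2 : 1 ≤ v ^ 2 := one_le_pow₀ hv
  have hsinh : rexp (2 * v ^ 2) / 4 ≤ Real.sinh (2 * v ^ 2) := by
    rw [Real.sinh_eq]
    have h1 : rexp (-(2 * v ^ 2)) ≤ 1 := Real.exp_le_one_iff.2 (by linarith)
    have h2 := Real.add_one_le_exp (2 * v ^ 2)
    linarith
  have hq := Real.pow_div_factorial_le_exp (v ^ 2) (by positivity) 2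
  have hexp : 16 * R ^ 2 * v ^ 3 ≤ rexp (v ^ 2) := by
    refine le_trans ?_ hq
    have : (v ^ 2) ^ 2 / ((2 : ℕ).factorial : ℝ) = v * v ^ 3 / 2 := by
      rw [show ((2 : ℕ).factorial : ℝ) = 2 by norm_num [Nat.factorial]]
      ring
    rw [this]
    have : 32 * R ^ 2 * v ^ 3 ≤ v * v ^ 3 := by gcongr
    linarith
  rw [mehlerB, harg]
  calc 4 * (v ^ 3 / Real.sinh (2 * v ^ 2) * R ^ 2)
      ≤ 4 * (v ^ 3 / (rexp (2 * v ^ 2) / 4) * R ^ 2) := by gcongr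
    _ = 16 * R ^ 2 * v ^ 3 * rexp (-(2 * v ^ 2)) := by rw [Real.exp_neg]; field_simp; ring
    _ ≤ rexp (v ^ 2) * rexp (-(2 * v ^ 2)) := by gcongr
    _ = _ := by rw [← Real.exp_add]; ring_nf

lemma exp_neg_log_le (n : ℕ) {v : ℝ} (hv : 1 ≤ v) :
    rexp (-(n / 2 * Real.log (4 * π * (1 / v)))) ≤ rexp (n * v ^ 2) := by
  have hv0 : 0 < v := by linarith
  apply Real.exp_le_exp.2
  have h1 : -Real.log v ≤ Real.log (4 * π * (1 / v)) := by
    rw [← Real.log_inv]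
    refine Real.log_le_log (by positivity) ?_
    rw [← one_div]
    exact le_mul_of_one_le_left (by positivity) (by linarith [Real.pi_gt_three])
  have h2 : Real.log v ≤ v ^ 2 := by nlinarith [Real.log_le_sub_one_of_pos hv0]
  nlinarith

lemma mehlerA_cube_mul_le {R R₁ ρ₀ v : ℝ} (hv : 1 ≤ v) (hR₁ : 0 < R₁) (hρ₀ : 0 < ρ₀)
    (hR : R₁ + 3 * ρ₀ ≤ R) :
    mehlerA (v ^ 3) (1 / v) * (R₁ + 3 * (ρ₀ / v)) ^ 2 ≤
      v ^ 3 * R₁ ^ 2 / 2 + (3 * R₁ * ρ₀ + 5 * ρ₀ ^ 2 + R ^ 2) * v ^ 2 := by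
  have h1 := mehlerA_le (μ := v ^ 3) (τ := 1 / v) (by positivity) (by positivity)
  have h2 : 1 / (4 * (1 / v)) = v / 4 := by field_simp
  rw [h2] at h1
  have hr : (R₁ + 3 * (ρ₀ / v)) ^ 2 ≤ R ^ 2 := by
    have : ρ₀ / v ≤ ρ₀ := div_le_self hρ₀.le hv
    gcongr
    linarith
  have hvv : v ≤ v ^ 2 := by nlinarith
  calc _ ≤ (v ^ 3 / 2 + v / 4) * (R₁ + 3 * (ρ₀ / v)) ^ 2 := by gcongr
    _ = v ^ 3 / 2 * (R₁ + 3 * (ρ₀ / v)) ^ 2 + v / 4 * (R₁ + 3 * (ρ₀ / v)) ^ 2 := by ring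
    _ ≤ v ^ 3 / 2 * (R₁ + 3 * (ρ₀ / v)) ^ 2 + v ^ 2 * R ^ 2 := by
        gcongr
        linarith
    _ = v ^ 3 * R₁ ^ 2 / 2 + 3 * R₁ * ρ₀ * v ^ 2 + 9 / 2 * ρ₀ ^ 2 * v + v ^ 2 * R ^ 2 := by
        field_simp
        ring
    _ ≤ _ := by
        have : 9 / 2 * ρ₀ ^ 2 * v ≤ 5 * ρ₀ ^ 2 * v ^ 2 := by
          have := sq_nonneg ρ₀
          nlinarith
        linarith

namespace IsHarmonicHeatSolution

variable {n : ℕ} {R μ T : ℝ} {y : ℝ → ℰ n → ℝ}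

lemma abs_le_exp_gaussian (h : IsHarmonicHeatSolution n R μ T y) (hμ : 0 < μ) {M : ℝ}
    (hM : 0 ≤ M) (h0 : ∀ x ∈ closedBall 0 R, |y 0 x| ≤ M) {t : ℝ} (ht : 0 < t) (htT : t ≤ T)
    {x : ℰ n} (hx : x ∈ closedBall 0 R) :
    |y t x| ≤ M * rexp (-(μ / 2) * ‖x‖ ^ 2 + ‖x‖ ^ 2 / (4 * t) - n * μ * t + n) := by
  refine (h.abs_le_gaussian hμ hM h0 t ⟨ht.le, htT⟩ x hx).trans ?_
  gcongr
  set z := 2 * μ * t with hz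
  have hz0 : 0 < z := by positivity
  have htanh : 1 - 1 / z ≤ Real.tanh z := by
    rw [Real.tanh_eq_sinh_div_cosh, le_div_iff₀ (Real.cosh_pos z), Real.sinh_eq, Real.cosh_eq]
    have h1 : rexp (-z) * (1 + 2 * z) ≤ rexp z := by
      have h2 := Real.add_one_le_exp (2 * z)
      calc _ ≤ rexp (-z) * rexp (2 * z) := by gcongr; linarith
        _ = _ := by rw [← Real.exp_add]; ring_nf
    have h3 : (1 - 1 / z) * ((rexp z + rexp (-z)) / 2) = (rexp z - rexp (-z)) / 2 -
          (rexp z + rexp (-z) - 2 * z * rexp (-z)) / (2 * z) := by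
      field_simp
      ring
    have h4 : 0 ≤ (rexp z + rexp (-z) - 2 * z * rexp (-z)) / (2 * z) := by
      have := Real.exp_pos (-z)
      apply div_nonneg _ (by positivity)
      nlinarith
    linarith
  have hlog : z - 1 ≤ Real.log (Real.cosh z) := by
    rw [Real.le_log_iff_exp_le (Real.cosh_pos z), Real.cosh_eq, Real.exp_sub]
    have h1 : (2 : ℝ) ≤ rexp 1 := by linarith [Real.add_one_le_exp 1]
    have h2 : rexp z / rexp 1 ≤ rexp z / 2 := by gcongr
    linarith [Real.exp_pos (-z)]
  have h1 : μ / 2 * (1 - 1 / z) * ‖x‖ ^ 2 ≤ μ / 2 * Real.tanh z * ‖x‖ ^ 2 := by gcongr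
  have h2 : μ / 2 * (1 - 1 / z) * ‖x‖ ^ 2 = μ / 2 * ‖x‖ ^ 2 - ‖x‖ ^ 2 / (4 * t) := by
    rw [hz]; field_simp; ring
  have h3 : (n : ℝ) / 2 * (z - 1) ≤ n / 2 * Real.log (Real.cosh z) := by gcongr
  linarith

end IsHarmonicHeatSolution

lemma le_of_mul_le_extrapolation {V k S Λ EA I err P Q s e U : ℝ} (hV : 0 < V) (hk : 0 ≤ k)
    (hI : 0 ≤ I) (hS : 0 ≤ S) (hP0 : 0 ≤ P)
    (h : V * U ≤ V * S + Λ * (EA * (I + k * V * S) + V * err)) (hP : Λ * EA ≤ P)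
    (hQ : 1 ≤ Q * V) (hs : S ≤ s) (he : Λ * err ≤ e) :
    U ≤ P * Q * I + (s + P * (k * s) + e) := by
  refine le_of_mul_le_mul_left ?_ hV
  have h1 : Λ * EA * (I + k * V * S) ≤ P * (Q * V * I + k * V * s) := by
    refine mul_le_mul hP (add_le_add (le_mul_of_one_le_left hI hQ) (by gcongr)) (by positivity) hP0
  have h2 := mul_le_mul_of_nonneg_left he hV.le
  have h3 := mul_le_mul_of_nonneg_left hs hV.le
  calc V * U ≤ V * S + (Λ * EA * (I + k * V * S) + V * (Λ * err)) := by linarith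
    _ ≤ V * s + (P * (Q * V * I + k * V * s) + V * e) := by linarith
    _ = _ := by ring

lemma slice_remainder_le {v R₁ R₂ C₁ C₂ C₃ C₄ M : ℝ} (hv : 1 ≤ v) (hM : 0 ≤ M) (hC₁ : 0 ≤ C₁)
    (hC₂ : 0 ≤ C₂) (hC₃ : 0 ≤ C₃) (hC₄ : 0 ≤ C₄) (n : ℕ) :
    rexp (-(v ^ 3 * R₂ ^ 2 / 2) + C₃ * v ^ 2) * M + rexp (v ^ 3 * R₁ ^ 2 / 2 + C₁ * v ^ 2) *
      (2 ^ n * (rexp (-(v ^ 3 * R₂ ^ 2 / 2) + C₃ * v ^ 2) * M)) +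
      rexp (-v ^ 3 + C₄ * v ^ 2) * M ≤
    rexp (-(min (R₂ ^ 2 - R₁ ^ 2) 2 / 2) * v ^ 3 + (C₁ + C₂ + C₃ + C₄ + n + 3) * v ^ 2) * M := by
  have hv3 : 0 ≤ v ^ 3 := by positivity
  have h1 := mul_le_mul_of_nonneg_right (min_le_left (R₂ ^ 2 - R₁ ^ 2) 2) hv3
  have h2 := mul_le_mul_of_nonneg_right (min_le_right (R₂ ^ 2 - R₁ ^ 2) 2) hv3
  set c := min (R₂ ^ 2 - R₁ ^ 2) 2
  have e1 := mul_nonneg hC₁ (sq_nonneg v)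
  have e2 := mul_nonneg hC₂ (sq_nonneg v)
  have e3 := mul_nonneg hC₃ (sq_nonneg v)
  have e4 := mul_nonneg hC₄ (sq_nonneg v)
  have e5 : 0 ≤ n * v ^ 2 := by positivity
  have e6 := mul_nonneg hv3 (sq_nonneg R₁)
  set X := rexp (-(c / 2) * v ^ 3 + (C₁ + C₂ + C₃ + C₄ + n) * v ^ 2) with hX
  have h2n : (2 : ℝ) ^ n ≤ rexp (n * v ^ 2) := by
    rw [Real.exp_nat_mul]
    have : 2 ≤ rexp (v ^ 2) := by
      linarith [Real.add_one_le_exp (v ^ 2), one_le_pow₀ hv (n := 2)]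
    gcongr
  have t1 : rexp (-(v ^ 3 * R₂ ^ 2 / 2) + C₃ * v ^ 2) ≤ X := Real.exp_le_exp.2 (by linarith)
  have t2 : rexp (v ^ 3 * R₁ ^ 2 / 2 + C₁ * v ^ 2) *
      (2 ^ n * rexp (-(v ^ 3 * R₂ ^ 2 / 2) + C₃ * v ^ 2)) ≤ X := by
    calc _ ≤ rexp (v ^ 3 * R₁ ^ 2 / 2 + C₁ * v ^ 2) * (rexp (n * v ^ 2) *
          rexp (-(v ^ 3 * R₂ ^ 2 / 2) + C₃ * v ^ 2)) := by gcongr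
      _ ≤ X := by
          rw [← Real.exp_add, ← Real.exp_add]
          exact Real.exp_le_exp.2 (by linarith)
  have t3 : rexp (-v ^ 3 + C₄ * v ^ 2) ≤ X := Real.exp_le_exp.2 (by linarith)
  have h3X : 3 * X ≤ rexp (-(c / 2) * v ^ 3 + (C₁ + C₂ + C₃ + C₄ + n + 3) * v ^ 2) :=
    calc 3 * X ≤ rexp (3 * v ^ 2) * X :=
          mul_le_mul_of_nonneg_right (le_exp_mul_sq (by norm_num) hv) (Real.exp_pos _).le
      _ = _ := by rw [hX, ← Real.exp_add]; ring_nf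
  calc _ = (rexp (-(v ^ 3 * R₂ ^ 2 / 2) + C₃ * v ^ 2) +
        rexp (v ^ 3 * R₁ ^ 2 / 2 + C₁ * v ^ 2) *
          (2 ^ n * rexp (-(v ^ 3 * R₂ ^ 2 / 2) + C₃ * v ^ 2)) +
        rexp (-v ^ 3 + C₄ * v ^ 2)) * M := by ring
    _ ≤ _ := mul_le_mul_of_nonneg_right (by linarith) hM

lemma volume_real_ball_eq {n : ℕ} (x : ℰ n) {r : ℝ} (hr : 0 < r) :
    volume.real (ball x r) = r ^ n * volume.real (ball (0 : ℰ n) 1) := by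
  rw [measureReal_def, Measure.addHaar_ball_of_pos volume x hr, finrank_euclideanSpace_fin,
    ENNReal.toReal_mul, ENNReal.toReal_ofReal (by positivity), measureReal_def]

namespace IsHarmonicHeatSolution

variable {n : ℕ} {R R₁ R₂ ρ₀ : ℝ}

set_option maxHeartbeats 1600000 in
lemma exists_abs_le_slice [NeZero n] (hR₁ : 0 < R₁) (h₂R : R₂ < R) (hρ₀ : 0 < ρ₀)
    (hρ₂ : R₁ + 3 * ρ₀ < R₂) :
    ∃ C : ℝ, 0 ≤ C ∧ ∀ (v T : ℝ) (y : ℝ → ℰ n → ℝ), 1 ≤ v →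
      32 * R ^ 2 ≤ v → IsHarmonicHeatSolution n R (v ^ 3) T y → ∀ M, 0 ≤ M →
      (∀ x ∈ closedBall 0 R, |y 0 x| ≤ M) → ∀ b, 2 / v ≤ b → b < T →
      ∀ x₀, ‖x₀‖ = R₁ + 2 * (ρ₀ / v) → ∀ x, ‖x‖ ≤ R₁ + 3 * (ρ₀ / v) →
      |y b x| ≤ rexp (v ^ 3 * R₁ ^ 2 / 2 + C * v ^ 2) * (∫ q in ball x₀ (ρ₀ / v), |y b q|) +
        rexp (-(min (R₂ ^ 2 - R₁ ^ 2) 2 / 2) * v ^ 3 + C * v ^ 2) * M := by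
  have hR₂ : 0 < R₂ := by linarith
  have hR : 0 < R := hR₂.trans h₂R
  obtain ⟨C₅, hC₅, H₅⟩ := exists_abs_sub_integral_mehler_le n hR₂ h₂R (sub_pos.2 hρ₂)
  obtain ⟨CΛ, hCΛ, HΛ⟩ := exists_extrapolation_factor_le hR hρ₀
  set V₀ := volume.real (ball (0 : ℰ n) 1)
  have hV₀0 : 0 < V₀ := ENNReal.toReal_pos (measure_ball_pos _ _ one_pos).ne' measure_ball_lt_top.ne
  set W := volume.real (closedBall (0 : ℰ n) R)
  set C₁ := CΛ + (3 * R₁ * ρ₀ + 5 * ρ₀ ^ 2 + R ^ 2) with hC₁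
  set C₂ := (2 / ρ₀) ^ n / V₀ + n with hC₂
  set C₃ := 2 * C₅ + 3 + R ^ 2 + n with hC₃
  set C₄ := CΛ + 6 * W + n with hC₄
  have hn0 : (0 : ℝ) ≤ n := Nat.cast_nonneg n
  have hC₁0 : 0 ≤ C₁ := by positivity
  have hC₂0 : 0 ≤ C₂ := by positivity
  have hC₃0 : 0 ≤ C₃ := by positivity
  have hC₄0 : 0 ≤ C₄ := by positivity
  refine ⟨C₁ + C₂ + C₃ + C₄ + n + 3, by positivity, fun v T y hv hvR h M hM h0 b hb hbT x₀ hx₀ x hx => ?_⟩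
  have hv0 : 0 < v := by linarith
  have hμ : 0 < v ^ 3 := by positivity
  have hs0 : 0 < 1 / v := by positivity
  have hab : b - (b - 1 / v) = 1 / v := by ring
  have ha : 1 / v ≤ b - 1 / v := by
    have : 2 / v = 1 / v + 1 / v := by ring
    linarith
  have hρv : ρ₀ / v ≤ ρ₀ := div_le_self hρ₀.le hv
  have hρv0 : 0 < ρ₀ / v := by positivity
  have hvv : v ≤ v ^ 2 := by nlinarith
  have hv2 : 1 ≤ v ^ 2 := one_le_pow₀ hv
  set Y := M * rexp (-(v ^ 3 * R₂ ^ 2 / 2) + (R ^ 2 + n) * v ^ 2) with hY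
  have hY0 : 0 ≤ Y := by positivity
  have hYb : ∀ σ ∈ Ico (b - 1 / v) b, ∀ z ∈ ball 0 R, R₂ ≤ ‖z‖ →
      |y σ z| ≤ Y := by
    intro σ hσ z hz hz2
    have hσ0 : 0 < σ := by linarith [hσ.1]
    refine (h.abs_le_exp_gaussian hμ hM h0 hσ0 (hσ.2.le.trans hbT.le)
      (ball_subset_closedBall hz)).trans ?_
    rw [hY]
    gcongr M * rexp ?_
    have h1 : ‖z‖ ^ 2 / (4 * σ) ≤ R ^ 2 * v ^ 2 := by
      rw [div_le_iff₀ (by positivity)]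
      have h2 : ‖z‖ ^ 2 ≤ R ^ 2 := by
        have := mem_ball_zero_iff.1 hz
        gcongr
      have h3 : 1 ≤ σ * v := by
        rw [← div_le_iff₀ hv0]
        exact ha.trans hσ.1
      have h4 : R ^ 2 * 1 * 1 ≤ R ^ 2 * (4 * (σ * v)) * v := by gcongr; linarith
      linarith
    have h2 : v ^ 3 * R₂ ^ 2 ≤ v ^ 3 * ‖z‖ ^ 2 := by gcongr
    have h3 : 0 ≤ n * v ^ 3 * σ := by positivity
    have h4 : (n : ℝ) ≤ n * v ^ 2 := le_mul_of_one_le_right hn0 hv2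
    linarith
  set g := cutoffExtension R (R ^ 2 - R₂ ^ 2) y (b - 1 / v)
  have haI : b - 1 / v ∈ Icc 0 T := ⟨by linarith, by linarith⟩
  have hη : 0 < R ^ 2 - R₂ ^ 2 := by nlinarith
  have hgc : Continuous g := by
    have := contDiffAt_cutoffExtension (u := y) hR hη (by nlinarith) isOpen_Ioo
      fun t ht x hx => h.contDiffAt ht hx
    refine continuous_iff_continuousAt.2 fun z => ?_
    exact ((this (b - 1 / v) ⟨by linarith, by linarith⟩ z).continuousAt).comp
      (f := fun z => (b - 1 / v, z)) (by fun_prop)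
  have hsub : ball x₀ (ρ₀ / v) ⊆ closedBall 0 (R₁ + 3 * (ρ₀ / v)) := fun z hz => by
    rw [mem_closedBall_zero_iff]
    have h1 := norm_le_norm_add_norm_sub' z x₀
    have h2 := mem_ball_iff_norm.1 hz
    linarith
  have hN : 1 ≤ ⌈v⌉₊ := Nat.one_le_ceil_iff.2 hv0
  have hB := mehlerB_cube_le hv hvR
  have hB0 : 0 < mehlerB (v ^ 3) (1 / v) := mehlerB_pos hμ hs0
  have hB1 : rexp (-v ^ 2) ≤ 1 := Real.exp_le_one_iff.2 (by linarith)
  set S := C₅ * (1 + v ^ 3) * Y * (1 / v) with hS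
  have key := abs_le_of_abs_sub_mehler_le hμ hs0 hgc (fun z hz => cutoffExtension_eq_zero hz) hM
    (fun z => abs_cutoffExtension_le hM fun hz => h.abs_le hM h0 _ haI z (ball_subset_closedBall hz))
    (h.continuousOn_slice ⟨by linarith, hbT.le⟩) hR (r := R₁ + 3 * (ρ₀ / v)) (S := S) (by linarith)
    (fun p hp => by
      have := H₅ (v ^ 3) T y h hμ (b - 1 / v) b (by linarith) (by linarith) hbT Y hY0 hYb p
        (by linarith)
      rwa [hab] at this)
    (hB.trans hB1) hN hρv0 (by linarith) hsub
    (hsub.trans (closedBall_subset_ball (by linarith))) hx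
  set V := volume.real (ball x₀ (ρ₀ / v / 2))
  have hVe : V = (ρ₀ / v / 2) ^ n * V₀ := volume_real_ball_eq _ (by positivity)
  have hV2 : volume.real (ball x₀ (ρ₀ / v)) = 2 ^ n * V := by
    rw [volume_real_ball_eq _ hρv0, hVe, ← mul_assoc, ← mul_pow]
    congr 2
    ring
  rw [hV2] at key
  have hΛ := HΛ v hv
  set Λ := ((⌈v⌉₊ : ℝ) + 1) * (16 * R * ⌈v⌉₊ / (ρ₀ / v)) ^ ⌈v⌉₊
  have hP : Λ * rexp (mehlerA (v ^ 3) (1 / v) * (R₁ + 3 * (ρ₀ / v)) ^ 2) ≤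
      rexp (v ^ 3 * R₁ ^ 2 / 2 + C₁ * v ^ 2) := by
    have h1 := Real.exp_le_exp.2 (mehlerA_cube_mul_le (R := R) hv hR₁ hρ₀ (by linarith))
    calc _ ≤ rexp (CΛ * v ^ 2) * _ := mul_le_mul hΛ h1 (Real.exp_pos _).le (Real.exp_pos _).le
      _ = _ := by rw [← Real.exp_add, hC₁]; ring_nf
  have hQ : 1 ≤ rexp (C₂ * v ^ 2) * V := by
    have h1 : (2 / ρ₀) ^ n / V₀ * v ^ n ≤ rexp (C₂ * v ^ 2) := by
      rw [hC₂, add_mul, Real.exp_add]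
      exact mul_le_mul (le_exp_mul_sq (by positivity) hv) (pow_le_exp_mul_sq n hv) (by positivity)
        (Real.exp_pos _).le
    calc (1 : ℝ) = (2 / ρ₀) ^ n / V₀ * v ^ n * V := by
          rw [hVe, div_mul_eq_mul_div, ← mul_pow, div_mul_eq_mul_div, ← mul_assoc, ← mul_pow,
            show 2 / ρ₀ * v * (ρ₀ / v / 2) = 1 by field_simp, one_pow, one_mul, div_self hV₀0.ne']
      _ ≤ _ := by gcongr
  have hSs : S ≤ rexp (-(v ^ 3 * R₂ ^ 2 / 2) + C₃ * v ^ 2) * M := by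
    have h1 : C₅ * (1 + v ^ 3) * (1 / v) ≤ 2 * C₅ * v ^ 3 := by
      have h2 : 1 + v ^ 3 ≤ 2 * v ^ 3 := by linarith [one_le_pow₀ hv (n := 3)]
      calc _ ≤ C₅ * (2 * v ^ 3) * 1 := by
            gcongr
            exact (div_le_one hv0).2 hv
        _ = _ := by ring
    have h3 := le_exp_mul_sq (K := 2 * C₅) (by positivity) hv
    have h4 := pow_le_exp_mul_sq 3 hv
    calc S = C₅ * (1 + v ^ 3) * (1 / v) * Y := by rw [hS]; ring
      _ ≤ rexp (2 * C₅ * v ^ 2) * rexp ((3 : ℕ) * v ^ 2) * Y := by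
          refine mul_le_mul_of_nonneg_right (h1.trans ?_) hY0
          exact mul_le_mul h3 h4 hμ.le (Real.exp_pos _).le
      _ = _ := by
          rw [hY, mul_comm M, ← mul_assoc, ← Real.exp_add, ← Real.exp_add, hC₃]
          push_cast
          ring_nf
  have he : Λ * (2 * rexp (mehlerB (v ^ 3) (1 / v) * R ^ 2) *
      (4 * (mehlerB (v ^ 3) (1 / v) * R ^ 2)) ^ (⌈v⌉₊ + 1) *
      (rexp (-(n / 2 * Real.log (4 * π * (1 / v)))) * M * W)) ≤
      rexp (-v ^ 3 + C₄ * v ^ 2) * M := by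
    have h1 : rexp (mehlerB (v ^ 3) (1 / v) * R ^ 2) ≤ 3 :=
      (Real.exp_le_exp.2 (by linarith)).trans Real.exp_one_lt_three.le
    have h2 : (4 * (mehlerB (v ^ 3) (1 / v) * R ^ 2)) ^ (⌈v⌉₊ + 1) ≤ rexp (-v ^ 3) := by
      calc _ ≤ rexp (-v ^ 2) ^ (⌈v⌉₊ + 1) := by gcongr
        _ = rexp ((⌈v⌉₊ + 1 : ℕ) * -v ^ 2) := by rw [Real.exp_nat_mul]
        _ ≤ _ := by
          apply Real.exp_le_exp.2
          push_cast
          have := mul_le_mul_of_nonneg_right (Nat.le_ceil v) (sq_nonneg v)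
          linarith [sq_nonneg v]
    have h3 := exp_neg_log_le n hv
    have h4 := le_exp_mul_sq (K := 6 * W) (by positivity) hv
    calc _ ≤ rexp (CΛ * v ^ 2) * (2 * 3 * rexp (-v ^ 3) *
          (rexp (n * v ^ 2) * M * W)) := by gcongr
      _ = rexp (CΛ * v ^ 2) * (rexp (-v ^ 3) * (rexp (n * v ^ 2) * M)) * (6 * W) := by
          ring
      _ ≤ rexp (CΛ * v ^ 2) * (rexp (-v ^ 3) * (rexp (n * v ^ 2) * M)) *
          rexp (6 * W * v ^ 2) := by gcongr
      _ = rexp (CΛ * v ^ 2) * rexp (-v ^ 3) * rexp (n * v ^ 2) *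
          rexp (6 * W * v ^ 2) * M := by ring
      _ = _ := by
          rw [← Real.exp_add, ← Real.exp_add, ← Real.exp_add, hC₄]
          ring_nf
  have hI0 : 0 ≤ ∫ q in ball x₀ (ρ₀ / v), |y b q| := integral_nonneg fun q => abs_nonneg _
  have hVpos : 0 < V := by rw [hVe]; positivity
  refine (le_of_mul_le_extrapolation hVpos (by positivity) hI0 (by positivity)
    (Real.exp_pos _).le key hP hQ hSs he).trans ?_
  rw [← Real.exp_add]
  refine add_le_add (mul_le_mul_of_nonneg_right (Real.exp_le_exp.2 ?_) hI0) ?_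
  · have : 0 ≤ (C₃ + C₄ + n + 3) * v ^ 2 := by positivity
    linarith
  · exact slice_remainder_le hv hM hC₁0 hC₂0 hC₃0 hC₄0 n

lemma exists_supSq_le_slice [NeZero n] (hR₁ : 0 < R₁) (h₂R : R₂ < R) (hρ₀ : 0 < ρ₀)
    (hρ₂ : R₁ + 3 * ρ₀ < R₂) :
    ∃ C c : ℝ, 0 ≤ C ∧ 0 < c ∧ ∀ (v T : ℝ) (y : ℝ → ℰ n → ℝ), 1 ≤ v → 32 * R ^ 2 ≤ v →
      IsHarmonicHeatSolution n R (v ^ 3) T y → ∀ b, 2 / v ≤ b → b < T →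
      ∀ x₀ : ℰ n, ‖x₀‖ = R₁ + 2 * (ρ₀ / v) →
      supSq R (y b) ≤ rexp (v ^ 3 * R₁ ^ 2 + C * v ^ 2) * (∫ q in ball x₀ (ρ₀ / v), y b q ^ 2) +
        rexp (-c * v ^ 3 + C * v ^ 2) * supSq R (y 0) := by
  have hR : 0 < R := by linarith
  obtain ⟨C, hC, H⟩ := exists_abs_le_slice (n := n) hR₁ h₂R hρ₀ hρ₂
  set c' := min (R₂ ^ 2 - R₁ ^ 2) 2
  set W := volume.real (ball (0 : ℰ n) R)
  have hW : 0 ≤ W := measureReal_nonneg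
  refine ⟨2 * C + 2 * W + 2 + R ^ 2 + 2 * n, min (R₁ ^ 2) c', by positivity,
    lt_min (by positivity) (lt_min (by nlinarith) two_pos), fun v T y hv hvR h b hb hbT x₀ hx₀ => ?_⟩
  have hv0 : 0 < v := by linarith
  have hv2 : 1 ≤ v ^ 2 := one_le_pow₀ hv
  have hv3 : 0 < v ^ 3 := by positivity
  have hb0 : 0 < b := lt_of_lt_of_le (by positivity) hb
  have hbI : b ∈ Icc 0 T := ⟨hb0.le, hbT.le⟩
  have h00 : ∀ x ∈ closedBall 0 R, |y 0 x| ≤ √(supSq R (y 0)) :=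
    fun x hx => h.abs_le_sqrt_supSq ⟨le_rfl, by linarith⟩ hx
  have hm : 0 ≤ supSq R (y 0) := supSq_nonneg _
  have hJ : 0 ≤ ∫ q in ball x₀ (ρ₀ / v), y b q ^ 2 := integral_nonneg fun q => sq_nonneg _
  have e1 := mul_nonneg hC (sq_nonneg v)
  have e2 := mul_nonneg hW (sq_nonneg v)
  have e3 := mul_nonneg (sq_nonneg R) (sq_nonneg v)
  have e4 : (n : ℝ) ≤ n * v ^ 2 := le_mul_of_one_le_right (Nat.cast_nonneg n) hv2
  have c1 := mul_le_mul_of_nonneg_right (min_le_left (R₁ ^ 2) c') hv3.le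
  have c2 := mul_le_mul_of_nonneg_right (min_le_right (R₁ ^ 2) c') hv3.le
  refine supSq_le hR.le fun x hx => ?_
  rcases le_total ‖x‖ (R₁ + 3 * (ρ₀ / v)) with hxr | hxr
  · have h1 := H v T y hv hvR h _ (Real.sqrt_nonneg _) h00 b hb hbT x₀ hx₀ x hxr
    set I := ∫ q in ball x₀ (ρ₀ / v), |y b q|
    set P := rexp (v ^ 3 * R₁ ^ 2 / 2 + C * v ^ 2) with hP
    set e := rexp (-(c' / 2) * v ^ 3 + C * v ^ 2) with he
    have hsub : ball x₀ (ρ₀ / v) ⊆ ball 0 R := fun z hz => by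
      rw [mem_ball_zero_iff]
      have h1 := norm_le_norm_add_norm_sub' z x₀
      have h2 := mem_ball_iff_norm.1 hz
      have h3 : ρ₀ / v ≤ ρ₀ := div_le_self hρ₀.le hv
      linarith
    have hI2 : I ^ 2 ≤ W * ∫ q in ball x₀ (ρ₀ / v), y b q ^ 2 := by
      have : IsFiniteMeasure (volume.restrict (ball x₀ (ρ₀ / v))) :=
        ⟨by simpa using measure_ball_lt_top⟩
      refine (_root_.sq_integral_abs_le ((h.integrableOn_abs hbI).mono_set hsub)
        ((h.integrableOn_sq hbI).mono_set hsub)).trans (mul_le_mul_of_nonneg_right ?_ hJ)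
      rw [measureReal_restrict_apply MeasurableSet.univ, univ_inter]
      exact measureReal_mono hsub measure_ball_lt_top.ne
    have hP2 : 2 * W * P ^ 2 ≤
        rexp (v ^ 3 * R₁ ^ 2 + (2 * C + 2 * W + 2 + R ^ 2 + 2 * n) * v ^ 2) := by
      calc _ ≤ rexp (2 * W * v ^ 2) * P ^ 2 := by
            gcongr
            exact le_exp_mul_sq (by positivity) hv
        _ = rexp (v ^ 3 * R₁ ^ 2 + 2 * C * v ^ 2 + 2 * W * v ^ 2) := by
            rw [hP, ← Real.exp_nat_mul, ← Real.exp_add]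
            push_cast
            ring_nf
        _ ≤ _ := Real.exp_le_exp.2 (by linarith)
    have he2 : 2 * e ^ 2 ≤ rexp (-min (R₁ ^ 2) c' * v ^ 3 +
        (2 * C + 2 * W + 2 + R ^ 2 + 2 * n) * v ^ 2) := by
      calc _ ≤ rexp (2 * v ^ 2) * e ^ 2 := by
            gcongr
            exact le_exp_mul_sq two_pos.le hv
        _ = rexp (-c' * v ^ 3 + 2 * C * v ^ 2 + 2 * v ^ 2) := by
            rw [he, ← Real.exp_nat_mul, ← Real.exp_add]
            push_cast
            ring_nf
        _ ≤ _ := Real.exp_le_exp.2 (by linarith)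
    calc y b x ^ 2 = |y b x| ^ 2 := (sq_abs _).symm
      _ ≤ (P * I + e * √(supSq R (y 0))) ^ 2 := by gcongr
      _ ≤ 2 * P ^ 2 * I ^ 2 + 2 * e ^ 2 * √(supSq R (y 0)) ^ 2 := by
          nlinarith [sq_nonneg (P * I - e * √(supSq R (y 0)))]
      _ ≤ 2 * P ^ 2 * (W * ∫ q in ball x₀ (ρ₀ / v), y b q ^ 2) + 2 * e ^ 2 * supSq R (y 0) := by
          rw [Real.sq_sqrt hm]
          gcongr
      _ = 2 * W * P ^ 2 * (∫ q in ball x₀ (ρ₀ / v), y b q ^ 2) + 2 * e ^ 2 * supSq R (y 0) := by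
          ring
      _ ≤ _ := by gcongr
  · have h1 := h.abs_le_exp_gaussian hv3 (Real.sqrt_nonneg _) h00 hb0 hbT.le hx
    have hxR : ‖x‖ ^ 2 ≤ R ^ 2 := by
      have := mem_closedBall_zero_iff.1 hx
      gcongr
    have h2 : ‖x‖ ^ 2 / (4 * b) ≤ R ^ 2 * v ^ 2 / 2 := by
      rw [div_le_iff₀ (by positivity)]
      have h3 : 2 ≤ b * v := (div_le_iff₀ hv0).1 hb
      have h4 : R ^ 2 * 1 * 1 ≤ R ^ 2 * (2 * (b * v)) * v := by gcongr; linarith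
      linarith
    have h5 : v ^ 3 * R₁ ^ 2 ≤ v ^ 3 * ‖x‖ ^ 2 := by
      have : 0 ≤ 3 * (ρ₀ / v) := by positivity
      have : R₁ ≤ ‖x‖ := by linarith
      gcongr
    have h6 : 0 ≤ n * v ^ 3 * b := by positivity
    calc y b x ^ 2 = |y b x| ^ 2 := (sq_abs _).symm
      _ ≤ _ := pow_le_pow_left₀ (abs_nonneg _) h1 2
      _ = rexp (2 * (-(v ^ 3 / 2) * ‖x‖ ^ 2 + ‖x‖ ^ 2 / (4 * b) - n * v ^ 3 * b + n)) *
          supSq R (y 0) := by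
          rw [mul_pow, Real.sq_sqrt hm, ← Real.exp_nat_mul, mul_comm, Nat.cast_ofNat]
      _ ≤ rexp (-min (R₁ ^ 2) c' * v ^ 3 +
          (2 * C + 2 * W + 2 + R ^ 2 + 2 * n) * v ^ 2) * supSq R (y 0) := by
          gcongr rexp ?_ * _
          linarith
      _ ≤ _ := le_add_of_nonneg_left (by positivity)

variable {S : Set (ℰ n)}

lemma exists_supSq_le_step [NeZero n] (hR₁ : 0 < R₁) (h₁₂ : R₁ < R₂) (h₂R : R₂ < R)
    (hS : MeasurableSet S) (hSR : S ⊆ ball 0 R) {ρ₁ : ℝ} (hρ₁ : 0 < ρ₁)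
    (hball : ∀ ρ, 0 < ρ → ρ ≤ ρ₁ → ∃ x₀, ‖x₀‖ = R₁ + 2 * ρ ∧ ball x₀ ρ ⊆ S) :
    ∃ C c v₀ : ℝ, 0 ≤ C ∧ 0 < c ∧ 1 ≤ v₀ ∧ ∀ (v T : ℝ) (y : ℝ → ℰ n → ℝ), v₀ ≤ v →
      IsHarmonicHeatSolution n R (v ^ 3) T y → ∀ t, 0 ≤ t → t + 3 / v < T →
      supSq R (y (t + 3 / v)) ≤
        rexp (v ^ 3 * R₁ ^ 2 + C * v ^ 2) * (∫ s in (0 : ℝ)..T, ∫ x in S, y s x ^ 2) +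
        rexp (-(c * v ^ 3)) * supSq R (y t) := by
  set ρ₀ := min ρ₁ ((R₂ - R₁) / 4)
  have hρ₀ : 0 < ρ₀ := lt_min hρ₁ (by linarith)
  obtain ⟨C, c, hC, hc, H⟩ := exists_supSq_le_slice (n := n) hR₁ h₂R hρ₀
    (by linarith [min_le_right ρ₁ ((R₂ - R₁) / 4)])
  refine ⟨C + 1, c / 2, max 1 (max (32 * R ^ 2) (2 * C / c)), by positivity, by positivity,
    le_max_left _ _, fun v T y hv₀ h t ht htT => ?_⟩
  obtain ⟨hv, hv₁⟩ := max_le_iff.1 hv₀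
  obtain ⟨hvR, hvC⟩ := max_le_iff.1 hv₁
  have hv0 : 0 < v := by linarith
  obtain ⟨x₀, hx₀, hx₀S⟩ := hball (ρ₀ / v) (by positivity)
    ((div_le_self hρ₀.le hv).trans (min_le_left _ _))
  set D := rexp (v ^ 3 * R₁ ^ 2 + C * v ^ 2) with hD
  have h3v : 3 / v = 2 / v + 1 / v := by ring
  have hiv : 0 < 1 / v := by positivity
  have h2v : 0 < 2 / v := by positivity
  have he : rexp (-c * v ^ 3 + C * v ^ 2) ≤ rexp (-(c / 2 * v ^ 3)) := by
    apply Real.exp_le_exp.2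
    rw [div_le_iff₀ hc] at hvC
    have := mul_le_mul_of_nonneg_right hvC (sq_nonneg v)
    linarith
  set e := rexp (-(c / 2 * v ^ 3))
  have key := h.mul_le_integral_of_le hS hSR le_rfl le_rfl (a := t + 2 / v) (b := t + 3 / v)
    (c := supSq R (y (t + 3 / v)) - e * supSq R (y t)) (by linarith) (by linarith) htT.le
    (Real.exp_pos (v ^ 3 * R₁ ^ 2 + C * v ^ 2)).le fun s hs => by
      have h1 := H v (T - t) _ hv hvR (h.shift ht le_rfl) (s - t) (by linarith [hs.1])
        (by linarith [hs.2]) x₀ hx₀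
      simp only [add_sub_cancel, add_zero] at h1
      have h2 := h.supSq_antitone (by nlinarith) (by linarith [hs.1]) hs.2 htT.le
      have h3 := setIntegral_mono_set ((h.integrableOn_sq ⟨by linarith [hs.1],
        by linarith [hs.2]⟩).mono_set hSR) (ae_of_all _ fun x => sq_nonneg (y s x)) hx₀S.eventuallyLE
      have h4 := mul_le_mul_of_nonneg_left h3 (Real.exp_pos (v ^ 3 * R₁ ^ 2 + C * v ^ 2)).le
      have h5 := mul_le_mul_of_nonneg_right he (supSq_nonneg (R := R) (y t))
      linarith
  rw [show t + 3 / v - (t + 2 / v) = 1 / v by ring, one_div_mul_eq_div, div_le_iff₀ hv0, ← hD] at key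
  have hO : 0 ≤ ∫ s in (0 : ℝ)..T, ∫ x in S, y s x ^ 2 :=
    intervalIntegral.integral_nonneg (by linarith) fun s _ => integral_nonneg fun x => sq_nonneg _
  have hvD : D * v ≤ rexp (v ^ 3 * R₁ ^ 2 + (C + 1) * v ^ 2) := by
    have h1 := pow_le_exp_mul_sq 1 hv
    rw [pow_one, Nat.cast_one, one_mul] at h1
    calc _ ≤ D * rexp (v ^ 2) := by gcongr
      _ = _ := by rw [hD, ← Real.exp_add]; ring_nf
  have := mul_le_mul_of_nonneg_right hvD hO
  linarith

lemma supSq_le_iterate {v T D q O : ℝ} {y : ℝ → ℰ n → ℝ} (hv : 0 < v) (hD : 0 ≤ D * O) (hq : 0 ≤ q)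
    (hq1 : q ≤ 1) (hstep : ∀ t, 0 ≤ t → t + 3 / v < T →
      supSq R (y (t + 3 / v)) ≤ D * O + q * supSq R (y t)) {t : ℝ} (ht : 0 ≤ t) (k : ℕ)
    (hk : t + k * (3 / v) < T) :
    supSq R (y (t + k * (3 / v))) ≤ k * (D * O) + q ^ k * supSq R (y t) := by
  have h3 : 0 < 3 / v := by positivity
  induction k with
  | zero => simp
  | succ k ih =>
    have e : t + (k + 1 : ℕ) * (3 / v) = t + k * (3 / v) + 3 / v := by push_cast; ring
    rw [e] at hk ⊢
    have h1 := mul_le_mul_of_nonneg_left (ih (by linarith)) hq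
    have h2 : 0 ≤ k * (D * O) := by positivity
    have h4 := mul_le_of_le_one_left h2 hq1
    refine (hstep _ (by positivity) hk).trans ?_
    rw [pow_succ']
    push_cast
    linarith

end IsHarmonicHeatSolution

lemma isOpen_annulus_sector {n : ℕ} {R₁ R₂ : ℝ} (hR₁ : 0 < R₁) {U : Set (ℰ n)} (hU : IsOpen U) :
    IsOpen {x : ℰ n | R₁ < ‖x‖ ∧ ‖x‖ < R₂ ∧ ‖x‖⁻¹ • x ∈ U} := by
  have h1 : ContinuousOn (fun x : ℰ n => ‖x‖⁻¹ • x) {x | R₁ < ‖x‖} :=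
    (continuousOn_id.norm.inv₀ fun x hx => (hR₁.trans hx).ne').smul continuousOn_id
  have h2 := (h1.isOpen_inter_preimage (isOpen_lt continuous_const continuous_norm) hU).inter
    (isOpen_lt continuous_norm (continuous_const (y := R₂)))
  convert h2 using 1
  ext x
  simp only [mem_ofPred_eq, mem_inter_iff, mem_preimage]
  tauto

lemma exists_ball_subset_annulus_sector {n : ℕ} {R₁ R₂ : ℝ} (hR₁ : 0 < R₁) (h₁₂ : R₁ < R₂)
    {U : Set (ℰ n)} (hU : IsOpen U) {θ : ℰ n} (hθU : θ ∈ U) (hθ : ‖θ‖ = 1) :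
    ∃ ρ₁, 0 < ρ₁ ∧ ∀ ρ, 0 < ρ → ρ ≤ ρ₁ → ∃ x₀, ‖x₀‖ = R₁ + 2 * ρ ∧
      ball x₀ ρ ⊆ {x : ℰ n | R₁ < ‖x‖ ∧ ‖x‖ < R₂ ∧ ‖x‖⁻¹ • x ∈ U} := by
  obtain ⟨ε, hε, hεU⟩ := Metric.isOpen_iff.1 hU θ hθU
  refine ⟨min (ε * R₁ / 2) ((R₂ - R₁) / 3), lt_min (by positivity) (by linarith),
    fun ρ hρ hρ₁ => ?_⟩
  have h1 := hρ₁.trans (min_le_left _ _)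
  have h2 := hρ₁.trans (min_le_right _ _)
  have hx₀ : ‖(R₁ + 2 * ρ) • θ‖ = R₁ + 2 * ρ := by
    rw [norm_smul, hθ, mul_one, Real.norm_of_nonneg (by linarith)]
  refine ⟨(R₁ + 2 * ρ) • θ, hx₀, fun x hx => ?_⟩
  have hxb := mem_ball_iff_norm.1 hx
  have h3 := abs_norm_sub_norm_le x ((R₁ + 2 * ρ) • θ)
  rw [hx₀] at h3
  obtain ⟨h4, h5⟩ := abs_lt.1 (h3.trans_lt hxb)
  have hx0 : 0 < ‖x‖ := by linarith
  refine ⟨by linarith, by linarith, hεU ?_⟩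
  rw [mem_ball_iff_norm]
  have h6 : ‖x‖⁻¹ • x - θ = ‖x‖⁻¹ • ((x - (R₁ + 2 * ρ) • θ) - (‖x‖ - (R₁ + 2 * ρ)) • θ) := by
    rw [sub_smul, sub_sub_sub_cancel_right, smul_sub, smul_smul, inv_mul_cancel₀ hx0.ne', one_smul]
  rw [h6, norm_smul, norm_inv, norm_norm, inv_mul_lt_iff₀ hx0]
  have h7 := norm_sub_le (x - (R₁ + 2 * ρ) • θ) ((‖x‖ - (R₁ + 2 * ρ)) • θ)
  rw [norm_smul, hθ, mul_one, Real.norm_eq_abs] at h7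
  nlinarith

lemma exponent_le_div_rpow {A δ₀ δ β X : ℝ} (hA : 0 ≤ A) (hδ₀ : 1 ≤ δ₀) (hδ : 0 < δ) (hβ : 1 < β)
    (h₁ : δ₀ ≤ δ → X ≤ 0) (h₂ : X ≤ A / δ ^ 2) :
    X ≤ (A * δ₀ ^ (2 * β) + 1 / (β - 1)) / δ ^ (2 * β) := by
  have hpos : 0 < δ ^ (2 * β) := Real.rpow_pos_of_pos hδ _
  rcases le_total δ₀ δ with h | h
  · exact (h₁ h).trans (by positivity)
  · refine h₂.trans ?_
    rw [div_le_div_iff₀ (by positivity) hpos]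
    have e1 : δ ^ (2 * β) = δ ^ (2 * β - 2) * δ ^ 2 := by
      rw [← Real.rpow_natCast, ← Real.rpow_add hδ]
      norm_num
    have e2 : δ ^ (2 * β - 2) ≤ δ₀ ^ (2 * β) := (Real.rpow_le_rpow hδ.le h (by linarith)).trans
        (Real.rpow_le_rpow_of_exponent_le hδ₀ (by linarith))
    rw [e1, ← mul_assoc]
    gcongr
    have := mul_le_mul_of_nonneg_left e2 hA
    have : 0 < 1 / (β - 1) := by positivity
    linarith

namespace IsHarmonicHeatSolution

variable {n : ℕ} {R R₁ R₂ : ℝ} {S : Set (ℰ n)}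

lemma integral_subset_le {μ T t₀ : ℝ} {y : ℝ → ℰ n → ℝ} (h : IsHarmonicHeatSolution n R μ T y)
    (ht₀ : 0 ≤ t₀) (ht₀T : t₀ ≤ T) (hS : MeasurableSet S) (hSR : S ⊆ ball 0 R) {B : Set (ℰ n)}
    (hB : MeasurableSet B) (hBS : B ⊆ S) :
    ∫ s in (0 : ℝ)..t₀, ∫ x in B, y s x ^ 2 ≤ ∫ s in (0 : ℝ)..T, ∫ x in S, y s x ^ 2 := by
  have hT : 0 ≤ T := ht₀.trans ht₀T
  have hi : IntervalIntegrable (fun s => ∫ x in S, y s x ^ 2) volume 0 T :=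
    (by rw [uIcc_of_le hT]; exact h.continuousOn_integral_sq hS hSR :
      ContinuousOn _ (uIcc 0 T)).intervalIntegrable
  have hj : IntervalIntegrable (fun s => ∫ x in B, y s x ^ 2) volume 0 T :=
    (by rw [uIcc_of_le hT]; exact h.continuousOn_integral_sq hB (hBS.trans hSR) :
      ContinuousOn _ (uIcc 0 T)).intervalIntegrable
  refine (intervalIntegral.integral_mono_interval le_rfl ht₀ ht₀T
    (ae_of_all _ fun s => integral_nonneg fun x => sq_nonneg _) hj).trans
    (intervalIntegral.integral_mono_on hT hj hi fun s hs => ?_)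
  exact setIntegral_mono_set ((h.integrableOn_sq hs).mono_set hSR)
    (ae_of_all _ fun x => sq_nonneg _) hBS.eventuallyLE

lemma exists_supSq_le_short [NeZero n] (hR₁ : 0 < R₁) (hS : MeasurableSet S) (hSR : S ⊆ ball 0 R)
    {x₀ : ℰ n} {ρ : ℝ} (hρ : 0 < ρ) (hx₀ : ‖x₀‖ = R₁ + 2 * ρ) (hball : ball x₀ ρ ⊆ S) :
    ∃ C : ℝ, 0 ≤ C ∧ ∀ (μ T : ℝ) (y : ℝ → ℰ n → ℝ), IsHarmonicHeatSolution n R μ T y → 0 < μ →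
      ∀ t₀, 0 < t₀ → t₀ < T → t₀ ≤ 1 → μ * t₀ ≤ 1 →
      supSq R (y t₀) ≤ rexp (C / t₀) * ∫ s in (0 : ℝ)..T, ∫ x in S, y s x ^ 2 := by
  have hxR : ‖x₀‖ < R := mem_ball_zero_iff.1 (hSR (hball (mem_ball_self hρ)))
  obtain ⟨C, hC, H⟩ := exists_supSq_le_of_short_time (by linarith) hρ hxR (by linarith)
    (hball.trans hSR)
  refine ⟨C, hC, fun μ T y h hμ t₀ h0 hT h1 hμ1 => (H μ T y h hμ t₀ h0 hT h1 hμ1).trans ?_⟩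
  exact mul_le_mul_of_nonneg_left (h.integral_subset_le h0.le hT.le hS hSR measurableSet_ball hball)
    (Real.exp_pos _).le

lemma exists_integral_sq_le_of_large [NeZero n] (hR₁ : 0 < R₁) (h₁₂ : R₁ < R₂) (h₂R : R₂ < R)
    (hS : MeasurableSet S) (hSR : S ⊆ ball 0 R) {ρ₁ : ℝ} (hρ₁ : 0 < ρ₁)
    (hball : ∀ ρ, 0 < ρ → ρ ≤ ρ₁ → ∃ x₀, ‖x₀‖ = R₁ + 2 * ρ ∧ ball x₀ ρ ⊆ S) :
    ∃ C v₀ : ℝ, 0 ≤ C ∧ 1 ≤ v₀ ∧ ∀ (v T : ℝ) (y : ℝ → ℰ n → ℝ), v₀ ≤ v →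
      IsHarmonicHeatSolution n R (v ^ 3) T y → R₁ ^ 2 / (2 * n) < T →
      ∫ x in ball 0 R, y T x ^ 2 ≤ rexp (C * v ^ 2 - 2 * n * (T - R₁ ^ 2 / (2 * n)) * v ^ 3) *
          ∫ s in (0 : ℝ)..T, ∫ x in S, y s x ^ 2 := by
  have hR : 0 < R := by linarith
  obtain ⟨x₀, hx₀, hx₀S⟩ := hball ρ₁ hρ₁ le_rfl
  obtain ⟨C', hC', H'⟩ := exists_supSq_le_short hR₁ hS hSR hρ₁ hx₀ hx₀S
  obtain ⟨C, c, v₀, hC, hc, hv₀, H⟩ := exists_supSq_le_step hR₁ h₁₂ h₂R hS hSR hρ₁ hball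
  have hn : (0 : ℝ) < n := Nat.cast_pos.2 (NeZero.pos n)
  set Ts := R₁ ^ 2 / (2 * n) with hTs
  have hTs0 : 0 < Ts := by positivity
  set k := ⌈C' / c⌉₊
  set W := volume.real (ball (0 : ℰ n) R)
  have hW : 0 ≤ W := measureReal_nonneg
  set K : ℝ := 3 * k + 1 with hK
  refine ⟨W + (R ^ 2 / Ts + 2 * n) + 2 * n * K + (k + 1) + C, max v₀ (2 * K / Ts), by positivity,
    le_max_of_le_left hv₀, fun v T y hvm h hT => ?_⟩
  obtain ⟨hvv, hvK⟩ := max_le_iff.1 hvm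
  have hv : 1 ≤ v := hv₀.trans hvv
  have hv0 : 0 < v := by linarith
  have hv3 : 0 < v ^ 3 := by positivity
  have hO : 0 ≤ ∫ s in (0 : ℝ)..T, ∫ x in S, y s x ^ 2 :=
    intervalIntegral.integral_nonneg (by linarith) fun s _ => integral_nonneg fun x => sq_nonneg _
  set O := ∫ s in (0 : ℝ)..T, ∫ x in S, y s x ^ 2
  have hKv : K / v ≤ Ts / 2 := by
    rw [div_le_iff₀ hTs0] at hvK
    rw [div_le_iff₀ hv0]
    linarith
  set t₁ := 1 / v ^ 3 + k * (3 / v) with ht₁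
  have ht₀ : 0 < 1 / v ^ 3 := by positivity
  have ht₁K : t₁ ≤ K / v := by
    have h1 : 1 / v ^ 3 ≤ 1 / v := one_div_le_one_div_of_le hv0 (le_self_pow₀ hv (by norm_num))
    have h2 : K / v = 1 / v + k * (3 / v) := by rw [hK]; ring
    linarith
  have ht₀₁ : 1 / v ^ 3 ≤ t₁ := le_add_of_nonneg_right (by positivity)
  have ht₁0 : 0 < t₁ := by linarith
  have hm₀ := H' (v ^ 3) T y h hv3 (1 / v ^ 3) ht₀ (by linarith)
    ((div_le_one hv3).2 (one_le_pow₀ hv)) (mul_one_div_cancel hv3.ne').le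
  have hD1 : 1 ≤ rexp (v ^ 3 * R₁ ^ 2 + C * v ^ 2) := Real.one_le_exp (by positivity)
  have hm₁ := supSq_le_iterate (k := k) hv0 (mul_nonneg (by linarith) hO) (Real.exp_pos _).le
    (Real.exp_le_one_iff.2 (by rw [neg_nonpos]; positivity)) (H v T y hvv h) ht₀.le (by linarith)
  rw [← ht₁] at hm₁
  set D := rexp (v ^ 3 * R₁ ^ 2 + C * v ^ 2) with hD
  have hm : supSq R (y t₁) ≤ rexp ((k + 1) * v ^ 2) * D * O := by
    have h1 : rexp (-(c * v ^ 3)) ^ k * supSq R (y (1 / v ^ 3)) ≤ D * O := by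
      calc _ ≤ rexp (-(c * v ^ 3)) ^ k * (rexp (C' / (1 / v ^ 3)) * O) := by gcongr
        _ = rexp ((C' - k * c) * v ^ 3) * O := by
            rw [← Real.exp_nat_mul, ← mul_assoc, ← Real.exp_add, div_div_eq_mul_div, div_one]
            ring_nf
        _ ≤ D * O := by
            refine mul_le_mul_of_nonneg_right (hD1.trans' (Real.exp_le_one_iff.2 ?_)) hO
            have := (div_le_iff₀ hc).1 (Nat.le_ceil (C' / c))
            exact mul_nonpos_of_nonpos_of_nonneg (by linarith) hv3.le
    have h2 := mul_le_mul_of_nonneg_right (le_exp_mul_sq (K := k + 1) (by positivity) hv)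
      (mul_nonneg (zero_le_one.trans hD1) hO)
    linarith
  have hsup : supSq R (y T) ≤ supSq R (y t₁) *
      rexp (2 * (R ^ 2 / (2 * Ts) + n + n * K * v ^ 2 - n * v ^ 3 * T)) := by
    refine supSq_le hR.le fun x hx => ?_
    have h1 := (h.shift ht₁0.le le_rfl).abs_le_exp_gaussian hv3 (Real.sqrt_nonneg (supSq R (y t₁)))
      (fun z hz => by simpa using h.abs_le_sqrt_supSq ⟨ht₁0.le, by linarith⟩ hz)
      (t := T - t₁) (by linarith) le_rfl hx
    rw [add_sub_cancel] at h1
    have h2 : ‖x‖ ^ 2 / (4 * (T - t₁)) ≤ R ^ 2 / (2 * Ts) := by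
      have := mem_closedBall_zero_iff.1 hx
      exact div_le_div₀ (by positivity) (by gcongr) (by positivity) (by linarith)
    have h3 : 0 ≤ v ^ 3 / 2 * ‖x‖ ^ 2 := by positivity
    have h4 : n * v ^ 3 * t₁ ≤ n * K * v ^ 2 := by
      calc _ ≤ n * v ^ 3 * (K / v) := by gcongr
        _ = _ := by field_simp
    calc y T x ^ 2 = |y T x| ^ 2 := (sq_abs _).symm
      _ ≤ _ := pow_le_pow_left₀ (abs_nonneg _) h1 2
      _ = _ := by rw [mul_pow, Real.sq_sqrt (supSq_nonneg _), ← Real.exp_nat_mul, Nat.cast_ofNat]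
      _ ≤ _ := by
          have := supSq_nonneg (R := R) (y t₁)
          gcongr _ * rexp ?_
          linarith
  have e5 := le_mul_of_one_le_right (by positivity : 0 ≤ R ^ 2 / Ts + 2 * n) (one_le_pow₀ hv (n := 2))
  have e6 : R₁ ^ 2 = 2 * n * Ts := by rw [hTs]; field_simp
  have e7 : 2 * (R ^ 2 / (2 * Ts)) = R ^ 2 / Ts := by field_simp
  calc _ ≤ W * supSq R (y T) := h.integral_sq_le_supSq ⟨by linarith, le_rfl⟩ subset_rfl
    _ ≤ rexp (W * v ^ 2) * (rexp ((k + 1) * v ^ 2) * D * O *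
        rexp (2 * (R ^ 2 / (2 * Ts) + n + n * K * v ^ 2 - n * v ^ 3 * T))) := by
        refine mul_le_mul (le_exp_mul_sq hW hv) (hsup.trans ?_) (supSq_nonneg _) (Real.exp_pos _).le
        exact mul_le_mul_of_nonneg_right hm (Real.exp_pos _).le
    _ = rexp (W * v ^ 2 + ((k + 1) * v ^ 2 + (v ^ 3 * R₁ ^ 2 + C * v ^ 2) +
        2 * (R ^ 2 / (2 * Ts) + n + n * K * v ^ 2 - n * v ^ 3 * T))) * O := by
        rw [hD, Real.exp_add (W * v ^ 2), Real.exp_add (_ + _) (2 * _),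
          Real.exp_add ((k + 1) * v ^ 2)]
        ring
    _ ≤ _ := by
        refine mul_le_mul_of_nonneg_right (Real.exp_le_exp.2 ?_) hO
        rw [e6]
        linarith

lemma exists_integral_sq_le_of_small [NeZero n] (hR₁ : 0 < R₁) (hS : MeasurableSet S)
    (hSR : S ⊆ ball 0 R) {x₀ : ℰ n} {ρ : ℝ} (hρ : 0 < ρ) (hx₀ : ‖x₀‖ = R₁ + 2 * ρ)
    (hball : ball x₀ ρ ⊆ S) {μ₁ Ts : ℝ} (hμ₁ : 0 < μ₁) (hTs : 0 < Ts) :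
    ∃ C : ℝ, 0 ≤ C ∧ ∀ (μ T : ℝ) (y : ℝ → ℰ n → ℝ), IsHarmonicHeatSolution n R μ T y → 0 < μ →
      μ ≤ μ₁ → Ts < T → ∫ x in ball 0 R, y T x ^ 2 ≤
        rexp (C - 2 * n / R ^ 2 * (T - Ts)) * ∫ s in (0 : ℝ)..T, ∫ x in S, y s x ^ 2 := by
  have hR : 0 < R := (norm_nonneg x₀).trans_lt
    (mem_ball_zero_iff.1 (hSR (hball (mem_ball_self hρ))))
  obtain ⟨C, hC, H⟩ := exists_supSq_le_short hR₁ hS hSR hρ hx₀ hball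
  set W := volume.real (ball (0 : ℰ n) R)
  have hW : 0 ≤ W := measureReal_nonneg
  set t₀ := min Ts (min 1 (1 / μ₁))
  have ht₀ : 0 < t₀ := by positivity
  have h1 : t₀ ≤ Ts := min_le_left _ _
  have h2 : t₀ ≤ 1 := (min_le_right _ _).trans (min_le_left _ _)
  have h3 : t₀ ≤ 1 / μ₁ := (min_le_right _ _).trans (min_le_right _ _)
  refine ⟨4 * W + C / t₀, by positivity, fun μ T y h hμ hμμ hT => ?_⟩
  have hO : 0 ≤ ∫ s in (0 : ℝ)..T, ∫ x in S, y s x ^ 2 :=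
    intervalIntegral.integral_nonneg (by linarith) fun s _ => integral_nonneg fun x => sq_nonneg _
  have hm := H μ T y h hμ t₀ ht₀ (h1.trans_lt hT) h2 (by
    rw [le_div_iff₀ hμ₁] at h3
    nlinarith)
  set O := ∫ s in (0 : ℝ)..T, ∫ x in S, y s x ^ 2
  have hsup : supSq R (y T) ≤ 4 * rexp (-(2 * n / R ^ 2 * (T - Ts))) * supSq R (y t₀) := by
    refine supSq_le hR.le fun x hx => ?_
    have h4 := (h.shift ht₀.le le_rfl).abs_le_decay hR (Real.sqrt_nonneg (supSq R (y t₀)))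
      (fun z hz => by simpa using h.abs_le_sqrt_supSq ⟨ht₀.le, by linarith⟩ hz)
      (T - t₀) ⟨by linarith, le_rfl⟩ x hx
    rw [add_sub_cancel] at h4
    calc y T x ^ 2 = |y T x| ^ 2 := (sq_abs _).symm
      _ ≤ _ := pow_le_pow_left₀ (abs_nonneg _) h4 2
      _ = 4 * rexp (-(2 * n / R ^ 2 * (T - t₀))) * supSq R (y t₀) := by
          rw [mul_pow, mul_pow, Real.sq_sqrt (supSq_nonneg _), ← Real.exp_nat_mul, Nat.cast_ofNat]
          ring_nf
      _ ≤ _ := by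
          have := supSq_nonneg (R := R) (y t₀)
          gcongr
  calc _ ≤ W * supSq R (y T) := h.integral_sq_le_supSq ⟨by linarith, le_rfl⟩ subset_rfl
    _ ≤ W * (4 * rexp (-(2 * n / R ^ 2 * (T - Ts))) * (rexp (C / t₀) * O)) :=
        mul_le_mul_of_nonneg_left (hsup.trans (mul_le_mul_of_nonneg_left hm (by positivity))) hW
    _ = 4 * W * (rexp (C / t₀ + -(2 * n / R ^ 2 * (T - Ts))) * O) := by rw [Real.exp_add]; ring
    _ ≤ rexp (4 * W) * (rexp (C / t₀ + -(2 * n / R ^ 2 * (T - Ts))) * O) := by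
        refine mul_le_mul_of_nonneg_right (by linarith [Real.add_one_le_exp (4 * W)])
          (mul_nonneg (Real.exp_pos _).le hO)
    _ = _ := by rw [← mul_assoc, ← Real.exp_add]; ring_nf

end IsHarmonicHeatSolution

/-- Observability of the harmonic heat equation, uniformly in `μ > 0`,
from the section of annulus `ω_Γ = {rθ : R₁ < r < R₂, θ ∈ Γ}` for every `T > T* = R₁²/(2d)`,
with cost `e^{c_β/(T−T*)^{2β}}`; the constants `c_β` can be chosen so that `c_β → ∞`
as `β → 1⁺`. -/
theorem statement13
    (d : ℕ) (hd : 2 ≤ d) (R R₁ R₂ : ℝ)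
    (hR₁ : 0 < R₁) (h₁₂ : R₁ < R₂) (h₂R : R₂ < R)
    (Γ : Set (EuclideanSpace ℝ (Fin d)))
    (hΓsub : Γ ⊆ sphere (0 : EuclideanSpace ℝ (Fin d)) 1)
    (hΓopen : ∃ U : Set (EuclideanSpace ℝ (Fin d)), IsOpen U ∧
      Γ = U ∩ sphere (0 : EuclideanSpace ℝ (Fin d)) 1)
    (hΓne : Γ.Nonempty)
    (ωΓ : Set (EuclideanSpace ℝ (Fin d)))
    (hωΓ : ωΓ = {x | ∃ r : ℝ, ∃ θ ∈ Γ, R₁ < r ∧ r < R₂ ∧ x = r • θ}) :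
    ∃ cβ : ℝ → ℝ,
      (∀ β : ℝ, 1 < β → 0 < cβ β) ∧
      Tendsto cβ (nhdsWithin 1 (Ioi 1)) atTop ∧
      ∀ β : ℝ, 1 < β →
      ∀ μ : ℝ, 0 < μ → ∀ T : ℝ, R₁ ^ 2 / (2 * d) < T →
      ∀ y : ℝ → EuclideanSpace ℝ (Fin d) → ℝ,
        IsHarmonicHeatSolution d R μ T y →
        (∫ x in ball (0 : EuclideanSpace ℝ (Fin d)) R, (y T x) ^ 2) ≤
          Real.exp (cβ β / (T - R₁ ^ 2 / (2 * d)) ^ (2 * β)) *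
            ∫ t in Ioc (0:ℝ) T, ∫ x in ωΓ, (y t x) ^ 2 := by
  have : NeZero d := ⟨by omega⟩
  obtain ⟨U, hU, rfl⟩ := hΓopen
  obtain ⟨θ, hθU, hθ⟩ := hΓne
  have hω : ωΓ = {x | R₁ < ‖x‖ ∧ ‖x‖ < R₂ ∧ ‖x‖⁻¹ • x ∈ U} := by
    rw [hωΓ]
    ext x
    constructor
    · rintro ⟨r, θ, ⟨hθU, hθ⟩, h1, h2, rfl⟩
      have hr : 0 < r := hR₁.trans h1
      have hx : ‖r • θ‖ = r := by
        rw [norm_smul, mem_sphere_zero_iff_norm.1 hθ, mul_one, Real.norm_of_nonneg hr.le]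
      refine ⟨by rwa [hx], by rwa [hx], ?_⟩
      rwa [hx, smul_smul, inv_mul_cancel₀ hr.ne', one_smul]
    · rintro ⟨h1, h2, hxU⟩
      have hx : ‖x‖ ≠ 0 := (hR₁.trans h1).ne'
      refine ⟨‖x‖, ‖x‖⁻¹ • x, ⟨hxU, ?_⟩, h1, h2, ?_⟩
      · rw [mem_sphere_zero_iff_norm, norm_smul, norm_inv, norm_norm, inv_mul_cancel₀ hx]
      · rw [smul_smul, mul_inv_cancel₀ hx, one_smul]
  have hS : MeasurableSet ωΓ := by
    rw [hω]
    exact (isOpen_annulus_sector hR₁ hU).measurableSet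
  have hSR : ωΓ ⊆ ball 0 R := by
    rw [hω]
    exact fun x hx => mem_ball_zero_iff.2 (hx.2.1.trans h₂R)
  obtain ⟨ρ₁, hρ₁, hball⟩ := exists_ball_subset_annulus_sector hR₁ h₁₂ hU hθU
    (mem_sphere_zero_iff_norm.1 hθ)
  rw [← hω] at hball
  obtain ⟨x₀, hx₀, hx₀S⟩ := hball ρ₁ hρ₁ le_rfl
  obtain ⟨C, v₀, hC, hv₀, H⟩ :=
    IsHarmonicHeatSolution.exists_integral_sq_le_of_large hR₁ h₁₂ h₂R hS hSR hρ₁ hball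
  have hd1 : (1 : ℝ) ≤ d := by exact_mod_cast (by omega : 1 ≤ d)
  have hR : 0 < R := by linarith
  set Ts := R₁ ^ 2 / (2 * d)
  have hTs : 0 < Ts := by positivity
  obtain ⟨C', hC', H'⟩ := IsHarmonicHeatSolution.exists_integral_sq_le_of_small hR₁ hS hSR hρ₁ hx₀
    hx₀S (pow_pos (zero_lt_one.trans_le hv₀) 3) hTs
  set l : ℝ := 2 * d / R ^ 2
  have hl : 0 < l := by positivity
  set A := C ^ 3 + C' ^ 3 / l ^ 2
  have hA : 0 ≤ A := by positivity
  set δ₀ := C + C' / l + 1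
  have hCl : 0 ≤ C' / l := by positivity
  have hδ₀ : 1 ≤ δ₀ := by linarith
  refine ⟨fun β => A * δ₀ ^ (2 * β) + 1 / (β - 1), fun β hβ => ?_, ?_,
    fun β hβ μ hμ T hT y h => ?_⟩
  · have : 0 < β - 1 := sub_pos.2 hβ
    positivity
  · have h1 : Tendsto (fun β : ℝ => β - 1) (nhdsWithin 1 (Ioi 1)) (nhdsWithin 0 (Ioi 0)) := by
      refine tendsto_nhdsWithin_iff.2 ⟨?_, ?_⟩
      · exact ((by fun_prop : Continuous fun β : ℝ => β - 1).tendsto' 1 0 (sub_self 1)).mono_left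
          nhdsWithin_le_nhds
      · filter_upwards [self_mem_nhdsWithin] with β hβ using sub_pos.2 (mem_Ioi.1 hβ)
    refine tendsto_atTop_mono (fun β => ?_) (tendsto_inv_nhdsGT_zero.comp h1)
    have : 0 ≤ A * δ₀ ^ (2 * β) := by positivity
    rw [Function.comp_apply, one_div]
    linarith
  have hδ : 0 < T - Ts := sub_pos.2 hT
  have hT0 : 0 ≤ T := by linarith
  suffices hX : ∃ X, X ≤ (A * δ₀ ^ (2 * β) + 1 / (β - 1)) / (T - Ts) ^ (2 * β) ∧
      ∫ x in ball (0 : EuclideanSpace ℝ (Fin d)) R, y T x ^ 2 ≤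
        Real.exp X * ∫ t in (0 : ℝ)..T, ∫ x in ωΓ, y t x ^ 2 by
    obtain ⟨X, hX, hy⟩ := hX
    rw [← intervalIntegral.integral_of_le hT0]
    refine hy.trans (mul_le_mul_of_nonneg_right (Real.exp_le_exp.2 hX) ?_)
    exact intervalIntegral.integral_nonneg hT0 fun s _ => integral_nonneg fun x => sq_nonneg _
  rcases le_total μ (v₀ ^ 3) with hμv | hμv
  · refine ⟨_, exponent_le_div_rpow hA hδ₀ hδ hβ (fun hle => ?_) ?_, H' μ T y h hμ hμv hT⟩
    · have := (div_le_iff₀' hl).1 (by linarith : C' / l ≤ T - Ts)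
      linarith
    · rw [le_div_iff₀ (by positivity)]
      have hlδ : 0 < l * (T - Ts) := mul_pos hl hδ
      rcases le_total C' (l * (T - Ts)) with hc | hc
      · exact (mul_nonpos_of_nonpos_of_nonneg (by linarith) (sq_nonneg _)).trans hA
      · have h1 : C' * (T - Ts) ^ 2 ≤ C' ^ 3 / l ^ 2 := by
          rw [le_div_iff₀ (by positivity)]
          have := mul_le_mul_of_nonneg_left (pow_le_pow_left₀ hlδ.le hc 2) hC'
          linarith
        have h2 := mul_nonneg hlδ.le (sq_nonneg (T - Ts))
        have h3 : 0 ≤ C ^ 3 := by positivity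
        linarith
  · obtain ⟨v, hv, rfl⟩ : ∃ v, v₀ ≤ v ∧ v ^ 3 = μ := by
      have h3 : (μ ^ (1 / 3 : ℝ)) ^ 3 = μ := by
        rw [← Real.rpow_natCast, ← Real.rpow_mul hμ.le]
        norm_num
      exact ⟨_, le_of_pow_le_pow_left₀ three_ne_zero (Real.rpow_nonneg hμ.le _) (by rwa [h3]), h3⟩
    have hv1 : 1 ≤ v := hv₀.trans hv
    have hv0 : 0 < v := by linarith
    have hdv : (T - Ts) * v ^ 3 ≤ 2 * d * (T - Ts) * v ^ 3 := by
      have : 0 ≤ (T - Ts) * v ^ 3 := by positivity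
      nlinarith
    refine ⟨_, exponent_le_div_rpow hA hδ₀ hδ hβ (fun hle => ?_) ?_, H v T y hv h hT⟩
    · have h1 : C ≤ (T - Ts) * v := by nlinarith
      have := mul_le_mul_of_nonneg_right h1 (sq_nonneg v)
      linarith
    · rw [le_div_iff₀ (by positivity)]
      rcases le_total C ((T - Ts) * v) with hc | hc
      · refine (mul_nonpos_of_nonpos_of_nonneg ?_ (sq_nonneg _)).trans hA
        have := mul_le_mul_of_nonneg_right hc (sq_nonneg v)
        linarith
      · have h1 := mul_le_mul_of_nonneg_left (pow_le_pow_left₀ (by positivity) hc 2) hC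
        have h2 : 0 ≤ 2 * d * (T - Ts) * v ^ 3 * (T - Ts) ^ 2 := by positivity
        have h3 : 0 ≤ C' ^ 3 / l ^ 2 := by positivity
        linarith
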